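/- Let d ≥ 4 and let P be a uniformly elliptic i.i.d. probability measure on Ω satisfying condition (𝒫). Then ℙ^z(T_{∂𝒫(0,N)} ≠ T_{∂⁺𝒫(0,N)}) = N^{−ξ(1)}, and for every z ∈ 𝒫̃(0,N), ℙ^z(|T_{∂𝒫(0,N)} − 𝔼^z[T_{∂𝒫(0,N)}]| > N R₂(N)) = N^{−ξ(1)}. -/

import Mathlib

open MeasureTheory Filter
open scoped ENNReal

noncomputable section

namespace RWRE

/-- sites of the lattice `ℤ^d`. -/
abbrev Site (d : ℕ) := Fin d → ℤ

/-- index set for the `2d` nearest-neighbour steps: `(i, true) ↦ e_i`, `(i, false) ↦ -e_i`. -/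
abbrev StepIdx (d : ℕ) := Fin d × Bool

/-- the signed unit vector corresponding to a step index. -/
def stepVec {d : ℕ} (s : StepIdx d) : Site d :=
  fun j => if j = s.1 then (if s.2 then 1 else -1) else 0

/-- probability vectors on the `2d` nearest-neighbour steps. -/
abbrev EnvAt (d : ℕ) := {p : StepIdx d → ℝ // (∀ s, 0 ≤ p s) ∧ ∑ s, p s = 1}

/-- the space of environments `Ω = (M_d)^{ℤ^d}`. -/
abbrev Env (d : ℕ) := Site d → EnvAt d

/-- the space of trajectories. -/
abbrev Path (d : ℕ) := ℕ → Site d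

/-- the shift of the environment by `x`. -/
def shift {d : ℕ} (x : Site d) (ω : Env d) : Env d := fun y => ω (x + y)

/-- transition probability in environment `ω` from site `y` by increment `v`. -/
def envP {d : ℕ} (ω : Env d) (y v : Site d) : ℝ≥0∞ :=
  ∑ s : StepIdx d, if v = stepVec s then ENNReal.ofReal ((ω y).1 s) else 0

/-- `μ` is the quenched law of the walk started at `x` in the environment `ω`: a
probability measure on path space whose cylinder probabilities are the products of
the transition probabilities of `ω`. -/
def IsQuenched {d : ℕ} (ω : Env d) (x : Site d) (μ : Measure (Path d)) : Prop :=
  IsProbabilityMeasure μ ∧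
    ∀ (n : ℕ) (γ : ℕ → Site d),
      μ {f | ∀ i ≤ n, f i = γ i} =
        (if γ 0 = x then 1 else 0) *
          ∏ i ∈ Finset.range n, envP ω (γ i) (γ (i + 1) - γ i)

/-- `Pq` is a measurable family of quenched laws. -/
def IsQuenchedFamily {d : ℕ} (Pq : Env d → Site d → Measure (Path d)) : Prop :=
  (∀ ω x, IsQuenched ω x (Pq ω x)) ∧
    ∀ (x : Site d) (A : Set (Path d)), MeasurableSet A →
      Measurable fun ω => Pq ω x A

/-- the annealed probability `ℙ^x(A) = ∫ P_ω^x(A) dP(ω)` of a path event. -/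
def ann {d : ℕ} (P : Measure (Env d)) (Pq : Env d → Site d → Measure (Path d))
    (x : Site d) (A : Set (Path d)) : ℝ≥0∞ :=
  ∫⁻ ω, Pq ω x A ∂P

/-- the annealed expectation `𝔼^x[g]` of a real path functional. -/
def annE {d : ℕ} (P : Measure (Env d)) (Pq : Env d → Site d → Measure (Path d))
    (x : Site d) (g : Path d → ℝ) : ℝ :=
  ∫ ω, (∫ f, g f ∂(Pq ω x)) ∂P

/-- `P` is an i.i.d. measure on the space of environments: its finite-dimensional
marginals are products of a fixed single-site probability measure. -/
def IsIID {d : ℕ} (P : Measure (Env d)) : Prop :=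
  ∃ ν : Measure (EnvAt d), IsProbabilityMeasure ν ∧
    ∀ (s : Finset (Site d)) (B : Site d → Set (EnvAt d)),
      (∀ x, MeasurableSet (B x)) →
        P {ω | ∀ x ∈ s, ω x ∈ B x} = ∏ x ∈ s, ν (B x)

/-- uniform ellipticity of `P`. -/
def UniformlyElliptic {d : ℕ} (P : Measure (Env d)) : Prop :=
  ∃ η : ℝ, 0 < η ∧ ∀ s : StepIdx d, P {ω : Env d | (ω 0).1 s < η} = 0

/-- a lattice point, viewed as a real vector. -/
def toR {d : ℕ} (x : Site d) : Fin d → ℝ := fun i => (x i : ℝ)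

/-- inner product of a lattice point with a real direction. -/
def dotR {d : ℕ} (x : Site d) (ℓ : Fin d → ℝ) : ℝ := ∑ i, (x i : ℝ) * ℓ i

/-- the euclidean norm of a real vector. -/
def norm2R {d : ℕ} (ℓ : Fin d → ℝ) : ℝ := Real.sqrt (∑ i, ℓ i ^ 2)

/-- the event `{T_L^{(-ℓ)} < T_L^{(ℓ)}}` that the walk reaches level `L` in
direction `-ℓ` strictly before reaching level `L` in direction `ℓ`. -/
def backtrackEvent {d : ℕ} (ℓ : Fin d → ℝ) (L : ℝ) : Set (Path d) :=
  {f | ∃ n, L ≤ dotR (f n) (-ℓ) ∧ ∀ m ≤ n, dotR (f m) ℓ < L}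

/-- condition `(T_γ)` in the direction `ℓ₀`. -/
def CondTAt {d : ℕ} (P : Measure (Env d)) (Pq : Env d → Site d → Measure (Path d))
    (γ : ℝ) (ℓ₀ : Fin d → ℝ) : Prop :=
  ∃ ε : ℝ, 0 < ε ∧ ∀ ℓ : Fin d → ℝ, norm2R ℓ = 1 → norm2R (ℓ - ℓ₀) < ε →
    ∃ C : ℝ, ∀ L : ℝ, 0 < L →
      ann P Pq 0 (backtrackEvent ℓ L) ≤ ENNReal.ofReal (C * Real.exp (-(L ^ γ)))

/-- condition `(T_γ)` in some direction. -/
def CondT {d : ℕ} (P : Measure (Env d)) (Pq : Env d → Site d → Measure (Path d))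
    (γ : ℝ) : Prop :=
  ∃ ℓ₀ : Fin d → ℝ, norm2R ℓ₀ = 1 ∧ CondTAt P Pq γ ℓ₀

/-- condition `(𝒫)`: condition `(T_γ)` holds for some `γ ∈ (0,1)` in some direction. -/
def CondP {d : ℕ} (P : Measure (Env d)) (Pq : Env d → Site d → Measure (Path d)) : Prop :=
  ∃ γ : ℝ, 0 < γ ∧ γ < 1 ∧ CondT P Pq γ

/-- condition `(𝒫)` in a given direction. -/
def CondPAt {d : ℕ} (P : Measure (Env d)) (Pq : Env d → Site d → Measure (Path d))
    (ℓ₀ : Fin d → ℝ) : Prop :=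
  ∃ γ : ℝ, 0 < γ ∧ γ < 1 ∧ CondTAt P Pq γ ℓ₀

/-- `Q` is invariant with respect to the point of view of the particle. -/
def InvariantPOV {d : ℕ} (Q : Measure (Env d)) : Prop :=
  ∀ g : Env d → ℝ, Measurable g → (∃ C : ℝ, ∀ ω, |g ω| ≤ C) →
    ∫ ω, (∑ s : StepIdx d, (ω 0).1 s * g (shift (stepVec s) ω)) ∂Q = ∫ ω, g ω ∂Q

/-- superpolynomial decay: `g N = N^{-ξ(1)}`. -/
def Superpoly (g : ℕ → ℝ) : Prop :=
  ∀ k : ℕ, Tendsto (fun N : ℕ => (N : ℝ) ^ k * g N) atTop (nhds 0)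

/-- the first coordinate `⟨x, e₁⟩` of a lattice point. -/
def firstCoord {d : ℕ} (x : Fin d → ℤ) : ℤ := if h : 0 < d then x ⟨0, h⟩ else 0

/-- the first coordinate `⟨ℓ, e₁⟩` of a real vector. -/
def firstCoordR {d : ℕ} (ℓ : Fin d → ℝ) : ℝ := if h : 0 < d then ℓ ⟨0, h⟩ else 0

/-- the first standard basis vector, as a real direction. -/
def e1R (d : ℕ) : Fin d → ℝ := fun i => if (i : ℕ) = 0 then 1 else 0

/-- `R_k(N) = ⌊exp((log log N)^{k+1})⌋`. -/
def Rk (k N : ℕ) : ℕ := ⌊Real.exp (Real.log (Real.log (N : ℝ)) ^ (k + 1))⌋₊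

/-- the `ℓ¹`-norm of a lattice point. -/
def norm1 {d : ℕ} (x : Site d) : ℤ := ∑ i, |x i|

/-- the parallelogram `𝒫(z,N)` (relative to the asymptotic direction `ϑ`). -/
def para {d : ℕ} (ϑ : Fin d → ℝ) (z : Site d) (N : ℕ) : Set (Site d) :=
  {x | |firstCoord (x - z)| < (N : ℤ) ^ 2 ∧
    ∀ i, |((x - z) i : ℝ) - (firstCoord (x - z) : ℝ) / firstCoordR ϑ * ϑ i|
      < (N : ℝ) * (Rk 5 N : ℝ)}

/-- the middle third `𝒫̃(z,N)` of the parallelogram. -/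
def paraMid {d : ℕ} (ϑ : Fin d → ℝ) (z : Site d) (N : ℕ) : Set (Site d) :=
  {x | 3 * |firstCoord (x - z)| < (N : ℤ) ^ 2 ∧
    ∀ i, 3 * |((x - z) i : ℝ) - (firstCoord (x - z) : ℝ) / firstCoordR ϑ * ϑ i|
      < (N : ℝ) * (Rk 5 N : ℝ)}

/-- the boundary `∂𝒫(z,N)`. -/
def paraBdry {d : ℕ} (ϑ : Fin d → ℝ) (z : Site d) (N : ℕ) : Set (Site d) :=
  {x | x ∉ para ϑ z N ∧ ∃ y ∈ para ϑ z N, norm1 (x - y) = 1}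

/-- the right boundary `∂⁺𝒫(z,N)`. -/
def paraBdryPlus {d : ℕ} (ϑ : Fin d → ℝ) (z : Site d) (N : ℕ) : Set (Site d) :=
  {x | x ∈ paraBdry ϑ z N ∧ firstCoord (x - z) = (N : ℤ) ^ 2}

/-- the walk hits the set `A`. -/
def hits {d : ℕ} (A : Set (Site d)) (f : Path d) : Prop := ∃ n, f n ∈ A

/-- the hitting time `T_A` of a set of sites. -/
def hitTime {d : ℕ} (A : Set (Site d)) (f : Path d) : ℕ := sInf {n | f n ∈ A}

/-- the hyperplane `H_M = {x : ⟨x,e₁⟩ = M}`. -/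
def hyper {d : ℕ} (M : ℤ) : Set (Site d) := {x | firstCoord x = M}

/-- the event that the walk hits `A`, at a time belonging to `I`, and in a point of `Δ`. -/
def exitEvent {d : ℕ} (A Δ : Set (Site d)) (I : Set ℕ) : Set (Path d) :=
  {f | hits A f ∧ f (hitTime A f) ∈ Δ ∧ hitTime A f ∈ I}

/-- the `d`-dimensional cube with corner `a` and side length `L`. -/
def cube {d : ℕ} (a : Site d) (L : ℕ) : Set (Site d) :=
  {x | ∀ i, a i ≤ x i ∧ x i < a i + (L : ℤ)}

/-- the same cube, as a finite set. -/
def cubeF {d : ℕ} (a : Site d) (L : ℕ) : Finset (Site d) :=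
  Fintype.piFinset fun i => Finset.Ico (a i) (a i + (L : ℤ))

/-- a `(d-1)`-dimensional cube of side length `L` inside the hyperplane `H_m`. -/
def cubeHyp {d : ℕ} (m : ℤ) (a : Site d) (L : ℕ) : Set (Site d) :=
  {x | firstCoord x = m ∧ ∀ i : Fin d, (i : ℕ) ≠ 0 → a i ≤ x i ∧ x i < a i + (L : ℤ)}

/-- the time interval `[t, t + L)`. -/
def interval (t L : ℕ) : Set ℕ := {n | t ≤ n ∧ n < t + L}

/-- `S` is the set of corners of a partition of `ℤ^d` into cubes of side length `L`. -/
def IsCubePartition {d : ℕ} (L : ℕ) (S : Set (Site d)) : Prop :=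
  (∀ x : Site d, ∃ a ∈ S, x ∈ cube a L) ∧
    ∀ a ∈ S, ∀ b ∈ S, a ≠ b → Disjoint (cube a L) (cube b L)

/-- `t` is a regeneration time of the path `f` in direction `e₁`. -/
def IsRegen {d : ℕ} (f : Path d) (t : ℕ) : Prop :=
  (∀ s < t, firstCoord (f s) < firstCoord (f t)) ∧
    firstCoord (f t) < firstCoord (f (t + 1)) ∧
    ∀ s, t + 1 < s → firstCoord (f (t + 1)) < firstCoord (f s)

/-- the `k`-th regeneration time `τ_k` (with the convention `τ₀ = 0`). -/
def regTime {d : ℕ} (f : Path d) : ℕ → ℕ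
  | 0 => 0
  | k + 1 => sInf {t | regTime f k < t ∧ IsRegen f t}

/-- the event `B_N` that each of the first `N²` regeneration gaps is at most `R(N)`. -/
def BN {d : ℕ} (N : ℕ) : Set (Path d) :=
  {f | ∀ k, 1 ≤ k → k ≤ N ^ 2 → regTime f k - regTime f (k - 1) ≤ Rk 1 N}

/-- `ϑ` is the asymptotic direction `lim Xₙ/‖Xₙ‖₂` of the walk, annealed a.s. -/
def DirSpeed {d : ℕ} (P : Measure (Env d)) (Pq : Env d → Site d → Measure (Path d))
    (ϑ : Fin d → ℝ) : Prop :=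
  ann P Pq 0 {f | ¬ Tendsto (fun n => fun i => toR (f n) i / norm2R (toR (f n)))
    atTop (nhds ϑ)} = 0

/-- the σ-algebra generated by the environment in the half space `⟨z,e₁⟩ ≤ m`. -/
def sigmaUpTo (d : ℕ) (m : ℤ) : MeasurableSpace (Env d) :=
  MeasurableSpace.comap
    (fun ω => (fun z : {z : Site d // firstCoord z ≤ m} => ω z.1)) inferInstance

/-- the cylinder of paths that agree with `γ` up to time `n`. -/
def cyl {d : ℕ} (n : ℕ) (γ : Path d) : Set (Path d) := {f | ∀ i ≤ n, f i = γ i}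

/-- the event `B` depends only on the path up to time `n`. -/
def UpTo {d : ℕ} (n : ℕ) (B : Set (Path d)) : Prop :=
  ∀ f g : Path d, (∀ i ≤ n, f i = g i) → f ∈ B → g ∈ B

/-- the prefix of a path up to time `n`. -/
def pre {d : ℕ} (n : ℕ) (f : Path d) : Fin (n + 1) → Site d := fun i => f i

/-- the extension of a prefix to a path, constant from time `n` on. -/
def extend {d n : ℕ} (s : Fin (n + 1) → Site d) : Path d :=
  fun i => s ⟨min i n, by omega⟩

lemma extend_apply {d n : ℕ} (s : Fin (n + 1) → Site d) {i : ℕ} (hi : i ≤ n) :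
    extend s i = s ⟨i, by omega⟩ := by
  simp [extend, hi]

lemma pre_eq_iff {d n : ℕ} (f g : Path d) : pre n f = pre n g ↔ ∀ i ≤ n, f i = g i := by
  constructor
  · intro h i hi
    exact congrFun h ⟨i, by omega⟩
  · intro h
    funext i
    exact h i (by omega)

lemma measurable_pre {d : ℕ} (n : ℕ) : Measurable (pre n : Path d → _) :=
  measurable_pi_lambda _ fun _ => measurable_pi_apply _

lemma pre_extend {d n : ℕ} (s : Fin (n + 1) → Site d) : pre n (extend s) = s := by
  funext i
  simp only [pre]
  rw [extend_apply s (by omega)]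

lemma preimage_pre {d n : ℕ} (s : Fin (n + 1) → Site d) : pre n ⁻¹' {s} = cyl n (extend s) := by
  ext f
  simp only [Set.mem_preimage, Set.mem_singleton_iff, cyl, Set.mem_ofPred_eq]
  rw [← pre_eq_iff, pre_extend]

lemma UpTo.eq_preimage {d n : ℕ} {B : Set (Path d)} (hB : UpTo n B) :
    B = pre n ⁻¹' (pre n '' B) := by
  apply Set.Subset.antisymm (Set.subset_preimage_image _ _)
  rintro f ⟨g, hg, hgf⟩
  exact hB g f ((pre_eq_iff g f).1 hgf) hg

lemma UpTo.measurableSet {d n : ℕ} {B : Set (Path d)} (hB : UpTo n B) : MeasurableSet B := by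
  rw [hB.eq_preimage]
  exact measurable_pre n (Set.to_countable _).measurableSet

lemma upTo_cyl {d : ℕ} (n : ℕ) (γ : Path d) : UpTo n (cyl n γ) := fun f g h hf i hi => by
  rw [← h i hi]; exact hf i hi

lemma UpTo.mono {d n m : ℕ} {B : Set (Path d)} (hB : UpTo n B) (h : n ≤ m) : UpTo m B :=
  fun f g hfg => hB f g fun i hi => hfg i (hi.trans h)

lemma UpTo.inter {d n : ℕ} {B C : Set (Path d)} (hB : UpTo n B) (hC : UpTo n C) :
    UpTo n (B ∩ C) := fun f g h hf => ⟨hB f g h hf.1, hC f g h hf.2⟩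

lemma UpTo.compl {d n : ℕ} {B : Set (Path d)} (hB : UpTo n B) : UpTo n Bᶜ :=
  fun f g h hf hg => hf (hB g f (fun i hi => (h i hi).symm) hg)

lemma measurableSet_cyl {d : ℕ} (n : ℕ) (γ : Path d) : MeasurableSet (cyl n γ) :=
  (upTo_cyl n γ).measurableSet

/-- finite measures on path space are determined by the cylinders. -/
lemma measure_ext_cyl {d : ℕ} {μ ν : Measure (Path d)} [IsFiniteMeasure μ]
    (h : ∀ n γ, μ (cyl n γ) = ν (cyl n γ)) : μ = ν := by
  set C : Set (Set (Path d)) := {s | s = ∅ ∨ ∃ n γ, s = cyl n γ} with hC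
  have hgen : ∀ n (B : Set (Path d)), UpTo n B → MeasurableSet[MeasurableSpace.generateFrom C] B := by
    intro n B hB
    have : B = ⋃ s ∈ pre n '' B, cyl n (extend s) := by
      conv_lhs => rw [hB.eq_preimage]
      ext f
      simp only [Set.mem_preimage, Set.mem_iUnion, ← preimage_pre]
      simp
    rw [this]
    refine MeasurableSet.biUnion (Set.to_countable _) fun s _ => ?_
    exact MeasurableSpace.measurableSet_generateFrom (Or.inr ⟨n, _, rfl⟩)
  refine ext_of_generate_finite C ?_ ?_ ?_ ?_
  · apply le_antisymm
    · refine iSup_le fun i => ?_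
      rintro s ⟨t, -, rfl⟩
      refine hgen i _ fun f g hfg hf => ?_
      simp only [Set.mem_preimage] at hf ⊢
      rwa [← hfg i le_rfl]
    · apply MeasurableSpace.generateFrom_le
      rintro s (rfl | ⟨n, γ, rfl⟩)
      · exact MeasurableSet.empty
      · exact measurableSet_cyl n γ
  · have key : ∀ n γ m γ', n ≤ m → (cyl n γ ∩ cyl m γ' : Set (Path d)).Nonempty →
        (cyl n γ ∩ cyl m γ' : Set (Path d)) = cyl m γ' := by
      rintro n γ m γ' hnm ⟨f, hf, hf'⟩
      apply Set.Subset.antisymm Set.inter_subset_right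
      intro g hg
      refine ⟨fun i hi => ?_, hg⟩
      rw [hg i (hi.trans hnm), ← hf' i (hi.trans hnm), hf i hi]
    rintro s hs t ht hst
    rcases hs with rfl | ⟨n, γ, rfl⟩
    · simp at hst
    rcases ht with rfl | ⟨m, γ', rfl⟩
    · simp at hst
    right
    rcases le_total n m with hnm | hnm
    · exact ⟨m, γ', key _ _ _ _ hnm hst⟩
    · rw [Set.inter_comm] at hst ⊢
      exact ⟨n, γ, key _ _ _ _ hnm hst⟩
  · rintro s (rfl | ⟨n, γ, rfl⟩)
    · simp
    · exact h n γ
  · have hu : (Set.univ : Set (Path d)) = ⋃ s : Fin (0 + 1) → Site d, cyl 0 (extend s) := by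
      ext f
      simp only [← preimage_pre]
      simp
    have hd : Pairwise (Function.onFun Disjoint fun s : Fin (0 + 1) → Site d => cyl 0 (extend s)) := by
      intro s t hst
      simp only [Function.onFun, ← preimage_pre]
      exact Disjoint.preimage _ (by simpa using hst)
    rw [hu, measure_iUnion hd fun s => measurableSet_cyl _ _,
      measure_iUnion hd fun s => measurableSet_cyl _ _]
    simp only [h]

/-- the path after time `n`. -/
def after {d : ℕ} (n : ℕ) (f : Path d) : Path d := fun i => f (n + i)

@[simp] lemma after_apply {d : ℕ} (n : ℕ) (f : Path d) (i : ℕ) : after n f i = f (n + i) := rfl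

lemma measurable_after {d : ℕ} (n : ℕ) : Measurable (after n : Path d → Path d) :=
  measurable_pi_lambda _ fun _ => measurable_pi_apply _

lemma measure_eq_tsum_fiber {X ι : Type*} [MeasurableSpace X] [MeasurableSpace ι] [Countable ι]
    [MeasurableSingletonClass ι] (μ : Measure X) {p : X → ι} (hp : Measurable p) {A : Set X}
    (hA : MeasurableSet A) : μ A = ∑' i, μ (p ⁻¹' {i} ∩ A) := by
  rw [← measure_iUnion]
  · rw [← Set.iUnion_inter]
    congr 1
    ext x
    simp
  · intro i j hij
    exact (Disjoint.preimage _ (by simpa using hij)).mono Set.inter_subset_left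
      Set.inter_subset_left
  · exact fun i => (hp (measurableSet_singleton i)).inter hA

lemma lintegral_eq_tsum_fiber {X ι : Type*} [MeasurableSpace X] [MeasurableSpace ι] [Countable ι]
    [MeasurableSingletonClass ι] (μ : Measure X) {p : X → ι} (hp : Measurable p) (g : ι → ℝ≥0∞) :
    ∫⁻ x, g (p x) ∂μ = ∑' i, g i * μ (p ⁻¹' {i}) := by
  rw [← lintegral_map (f := g) (Measurable.of_discrete) hp, lintegral_countable']
  simp [Measure.map_apply hp]

section Quenched

variable {d : ℕ} {Pq : Env d → Site d → Measure (Path d)}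

lemma IsQuenchedFamily.prob (hPq : IsQuenchedFamily Pq) (ω : Env d) (x : Site d) :
    IsProbabilityMeasure (Pq ω x) := (hPq.1 ω x).1

lemma IsQuenchedFamily.cyl_eq (hPq : IsQuenchedFamily Pq) (ω : Env d) (x : Site d) (n : ℕ)
    (γ : Path d) : Pq ω x (cyl n γ) =
      (if γ 0 = x then 1 else 0) * ∏ i ∈ Finset.range n, envP ω (γ i) (γ (i + 1) - γ i) :=
  (hPq.1 ω x).2 n γ

lemma IsQuenchedFamily.start (hPq : IsQuenchedFamily Pq) (ω : Env d) (x : Site d) :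
    ∀ᵐ f ∂(Pq ω x), f 0 = x := by
  have := hPq.prob ω x
  have h := hPq.cyl_eq ω x 0 (fun _ => x)
  simp only [if_true, Finset.range_zero, Finset.prod_empty, mul_one] at h
  have h' := (prob_compl_eq_zero_iff (measurableSet_cyl 0 fun _ => x)).2 h
  refine measure_mono_null ?_ h'
  intro f hf hf'
  exact hf (hf' 0 le_rfl)

lemma IsQuenchedFamily.markov_cyl (hPq : IsQuenchedFamily Pq) (ω : Env d) (x : Site d) (n : ℕ)
    (γ : Path d) {A : Set (Path d)} (hA : MeasurableSet A) :
    Pq ω x (cyl n γ ∩ after n ⁻¹' A) = Pq ω x (cyl n γ) * Pq ω (γ n) A := by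
  have := hPq.prob ω x
  have := hPq.prob ω (γ n)
  have key : ((Pq ω x).restrict (cyl n γ)).map (after n) = (Pq ω x (cyl n γ)) • Pq ω (γ n) := by
    refine measure_ext_cyl fun m γ' => ?_
    rw [Measure.map_apply (measurable_after n) (measurableSet_cyl _ _),
      Measure.restrict_apply (measurable_after n (measurableSet_cyl _ _)), Measure.smul_apply,
      smul_eq_mul, hPq.cyl_eq ω (γ n)]
    by_cases h0 : γ' 0 = γ n
    · set ρ : Path d := fun i => if i ≤ n then γ i else γ' (i - n) with hρ
      have hρ1 : ∀ i ≤ n, ρ i = γ i := fun i hi => by simp [hρ, hi]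
      have hρ2 : ∀ i, ρ (n + i) = γ' i := fun i => by
        rcases Nat.eq_zero_or_pos i with rfl | hi
        · simp [hρ, h0]
        · simp only [hρ]
          rw [if_neg (by omega)]
          congr 1; omega
      have heq : after n ⁻¹' cyl m γ' ∩ cyl n γ = cyl (n + m) ρ := by
        ext f
        simp only [cyl, Set.mem_inter_iff, Set.mem_preimage, Set.mem_ofPred_eq, after_apply]
        constructor
        · rintro ⟨h1, h2⟩ i hi
          rcases le_or_gt i n with h | h
          · rw [h2 i h, hρ1 i h]
          · obtain ⟨j, rfl⟩ := Nat.exists_eq_add_of_lt h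
            rw [add_assoc, h1 (j + 1) (by omega), hρ2]
        · intro h
          refine ⟨fun i hi => by rw [h _ (by omega), hρ2], fun i hi => by rw [h i (by omega), hρ1 i hi]⟩
      rw [heq, hPq.cyl_eq, hPq.cyl_eq, Finset.prod_range_add, hρ1 0 (by omega), if_pos h0, one_mul,
        ← mul_assoc]
      congr 1
      · congr 1
        refine Finset.prod_congr rfl fun i hi => ?_
        rw [Finset.mem_range] at hi
        rw [hρ1 i (by omega), hρ1 (i + 1) (by omega)]
      · refine Finset.prod_congr rfl fun i hi => ?_
        rw [hρ2, add_assoc, hρ2]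
    · have heq : after n ⁻¹' cyl m γ' ∩ cyl n γ = ∅ := by
        ext f
        simp only [cyl, Set.mem_inter_iff, Set.mem_preimage, Set.mem_ofPred_eq, after_apply,
          Set.mem_empty_iff_false, iff_false]
        rintro ⟨h1, h2⟩
        exact h0 (by rw [← h1 0 (by omega), ← h2 n le_rfl, add_zero])
      rw [heq, if_neg h0]
      simp
  have := congrArg (fun μ => μ A) key
  simp only [Measure.smul_apply, smul_eq_mul] at this
  rw [← this, Measure.map_apply (measurable_after n) hA,
      Measure.restrict_apply (measurable_after n hA), Set.inter_comm]

/-- the Markov property at a deterministic time. -/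
lemma IsQuenchedFamily.markov (hPq : IsQuenchedFamily Pq) (ω : Env d) (x : Site d) {n : ℕ}
    {B : Set (Path d)} (hB : UpTo n B) {A : Set (Path d)} (hA : MeasurableSet A) :
    Pq ω x (B ∩ after n ⁻¹' A) = ∫⁻ f in B, Pq ω (f n) A ∂(Pq ω x) := by
  have hAm := measurable_after n hA
  have hBm := hB.measurableSet
  rw [measure_eq_tsum_fiber (Pq ω x) (measurable_pre n) (hBm.inter hAm)]
  have h0 := lintegral_eq_tsum_fiber ((Pq ω x).restrict B) (measurable_pre n)
    (fun s : Fin (n + 1) → Site d => Pq ω (s (Fin.last n)) A)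
  refine Eq.trans ?_ h0.symm
  congr 1
  funext s
  rw [Measure.restrict_apply (measurable_pre n (measurableSet_singleton s)), preimage_pre]
  by_cases hs : extend s ∈ B
  · have h1 : cyl n (extend s) ∩ B = cyl n (extend s) := by
      rw [Set.inter_eq_left]
      intro f hf
      exact hB _ f (fun i hi => (hf i hi).symm) hs
    rw [← Set.inter_assoc, h1, hPq.markov_cyl ω x n _ hA, mul_comm, extend_apply s le_rfl]
    rfl
  · have h1 : cyl n (extend s) ∩ B = ∅ := by
      ext f
      simp only [Set.mem_inter_iff, Set.mem_empty_iff_false, iff_false]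
      rintro ⟨hf, hfB⟩
      exact hs (hB f _ hf hfB)
    rw [← Set.inter_assoc, h1]
    simp

lemma IsQuenchedFamily.markov_le (hPq : IsQuenchedFamily Pq) (ω : Env d) (x : Site d) {n : ℕ}
    {B : Set (Path d)} (hB : UpTo n B) {A : Set (Path d)} (hA : MeasurableSet A) {c : ℝ≥0∞}
    (hc : ∀ f ∈ B, Pq ω (f n) A ≤ c) :
    Pq ω x (B ∩ after n ⁻¹' A) ≤ c * Pq ω x B := by
  rw [hPq.markov ω x hB hA]
  calc _ ≤ ∫⁻ f in B, c ∂(Pq ω x) := setLIntegral_mono' hB.measurableSet hc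
    _ = _ := by rw [setLIntegral_const]

lemma IsQuenchedFamily.le_markov (hPq : IsQuenchedFamily Pq) (ω : Env d) (x : Site d) {n : ℕ}
    {B : Set (Path d)} (hB : UpTo n B) {A : Set (Path d)} (hA : MeasurableSet A) {c : ℝ≥0∞}
    (hc : ∀ f ∈ B, c ≤ Pq ω (f n) A) :
    c * Pq ω x B ≤ Pq ω x (B ∩ after n ⁻¹' A) := by
  rw [hPq.markov ω x hB hA]
  calc _ = ∫⁻ f in B, c ∂(Pq ω x) := by rw [setLIntegral_const]
    _ ≤ _ := setLIntegral_mono' hB.measurableSet hc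

/-- strong Markov upper bound: the events `B n` are the disjoint stopping events. -/
lemma IsQuenchedFamily.strong_markov_le (hPq : IsQuenchedFamily Pq) (ω : Env d) (x : Site d)
    {B : ℕ → Set (Path d)} (hB : ∀ n, UpTo n (B n)) (hdisj : Pairwise (Function.onFun Disjoint B))
    {A : Set (Path d)} (hA : MeasurableSet A) {c : ℝ≥0∞}
    (hc : ∀ n, ∀ f ∈ B n, Pq ω (f n) A ≤ c) :
    Pq ω x (⋃ n, B n ∩ after n ⁻¹' A) ≤ c * Pq ω x (⋃ n, B n) := by
  calc _ ≤ ∑' n, Pq ω x (B n ∩ after n ⁻¹' A) := measure_iUnion_le _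
    _ ≤ ∑' n, c * Pq ω x (B n) := ENNReal.tsum_le_tsum fun n => hPq.markov_le ω x (hB n) hA (hc n)
    _ = _ := by rw [ENNReal.tsum_mul_left, measure_iUnion hdisj fun n => (hB n).measurableSet]

lemma IsQuenchedFamily.le_strong_markov (hPq : IsQuenchedFamily Pq) (ω : Env d) (x : Site d)
    {B : ℕ → Set (Path d)} (hB : ∀ n, UpTo n (B n)) (hdisj : Pairwise (Function.onFun Disjoint B))
    {A : Set (Path d)} (hA : MeasurableSet A) {c : ℝ≥0∞}
    (hc : ∀ n, ∀ f ∈ B n, c ≤ Pq ω (f n) A) :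
    c * Pq ω x (⋃ n, B n) ≤ Pq ω x (⋃ n, B n ∩ after n ⁻¹' A) := by
  rw [measure_iUnion hdisj fun n => (hB n).measurableSet, ← ENNReal.tsum_mul_left, measure_iUnion]
  · exact ENNReal.tsum_le_tsum fun n => hPq.le_markov ω x (hB n) hA (hc n)
  · exact fun i j hij => (hdisj hij).mono Set.inter_subset_left Set.inter_subset_left
  · exact fun n => (hB n).measurableSet.inter (measurable_after n hA)

end Quenched

/-- the path makes nearest-neighbour steps. -/
def NN {d : ℕ} (f : Path d) : Prop := ∀ n, ∃ s : StepIdx d, f (n + 1) = f n + stepVec s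

lemma envP_ne_zero {d : ℕ} {ω : Env d} {y v : Site d} (h : envP ω y v ≠ 0) :
    ∃ s, v = stepVec s := by
  by_contra hc
  push Not at hc
  exact h (Finset.sum_eq_zero fun s _ => by rw [if_neg (hc s)])

lemma stepVec_injective {d : ℕ} : Function.Injective (stepVec : StepIdx d → Site d) := by
  rintro ⟨i, b⟩ ⟨j, c⟩ h
  have h1 := congrFun h i
  have h2 := congrFun h j
  simp only [stepVec, if_true] at h1 h2
  by_cases hij : i = j
  · subst hij
    cases b <;> cases c <;> simp_all
  · rw [if_neg hij] at h1
    cases b <;> simp_all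

lemma envP_stepVec {d : ℕ} (ω : Env d) (y : Site d) (s : StepIdx d) :
    envP ω y (stepVec s) = ENNReal.ofReal ((ω y).1 s) := by
  unfold envP
  rw [Finset.sum_eq_single s]
  · simp
  · intro b _ hb
    rw [if_neg fun h => hb (stepVec_injective h).symm]
  · simp

section Quenched

variable {d : ℕ} {Pq : Env d → Site d → Measure (Path d)}

lemma IsQuenchedFamily.ae_nn (hPq : IsQuenchedFamily Pq) (ω : Env d) (x : Site d) :
    ∀ᵐ f ∂(Pq ω x), NN f := by
  rw [show (∀ᵐ f ∂(Pq ω x), NN f) ↔ _ from ae_all_iff]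
  intro n
  set A : Set (Path d) := {f | ¬ ∃ s, f 1 = f 0 + stepVec s}
  have hA : UpTo 1 A := by
    intro f g h hf
    simp only [A, Set.mem_ofPred_eq] at *
    rwa [← h 0 (by omega), ← h 1 le_rfl]
  have hz : ∀ y, Pq ω y A = 0 := by
    intro y
    rw [measure_eq_tsum_fiber _ (measurable_pre 1) hA.measurableSet]
    simp only [ENNReal.tsum_eq_zero]
    intro s
    by_cases hs : extend s ∈ A
    · refine measure_mono_null Set.inter_subset_left ?_
      rw [preimage_pre, hPq.cyl_eq]
      have : envP ω (extend s 0) (extend s (0 + 1) - extend s 0) = 0 := by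
        by_contra h
        obtain ⟨t, ht⟩ := envP_ne_zero h
        exact hs ⟨t, by rw [← ht]; simp⟩
      rw [Finset.prod_range_one, this, mul_zero]
    · refine measure_mono_null (t := ∅) ?_ (by simp)
      rintro f ⟨hf, hfA⟩
      rw [preimage_pre] at hf
      exact hs (hA f _ hf hfA)
  have h := hPq.markov_le ω x (n := n) (B := Set.univ) (fun _ _ _ _ => trivial) hA.measurableSet
    (c := 0) (fun f _ => (hz _).le)
  rw [zero_mul, Set.univ_inter, nonpos_iff_eq_zero] at h
  exact h

end Quenched

/-- `g` depends only on the environment in `S`. -/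
def LocalOn {d : ℕ} {β : Type*} (S : Set (Site d)) (g : Env d → β) : Prop :=
  ∀ ω ω' : Env d, (∀ y ∈ S, ω y = ω' y) → g ω = g ω'

section Locality

variable {d : ℕ} {Pq : Env d → Site d → Measure (Path d)}

lemma IsQuenchedFamily.local_upTo (hPq : IsQuenchedFamily Pq) (x : Site d) {n : ℕ}
    {B : Set (Path d)} (hB : UpTo n B) {S : Set (Site d)} (hS : ∀ f ∈ B, ∀ i < n, f i ∈ S) :
    LocalOn S fun ω => Pq ω x B := by
  intro ω ω' h
  simp only
  rw [measure_eq_tsum_fiber _ (measurable_pre n) hB.measurableSet,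
    measure_eq_tsum_fiber _ (measurable_pre n) hB.measurableSet]
  congr 1
  funext s
  rw [preimage_pre]
  by_cases hs : extend s ∈ B
  · have h1 : cyl n (extend s) ∩ B = cyl n (extend s) := by
      rw [Set.inter_eq_left]
      intro f hf
      exact hB _ f (fun i hi => (hf i hi).symm) hs
    rw [h1, hPq.cyl_eq, hPq.cyl_eq]
    congr 1
    refine Finset.prod_congr rfl fun i hi => ?_
    unfold envP
    rw [h _ (hS _ hs i (Finset.mem_range.1 hi))]
  · have h1 : cyl n (extend s) ∩ B = ∅ := by
      ext f
      simp only [Set.mem_inter_iff, Set.mem_empty_iff_false, iff_false]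
      rintro ⟨hf, hfB⟩
      exact hs (hB f _ hf hfB)
    rw [h1]
    simp

/-- the event that the path never leaves `S`. -/
def stay {d : ℕ} (S : Set (Site d)) : Set (Path d) := {f | ∀ i, f i ∈ S}

lemma upTo_stayBefore (S : Set (Site d)) (n : ℕ) : UpTo n {f : Path d | ∀ i < n, f i ∈ S} :=
  fun f g h hf i hi => by rw [← h i hi.le]; exact hf i hi

lemma stay_eq_iInter (S : Set (Site d)) : stay S = ⋂ n, {f : Path d | ∀ i < n, f i ∈ S} := by
  ext f
  simp only [stay, Set.mem_ofPred_eq, Set.mem_iInter]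
  exact ⟨fun h n i _ => h i, fun h i => h (i + 1) i (by omega)⟩

lemma measurableSet_stay (S : Set (Site d)) : MeasurableSet (stay S) := by
  rw [stay_eq_iInter]
  exact MeasurableSet.iInter fun n => (upTo_stayBefore S n).measurableSet

lemma IsQuenchedFamily.local_stay (hPq : IsQuenchedFamily Pq) (x : Site d)
    {A : Set (Path d)} (hA : MeasurableSet A) {S : Set (Site d)} (hS : A ⊆ stay S) :
    LocalOn S fun ω => Pq ω x A := by
  intro ω ω' h
  have := hPq.prob ω x
  have := hPq.prob ω' x
  have key : (Pq ω x).restrict (stay S) = (Pq ω' x).restrict (stay S) := by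
    refine measure_ext_cyl fun n γ => ?_
    rw [Measure.restrict_apply (measurableSet_cyl n γ), Measure.restrict_apply (measurableSet_cyl n γ)]
    set D : ℕ → Set (Path d) := fun m => cyl n γ ∩ {f | ∀ i < n + m, f i ∈ S}
    have hD : ∀ m, UpTo (n + m) (D m) := fun m =>
      ((upTo_cyl n γ).mono (by omega)).inter (upTo_stayBefore S _)
    have hanti : Antitone D := by
      intro m m' hm f hf
      exact ⟨hf.1, fun i hi => hf.2 i (by omega)⟩
    have heq : cyl n γ ∩ stay S = ⋂ m, D m := by
      ext f
      simp only [D, stay, Set.mem_inter_iff, Set.mem_ofPred_eq, Set.mem_iInter]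
      exact ⟨fun h m => ⟨h.1, fun i _ => h.2 i⟩, fun h => ⟨(h 0).1, fun i => (h (i + 1)).2 i (by omega)⟩⟩
    rw [heq]
    have t1 := tendsto_measure_iInter_atTop (μ := Pq ω x)
      (fun m => (hD m).measurableSet.nullMeasurableSet) hanti ⟨0, measure_ne_top _ _⟩
    have t2 := tendsto_measure_iInter_atTop (μ := Pq ω' x)
      (fun m => (hD m).measurableSet.nullMeasurableSet) hanti ⟨0, measure_ne_top _ _⟩
    refine tendsto_nhds_unique t1 (t2.congr fun m => ?_)
    exact ((hPq.local_upTo x (hD m) (S := S) fun f hf => hf.2) ω ω' h).symm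
  have h1 := congrArg (fun μ => μ A) key
  simp only [Measure.restrict_apply hA, Set.inter_eq_left.2 hS] at h1
  exact h1

lemma IsQuenchedFamily.local_iUnion (hPq : IsQuenchedFamily Pq) (x : Site d)
    {B : ℕ → Set (Path d)} (hB : ∀ n, UpTo n (B n)) {S : Set (Site d)}
    (hS : ∀ n, ∀ f ∈ B n, ∀ i < n, f i ∈ S) :
    LocalOn S fun ω => Pq ω x (⋃ n, B n) := by
  have hd : ∀ n, UpTo n (disjointed B n) := by
    intro n f g h hf
    rw [disjointed_apply] at *
    refine ⟨hB n f g h hf.1, fun hg => hf.2 ?_⟩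
    simp only [Finset.sup_set_eq_biUnion, Set.mem_iUnion, Finset.mem_Iio] at hg ⊢
    obtain ⟨m, hm, hg⟩ := hg
    exact ⟨m, hm, hB m g f (fun i hi => (h i (hi.trans hm.le)).symm) hg⟩
  intro ω ω' h
  simp only
  rw [← iUnion_disjointed, measure_iUnion (disjoint_disjointed _) fun n => (hd n).measurableSet,
    measure_iUnion (disjoint_disjointed _) fun n => (hd n).measurableSet]
  congr 1
  funext n
  exact hPq.local_upTo x (hd n) (fun f hf => hS n f (disjointed_subset B n hf)) ω ω' h

end Locality

section Independence

variable {d : ℕ} {P : Measure (Env d)}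

lemma IsIID.isProbabilityMeasure (h : IsIID P) : IsProbabilityMeasure P := by
  obtain ⟨ν, -, h⟩ := h
  constructor
  have := h ∅ (fun _ => Set.univ) fun _ => MeasurableSet.univ
  simpa using this

lemma IsIID.iIndep (h : IsIID P) :
    ProbabilityTheory.iIndepFun (fun (x : Site d) (ω : Env d) => ω x) P := by
  rw [ProbabilityTheory.iIndepFun_iff_measure_inter_preimage_eq_mul]
  obtain ⟨ν, hν, h⟩ := h
  classical
  intro S B hB
  set B' : Site d → Set (EnvAt d) := fun x => if x ∈ S then B x else Set.univ
  have hB' : ∀ x, MeasurableSet (B' x) := by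
    intro x
    by_cases hx : x ∈ S
    · simpa [B', hx] using hB x hx
    · simp [B', hx]
  have h1 := h S B' hB'
  have e1 : (⋂ i ∈ S, (fun ω : Env d => ω i) ⁻¹' B i) = {ω | ∀ x ∈ S, ω x ∈ B' x} := by
    ext ω
    simp only [Set.mem_iInter, Set.mem_preimage, Set.mem_ofPred_eq]
    refine forall₂_congr fun x hx => ?_
    simp [B', hx]
  rw [e1, h1]
  refine Finset.prod_congr rfl fun x hx => ?_
  have h2 := h {x} B' hB'
  simp only [Finset.mem_singleton, forall_eq, Finset.prod_singleton] at h2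
  rw [← h2]
  simp [B', hx, Set.preimage]

/-- independence of functions of the environment in disjoint regions. -/
lemma IsIID.lintegral_mul (h : IsIID P) {S T : Set (Site d)} (hST : Disjoint S T)
    {g k : Env d → ℝ≥0∞} (hg : Measurable g) (hk : Measurable k) (hgS : LocalOn S g)
    (hkT : LocalOn T k) : ∫⁻ ω, g ω * k ω ∂P = (∫⁻ ω, g ω ∂P) * ∫⁻ ω, k ω ∂P := by
  classical
  have hle : ∀ x : Site d, MeasurableSpace.comap (fun ω : Env d => ω x) inferInstance ≤
      (inferInstance : MeasurableSpace (Env d)) := fun x => (measurable_pi_apply x).comap_le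
  have hne : Nonempty (Env d) := by
    by_contra hcon
    rw [not_nonempty_iff] at hcon
    have := h.isProbabilityMeasure
    have := IsProbabilityMeasure.ne_zero P
    exact this (Measure.eq_zero_of_isEmpty P)
  obtain ⟨ω₀⟩ := hne
  have key : ∀ (S : Set (Site d)) (g : Env d → ℝ≥0∞), Measurable g → LocalOn S g →
      Measurable[⨆ x ∈ S, MeasurableSpace.comap (fun ω : Env d => ω x) inferInstance] g := by
    intro S g hg hgS
    have e : g = g ∘ fun ω x => if x ∈ S then ω x else ω₀ x := by
      funext ω
      refine hgS _ _ fun y hy => ?_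
      simp [hy]
    rw [e]
    refine hg.comp ?_
    refine @measurable_pi_lambda _ _ _ (_) _ _ fun x => ?_
    by_cases hx : x ∈ S
    · simp only [hx, if_true]
      refine Measurable.mono (Measurable.of_comap_le le_rfl) ?_ le_rfl
      exact le_iSup₂_of_le x hx le_rfl
    · simp only [hx, if_false]
      exact measurable_const
  refine ProbabilityTheory.lintegral_mul_eq_lintegral_mul_lintegral_of_independent_measurableSpace
    (iSup₂_le fun x _ => hle x) (iSup₂_le fun x _ => hle x)
    (ProbabilityTheory.indep_iSup_of_disjoint hle h.iIndep hST) (key S g hg hgS) (key T k hk hkT)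

lemma IsIID.lintegral_prod (h : IsIID P) {ι : Type*} (s : Finset ι) {S : ι → Set (Site d)}
    (hS : ∀ i ∈ s, ∀ j ∈ s, i ≠ j → Disjoint (S i) (S j))
    {g : ι → Env d → ℝ≥0∞} (hg : ∀ i, Measurable (g i)) (hgS : ∀ i ∈ s, LocalOn (S i) (g i)) :
    ∫⁻ ω, ∏ i ∈ s, g i ω ∂P = ∏ i ∈ s, ∫⁻ ω, g i ω ∂P := by
  classical
  have := h.isProbabilityMeasure
  induction s using Finset.induction_on with
  | empty => simp
  | insert a s ha ih =>
    simp only [Finset.prod_insert ha]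
    rw [h.lintegral_mul (S := S a) (T := ⋃ i ∈ s, S i) _ (hg a) _ (hgS a (by simp)) _, ih]
    · exact fun i hi j hj => hS i (by simp [hi]) j (by simp [hj])
    · exact fun i hi => hgS i (by simp [hi])
    · rw [Set.disjoint_iUnion₂_right]
      intro i hi
      exact hS a (by simp) i (by simp [hi]) (fun e => ha (e ▸ hi))
    · exact Finset.measurable_fun_prod _ fun i _ => hg i
    · intro ω ω' hω
      refine Finset.prod_congr rfl fun i hi => ?_
      exact hgS i (by simp [hi]) ω ω' fun y hy => hω y (Set.mem_biUnion hi hy)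

lemma measurable_shift (x : Site d) : Measurable (shift x : Env d → Env d) :=
  measurable_pi_lambda _ fun _ => measurable_pi_apply _

lemma IsIID.map_shift (h : IsIID P) (x : Site d) : P.map (shift x) = P := by
  have := h.isProbabilityMeasure
  obtain ⟨ν, hν, h⟩ := h
  classical
  have key : ∀ Q : Measure (Env d), (∀ (s : Finset (Site d)) (B : Site d → Set (EnvAt d)),
      (∀ x, MeasurableSet (B x)) → Q {ω | ∀ x ∈ s, ω x ∈ B x} = ∏ x ∈ s, ν (B x)) →
      Q = Measure.infinitePi fun _ => ν := by
    intro Q hQ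
    refine Measure.eq_infinitePi _ fun s t ht => ?_
    rw [← hQ s t ht]
    congr 1
  rw [key P h]
  apply key
  intro s B hB
  rw [← key P h, Measure.map_apply (measurable_shift x)]
  · have := h (s.map (addLeftEmbedding x)) (fun y => B (y - x)) fun y => hB _
    simp only [Finset.prod_map, addLeftEmbedding_apply, add_sub_cancel_left] at this
    rw [← this]
    congr 1
    ext ω
    simp [shift]
  · have : {ω : Env d | ∀ x ∈ s, ω x ∈ B x} = ⋂ x ∈ s, (fun ω : Env d => ω x) ⁻¹' B x := by
      ext ω; simp
    rw [this]
    exact Finset.measurableSet_biInter s fun y _ => measurable_pi_apply y (hB y)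

/-- all transition probabilities are at least `η`. -/
def Ell {d : ℕ} (η : ℝ) (ω : Env d) : Prop := ∀ x s, η ≤ (ω x).1 s

lemma UniformlyElliptic.exists_ell (hUE : UniformlyElliptic P) (h : IsIID P) :
    ∃ η : ℝ, 0 < η ∧ ∀ᵐ ω ∂P, Ell η ω := by
  obtain ⟨η, hη, hE⟩ := hUE
  refine ⟨η, hη, ?_⟩
  unfold Ell
  rw [ae_all_iff]
  intro x
  rw [ae_all_iff]
  intro s
  have h1 : P (shift x ⁻¹' {ω | (ω 0).1 s < η}) = 0 := by
    rw [← Measure.map_apply (measurable_shift x), h.map_shift, hE]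
    refine measurableSet_lt ?_ measurable_const
    exact (measurable_pi_apply s).comp (measurable_subtype_coe.comp (measurable_pi_apply 0))
  refine measure_mono_null ?_ h1
  intro ω hω
  simpa [shift] using hω

end Independence

section Annealed

variable {d : ℕ} {P : Measure (Env d)} {Pq : Env d → Site d → Measure (Path d)}

/-- the annealed law as a measure on path space. -/
def annM {d : ℕ} (P : Measure (Env d)) (Pq : Env d → Site d → Measure (Path d)) (x : Site d) :
    Measure (Path d) := P.bind fun ω => Pq ω x

lemma IsQuenchedFamily.measurable (hPq : IsQuenchedFamily Pq) (x : Site d) :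
    Measurable fun ω => Pq ω x :=
  Measure.measurable_of_measurable_coe _ fun A hA => hPq.2 x A hA

lemma annM_apply (hPq : IsQuenchedFamily Pq) (x : Site d) {A : Set (Path d)}
    (hA : MeasurableSet A) : annM P Pq x A = ∫⁻ ω, Pq ω x A ∂P :=
  Measure.bind_apply hA (hPq.measurable x).aemeasurable

lemma ann_le_annM (hPq : IsQuenchedFamily Pq) (x : Site d) (A : Set (Path d)) :
    ann P Pq x A ≤ annM P Pq x A := by
  rw [← measure_toMeasurable, annM_apply hPq x (measurableSet_toMeasurable _ _)]
  exact lintegral_mono fun ω => measure_mono (subset_toMeasurable _ _)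

lemma ann_eq_annM (hPq : IsQuenchedFamily Pq) (x : Site d) {A : Set (Path d)}
    (hA : MeasurableSet A) : ann P Pq x A = annM P Pq x A := (annM_apply hPq x hA).symm

lemma isProbabilityMeasure_annM [IsProbabilityMeasure P] (hPq : IsQuenchedFamily Pq) (x : Site d) :
    IsProbabilityMeasure (annM P Pq x) := by
  constructor
  rw [annM_apply hPq x MeasurableSet.univ]
  have : ∀ ω, Pq ω x Set.univ = 1 := fun ω => (hPq.prob ω x).measure_univ
  simp [this]

lemma ae_annM (hPq : IsQuenchedFamily Pq) (x : Site d) {p : Path d → Prop}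
    (hp : MeasurableSet {f | p f}) (h : ∀ᵐ ω ∂P, ∀ᵐ f ∂(Pq ω x), p f) : ∀ᵐ f ∂(annM P Pq x), p f := by
  change annM P Pq x {f | p f}ᶜ = 0
  rw [annM_apply hPq x hp.compl, lintegral_eq_zero_iff (hPq.2 x _ hp.compl)]
  exact h

lemma measurableSet_nn : MeasurableSet {f : Path d | NN f} := by
  have : {f : Path d | NN f} = ⋂ n, {f | ∃ s : StepIdx d, f (n + 1) = f n + stepVec s} := by
    ext f; simp [NN]
  rw [this]
  refine MeasurableSet.iInter fun n => ?_
  refine UpTo.measurableSet (n := n + 1) fun f g h hf => ?_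
  simp only [Set.mem_ofPred_eq] at *
  rwa [← h n (by omega), ← h (n + 1) le_rfl]

lemma ae_nn_annM (hPq : IsQuenchedFamily Pq) (x : Site d) : ∀ᵐ f ∂(annM P Pq x), NN f :=
  ae_annM hPq x measurableSet_nn (Eventually.of_forall fun ω => hPq.ae_nn ω x)

lemma measurableSet_eval (n : ℕ) (S : Set (Site d)) : MeasurableSet {f : Path d | f n ∈ S} :=
  UpTo.measurableSet (n := n) fun f g h hf => by
    simp only [Set.mem_ofPred_eq] at *
    rwa [← h n le_rfl]

lemma ae_start_annM (hPq : IsQuenchedFamily Pq) (x : Site d) : ∀ᵐ f ∂(annM P Pq x), f 0 = x :=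
  ae_annM hPq x (measurableSet_eval 0 {x}) (Eventually.of_forall fun ω => hPq.start ω x)

/-- translation of a path. -/
def translate {d : ℕ} (x : Site d) (f : Path d) : Path d := fun n => x + f n

lemma measurable_translate (x : Site d) : Measurable (translate x : Path d → Path d) :=
  measurable_pi_lambda _ fun n => (Measurable.of_discrete (f := fun y : Site d => x + y)).comp
    (measurable_pi_apply n)

lemma IsQuenchedFamily.eq_map_translate (hPq : IsQuenchedFamily Pq) (ω : Env d) (x y : Site d) :
    Pq ω (x + y) = (Pq (shift x ω) y).map (translate x) := by
  have := hPq.prob ω (x + y)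
  have := hPq.prob (shift x ω) y
  refine measure_ext_cyl fun n γ => ?_
  rw [Measure.map_apply (measurable_translate x) (measurableSet_cyl n γ)]
  have : translate x ⁻¹' cyl n γ = cyl n fun i => γ i - x := by
    ext f
    simp only [translate, cyl, Set.mem_preimage, Set.mem_ofPred_eq]
    refine forall₂_congr fun i hi => ?_
    rw [eq_sub_iff_add_eq, add_comm]
  rw [this, hPq.cyl_eq, hPq.cyl_eq]
  congr 1
  · congr 1
    rw [sub_eq_iff_eq_add, add_comm]
  · refine Finset.prod_congr rfl fun i _ => ?_
    simp [envP, shift]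

lemma annM_add (hPq : IsQuenchedFamily Pq) (h : IsIID P) (x y : Site d) :
    annM P Pq (x + y) = (annM P Pq y).map (translate x) := by
  ext A hA
  have hm := measurable_translate x hA
  rw [Measure.map_apply (measurable_translate x) hA, annM_apply hPq _ hA, annM_apply hPq _ hm]
  conv_rhs => rw [← h.map_shift x]
  rw [lintegral_map (hPq.2 y _ hm) (measurable_shift x)]
  refine lintegral_congr fun ω => ?_
  rw [hPq.eq_map_translate, Measure.map_apply (measurable_translate x) hA]

lemma annM_eq (hPq : IsQuenchedFamily Pq) (h : IsIID P) (x : Site d) {A : Set (Path d)}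
    (hA : MeasurableSet A) : annM P Pq x A = annM P Pq 0 (translate x ⁻¹' A) := by
  conv_lhs => rw [← add_zero x, annM_add hPq h, Measure.map_apply (measurable_translate x) hA]

/-- annealed Markov property with fresh environment. -/
lemma annM_fresh (hPq : IsQuenchedFamily Pq) (h : IsIID P) (x y : Site d) {n : ℕ}
    {B : Set (Path d)} (hB : UpTo n B) {S T : Set (Site d)} (hST : Disjoint S T)
    (hS : ∀ f ∈ B, ∀ i < n, f i ∈ S) (hy : ∀ f ∈ B, f n = y)
    {A : Set (Path d)} (hA : MeasurableSet A) (hT : LocalOn T fun ω => Pq ω y A) :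
    annM P Pq x (B ∩ after n ⁻¹' A) = annM P Pq x B * annM P Pq y A := by
  rw [annM_apply hPq x (hB.measurableSet.inter (measurable_after n hA)),
    annM_apply hPq x hB.measurableSet, annM_apply hPq y hA,
    ← h.lintegral_mul hST (hPq.2 x _ hB.measurableSet) (hPq.2 y _ hA) (hPq.local_upTo x hB hS) hT]
  refine lintegral_congr fun ω => ?_
  rw [hPq.markov ω x hB hA, mul_comm, ← setLIntegral_const]
  refine setLIntegral_congr_fun hB.measurableSet fun f hf => ?_
  simp only [hy f hf]

end Annealed

section FirstHit

variable {d : ℕ} {P : Measure (Env d)} {Pq : Env d → Site d → Measure (Path d)}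

/-- the first visit to `Y` happens at time `n`. -/
def firstHit {d : ℕ} (Y : Set (Site d)) (n : ℕ) : Set (Path d) := {f | f n ∈ Y ∧ ∀ m < n, f m ∉ Y}

lemma upTo_firstHit (Y : Set (Site d)) (n : ℕ) : UpTo n (firstHit Y n) := by
  intro f g h hf
  refine ⟨by rw [← h n le_rfl]; exact hf.1, fun m hm => ?_⟩
  rw [← h m hm.le]
  exact hf.2 m hm

lemma disjoint_firstHit (Y : Set (Site d)) : Pairwise (Function.onFun Disjoint (firstHit Y)) := by
  intro n m hnm
  rw [Function.onFun, Set.disjoint_left]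
  rintro f hf hf'
  rcases lt_or_gt_of_ne hnm with h | h
  · exact hf'.2 n h hf.1
  · exact hf.2 m h hf'.1

lemma exists_firstHit {Y : Set (Site d)} {f : Path d} {n : ℕ} (h : f n ∈ Y) :
    ∃ m ≤ n, f ∈ firstHit Y m := by
  classical
  have hex : ∃ n, f n ∈ Y := ⟨n, h⟩
  exact ⟨Nat.find hex, Nat.find_min' hex h, Nat.find_spec hex, fun m hm => Nat.find_min hex hm⟩

lemma IsQuenchedFamily.firstHit_le (hPq : IsQuenchedFamily Pq) (ω : Env d) (x y : Site d)
    {A : Set (Path d)} (hA : MeasurableSet A) :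
    Pq ω x (⋃ n, firstHit {y} n ∩ after n ⁻¹' A) ≤ Pq ω y A := by
  have := hPq.prob ω x
  refine (hPq.strong_markov_le ω x (upTo_firstHit {y}) (disjoint_firstHit {y}) hA
    (c := Pq ω y A) fun n f hf => ?_).trans (mul_le_of_le_one_right (zero_le) prob_le_one)
  rw [show f n = y from hf.1]

lemma measurableSet_firstHit_after (Y : Set (Site d)) {A : Set (Path d)} (hA : MeasurableSet A) :
    MeasurableSet (⋃ n, firstHit Y n ∩ after n ⁻¹' A) :=
  MeasurableSet.iUnion fun n => (upTo_firstHit Y n).measurableSet.inter (measurable_after n hA)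

lemma annM_firstHit_le (hPq : IsQuenchedFamily Pq) (x y : Site d)
    {A : Set (Path d)} (hA : MeasurableSet A) :
    annM P Pq x (⋃ n, firstHit {y} n ∩ after n ⁻¹' A) ≤ annM P Pq y A := by
  rw [annM_apply hPq x (measurableSet_firstHit_after _ hA), annM_apply hPq y hA]
  exact lintegral_mono fun ω => hPq.firstHit_le ω x y hA

end FirstHit

/-- the first time in `[0, n]` at which `φ ∘ f` is maximal. -/
lemma exists_first_argmax {d : ℕ} (φ : Site d → ℝ) (f : Path d) (n : ℕ) :
    ∃ s ≤ n, (∀ m ≤ n, φ (f m) ≤ φ (f s)) ∧ ∀ m < s, f m ≠ f s := by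
  classical
  obtain ⟨t, ht, hmax⟩ := Finset.exists_max_image (Finset.range (n + 1)) (fun m => φ (f m))
    ⟨0, by simp⟩
  have hex : ∃ s, s ≤ n ∧ ∀ m ≤ n, φ (f m) ≤ φ (f s) :=
    ⟨t, by simpa [Nat.lt_succ_iff] using ht, fun m hm => hmax m (by simp; omega)⟩
  refine ⟨Nat.find hex, (Nat.find_spec hex).1, (Nat.find_spec hex).2, fun m hm he => ?_⟩
  refine Nat.find_min hex hm ⟨by have := (Nat.find_spec hex).1; omega, ?_⟩
  rw [he]
  exact (Nat.find_spec hex).2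

/-- the path falls by at least `L` below the value of `φ` at `y`, without ever exceeding it. -/
def dropEvent {d : ℕ} (φ : Site d → ℝ) (y : Site d) (L : ℝ) : Set (Path d) :=
  {f | ∃ n, φ (f n) ≤ φ y - L ∧ ∀ m ≤ n, φ (f m) ≤ φ y}

lemma measurableSet_dropEvent {d : ℕ} (φ : Site d → ℝ) (y : Site d) (L : ℝ) :
    MeasurableSet (dropEvent φ y L) := by
  have : dropEvent φ y L = ⋃ n, {f | φ (f n) ≤ φ y - L ∧ ∀ m ≤ n, φ (f m) ≤ φ y} := by
    ext f; simp [dropEvent]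
  rw [this]
  refine MeasurableSet.iUnion fun n => UpTo.measurableSet (n := n) fun f g h hf => ?_
  simp only [Set.mem_ofPred_eq] at *
  rw [← h n le_rfl]
  exact ⟨hf.1, fun m hm => by rw [← h m hm]; exact hf.2 m hm⟩

/-- the level of a site in the direction `u`. -/
def lev {d : ℕ} (u : Fin d → ℤ) (x : Site d) : ℤ := ∑ i, u i * x i

/-- a stretch of the path inside `V` violates the cone condition by more than `L`. -/
def badCone {d : ℕ} (u : Fin d → ℤ) (c : ℝ) (V : Finset (Site d)) (L : ℝ) : Set (Path d) :=
  {f | ∃ n, (∀ m ≤ n, f m ∈ V) ∧ ∃ s ≤ n, ∃ i,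
    (lev u (f n) : ℝ) - lev u (f s) < c * |(f n i : ℝ) - f s i| - L}

lemma drop_subset {d : ℕ} (φ : Site d → ℝ) (V : Finset (Site d)) (L : ℝ) :
    {f : Path d | ∃ n, (∀ m ≤ n, f m ∈ V) ∧ ∃ s ≤ n, φ (f n) ≤ φ (f s) - L} ⊆
      ⋃ y ∈ V, ⋃ n, firstHit {y} n ∩ after n ⁻¹' dropEvent φ y L := by
  rintro f ⟨n, hV, s, hs, hdrop⟩
  obtain ⟨t, ht, hmax, hfirst⟩ := exists_first_argmax φ f n
  simp only [Set.mem_iUnion]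
  refine ⟨f t, hV t ht, t, ⟨rfl, fun m hm => hfirst m hm⟩, n - t, ?_, ?_⟩
  · simp only [after_apply]
    rw [show t + (n - t) = n by omega]
    linarith [hmax s hs]
  · intro m hm
    exact hmax _ (by omega)

section Setup

variable {d : ℕ} {P : Measure (Env d)} {Pq : Env d → Site d → Measure (Path d)}

lemma annM_drop_le (hPq : IsQuenchedFamily Pq) (x : Site d) (φ : Site d → ℝ)
    (V : Finset (Site d)) (L : ℝ) (b : ℝ≥0∞)
    (hb : ∀ y ∈ V, annM P Pq y (dropEvent φ y L) ≤ b) :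
    annM P Pq x {f : Path d | ∃ n, (∀ m ≤ n, f m ∈ V) ∧ ∃ s ≤ n, φ (f n) ≤ φ (f s) - L} ≤
      V.card * b := by
  calc _ ≤ annM P Pq x (⋃ y ∈ V, ⋃ n, firstHit {y} n ∩ after n ⁻¹' dropEvent φ y L) :=
        measure_mono (drop_subset φ V L)
    _ ≤ ∑ y ∈ V, annM P Pq x (⋃ n, firstHit {y} n ∩ after n ⁻¹' dropEvent φ y L) :=
        measure_biUnion_finset_le _ _
    _ ≤ ∑ y ∈ V, b := Finset.sum_le_sum fun y hy =>
        (annM_firstHit_le hPq x y (measurableSet_dropEvent φ y L)).trans (hb y hy)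
    _ = _ := by simp

/-- the standing data extracted from the assumptions. -/
structure Setup {d : ℕ} (P : Measure (Env d)) (Pq : Env d → Site d → Measure (Path d)) where
  hPq : IsQuenchedFamily Pq
  iid : IsIID P
  (η : ℝ)
  η_pos : 0 < η
  ell : ∀ᵐ ω ∂P, Ell η ω
  (u : Fin d → ℤ)
  (c : ℝ)
  c_pos : 0 < c
  c_le : c ≤ 1
  (a : ℝ)
  a_pos : 0 < a
  (C : ℝ)
  C_pos : 0 < C
  (γ : ℝ)
  γ_pos : 0 < γ
  γ_lt : γ < 1
  cone : ∀ (V : Finset (Site d)) (x : Site d) (L : ℝ), 0 < L →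
    annM P Pq x (badCone u c V L) ≤ ENNReal.ofReal (C * V.card * Real.exp (-(a * L ^ γ)))

lemma norm2R_eq {d : ℕ} (v : Fin d → ℝ) : norm2R v = ‖WithLp.toLp 2 v‖ := by
  rw [EuclideanSpace.norm_eq]
  simp [norm2R]

lemma norm2R_le_sum {d : ℕ} (v : Fin d → ℝ) : norm2R v ≤ ∑ i, |v i| := by
  unfold norm2R
  apply Real.sqrt_le_iff.2
  refine ⟨Finset.sum_nonneg fun i _ => abs_nonneg _, ?_⟩
  calc ∑ i, v i ^ 2 = ∑ i, |v i| ^ 2 := by simp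
    _ ≤ _ := Finset.sum_sq_le_sq_sum_of_nonneg fun i _ => abs_nonneg _

lemma norm2R_add_le {d : ℕ} (v w : Fin d → ℝ) : norm2R (v + w) ≤ norm2R v + norm2R w := by
  simp only [norm2R_eq]
  exact norm_add_le _ _

lemma norm2R_smul {d : ℕ} (r : ℝ) (v : Fin d → ℝ) : norm2R (r • v) = |r| * norm2R v := by
  simp only [norm2R_eq]
  rw [WithLp.toLp_smul, norm_smul, Real.norm_eq_abs]

lemma normalize_close {d : ℕ} {v ℓ : Fin d → ℝ} {ε : ℝ} (hε : ε ≤ 1) (hℓ : norm2R ℓ = 1)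
    (hv : norm2R (v - ℓ) < ε / 2) :
    1 / 2 ≤ norm2R v ∧ norm2R v ≤ 2 ∧ norm2R ((norm2R v)⁻¹ • v) = 1 ∧
      norm2R ((norm2R v)⁻¹ • v - ℓ) < ε := by
  have h1 : norm2R v ≤ norm2R (v - ℓ) + norm2R ℓ := by
    simpa using norm2R_add_le (v - ℓ) ℓ
  have hsymm : norm2R (ℓ - v) = norm2R (v - ℓ) := by
    rw [show ℓ - v = (-1 : ℝ) • (v - ℓ) by simp, norm2R_smul]; simp
  have h2 : norm2R ℓ ≤ norm2R (v - ℓ) + norm2R v := by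
    have := norm2R_add_le (ℓ - v) v
    rw [hsymm] at this
    simpa using this
  have hpos : 0 < norm2R v := by linarith
  refine ⟨by linarith, by linarith, ?_, ?_⟩
  · rw [norm2R_smul, abs_of_pos (inv_pos.2 hpos), inv_mul_cancel₀ hpos.ne']
  · have h3 : norm2R ((norm2R v)⁻¹ • v - v) = |1 - norm2R v| := by
      have : (norm2R v)⁻¹ • v - v = ((norm2R v)⁻¹ - 1) • v := by rw [sub_smul, one_smul]
      rw [this, norm2R_smul]
      nth_rewrite 2 [← abs_of_pos hpos]
      rw [← abs_mul, sub_mul, inv_mul_cancel₀ hpos.ne', one_mul]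
    have h4 := norm2R_add_le ((norm2R v)⁻¹ • v - v) (v - ℓ)
    rw [sub_add_sub_cancel, h3] at h4
    have : |1 - norm2R v| ≤ norm2R (v - ℓ) := by
      rw [abs_le]; constructor <;> linarith
    linarith

/-- an integer direction near `ℓ` whose perturbations remain near `ℓ`. -/
lemma exists_integer_direction {d : ℕ} (ℓ : Fin d → ℝ) {ε : ℝ} (hε : 0 < ε) :
    ∃ (u : Fin d → ℤ) (q δ : ℝ), 0 < q ∧ 0 < δ ∧ ∀ (σ : ℝ) (i : Fin d), |σ| = 1 →
      norm2R ((fun j => (u j : ℝ) / q - if j = i then σ * δ else 0) - ℓ) < ε := by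
  obtain ⟨N, hN⟩ := exists_nat_gt ((2 * (d + 1) : ℝ) / ε)
  have hNpos : (0 : ℝ) < N := lt_trans (by positivity) hN
  refine ⟨fun j => ⌊(N : ℝ) * ℓ j⌋, N, ε / 2, hNpos, by positivity, fun σ i hσ => ?_⟩
  refine (norm2R_le_sum _).trans_lt ?_
  have h1 : ∀ j, |((fun j => ((⌊(N : ℝ) * ℓ j⌋ : ℤ) : ℝ) / N - if j = i then σ * (ε / 2) else 0) - ℓ) j|
      ≤ 1 / N + if j = i then ε / 2 else 0 := by
    intro j
    simp only [Pi.sub_apply]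
    have ha : |((⌊(N : ℝ) * ℓ j⌋ : ℤ) : ℝ) / N - ℓ j| ≤ 1 / N := by
      have e : ((⌊(N : ℝ) * ℓ j⌋ : ℤ) : ℝ) / N - ℓ j = (⌊(N : ℝ) * ℓ j⌋ - N * ℓ j) / N := by
        field_simp
      rw [e, abs_div, abs_of_pos hNpos]
      gcongr
      rw [abs_le]
      have h1 := Int.floor_le ((N : ℝ) * ℓ j)
      have h2 := Int.lt_floor_add_one ((N : ℝ) * ℓ j)
      constructor <;> linarith
    have hb : |if j = i then σ * (ε / 2) else 0| ≤ if j = i then ε / 2 else 0 := by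
      split_ifs
      · rw [abs_mul, hσ, abs_of_pos (by positivity)]; simp
      · simp
    calc _ = |(((⌊(N : ℝ) * ℓ j⌋ : ℤ) : ℝ) / N - ℓ j) - (if j = i then σ * (ε / 2) else 0)| := by
          congr 1; ring
      _ ≤ _ := (abs_sub _ _).trans (add_le_add ha hb)
  refine (Finset.sum_le_sum fun j _ => h1 j).trans_lt ?_
  rw [Finset.sum_add_distrib]
  simp only [Finset.sum_const, Finset.card_univ, Fintype.card_fin, nsmul_eq_mul,
    Finset.sum_ite_eq', Finset.mem_univ, if_true]
  have : (d : ℝ) * (1 / N) < ε / 2 := by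
    rw [mul_one_div, div_lt_iff₀ hNpos]
    rw [div_lt_iff₀ hε] at hN
    nlinarith
  linarith

lemma dotR_smul {d : ℕ} (x : Site d) (r : ℝ) (v : Fin d → ℝ) : dotR x (r • v) = r * dotR x v := by
  unfold dotR
  rw [Finset.mul_sum]
  exact Finset.sum_congr rfl fun i _ => by simp; ring

lemma dotR_neg {d : ℕ} (x : Site d) (v : Fin d → ℝ) : dotR x (-v) = - dotR x v := by
  simp [dotR]

lemma exists_dir_bound (hPq : IsQuenchedFamily Pq) (hCond : CondP P Pq) :
    ∃ (u : Fin d → ℤ) (c a C γ : ℝ), 0 < c ∧ 0 < a ∧ 0 < C ∧ 0 < γ ∧ γ < 1 ∧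
      ∀ (b : Bool) (i : Fin d) (L : ℝ), 0 < L →
        annM P Pq 0 (dropEvent (fun x => (lev u x : ℝ) - (if b then 1 else -1) * c * x i) 0 L) ≤
          ENNReal.ofReal (C * Real.exp (-(a * L ^ γ))) := by
  obtain ⟨γ, hγ, hγ1, ℓ, hℓ, ε, hε, hT⟩ := hCond
  have hε' : 0 < min ε 1 / 2 := by positivity
  obtain ⟨u, q, δ, hq, hδ, hclose⟩ := exists_integer_direction ℓ hε'
  set v : Bool → Fin d → Fin d → ℝ := fun b i j =>
    (u j : ℝ) / q - if j = i then (if b then 1 else -1) * δ else 0 with hv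
  have hnc : ∀ b i, _ := fun b i => normalize_close (v := v b i) (min_le_right ε 1) hℓ
    (hclose (if b then 1 else -1) i (by cases b <;> simp))
  have hTT := fun b i => hT _ (hnc b i).2.2.1 ((hnc b i).2.2.2.trans_le (min_le_left _ _))
  choose K hK using hTT
  set C := 1 + ∑ b, ∑ i, |K b i| with hC
  refine ⟨u, q * δ, ((2 * q)⁻¹) ^ γ, C, γ, by positivity, by positivity, by positivity, hγ, hγ1, ?_⟩
  intro b i L hL
  have hdot : ∀ x : Site d, (lev u x : ℝ) - (if b then 1 else -1) * (q * δ) * x i =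
      q * dotR x (v b i) := by
    intro x
    simp only [dotR, hv, mul_sub, Finset.sum_sub_distrib, lev]
    simp only [mul_ite, mul_zero, Finset.sum_ite_eq', Finset.mem_univ, if_true]
    push_cast
    rw [Finset.mul_sum]
    congr 1
    · exact Finset.sum_congr rfl fun j _ => by field_simp
    · cases b <;> simp <;> ring
  have hsub : dropEvent (fun x => (lev u x : ℝ) - (if b then 1 else -1) * (q * δ) * x i) 0 L ⊆
      backtrackEvent ((norm2R (v b i))⁻¹ • v b i) (L * (2 * q)⁻¹) := by
    rintro f ⟨n, h1, h2⟩
    obtain ⟨hn1, hn2, -, -⟩ := hnc b i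
    have hnpos : 0 < norm2R (v b i) := by linarith
    have hz : dotR (0 : Site d) (v b i) = 0 := by simp [dotR]
    simp only [hdot, hz] at h1 h2
    refine ⟨n, ?_, fun m hm => ?_⟩
    · rw [dotR_neg, dotR_smul]
      have h3 : dotR (f n) (v b i) ≤ - (L / q) := by
        rw [← neg_div, le_div_iff₀ hq]; linarith
      have h4 : (1 / 2 : ℝ) ≤ (norm2R (v b i))⁻¹ := by
        rw [one_div]; exact inv_anti₀ hnpos hn2
      have h5 : 0 < L / q := by positivity
      have e : L * (2 * q)⁻¹ = 1 / 2 * (L / q) := by field_simp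
      rw [e]
      nlinarith
    · rw [dotR_smul]
      have h3 : dotR (f m) (v b i) ≤ 0 := by
        have := h2 m hm
        by_contra hcon
        push Not at hcon
        have := mul_pos hq hcon
        linarith
      have h4 : 0 < (norm2R (v b i))⁻¹ := inv_pos.2 hnpos
      have : (norm2R (v b i))⁻¹ * dotR (f m) (v b i) ≤ 0 := mul_nonpos_of_nonneg_of_nonpos h4.le h3
      have : 0 < L * (2 * q)⁻¹ := by positivity
      linarith
  rw [← ann_eq_annM hPq 0 (measurableSet_dropEvent _ _ _)]
  calc _ ≤ ann P Pq 0 (backtrackEvent ((norm2R (v b i))⁻¹ • v b i) (L * (2 * q)⁻¹)) :=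
        lintegral_mono fun ω => measure_mono hsub
    _ ≤ _ := hK b i _ (by positivity)
    _ ≤ _ := by
      apply ENNReal.ofReal_le_ofReal
      rw [Real.mul_rpow hL.le (by positivity), mul_comm (L ^ γ)]
      gcongr
      have h1 : |K b i| ≤ ∑ j, |K b j| :=
        Finset.single_le_sum (f := fun j => |K b j|) (fun j _ => abs_nonneg _) (Finset.mem_univ i)
      have h2 : ∑ j, |K b j| ≤ ∑ b, ∑ j, |K b j| :=
        Finset.single_le_sum (f := fun b => ∑ j, |K b j|)
          (fun b _ => Finset.sum_nonneg fun j _ => abs_nonneg _) (Finset.mem_univ b)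
      linarith [le_abs_self (K b i)]

lemma dropEvent_translate (u : Fin d → ℤ) (σ c : ℝ) (i : Fin d) (y : Site d) (L : ℝ) :
    translate y ⁻¹' dropEvent (fun x => (lev u x : ℝ) - σ * c * x i) y L =
      dropEvent (fun x => (lev u x : ℝ) - σ * c * x i) 0 L := by
  have h : ∀ x : Site d, lev u (y + x) = lev u y + lev u x := by
    intro x
    simp [lev, mul_add, Finset.sum_add_distrib]
  have h0 : lev u (0 : Site d) = 0 := by simp [lev]
  ext f
  simp only [dropEvent, translate, Set.mem_preimage, Set.mem_ofPred_eq, h, h0, Pi.add_apply,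
    Int.cast_add, Pi.zero_apply, Int.cast_zero]
  refine exists_congr fun n => and_congr ?_ (forall₂_congr fun m _ => ?_) <;>
  · constructor <;> intro h <;> linarith

lemma exists_setup (hPq : IsQuenchedFamily Pq) (hUE : UniformlyElliptic P) (hIID : IsIID P)
    (hCond : CondP P Pq) : Nonempty (Setup P Pq) := by
  obtain ⟨η, hη, hell⟩ := hUE.exists_ell hIID
  obtain ⟨u, c, a, C, γ, hc, ha, hC, hγ, hγ1, hb⟩ := exists_dir_bound hPq hCond
  have main : ∀ (V : Finset (Site d)) (x : Site d) (L : ℝ), 0 < L →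
      annM P Pq x (badCone u c V L) ≤
        ENNReal.ofReal ((2 * d * C + 1) * V.card * Real.exp (-(a * L ^ γ))) := by
    intro V x L hL
    set φ : Bool → Fin d → Site d → ℝ := fun b i x => (lev u x : ℝ) - (if b then 1 else -1) * c * x i
    have hsub : badCone u c V L ⊆ ⋃ b : Bool, ⋃ i : Fin d,
        {f : Path d | ∃ n, (∀ m ≤ n, f m ∈ V) ∧ ∃ s ≤ n, φ b i (f n) ≤ φ b i (f s) - L} := by
      rintro f ⟨n, hV, s, hs, i, hlt⟩
      simp only [Set.mem_iUnion]
      rcases le_total 0 ((f n i : ℝ) - f s i) with h | h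
      · refine ⟨true, i, n, hV, s, hs, ?_⟩
        rw [abs_of_nonneg h] at hlt
        simp only [φ, if_true]
        linarith
      · refine ⟨false, i, n, hV, s, hs, ?_⟩
        rw [abs_of_nonpos h] at hlt
        simp only [φ]
        norm_num
        linarith
    have hone : ∀ b i, annM P Pq x
        {f : Path d | ∃ n, (∀ m ≤ n, f m ∈ V) ∧ ∃ s ≤ n, φ b i (f n) ≤ φ b i (f s) - L} ≤
        V.card * ENNReal.ofReal (C * Real.exp (-(a * L ^ γ))) := by
      intro b i
      refine annM_drop_le hPq x (φ b i) V L _ fun y _ => ?_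
      rw [annM_eq hPq hIID y (measurableSet_dropEvent _ _ _), dropEvent_translate]
      exact hb b i L hL
    calc _ ≤ _ := measure_mono hsub
      _ ≤ ∑ b : Bool, annM P Pq x (⋃ i : Fin d, {f : Path d | ∃ n, (∀ m ≤ n, f m ∈ V) ∧
          ∃ s ≤ n, φ b i (f n) ≤ φ b i (f s) - L}) := measure_iUnion_fintype_le _ _
      _ ≤ ∑ b : Bool, ∑ i : Fin d, annM P Pq x {f : Path d | ∃ n, (∀ m ≤ n, f m ∈ V) ∧
          ∃ s ≤ n, φ b i (f n) ≤ φ b i (f s) - L} :=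
        Finset.sum_le_sum fun b _ => measure_iUnion_fintype_le _ _
      _ ≤ ∑ b : Bool, ∑ i : Fin d, V.card * ENNReal.ofReal (C * Real.exp (-(a * L ^ γ))) :=
        Finset.sum_le_sum fun b _ => Finset.sum_le_sum fun i _ => hone b i
      _ = ENNReal.ofReal (2 * d * C * V.card * Real.exp (-(a * L ^ γ))) := by
        simp only [Finset.sum_const, Finset.card_univ, Fintype.card_fin, Fintype.card_bool,
          nsmul_eq_mul]
        rw [show 2 * (d : ℝ) * C * V.card * Real.exp (-(a * L ^ γ)) =
          2 * (d * (V.card * (C * Real.exp (-(a * L ^ γ))))) by ring]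
        generalize hE : C * Real.exp (-(a * L ^ γ)) = E
        rw [ENNReal.ofReal_mul (by norm_num), ENNReal.ofReal_mul (by positivity),
          ENNReal.ofReal_mul (by positivity)]
        simp
      _ ≤ _ := by
        apply ENNReal.ofReal_le_ofReal
        gcongr
        linarith
  refine ⟨⟨hPq, hIID, η, hη, hell, u, min c 1, by positivity, min_le_right _ _, a, ha,
    2 * d * C + 1, by positivity, γ, hγ, hγ1, fun V x L hL => ?_⟩⟩
  refine (measure_mono ?_).trans (main V x L hL)
  rintro f ⟨n, hV, s, hs, i, hlt⟩
  refine ⟨n, hV, s, hs, i, hlt.trans_le ?_⟩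
  gcongr
  exact min_le_left _ _

end Setup

/-- the cube of radius `r` around the origin. -/
def box (d r : ℕ) : Finset (Site d) := Fintype.piFinset fun _ => Finset.Icc (-(r : ℤ)) r

lemma mem_box {d r : ℕ} {x : Site d} : x ∈ box d r ↔ ∀ i, |x i| ≤ r := by
  simp [box, Fintype.mem_piFinset, abs_le]

lemma card_box (d r : ℕ) : (box d r).card = (2 * r + 1) ^ d := by
  rw [box, Fintype.card_piFinset]
  simp only [Int.card_Icc, Finset.prod_const, Finset.card_univ, Fintype.card_fin]
  congr 1
  omega

lemma box_mono {d r s : ℕ} (h : r ≤ s) : box d r ⊆ box d s := fun x hx => by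
  rw [mem_box] at *
  exact fun i => (hx i).trans (by exact_mod_cast h)

lemma zero_mem_box (d r : ℕ) : (0 : Site d) ∈ box d r := by simp [mem_box]

section Lev

variable {d : ℕ}

lemma lev_add (u : Fin d → ℤ) (x y : Site d) : lev u (x + y) = lev u x + lev u y := by
  simp [lev, mul_add, Finset.sum_add_distrib]

lemma lev_sub (u : Fin d → ℤ) (x y : Site d) : lev u (x - y) = lev u x - lev u y := by
  simp [lev, mul_sub, Finset.sum_sub_distrib]

@[simp] lemma lev_zero (u : Fin d → ℤ) : lev u 0 = 0 := by simp [lev]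

lemma lev_nsmul (u : Fin d → ℤ) (k : ℕ) (x : Site d) : lev u (k • x) = k * lev u x := by
  simp only [lev, Pi.smul_apply, nsmul_eq_mul, Finset.mul_sum]
  exact Finset.sum_congr rfl fun i _ => by ring

lemma lev_stepVec (u : Fin d → ℤ) (s : StepIdx d) :
    lev u (stepVec s) = if s.2 then u s.1 else -u s.1 := by
  simp only [lev, stepVec, mul_ite, mul_zero, Finset.sum_ite_eq', Finset.mem_univ, if_true]
  split_ifs <;> ring

/-- a bound for the change of level in one step. -/
def width (u : Fin d → ℤ) : ℕ := ∑ i, (u i).natAbs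

lemma abs_le_width (u : Fin d → ℤ) (i : Fin d) : |u i| ≤ width u := by
  rw [Int.abs_eq_natAbs]
  have := Finset.single_le_sum (f := fun i => (u i).natAbs) (fun _ _ => Nat.zero_le _)
    (Finset.mem_univ i)
  exact_mod_cast this

lemma abs_lev_stepVec_le (u : Fin d → ℤ) (s : StepIdx d) : |lev u (stepVec s)| ≤ width u := by
  rw [lev_stepVec]
  split_ifs
  · exact abs_le_width u _
  · rw [abs_neg]; exact abs_le_width u _

lemma NN.lev_succ {f : Path d} (hf : NN f) (u : Fin d → ℤ) (n : ℕ) :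
    |lev u (f (n + 1)) - lev u (f n)| ≤ width u := by
  obtain ⟨s, hs⟩ := hf n
  rw [hs, lev_add, add_sub_cancel_left]
  exact abs_lev_stepVec_le u s

lemma abs_stepVec_le (s : StepIdx d) (i : Fin d) : |stepVec s i| ≤ 1 := by
  unfold stepVec
  split_ifs <;> simp

lemma NN.coord_succ {f : Path d} (hf : NN f) (n : ℕ) (i : Fin d) : |f (n + 1) i - f n i| ≤ 1 := by
  obtain ⟨s, hs⟩ := hf n
  rw [hs, Pi.add_apply, add_sub_cancel_left]
  exact abs_stepVec_le s i

lemma NN.coord_le {f : Path d} (hf : NN f) (n m : ℕ) (i : Fin d) : |f (n + m) i - f n i| ≤ m := by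
  induction m with
  | zero => simp
  | succ m ih =>
    have := hf.coord_succ (n + m) i
    rw [abs_le] at *
    push_cast
    rw [← add_assoc n m 1]
    constructor <;> linarith [this.1, this.2, ih.1, ih.2]

end Lev

section Ellipticity

variable {d : ℕ} {P : Measure (Env d)} {Pq : Env d → Site d → Measure (Path d)}

lemma IsQuenchedFamily.cyl_ge (hPq : IsQuenchedFamily Pq) {η : ℝ} {ω : Env d} (hω : Ell η ω)
    (x : Site d) (n : ℕ) (γ : Path d) (h0 : γ 0 = x)
    (hγ : ∀ i < n, ∃ s, γ (i + 1) = γ i + stepVec s) :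
    ENNReal.ofReal η ^ n ≤ Pq ω x (cyl n γ) := by
  rw [hPq.cyl_eq, if_pos h0, one_mul]
  calc ENNReal.ofReal η ^ n = ∏ i ∈ Finset.range n, ENNReal.ofReal η := by simp
    _ ≤ _ := by
      refine Finset.prod_le_prod' fun i hi => ?_
      obtain ⟨s, hs⟩ := hγ i (Finset.mem_range.1 hi)
      rw [hs, add_sub_cancel_left, envP_stepVec]
      exact ENNReal.ofReal_le_ofReal (hω _ _)

/-- the straight path from `x` with steps `s`. -/
def straight (x : Site d) (s : StepIdx d) : Path d := fun k => x + k • stepVec s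

lemma IsQuenchedFamily.straight_ge (hPq : IsQuenchedFamily Pq) {η : ℝ} {ω : Env d}
    (hω : Ell η ω) (x : Site d) (s : StepIdx d) (n : ℕ) :
    ENNReal.ofReal η ^ n ≤ Pq ω x (cyl n (straight x s)) :=
  hPq.cyl_ge hω x n _ (by simp [straight]) fun i _ => ⟨s, by simp only [straight, succ_nsmul, add_assoc]⟩

lemma IsQuenchedFamily.stay_box_eq_zero (hd : 0 < d) (hPq : IsQuenchedFamily Pq) {η : ℝ}
    (hη : 0 < η) {ω : Env d} (hω : Ell η ω) (r : ℕ) (x : Site d) :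
    Pq ω x (stay (box d r : Set (Site d))) = 0 := by
  set V : Set (Site d) := (box d r : Set (Site d)) with hV
  set t : ℝ≥0∞ := ⨆ y : Site d, Pq ω y (stay V) with ht
  set h := 2 * r + 1
  set e : ℝ≥0∞ := ENNReal.ofReal η ^ h with he
  have hepos : e ≠ 0 := by simp [he, hη]
  have ht1 : t ≤ 1 := iSup_le fun y => by
    have := hPq.prob ω y
    exact prob_le_one
  have he1 : e ≤ 1 := by
    have := hPq.prob ω x
    exact (hPq.straight_ge hω x (⟨0, hd⟩, true) h).trans prob_le_one
  have key : t ≤ (1 - e) * t := by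
    refine iSup_le fun y => ?_
    have := hPq.prob ω y
    set B : Set (Path d) := {f | ∀ i < h + 1, f i ∈ V}
    have hB : UpTo h B := fun f g hfg hf i hi => by rw [← hfg i (by omega)]; exact hf i hi
    by_cases hy : y ∈ V
    · calc Pq ω y (stay V) ≤ Pq ω y (B ∩ after h ⁻¹' stay V) := by
            refine measure_mono fun f hf => ⟨fun i _ => hf i, fun i => hf _⟩
        _ ≤ t * Pq ω y B := hPq.markov_le ω y hB (measurableSet_stay V)
            fun f _ => le_iSup (fun z => Pq ω z (stay V)) (f h)
        _ ≤ t * (1 - e) := by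
            gcongr
            have hc : cyl h (straight y (⟨0, hd⟩, true)) ⊆ Bᶜ := by
              intro f hf hfB
              have h1 := hf h le_rfl
              have h2 := hfB h (by omega)
              rw [h1, hV, Finset.mem_coe, mem_box] at h2
              have h3 := h2 ⟨0, hd⟩
              rw [hV, Finset.mem_coe, mem_box] at hy
              have h4 := hy ⟨0, hd⟩
              simp only [straight, stepVec, Pi.add_apply, Pi.smul_apply, if_true] at h3
              simp only [nsmul_eq_mul, mul_one] at h3
              rw [abs_le] at h3 h4
              have : (h : ℤ) = 2 * r + 1 := by simp [h]
              omega
            have h5 : e ≤ Pq ω y Bᶜ := (hPq.straight_ge hω y _ h).trans (measure_mono hc)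
            have h6 := prob_compl_eq_one_sub (μ := Pq ω y) hB.compl.measurableSet
            rw [compl_compl] at h6
            rw [h6]
            exact tsub_le_tsub_left h5 1
        _ = _ := mul_comm _ _
    · have : Pq ω y (stay V) = 0 := by
        refine measure_mono_null ?_ (hPq.start ω y)
        intro f hf hf'
        exact hy (hf' ▸ hf 0)
      rw [this]; exact zero_le
  have ht0 : t = 0 := by
    by_contra hne
    have hlt : (1 - e) * t < 1 * t := by
      refine ENNReal.mul_lt_mul_left hne (ht1.trans_lt ENNReal.one_lt_top).ne ?_
      exact ENNReal.sub_lt_self ENNReal.one_ne_top one_ne_zero hepos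
    rw [one_mul] at hlt
    exact absurd key (not_le.2 hlt)
  exact le_antisymm ((le_iSup (fun z => Pq ω z (stay V)) x).trans ht0.le) zero_le

lemma Setup.ae_exit (hd : 0 < d) (S : Setup P Pq) (x : Site d) :
    ∀ᵐ f ∂(annM P Pq x), ∀ r, ∃ n, f n ∉ box d r := by
  rw [ae_all_iff]
  intro r
  have hset : {f : Path d | ∃ n, f n ∉ box d r} = (stay (box d r : Set (Site d)))ᶜ := by
    ext f; simp [stay]
  refine ae_annM S.hPq x (by rw [hset]; exact (measurableSet_stay _).compl) ?_
  filter_upwards [S.ell] with ω hω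
  have := S.hPq.stay_box_eq_zero hd S.η_pos hω r x
  rw [← compl_compl (stay _), ← hset] at this
  exact this

end Ellipticity

/-- stretched exponentials beat powers. -/
lemma exists_exp_le_pow {a γ : ℝ} (ha : 0 < a) (hγ : 0 < γ) (p : ℕ) :
    ∃ K : ℝ, 0 < K ∧ ∀ y : ℝ, 1 ≤ y → Real.exp (-(a * y ^ γ)) ≤ K / y ^ p := by
  obtain ⟨m, hm⟩ := exists_nat_ge ((p : ℝ) / γ)
  refine ⟨m.factorial / a ^ m, by positivity, fun y hy => ?_⟩
  have hy0 : 0 < y := by linarith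
  have h1 : (a * y ^ γ) ^ m / m.factorial ≤ Real.exp (a * y ^ γ) :=
    Real.pow_div_factorial_le_exp _ (by positivity) m
  have h2 : y ^ p ≤ (y ^ γ) ^ m := by
    rw [← Real.rpow_natCast y p, ← Real.rpow_natCast (y ^ γ) m, ← Real.rpow_mul hy0.le]
    apply Real.rpow_le_rpow_of_exponent_le hy
    rw [div_le_iff₀ hγ] at hm
    linarith
  rw [Real.exp_neg, inv_eq_one_div, div_le_div_iff₀ (Real.exp_pos _) (by positivity), one_mul]
  rw [mul_pow, div_le_iff₀ (by positivity)] at h1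
  calc y ^ p ≤ (y ^ γ) ^ m := h2
    _ = (a ^ m * (y ^ γ) ^ m) / a ^ m := by field_simp
    _ ≤ (Real.exp (a * y ^ γ) * m.factorial) / a ^ m := by gcongr
    _ = _ := by ring

/-- the cone condition holds up to the error `L` in the box of radius `M`, and the levels grow
linearly after leaving it. -/
structure GoodPath {d : ℕ} (u : Fin d → ℤ) (c : ℝ) (M : ℕ) (L : ℝ) (f : Path d) : Prop where
  start : f 0 = 0
  nn : NN f
  exit : ∀ r, ∃ n, f n ∉ box d r
  cone : ∀ n s, (∀ m ≤ n, f m ∈ box d M) → s ≤ n → ∀ i,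
    c * |(f n i : ℝ) - f s i| - L ≤ lev u (f n) - lev u (f s)
  far : ∀ n k, (∃ m ≤ n, f m ∉ box d (2 ^ k * M)) → c * 2 ^ k * M / 2 ≤ lev u (f n)

lemma goodPath_of_not_bad {d : ℕ} {u : Fin d → ℤ} {c : ℝ} (hc : 0 < c) {M : ℕ} (hM : 1 ≤ M)
    {L : ℕ → ℝ} (hL : ∀ k, L k ≤ c * 2 ^ k * M / 4) (hL1 : ∀ k, L (k + 1) ≤ c * 2 ^ k * M / 4)
    {f : Path d} (h0 : f 0 = 0) (hnn : NN f) (hex : ∀ r, ∃ n, f n ∉ box d r)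
    (hbad : ∀ k, f ∉ badCone u c (box d (2 ^ k * M)) (L k)) : GoodPath u c M (L 0) f := by
  have hcone : ∀ k n s, (∀ m ≤ n, f m ∈ box d (2 ^ k * M)) → s ≤ n → ∀ i,
      c * |(f n i : ℝ) - f s i| - L k ≤ lev u (f n) - lev u (f s) := by
    intro k n s hm hs i
    by_contra hcon
    push Not at hcon
    exact hbad k ⟨n, hm, s, hs, i, hcon⟩
  refine ⟨h0, hnn, hex, by simpa using hcone 0, ?_⟩
  rintro n k ⟨m, hmn, hm⟩
  classical
  have hexj : ∃ j, ∀ m ≤ n, f m ∈ box d (2 ^ j * M) := by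
    refine ⟨n, fun m hm => ?_⟩
    rw [mem_box]
    intro i
    have := hnn.coord_le 0 m i
    rw [h0, zero_add, Pi.zero_apply, sub_zero] at this
    refine this.trans ?_
    have h2 : n < 2 ^ n := Nat.lt_two_pow_self
    have : 2 ^ n * 1 ≤ 2 ^ n * M := Nat.mul_le_mul_left _ hM
    have : m ≤ 2 ^ n * M := by omega
    exact_mod_cast this
  have hspec := Nat.find_spec hexj
  set j := Nat.find hexj with hj
  have hkj : k < j := by
    by_contra hcon
    push Not at hcon
    exact hm (box_mono (Nat.mul_le_mul_right _ (Nat.pow_le_pow_right (by norm_num) hcon)) (hspec m hmn))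
  obtain ⟨l, hl⟩ : ∃ l, j = l + 1 := ⟨j - 1, by omega⟩
  have hmin := Nat.find_min hexj (m := l) (by omega)
  push Not at hmin
  obtain ⟨m', hm'n, hm'⟩ := hmin
  obtain ⟨e, hem, he1, he2⟩ := exists_firstHit (Y := ((box d (2 ^ l * M) : Finset (Site d)) : Set (Site d))ᶜ) hm'
  have he0 : e ≠ 0 := by
    rintro rfl
    apply he1
    rw [h0]
    exact zero_mem_box d _
  obtain ⟨e', rfl⟩ := Nat.exists_eq_succ_of_ne_zero he0
  have hin : ∀ m ≤ e', f m ∈ box d (2 ^ l * M) := fun m hm => by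
    have := he2 m (by omega)
    simpa using this
  have hout : ¬ ∀ i, |f (e' + 1) i| ≤ ((2 ^ l * M : ℕ) : ℤ) := by
    rw [← mem_box]; simpa using he1
  push Not at hout
  obtain ⟨i, hi⟩ := hout
  have hb : ((2 ^ l * M : ℕ) : ℤ) ≤ |f e' i| := by
    have := hnn.coord_succ e' i
    have h3 := abs_sub_abs_le_abs_sub (f (e' + 1) i) (f e' i)
    omega
  have hbR : (2 : ℝ) ^ l * M ≤ |(f e' i : ℝ)| := by exact_mod_cast hb
  have c1 := hcone l e' 0 hin (Nat.zero_le _) i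
  rw [h0, lev_zero, Pi.zero_apply, Int.cast_zero, sub_zero, sub_zero] at c1
  have c2 := hcone (l + 1) n e' (by rw [← hl]; exact hspec) (by omega) i
  have hpos : 0 ≤ c * |(f n i : ℝ) - f e' i| := by positivity
  have e1 := hL l
  have e2 := hL1 l
  have e3 := mul_le_mul_of_nonneg_left hbR hc.le
  have e4 : c * 2 ^ k * M / 2 ≤ c * 2 ^ l * M / 2 := by
    gcongr
    · norm_num
    · omega
  linarith

section Good

variable {d : ℕ} {P : Measure (Env d)} {Pq : Env d → Site d → Measure (Path d)}

lemma Setup.prob (S : Setup P Pq) : IsProbabilityMeasure P := S.iid.isProbabilityMeasure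

lemma Setup.exists_goodPath_bound (hd : 0 < d) (S : Setup P Pq) :
    ∃ C a : ℝ, 0 < C ∧ 0 < a ∧ ∀ (M : ℕ) (L : ℝ), 1 ≤ M → 1 ≤ L → L ≤ S.c * M / 4 →
      annM P Pq 0 {f | ¬ GoodPath S.u S.c M L f} ≤
        ENNReal.ofReal (C * M ^ d * Real.exp (-(a * L ^ S.γ))) := by
  set a' := S.a * ((1 / 2 : ℝ) ^ S.γ) / 2 with ha'
  have ha'pos : 0 < a' := by have := S.a_pos; positivity
  obtain ⟨K, hK, hKb⟩ := exists_exp_le_pow ha'pos S.γ_pos (d + 1)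
  refine ⟨S.C * 3 ^ d * K * 2, a', by have := S.C_pos; positivity, ha'pos, ?_⟩
  intro M L hM hL hLM
  have hc := S.c_pos
  have hγ := S.γ_pos
  have hCpos := S.C_pos
  have hM' : (1 : ℝ) ≤ M := by exact_mod_cast hM
  set Lk : ℕ → ℝ := fun k => if k = 0 then L else S.c * 2 ^ k * M / 8 with hLk
  have hLk0 : Lk 0 = L := by simp [hLk]
  have hLks : ∀ k, Lk (k + 1) = S.c * 2 ^ k * M / 4 := fun k => by
    simp only [hLk, Nat.succ_ne_zero, if_false, pow_succ]; ring
  have hlow : ∀ k, 2 ^ k * L * (1 / 2) ≤ Lk k := by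
    intro k
    rcases k with _ | k
    · rw [hLk0]; simp; linarith
    · rw [hLks, pow_succ]
      have : (2 : ℝ) ^ k * L ≤ 2 ^ k * (S.c * M / 4) := by gcongr
      linarith
  have hsub : {f | ¬ GoodPath S.u S.c M L f} ⊆
      {f | ¬ (f 0 = 0 ∧ NN f ∧ ∀ r, ∃ n, f n ∉ box d r)} ∪
        ⋃ k, badCone S.u S.c (box d (2 ^ k * M)) (Lk k) := by
    intro f hf
    by_contra hcon
    simp only [Set.mem_union, Set.mem_ofPred_eq, not_or, not_not, Set.mem_iUnion, not_exists] at hcon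
    apply hf
    rw [← hLk0]
    refine goodPath_of_not_bad hc hM (fun k => ?_) (fun k => (hLks k).le) hcon.1.1 hcon.1.2.1
      hcon.1.2.2 hcon.2
    rcases k with _ | k
    · rw [hLk0]; simpa using hLM
    · rw [hLks, pow_succ]
      have : 0 ≤ S.c * 2 ^ k * M := by positivity
      linarith
  have hnull : annM P Pq 0 {f | ¬ (f 0 = 0 ∧ NN f ∧ ∀ r, ∃ n, f n ∉ box d r)} = 0 := by
    have h1 := ae_start_annM (P := P) S.hPq (0 : Site d)
    have h2 := ae_nn_annM (P := P) S.hPq (0 : Site d)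
    have h3 := S.ae_exit hd (0 : Site d)
    exact (h1.and (h2.and h3))
  have hterm : ∀ k, annM P Pq 0 (badCone S.u S.c (box d (2 ^ k * M)) (Lk k)) ≤
      ENNReal.ofReal ((S.C * 3 ^ d * K * M ^ d * Real.exp (-(a' * L ^ S.γ))) * (1 / 2) ^ k) := by
    intro k
    have h2k : (1 : ℝ) ≤ 2 ^ k := one_le_pow₀ (by norm_num)
    have hpos : 0 < Lk k := lt_of_lt_of_le (by positivity) (hlow k)
    refine (S.cone _ 0 (Lk k) hpos).trans (ENNReal.ofReal_le_ofReal ?_)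
    have hcard : ((box d (2 ^ k * M)).card : ℝ) ≤ 3 ^ d * (2 ^ k) ^ d * M ^ d := by
      rw [card_box, ← mul_pow, ← mul_pow]
      push_cast
      gcongr
      have : (1 : ℝ) ≤ 2 ^ k * M := by nlinarith
      linarith
    have hexp : Real.exp (-(S.a * Lk k ^ S.γ)) ≤
        Real.exp (-(a' * L ^ S.γ)) * (K / (2 ^ k) ^ (d + 1)) := by
      refine le_trans ?_ (mul_le_mul_of_nonneg_left (hKb _ h2k) (Real.exp_pos _).le)
      rw [← Real.exp_add]
      apply Real.exp_le_exp.2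
      have h1 : (2 ^ k * L * (1 / 2)) ^ S.γ ≤ Lk k ^ S.γ :=
        Real.rpow_le_rpow (by positivity) (hlow k) hγ.le
      rw [Real.mul_rpow (by positivity) (by positivity), Real.mul_rpow (by positivity) (by positivity)] at h1
      have hX : 1 ≤ ((2 : ℝ) ^ k) ^ S.γ := Real.one_le_rpow h2k hγ.le
      have hY : 1 ≤ L ^ S.γ := Real.one_le_rpow hL hγ.le
      have h3 : ((2 : ℝ) ^ k) ^ S.γ + L ^ S.γ ≤ 2 * (((2 : ℝ) ^ k) ^ S.γ * L ^ S.γ) := by nlinarith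
      have h4 := mul_le_mul_of_nonneg_left h1 S.a_pos.le
      have h5 := mul_le_mul_of_nonneg_left h3 ha'pos.le
      have h6 : a' * (2 * (((2 : ℝ) ^ k) ^ S.γ * L ^ S.γ)) =
          S.a * (((2 : ℝ) ^ k) ^ S.γ * L ^ S.γ * (1 / 2) ^ S.γ) := by rw [ha']; ring
      linarith
    calc S.C * (box d (2 ^ k * M)).card * Real.exp (-(S.a * Lk k ^ S.γ))
        ≤ S.C * (3 ^ d * (2 ^ k) ^ d * M ^ d) *
          (Real.exp (-(a' * L ^ S.γ)) * (K / (2 ^ k) ^ (d + 1))) := by gcongr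
      _ = _ := by
        rw [one_div, inv_pow]
        field_simp
        ring
  calc _ ≤ _ := measure_mono hsub
    _ ≤ 0 + annM P Pq 0 (⋃ k, badCone S.u S.c (box d (2 ^ k * M)) (Lk k)) := by
      rw [← hnull]; exact measure_union_le _ _
    _ ≤ ∑' k : ℕ, ENNReal.ofReal ((S.C * 3 ^ d * K * M ^ d * Real.exp (-(a' * L ^ S.γ))) * (1 / 2) ^ k) := by
      rw [zero_add]
      exact (measure_iUnion_le _).trans (ENNReal.tsum_le_tsum hterm)
    _ = _ := by
      rw [← ENNReal.ofReal_tsum_of_nonneg (fun k => by positivity)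
        (summable_geometric_two.mul_left _), tsum_mul_left, tsum_geometric_two]
      congr 1
      ring

/-- the event that the path never goes below level `0`. -/
def stayUp {d : ℕ} (u : Fin d → ℤ) : Set (Path d) := stay {x | 0 ≤ lev u x}

lemma measurableSet_stayUp (u : Fin d → ℤ) : MeasurableSet (stayUp u) := measurableSet_stay _

lemma Setup.exists_goodPath (hd : 0 < d) (S : Setup P Pq) :
    ∃ (M : ℕ) (L : ℝ), 1 ≤ M ∧ 1 ≤ L ∧ annM P Pq 0 {f | ¬ GoodPath S.u S.c M L f} < 1 := by
  obtain ⟨C, a, hC, ha, hb⟩ := S.exists_goodPath_bound hd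
  have hc := S.c_pos
  have hc1 := S.c_le
  set a' := a * (S.c / 4) ^ S.γ with ha'
  have ha'pos : 0 < a' := by positivity
  obtain ⟨K, hK, hKb⟩ := exists_exp_le_pow ha'pos S.γ_pos (d + 1)
  obtain ⟨M, hM⟩ := exists_nat_gt (max (4 / S.c) (C * K))
  have hM4 : 4 / S.c < M := (le_max_left _ _).trans_lt hM
  have hMK : C * K < M := (le_max_right _ _).trans_lt hM
  have hMpos : (0 : ℝ) < M := lt_trans (by positivity) hM4
  have hM1 : 1 ≤ M := by
    have : 0 < M := by exact_mod_cast hMpos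
    omega
  have hL1 : 1 ≤ S.c * M / 4 := by
    rw [div_lt_iff₀ hc] at hM4
    linarith
  refine ⟨M, S.c * M / 4, hM1, hL1, (hb M _ hM1 hL1 le_rfl).trans_lt ?_⟩
  rw [← ENNReal.ofReal_one, ENNReal.ofReal_lt_ofReal_iff one_pos]
  have h1 := hKb M (by exact_mod_cast hM1)
  have h2 : a * (S.c * M / 4) ^ S.γ = a' * (M : ℝ) ^ S.γ := by
    rw [show S.c * M / 4 = S.c / 4 * M by ring, Real.mul_rpow (by positivity) hMpos.le, ha']
    ring
  rw [h2]
  calc C * M ^ d * Real.exp (-(a' * M ^ S.γ)) ≤ C * M ^ d * (K / M ^ (d + 1)) := by gcongr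
    _ = C * K / M := by rw [pow_succ]; field_simp
    _ < 1 := by rwa [div_lt_one hMpos]

lemma GoodPath.lev_ge {u : Fin d → ℤ} {c : ℝ} (hd : 0 < d) (hc : 0 < c) {M : ℕ} {L : ℝ}
    (hL : 0 ≤ L) {f : Path d} (h : GoodPath u c M L f) (n : ℕ) : -L ≤ lev u (f n) := by
  by_cases hin : ∀ m ≤ n, f m ∈ box d M
  · have := h.cone n 0 hin (Nat.zero_le _) ⟨0, hd⟩
    rw [h.start, lev_zero] at this
    have : 0 ≤ c * |(f n ⟨0, hd⟩ : ℝ) - (0 : Site d) ⟨0, hd⟩| := by positivity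
    push_cast at *
    linarith
  · push Not at hin
    have := h.far n 0 (by simpa using hin)
    have : 0 ≤ c * 2 ^ 0 * M / 2 := by positivity
    linarith

/-- the direction of a step that increases the level. -/
lemma Setup.exists_upStep (hd : 0 < d) (S : Setup P Pq) :
    ∃ s : StepIdx d, 1 ≤ lev S.u (stepVec s) := by
  have hu : ∃ i, S.u i ≠ 0 := by
    by_contra hcon
    push Not at hcon
    have hz : ∀ x, lev S.u x = 0 := fun x => by simp [lev, hcon]
    obtain ⟨M, L, hM, hL, hlt⟩ := S.exists_goodPath hd
    have := S.prob
    have := isProbabilityMeasure_annM (P := P) S.hPq (0 : Site d)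
    have hne : ({f | ¬ GoodPath S.u S.c M L f} : Set (Path d)) ≠ Set.univ := by
      intro h; rw [h, measure_univ] at hlt; exact lt_irrefl _ hlt
    obtain ⟨f, hf⟩ := (Set.ne_univ_iff_exists_notMem _).1 hne
    have hf : GoodPath S.u S.c M L f := by simpa using hf
    obtain ⟨n, hn⟩ := hf.exit M
    have h1 := hf.far n 0 ⟨n, le_rfl, by simpa using hn⟩
    rw [hz] at h1
    have := S.c_pos
    have : (1 : ℝ) ≤ M := by exact_mod_cast hM
    have : 0 < S.c * 2 ^ 0 * M / 2 := by positivity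
    push_cast at h1
    linarith
  obtain ⟨i, hi⟩ := hu
  rcases lt_or_gt_of_ne hi with h | h
  · exact ⟨(i, false), by rw [lev_stepVec]; simp; omega⟩
  · exact ⟨(i, true), by rw [lev_stepVec]; simp; omega⟩

lemma Setup.stayUp_pos (hd : 0 < d) (S : Setup P Pq) : 0 < annM P Pq 0 (stayUp S.u) := by
  obtain ⟨M, L, hM, hL, hlt⟩ := S.exists_goodPath hd
  obtain ⟨s, hs⟩ := S.exists_upStep hd
  have := S.prob
  have hprob := isProbabilityMeasure_annM (P := P) S.hPq (0 : Site d)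
  obtain ⟨h, hh⟩ := exists_nat_ge L
  set y : Site d := h • stepVec s with hy
  set A : Set (Path d) := stay {x | lev S.u y - h ≤ lev S.u x} with hA
  have hAm : MeasurableSet A := measurableSet_stay _
  have hApos : 0 < annM P Pq y A := by
    rw [annM_eq S.hPq S.iid y hAm]
    have hsub : {f | GoodPath S.u S.c M L f} ⊆ translate y ⁻¹' A := by
      intro f hf n
      have h1 := GoodPath.lev_ge hd S.c_pos (by linarith) hf n
      have h2 : -(h : ℝ) ≤ lev S.u (f n) := by linarith
      have h3 : -(h : ℤ) ≤ lev S.u (f n) := by exact_mod_cast h2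
      simp only [translate, Set.mem_ofPred_eq, lev_add]
      linarith
    refine pos_iff_ne_zero.2 fun h0 => ?_
    have h1 : annM P Pq 0 {f | GoodPath S.u S.c M L f} = 0 := measure_mono_null hsub h0
    have h2 : (1 : ℝ≥0∞) ≤ annM P Pq 0 {f | ¬ GoodPath S.u S.c M L f} := by
      have h3 : (Set.univ : Set (Path d)) ⊆ {f | GoodPath S.u S.c M L f} ∪ {f | ¬ GoodPath S.u S.c M L f} :=
        fun f _ => Classical.em _
      calc (1 : ℝ≥0∞) = annM P Pq 0 Set.univ := measure_univ.symm
        _ ≤ _ := (measure_mono h3).trans (measure_union_le _ _)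
        _ = _ := by rw [h1, zero_add]
    exact absurd h2 (not_le.2 hlt)
  have hsub : cyl h (straight 0 s) ∩ after h ⁻¹' A ⊆ stayUp S.u := by
    rintro f ⟨hf1, hf2⟩ n
    rcases le_or_gt n h with hn | hn
    · rw [hf1 n hn]
      simp only [straight, zero_add, Set.mem_ofPred_eq, lev_nsmul]
      positivity
    · have h1 := hf2 (n - h)
      simp only [after_apply, Set.mem_ofPred_eq] at h1
      rw [show h + (n - h) = n by omega] at h1
      have h2 : (h : ℤ) ≤ lev S.u y := by
        rw [hy, lev_nsmul]
        nlinarith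
      simp only [Set.mem_ofPred_eq]
      linarith
  have hlow : ENNReal.ofReal S.η ^ h * annM P Pq y A ≤
      annM P Pq 0 (cyl h (straight 0 s) ∩ after h ⁻¹' A) := by
    rw [annM_apply S.hPq y hAm, annM_apply S.hPq 0 ((measurableSet_cyl _ _).inter (measurable_after h hAm)),
      ← lintegral_const_mul _ (S.hPq.2 y A hAm)]
    refine lintegral_mono_ae ?_
    filter_upwards [S.ell] with ω hω
    rw [S.hPq.markov_cyl ω 0 h _ hAm]
    have : straight 0 s h = y := by simp [straight, hy]
    rw [this]
    gcongr
    exact S.hPq.straight_ge hω 0 s h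
  refine lt_of_lt_of_le ?_ (hlow.trans (measure_mono hsub))
  exact ENNReal.mul_pos (by simp [S.η_pos]) hApos.ne'

end Good

section Record

variable {d : ℕ} {P : Measure (Env d)} {Pq : Env d → Site d → Measure (Path d)}

/-- the path after time `n`, recentered at its position at time `n`. -/
def recen {d : ℕ} (n : ℕ) (f : Path d) : Path d := fun i => f (n + i) - f n

@[simp] lemma recen_apply (n : ℕ) (f : Path d) (i : ℕ) : recen n f i = f (n + i) - f n := rfl

lemma measurable_recen (n : ℕ) : Measurable (recen n : Path d → Path d) :=
  measurable_pi_lambda _ fun i => (measurable_pi_apply (n + i)).sub (measurable_pi_apply n)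

lemma recen_recen (n m : ℕ) (f : Path d) : recen m (recen n f) = recen (n + m) f := by
  funext i
  simp [add_assoc]

lemma recen_eq_translate (n : ℕ) (f : Path d) : recen n f = translate (-f n) (after n f) := by
  funext i
  simp only [recen_apply, translate, after_apply]
  abel

/-- the half space of nonnegative levels. -/
def upHalf {d : ℕ} (u : Fin d → ℤ) : Set (Site d) := {x | 0 ≤ lev u x}

lemma local_translate (hPq : IsQuenchedFamily Pq) {T : Set (Site d)} {A : Set (Path d)}
    (hA : MeasurableSet A) (hT : LocalOn T fun ω => Pq ω 0 A) (y : Site d) :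
    LocalOn {x | x - y ∈ T} fun ω => Pq ω y (translate (-y) ⁻¹' A) := by
  intro ω ω' h
  have key : ∀ ω : Env d, Pq ω y (translate (-y) ⁻¹' A) = Pq (shift y ω) 0 A := fun ω => by
    have := hPq.eq_map_translate ω y 0
    rw [add_zero] at this
    rw [this, Measure.map_apply (measurable_translate y) (measurable_translate (-y) hA),
      ← Set.preimage_comp]
    congr 1
    ext f
    have : (translate (-y) ∘ translate y) f = f := by funext i; simp [translate]
    rw [Set.mem_preimage, this]
  simp only [key]
  refine hT _ _ fun z hz => h _ ?_
  simpa using hz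

/-- regeneration at a record time: the future is independent of the past. -/
lemma annM_record_single (hPq : IsQuenchedFamily Pq) (h : IsIID P) (u : Fin d → ℤ) (x : Site d)
    {n : ℕ} {B : Set (Path d)} (hB : UpTo n B)
    (hrec : ∀ f ∈ B, ∀ i < n, lev u (f i) < lev u (f n))
    {A : Set (Path d)} (hA : MeasurableSet A) (hT : LocalOn (upHalf u) fun ω => Pq ω 0 A) :
    annM P Pq x (B ∩ recen n ⁻¹' A) = annM P Pq x B * annM P Pq 0 A := by
  have hp : Measurable fun f : Path d => f n := measurable_pi_apply n
  rw [measure_eq_tsum_fiber _ hp (hB.measurableSet.inter (measurable_recen n hA)),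
    measure_eq_tsum_fiber _ hp hB.measurableSet, ← ENNReal.tsum_mul_right]
  refine tsum_congr fun y => ?_
  set By : Set (Path d) := (fun f : Path d => f n) ⁻¹' {y} ∩ B with hBy
  have hByU : UpTo n By := by
    refine UpTo.inter (fun f g hfg hf => ?_) hB
    simp only [Set.mem_preimage, Set.mem_singleton_iff] at *
    rw [← hfg n le_rfl, hf]
  have hset : (fun f : Path d => f n) ⁻¹' {y} ∩ (B ∩ recen n ⁻¹' A) =
      By ∩ after n ⁻¹' (translate (-y) ⁻¹' A) := by
    ext f
    simp only [hBy, Set.mem_inter_iff, Set.mem_preimage, Set.mem_singleton_iff]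
    constructor
    · rintro ⟨rfl, h1, h2⟩
      exact ⟨⟨rfl, h1⟩, by rwa [← recen_eq_translate]⟩
    · rintro ⟨⟨rfl, h1⟩, h2⟩
      exact ⟨rfl, h1, by rwa [recen_eq_translate]⟩
  have hAy : MeasurableSet (translate (-y) ⁻¹' A) := measurable_translate (-y) hA
  have hST : Disjoint {z | lev u z < lev u y} {z | z - y ∈ upHalf u} := by
    rw [Set.disjoint_left]
    intro z hz hz'
    simp only [Set.mem_ofPred_eq, upHalf, lev_sub] at hz hz'
    linarith
  rw [hset, annM_fresh hPq h x y hByU hST (fun f hf i hi => ?_) (fun f hf => hf.1) hAy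
    (local_translate hPq hA hT y), annM_eq hPq h y hAy]
  · congr 2
    ext f
    have : translate (-y) (translate y f) = f := by funext i; simp [translate]
    simp only [Set.mem_preimage, this]
  · have h1 := hrec f hf.2 i hi
    rwa [show f n = y from hf.1] at h1

lemma annM_record (hPq : IsQuenchedFamily Pq) (h : IsIID P) (u : Fin d → ℤ) (x : Site d)
    {B : ℕ → Set (Path d)} (hB : ∀ n, UpTo n (B n))
    (hdisj : Pairwise (Function.onFun Disjoint B))
    (hrec : ∀ n, ∀ f ∈ B n, ∀ i < n, lev u (f i) < lev u (f n))
    {A : Set (Path d)} (hA : MeasurableSet A) (hT : LocalOn (upHalf u) fun ω => Pq ω 0 A) :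
    annM P Pq x (⋃ n, B n ∩ recen n ⁻¹' A) = annM P Pq x (⋃ n, B n) * annM P Pq 0 A := by
  rw [measure_iUnion (fun i j hij => (hdisj hij).mono Set.inter_subset_left Set.inter_subset_left)
      fun n => (hB n).measurableSet.inter (measurable_recen n hA),
    measure_iUnion hdisj fun n => (hB n).measurableSet, ← ENNReal.tsum_mul_right]
  exact tsum_congr fun n => annM_record_single hPq h u x (hB n) (hrec n) hA hT

lemma local_stayUp (hPq : IsQuenchedFamily Pq) (u : Fin d → ℤ) :
    LocalOn (upHalf u) fun ω => Pq ω 0 (stayUp u) :=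
  hPq.local_stay 0 (measurableSet_stayUp u) le_rfl

lemma local_compl (hPq : IsQuenchedFamily Pq) {T : Set (Site d)} {A : Set (Path d)}
    (hA : MeasurableSet A) {x : Site d} (hT : LocalOn T fun ω => Pq ω x A) :
    LocalOn T fun ω => Pq ω x Aᶜ := fun ω ω' h => by
  have := hPq.prob ω x
  have := hPq.prob ω' x
  simp only [prob_compl_eq_one_sub hA]
  rw [show Pq ω x A = Pq ω' x A from hT ω ω' h]

end Record

section Regen

variable {d : ℕ} {P : Measure (Env d)} {Pq : Env d → Site d → Measure (Path d)}

/-- `t` is a renewal time of the path for the level function. -/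
def IsReg {d : ℕ} (u : Fin d → ℤ) (f : Path d) (t : ℕ) : Prop :=
  (∀ s < t, lev u (f s) < lev u (f t)) ∧ ∀ s, t ≤ s → lev u (f t) ≤ lev u (f s)

/-- the walk has just reached level `j * K`, and all attempts at earlier multiples failed. -/
def attempts {d : ℕ} (u : Fin d → ℤ) (K j n : ℕ) : Set (Path d) :=
  firstHit {x | ((j * K : ℕ) : ℤ) ≤ lev u x} n ∩ {f | ∀ i, 1 ≤ i → i < j → ∃ t t', t < t' ∧ t' ≤ n ∧
    f ∈ firstHit {x | ((i * K : ℕ) : ℤ) ≤ lev u x} t ∧ lev u (f t') < lev u (f t) ∧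
    ∀ m ≤ t', lev u (f m) < ((i + 1) * K : ℕ)}

lemma upTo_attempts (u : Fin d → ℤ) (K j n : ℕ) : UpTo n (attempts u K j n) := by
  refine (upTo_firstHit _ n).inter fun f g h hf i hi hij => ?_
  obtain ⟨t, t', h1, h2, h3, h4, h5⟩ := hf i hi hij
  refine ⟨t, t', h1, h2, (upTo_firstHit _ t) f g (fun m hm => h m (by omega)) h3, ?_, ?_⟩
  · rwa [← h t (by omega), ← h t' h2]
  · intro m hm
    rw [← h m (by omega)]
    exact h5 m hm

lemma disjoint_attempts (u : Fin d → ℤ) (K j : ℕ) :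
    Pairwise (Function.onFun Disjoint (attempts u K j)) := fun _ _ h =>
  (disjoint_firstHit _ h).mono Set.inter_subset_left Set.inter_subset_left

lemma attempts_subset (u : Fin d → ℤ) (K j : ℕ) (hj : 1 ≤ j) :
    ⋃ n, attempts u K (j + 1) n ⊆ ⋃ n, attempts u K j n ∩ recen n ⁻¹' (stayUp u)ᶜ := by
  intro f hf
  obtain ⟨n, hn⟩ := Set.mem_iUnion.1 hf
  obtain ⟨t, t', h1, h2, h3, h4, -⟩ := hn.2 j hj (by omega)
  refine Set.mem_iUnion.2 ⟨t, ⟨h3, fun i hi hij => ?_⟩, fun hup => ?_⟩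
  · obtain ⟨r, r', k1, k2, k3, k4, k5⟩ := hn.2 i hi (by omega)
    refine ⟨r, r', k1, ?_, k3, k4, k5⟩
    by_contra hlt
    have h5 := k5 t (by omega)
    have h6 := h3.1
    simp only [Set.mem_ofPred_eq] at h6
    have : (i + 1) * K ≤ j * K := Nat.mul_le_mul_right _ hij
    have : (((i + 1) * K : ℕ) : ℤ) ≤ ((j * K : ℕ) : ℤ) := by exact_mod_cast this
    linarith
  · have := hup (t' - t)
    simp only [recen_apply, Set.mem_ofPred_eq, lev_sub] at this
    rw [show t + (t' - t) = t' by omega] at this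
    linarith

lemma annM_attempts_le (hPq : IsQuenchedFamily Pq) [IsProbabilityMeasure P] (h : IsIID P)
    (u : Fin d → ℤ) (K j : ℕ) :
    annM P Pq 0 (⋃ n, attempts u K (j + 1) n) ≤ annM P Pq 0 (stayUp u)ᶜ ^ j := by
  have := isProbabilityMeasure_annM (P := P) hPq (0 : Site d)
  induction j with
  | zero => simpa using prob_le_one
  | succ j ih =>
    refine (measure_mono (attempts_subset u K (j + 1) (by omega))).trans ?_
    rw [annM_record hPq h u 0 (upTo_attempts u K (j + 1)) (disjoint_attempts u K (j + 1)) ?_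
      (measurableSet_stayUp u).compl
      (local_compl hPq (measurableSet_stayUp u) (local_stayUp hPq u)), pow_succ]
    · gcongr
    · intro n f hf i hi
      have h1 := hf.1.1
      have h2 := hf.1.2 i hi
      simp only [Set.mem_ofPred_eq] at h1 h2
      linarith

lemma GoodPath.exists_isReg {u : Fin d → ℤ} {c : ℝ} (hd : 0 < d) (hc : 0 < c) {r : ℕ} {L : ℝ}
    {f : Path d} (hf : GoodPath u c r L f) {J K : ℕ} (hK : L + width u < K)
    (hL : 0 ≤ L) (hr : (((J + 2) * K : ℕ) : ℝ) + width u ≤ c * r / 2)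
    (hatt : f ∉ ⋃ n, attempts u K (J + 1) n) :
    ∃ t, 0 < t ∧ IsReg u f t ∧ ∀ s ≤ t, f s ∈ box d r := by
  obtain ⟨n₀, hn₀⟩ := hf.exit r
  have hfar : ∀ n, (∃ m ≤ n, f m ∉ box d r) → (((J + 2) * K : ℕ) : ℤ) + width u ≤ lev u (f n) := by
    intro n hn
    have h1 := hf.far n 0 (by simpa using hn)
    have : (((J + 2) * K : ℕ) : ℝ) + width u ≤ lev u (f n) := by
      refine hr.trans (le_trans (le_of_eq ?_) h1)
      ring
    exact_mod_cast this
  have hKpos : 0 < K := by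
    have : (0 : ℝ) < K := by
      have : (0 : ℝ) ≤ width u := by positivity
      linarith
    exact_mod_cast this
  have hlarge : ∀ i ≤ J + 2, ((i * K : ℕ) : ℤ) ≤ lev u (f n₀) := by
    intro i hi
    have h1 := hfar n₀ ⟨n₀, le_rfl, hn₀⟩
    have h2 : i * K ≤ (J + 2) * K := Nat.mul_le_mul_right _ hi
    have h3 : ((i * K : ℕ) : ℤ) ≤ (((J + 2) * K : ℕ) : ℤ) := by exact_mod_cast h2
    have : (0 : ℤ) ≤ width u := by positivity
    linarith
  obtain ⟨n, -, hn⟩ := exists_firstHit (Y := {x | (((J + 1) * K : ℕ) : ℤ) ≤ lev u x})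
    (hlarge (J + 1) (by omega))
  have h1 : ¬ f ∈ attempts u K (J + 1) n := fun h => hatt (Set.mem_iUnion.2 ⟨n, h⟩)
  have h2 : ∃ i, 1 ≤ i ∧ i < J + 1 ∧ ∀ t t', t < t' → t' ≤ n →
      f ∈ firstHit {x | ((i * K : ℕ) : ℤ) ≤ lev u x} t → lev u (f t') < lev u (f t) →
      ∃ m ≤ t', (((i + 1) * K : ℕ) : ℤ) ≤ lev u (f m) := by
    by_contra hcon
    refine h1 ⟨hn, fun i hi hij => ?_⟩
    by_contra hcon2
    refine hcon ⟨i, hi, hij, fun t t' k1 k2 k3 k4 => ?_⟩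
    by_contra hcon3
    push Not at hcon3
    exact hcon2 ⟨t, t', k1, k2, k3, k4, hcon3⟩
  obtain ⟨i, hi, hiJ, hfail⟩ := h2
  obtain ⟨t, -, ht⟩ := exists_firstHit (Y := {x | ((i * K : ℕ) : ℤ) ≤ lev u x})
    (hlarge i (by omega))
  have htlev : ((i * K : ℕ) : ℤ) ≤ lev u (f t) := ht.1
  have hiK : (0 : ℤ) < ((i * K : ℕ) : ℤ) := by
    have : 0 < i * K := Nat.mul_pos hi hKpos
    exact_mod_cast this
  have ht0 : 0 < t := by
    rcases Nat.eq_zero_or_pos t with h | h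
    · rw [h, hf.start, lev_zero] at htlev
      omega
    · exact h
  have htup : lev u (f t) < ((i * K : ℕ) : ℤ) + width u := by
    have k1 := ht.2 (t - 1) (by omega)
    have k2 := hf.nn.lev_succ u (t - 1)
    rw [show t - 1 + 1 = t by omega, abs_le] at k2
    simp only [Set.mem_ofPred_eq, not_le] at k1
    linarith
  have hiK2 : ((i * K : ℕ) : ℤ) + K ≤ (((J + 2) * K : ℕ) : ℤ) := by
    have : i * K + K ≤ (J + 2) * K := by nlinarith
    exact_mod_cast this
  refine ⟨t, ht0, ⟨fun s hs => ?_, fun s hs => ?_⟩, fun s hs => ?_⟩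
  · have k1 := ht.2 s hs
    simp only [Set.mem_ofPred_eq, not_le] at k1
    linarith
  · by_contra hlt
    push Not at hlt
    have hst : t < s := lt_of_le_of_ne hs fun h => by rw [h] at hlt; exact lt_irrefl _ hlt
    obtain ⟨m, hm, hmlev⟩ : ∃ m ≤ s, (((i + 1) * K : ℕ) : ℤ) ≤ lev u (f m) := by
      rcases le_or_gt s n with hsn | hsn
      · exact hfail t s hst hsn ht hlt
      · refine ⟨n, hsn.le, le_trans ?_ hn.1⟩
        have : (i + 1) * K ≤ (J + 1) * K := Nat.mul_le_mul_right _ (by omega)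
        exact_mod_cast this
    by_cases hin : ∀ m ≤ s, f m ∈ box d r
    · have k1 := hf.cone s m hin hm ⟨0, hd⟩
      have k2 : 0 ≤ c * |(f s ⟨0, hd⟩ : ℝ) - f m ⟨0, hd⟩| := by positivity
      have k3 : lev u (f s) - lev u (f m) ≤ (width u : ℤ) - K := by
        push_cast at hmlev htup
        linarith
      have k4 : (lev u (f s) : ℝ) - lev u (f m) ≤ (width u : ℝ) - K := by exact_mod_cast k3
      linarith
    · push Not at hin
      have := hfar s hin
      have : (0 : ℤ) ≤ K := by positivity
      linarith
  · by_contra hout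
    have := hfar t ⟨s, hs, hout⟩
    have : (0 : ℤ) ≤ K := by positivity
    linarith

end Regen

section RegenTail

variable {d : ℕ} {P : Measure (Env d)} {Pq : Env d → Site d → Measure (Path d)}

/-- a renewal time occurs before the path leaves the box of radius `r`. -/
def RegIn {d : ℕ} (u : Fin d → ℤ) (r : ℕ) (f : Path d) : Prop :=
  ∃ t, 0 < t ∧ IsReg u f t ∧ ∀ s ≤ t, f s ∈ box d r

lemma RegIn.mono {u : Fin d → ℤ} {r r' : ℕ} (h : r ≤ r') {f : Path d} (hf : RegIn u r f) :
    RegIn u r' f := by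
  obtain ⟨t, h1, h2, h3⟩ := hf
  exact ⟨t, h1, h2, fun s hs => box_mono h (h3 s hs)⟩

lemma Setup.exists_stayUp_compl_le (hd : 0 < d) (S : Setup P Pq) :
    ∃ b : ℝ, 0 < b ∧ annM P Pq 0 (stayUp S.u)ᶜ ≤ ENNReal.ofReal (Real.exp (-b)) := by
  have := S.prob
  have := isProbabilityMeasure_annM (P := P) S.hPq (0 : Site d)
  have hpos := S.stayUp_pos hd
  have hlt : annM P Pq 0 (stayUp S.u)ᶜ < 1 := by
    rw [prob_compl_eq_one_sub (measurableSet_stayUp _)]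
    exact ENNReal.sub_lt_self ENNReal.one_ne_top one_ne_zero hpos.ne'
  set p := (annM P Pq 0 (stayUp S.u)ᶜ).toReal with hp
  have hp1 : p < 1 := by
    rw [hp, ← ENNReal.toReal_one]
    exact (ENNReal.toReal_lt_toReal (measure_ne_top _ _) ENNReal.one_ne_top).2 hlt
  set q := max p (1 / 2) with hq
  have hq0 : 0 < q := lt_of_lt_of_le (by norm_num) (le_max_right _ _)
  have hq1 : q < 1 := max_lt hp1 (by norm_num)
  refine ⟨-Real.log q, by have := Real.log_neg hq0 hq1; linarith, ?_⟩
  rw [neg_neg, Real.exp_log hq0, ← ENNReal.ofReal_toReal (measure_ne_top (annM P Pq 0) _)]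
  exact ENNReal.ofReal_le_ofReal (le_max_left _ _)

lemma Setup.exists_regIn_sq_bound (hd : 0 < d) (S : Setup P Pq) :
    ∃ (D : ℕ) (C b : ℝ), 1 ≤ D ∧ 0 < C ∧ 0 < b ∧ ∀ q : ℕ, 1 ≤ q →
      annM P Pq 0 {f | ¬ RegIn S.u (D * q ^ 2) f} ≤
        ENNReal.ofReal (C * Real.exp (-(b * (q : ℝ) ^ S.γ))) := by
  obtain ⟨C, a, hC, ha, hgood⟩ := S.exists_goodPath_bound hd
  obtain ⟨b, hb, hup⟩ := S.exists_stayUp_compl_le hd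
  have := S.prob
  have hprob := isProbabilityMeasure_annM (P := P) S.hPq (0 : Site d)
  have hc := S.c_pos
  set w := width S.u with hw
  obtain ⟨D, hD⟩ := exists_nat_ge (2 * (3 + w) / S.c + 4 / S.c + 1 : ℝ)
  have hD0 : (1 : ℝ) ≤ D := by
    have : (0 : ℝ) ≤ 2 * (3 + w) / S.c + 4 / S.c := by positivity
    linarith
  have hD1 : 2 * (3 + w) ≤ S.c * D := by
    have h1 : 2 * (3 + w) / S.c ≤ D := by
      have : (0 : ℝ) ≤ 4 / S.c := by positivity
      linarith
    rwa [div_le_iff₀' hc] at h1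
  have hD2 : 4 ≤ S.c * D := by
    have h1 : 4 / S.c ≤ D := by
      have : (0 : ℝ) ≤ 2 * (3 + w) / S.c := by positivity
      linarith
    rwa [div_le_iff₀' hc] at h1
  set a' := a * (1 / 2) ^ S.γ with ha'
  have ha'pos : 0 < a' := by positivity
  obtain ⟨K, hK, hKb⟩ := exists_exp_le_pow (half_pos ha'pos) S.γ_pos (2 * d)
  set b' := min (a' / 2) b with hb'
  have hb'pos : 0 < b' := lt_min (by positivity) hb
  set q₀ : ℕ := 2 * w + 4 with hq₀
  set C' := C * D ^ d * K + 1 + Real.exp (b' * (q₀ : ℝ) ^ S.γ) with hC'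
  refine ⟨D, C', b', by exact_mod_cast hD0, by positivity, hb'pos, fun q hq => ?_⟩
  have hq1 : (1 : ℝ) ≤ q := by exact_mod_cast hq
  rcases lt_or_ge q q₀ with hlt | hge
  · refine prob_le_one.trans ?_
    rw [← ENNReal.ofReal_one]
    refine ENNReal.ofReal_le_ofReal ?_
    have h1 : Real.exp (b' * (q₀ : ℝ) ^ S.γ) * Real.exp (-(b' * (q : ℝ) ^ S.γ)) ≤
        C' * Real.exp (-(b' * (q : ℝ) ^ S.γ)) := by
      gcongr
      have : 0 ≤ C * D ^ d * K := by positivity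
      linarith
    refine le_trans ?_ h1
    rw [← Real.exp_add]
    refine Real.one_le_exp ?_
    have : (q : ℝ) ^ S.γ ≤ (q₀ : ℝ) ^ S.γ := by
      have := S.γ_pos
      gcongr
    nlinarith
  · set L : ℝ := (q : ℝ) / 2 with hL
    have hqq : (2 * w + 4 : ℝ) ≤ q := by exact_mod_cast hge
    have hqsq : (q : ℝ) ≤ (q : ℝ) ^ 2 := by nlinarith
    have hsub : {f | ¬ RegIn S.u (D * q ^ 2) f} ⊆
        {f | ¬ GoodPath S.u S.c (D * q ^ 2) L f} ∪ ⋃ n, attempts S.u q (q + 1) n := by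
      intro f hf
      by_contra hcon
      rw [Set.mem_union, not_or] at hcon
      obtain ⟨h1, h2⟩ := hcon
      simp only [Set.mem_ofPred_eq, not_not] at h1
      refine hf (h1.exists_isReg hd hc (K := q) (J := q) ?_ (by positivity) ?_ h2)
      · rw [hL]; linarith
      · push_cast
        have : (w : ℝ) ≤ w * (q : ℝ) ^ 2 := by nlinarith
        nlinarith
    have hg := hgood (D * q ^ 2) L (Nat.mul_pos (by exact_mod_cast hD0) (by positivity))
      (by rw [hL]; linarith [show (0 : ℝ) ≤ w by positivity]) (by
        push_cast
        rw [hL]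
        nlinarith)
    have hqp : (0 : ℝ) < q := by linarith
    refine (measure_mono hsub).trans ((measure_union_le _ _).trans ?_)
    refine (add_le_add hg ((annM_attempts_le S.hPq S.iid S.u q q).trans
      (pow_le_pow_left' hup q))).trans ?_
    rw [← ENNReal.ofReal_pow (Real.exp_pos _).le, ← ENNReal.ofReal_add (by positivity)
      (by positivity)]
    refine ENNReal.ofReal_le_ofReal ?_
    have e1 : a * L ^ S.γ = a' * (q : ℝ) ^ S.γ := by
      rw [hL, show (q : ℝ) / 2 = 1 / 2 * q by ring, Real.mul_rpow (by norm_num) hqp.le, ha']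
      ring
    have e2 : Real.exp (-(a' * (q : ℝ) ^ S.γ)) =
        Real.exp (-(a' / 2 * (q : ℝ) ^ S.γ)) * Real.exp (-(a' / 2 * (q : ℝ) ^ S.γ)) := by
      rw [← Real.exp_add]; congr 1; ring
    have hqγ : 0 ≤ (q : ℝ) ^ S.γ := by positivity
    have e3 : Real.exp (-(a' / 2 * (q : ℝ) ^ S.γ)) ≤ Real.exp (-(b' * (q : ℝ) ^ S.γ)) := by
      apply Real.exp_le_exp.2
      have : b' ≤ a' / 2 := min_le_left _ _
      nlinarith
    have e4 : Real.exp (-b) ^ q ≤ Real.exp (-(b' * (q : ℝ) ^ S.γ)) := by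
      rw [← Real.exp_nat_mul]
      apply Real.exp_le_exp.2
      have h1 : b' ≤ b := min_le_right _ _
      have h2 : (q : ℝ) ^ S.γ ≤ q := by
        conv_rhs => rw [← Real.rpow_one (q : ℝ)]
        exact Real.rpow_le_rpow_of_exponent_le hq1 S.γ_lt.le
      nlinarith
    have e5 := hKb q hq1
    have e6 : (q : ℝ) ^ (2 * d) * Real.exp (-(a' / 2 * (q : ℝ) ^ S.γ)) ≤ K := by
      calc _ ≤ (q : ℝ) ^ (2 * d) * (K / (q : ℝ) ^ (2 * d)) := by gcongr
        _ = K := by field_simp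
    rw [e1, e2]
    push_cast
    calc C * ((D : ℝ) * (q : ℝ) ^ 2) ^ d *
          (Real.exp (-(a' / 2 * (q : ℝ) ^ S.γ)) * Real.exp (-(a' / 2 * (q : ℝ) ^ S.γ))) +
          Real.exp (-b) ^ q
        = C * D ^ d * ((q : ℝ) ^ (2 * d) * Real.exp (-(a' / 2 * (q : ℝ) ^ S.γ))) *
          Real.exp (-(a' / 2 * (q : ℝ) ^ S.γ)) + Real.exp (-b) ^ q := by
          rw [mul_pow, ← pow_mul]; ring
      _ ≤ C * D ^ d * K * Real.exp (-(b' * (q : ℝ) ^ S.γ)) + Real.exp (-(b' * (q : ℝ) ^ S.γ)) := by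
          gcongr
      _ = (C * D ^ d * K + 1) * Real.exp (-(b' * (q : ℝ) ^ S.γ)) := by ring
      _ ≤ _ := by
          gcongr
          rw [hC']
          have := Real.exp_pos (b' * (q₀ : ℝ) ^ S.γ)
          linarith

/-- stretched exponential tail for the radius of the first renewal block. -/
lemma Setup.exists_regIn_bound (hd : 0 < d) (S : Setup P Pq) :
    ∃ C b κ : ℝ, 0 < C ∧ 0 < b ∧ 0 < κ ∧ ∀ r : ℕ, 1 ≤ r →
      annM P Pq 0 {f | ¬ RegIn S.u r f} ≤ ENNReal.ofReal (C * Real.exp (-(b * (r : ℝ) ^ κ))) := by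
  obtain ⟨D, C, b, hD, hC, hb, hbound⟩ := S.exists_regIn_sq_bound hd
  have := S.prob
  have hprob := isProbabilityMeasure_annM (P := P) S.hPq (0 : Site d)
  have hγ := S.γ_pos
  have hD0 : (0 : ℝ) < D := by exact_mod_cast hD
  set b' := b * (1 / (4 * D)) ^ (S.γ / 2) with hb'
  have hb'pos : 0 < b' := by positivity
  refine ⟨C + Real.exp (b' * (D : ℝ) ^ (S.γ / 2)), b', S.γ / 2, by positivity, hb'pos,
    by positivity, fun r hr => ?_⟩
  have hr1 : (1 : ℝ) ≤ r := by exact_mod_cast hr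
  rcases lt_or_ge r D with hlt | hge
  · refine prob_le_one.trans ?_
    rw [← ENNReal.ofReal_one]
    refine ENNReal.ofReal_le_ofReal ?_
    have h1 : Real.exp (b' * (D : ℝ) ^ (S.γ / 2)) * Real.exp (-(b' * (r : ℝ) ^ (S.γ / 2))) ≤
        (C + Real.exp (b' * (D : ℝ) ^ (S.γ / 2))) * Real.exp (-(b' * (r : ℝ) ^ (S.γ / 2))) := by
      gcongr
      linarith
    refine le_trans ?_ h1
    rw [← Real.exp_add]
    refine Real.one_le_exp ?_
    have : (r : ℝ) ^ (S.γ / 2) ≤ (D : ℝ) ^ (S.γ / 2) := by gcongr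
    nlinarith
  · set q := Nat.sqrt (r / D) with hq
    have hq1 : 1 ≤ q := by
      rw [hq, Nat.one_le_iff_ne_zero, Ne, Nat.sqrt_eq_zero]
      exact (Nat.div_pos hge hD).ne'
    have hle : D * q ^ 2 ≤ r := by
      calc D * q ^ 2 ≤ D * (r / D) := Nat.mul_le_mul_left _ (Nat.sqrt_le' _)
        _ ≤ r := Nat.mul_div_le r D
    have hup : (r : ℝ) ≤ 4 * D * (q : ℝ) ^ 2 := by
      have h1 : r / D < (q + 1) ^ 2 := Nat.lt_succ_sqrt' _
      have h2 : r < (q + 1) ^ 2 * D := (Nat.div_lt_iff_lt_mul hD).1 h1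
      have h3 : (q + 1) ^ 2 ≤ 4 * q ^ 2 := by nlinarith
      have h4 : r ≤ 4 * D * q ^ 2 := by nlinarith
      exact_mod_cast h4
    have hmono : {f | ¬ RegIn S.u r f} ⊆ {f | ¬ RegIn S.u (D * q ^ 2) f} :=
      fun f hf h => hf (h.mono hle)
    refine (measure_mono hmono).trans ((hbound q hq1).trans (ENNReal.ofReal_le_ofReal ?_))
    have hkey : b' * (r : ℝ) ^ (S.γ / 2) ≤ b * (q : ℝ) ^ S.γ := by
      rw [hb', mul_assoc, ← Real.mul_rpow (by positivity) (by positivity)]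
      have h1 : 1 / (4 * (D : ℝ)) * r ≤ (q : ℝ) ^ 2 := by
        rw [one_div, inv_mul_le_iff₀ (by positivity)]
        exact hup
      have h2 : (q : ℝ) ^ S.γ = ((q : ℝ) ^ 2) ^ (S.γ / 2) := by
        rw [← Real.rpow_natCast, ← Real.rpow_mul (by positivity)]
        congr 1
        push_cast
        ring
      rw [h2]
      gcongr
    have hexp := Real.exp_pos (b' * (D : ℝ) ^ (S.γ / 2))
    calc C * Real.exp (-(b * (q : ℝ) ^ S.γ))
        ≤ (C + Real.exp (b' * (D : ℝ) ^ (S.γ / 2))) * Real.exp (-(b * (q : ℝ) ^ S.γ)) := by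
          gcongr; linarith
      _ ≤ _ := by gcongr

end RegenTail

lemma measurable_apply_nat {α β : Type*} [MeasurableSpace α] [MeasurableSpace β] {g : ℕ → α → β}
    (hg : ∀ n, Measurable (g n)) {τ : α → ℕ} (hτ : Measurable τ) : Measurable fun x => g (τ x) x := by
  have h : Measurable fun p : ℕ × α => g p.1 p.2 := measurable_from_prod_countable_right hg
  exact h.comp (hτ.prodMk measurable_id)

section Blocks

variable {d : ℕ} {P : Measure (Env d)} {Pq : Env d → Site d → Measure (Path d)}

/-- the first positive renewal time. -/
def tau {d : ℕ} (u : Fin d → ℤ) (f : Path d) : ℕ := sInf {t | 0 < t ∧ IsReg u f t}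

/-- the recentered path after the first renewal time. -/
def renew {d : ℕ} (u : Fin d → ℤ) (f : Path d) : Path d := recen (tau u f) f

/-- the path has a positive renewal time. -/
def HasReg {d : ℕ} (u : Fin d → ℤ) (f : Path d) : Prop := ∃ t, 0 < t ∧ IsReg u f t

lemma HasReg.tau_pos {u : Fin d → ℤ} {f : Path d} (h : HasReg u f) : 0 < tau u f :=
  (Nat.sInf_mem (s := {t | 0 < t ∧ IsReg u f t}) h).1

lemma HasReg.isReg {u : Fin d → ℤ} {f : Path d} (h : HasReg u f) : IsReg u f (tau u f) :=
  (Nat.sInf_mem (s := {t | 0 < t ∧ IsReg u f t}) h).2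

lemma tau_le {u : Fin d → ℤ} {f : Path d} {t : ℕ} (ht : 0 < t) (h : IsReg u f t) :
    tau u f ≤ t := Nat.sInf_le ⟨ht, h⟩

lemma measurableSet_isReg (u : Fin d → ℤ) (t : ℕ) : MeasurableSet {f : Path d | IsReg u f t} := by
  have : {f : Path d | IsReg u f t} = {f | ∀ s < t, lev u (f s) < lev u (f t)} ∩
      ⋂ s, {f | t ≤ s → lev u (f t) ≤ lev u (f s)} := by
    ext f; simp [IsReg]
  rw [this]
  refine MeasurableSet.inter (UpTo.measurableSet (n := t) fun f g h hf s hs => ?_)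
    (MeasurableSet.iInter fun s => UpTo.measurableSet (n := max s t) fun f g h hf hs => ?_)
  · rw [← h s hs.le, ← h t le_rfl]
    exact hf s hs
  · rw [← h s (le_max_left _ _), ← h t (le_max_right _ _)]
    exact hf hs

lemma measurableSet_hasReg (u : Fin d → ℤ) : MeasurableSet {f : Path d | HasReg u f} := by
  have : {f : Path d | HasReg u f} = ⋃ t, {f | 0 < t ∧ IsReg u f t} := by ext f; simp [HasReg]
  rw [this]
  refine MeasurableSet.iUnion fun t => ?_
  by_cases ht : 0 < t
  · simpa [ht] using measurableSet_isReg u t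
  · simp [ht]

lemma measurable_tau (u : Fin d → ℤ) : Measurable (tau u : Path d → ℕ) := by
  refine measurable_of_Ici fun n => ?_
  have : tau u ⁻¹' Set.Ici n = {f : Path d | n = 0} ∪ ({f | HasReg u f} ∩
      ⋂ t : ℕ, {f | t < n → 0 < t → ¬ IsReg u f t}) := by
    ext f
    simp only [Set.mem_preimage, Set.mem_Ici, Set.mem_union, Set.mem_ofPred_eq, Set.mem_inter_iff,
      Set.mem_iInter]
    constructor
    · intro h
      rcases Nat.eq_zero_or_pos n with hn | hn
      · exact Or.inl hn
      · refine Or.inr ⟨?_, fun t ht h0 hr => ?_⟩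
        · by_contra hno
          have : tau u f = 0 := by
            rw [tau, show {t | 0 < t ∧ IsReg u f t} = ∅ from ?_, Nat.sInf_empty]
            exact Set.eq_empty_of_forall_notMem fun t ht => hno ⟨t, ht⟩
          omega
        · have := tau_le h0 hr
          omega
    · rintro (h | ⟨h1, h2⟩)
      · omega
      · by_contra hlt
        push Not at hlt
        exact h2 _ hlt h1.tau_pos h1.isReg
  rw [this]
  refine MeasurableSet.union (MeasurableSet.const _) ((measurableSet_hasReg u).inter
    (MeasurableSet.iInter fun t => ?_))
  by_cases h1 : t < n
  · by_cases h2 : 0 < t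
    · simp only [h1, h2, forall_const]
      exact (measurableSet_isReg u t).compl
    · simp [h2]
  · simp [h1]

lemma measurable_renew (u : Fin d → ℤ) : Measurable (renew u : Path d → Path d) :=
  measurable_apply_nat (g := recen) measurable_recen (measurable_tau u)

/-- the part of the event that `n` is the first renewal time which is decided by time `n`. -/
def preReg {d : ℕ} (u : Fin d → ℤ) (n : ℕ) : Set (Path d) :=
  {f | 0 < n ∧ (∀ s < n, lev u (f s) < lev u (f n)) ∧ ∀ s, 0 < s → s < n →
    ¬ ((∀ r < s, lev u (f r) < lev u (f s)) ∧ ∀ r ≤ n, s ≤ r → lev u (f s) ≤ lev u (f r))}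

lemma upTo_preReg (u : Fin d → ℤ) (n : ℕ) : UpTo n (preReg u n) := by
  intro f g h ⟨h0, h1, h2⟩
  refine ⟨h0, fun s hs => ?_, fun s hs hsn ⟨k1, k2⟩ => ?_⟩
  · rw [← h s hs.le, ← h n le_rfl]
    exact h1 s hs
  · refine h2 s hs hsn ⟨fun r hr => ?_, fun r hr hsr => ?_⟩
    · rw [h s hsn.le, h r (by omega)]
      exact k1 r hr
    · rw [h s hsn.le, h r hr]
      exact k2 r hr hsr

lemma mem_preReg_iff (u : Fin d → ℤ) (n : ℕ) (f : Path d) :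
    f ∈ preReg u n ∩ recen n ⁻¹' stayUp u ↔ HasReg u f ∧ tau u f = n := by
  have hup : f ∈ recen n ⁻¹' stayUp u ↔ ∀ s, n ≤ s → lev u (f n) ≤ lev u (f s) := by
    constructor
    · intro h s hs
      have := h (s - n)
      simp only [recen_apply, Set.mem_ofPred_eq, lev_sub] at this
      rw [show n + (s - n) = s by omega] at this
      linarith
    · intro h s
      simp only [recen_apply, Set.mem_ofPred_eq, lev_sub]
      linarith [h (n + s) (by omega)]
  rw [Set.mem_inter_iff, hup]
  constructor
  · rintro ⟨⟨h0, h1, h2⟩, h3⟩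
    have hreg : IsReg u f n := ⟨h1, h3⟩
    have hhas : HasReg u f := ⟨n, h0, hreg⟩
    refine ⟨hhas, le_antisymm (tau_le h0 hreg) ?_⟩
    by_contra hlt
    push Not at hlt
    exact h2 _ hhas.tau_pos hlt ⟨hhas.isReg.1, fun r _ hr => hhas.isReg.2 r hr⟩
  · rintro ⟨hhas, rfl⟩
    refine ⟨⟨hhas.tau_pos, hhas.isReg.1, fun s hs hst ⟨k1, k2⟩ => ?_⟩, hhas.isReg.2⟩
    have : IsReg u f s := by
      refine ⟨k1, fun r hr => ?_⟩
      rcases le_or_gt r (tau u f) with h | h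
      · exact k2 r h hr
      · exact (k2 _ le_rfl hst.le).trans (hhas.isReg.2 r h.le)
    have := tau_le hs this
    omega

/-- a functional of the path and a time which depends only on the path up to that time. -/
def Adapted {d : ℕ} {β : Type*} (Φ : ℕ → Path d → β) : Prop :=
  ∀ n f g, (∀ i ≤ n, f i = g i) → Φ n f = Φ n g

lemma Adapted.eq_extend {β : Type*} {Φ : ℕ → Path d → β} (h : Adapted Φ) (n : ℕ) (f : Path d) :
    Φ n f = Φ n (extend (pre n f)) :=
  h n _ _ fun i hi => by rw [extend_apply _ hi]; rfl

lemma Adapted.measurable {β : Type*} [MeasurableSpace β] {Φ : ℕ → Path d → β} (h : Adapted Φ)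
    (n : ℕ) : Measurable (Φ n) := by
  have : Φ n = (fun s => Φ n (extend s)) ∘ pre n := by
    funext f
    exact h.eq_extend n f
  rw [this]
  exact Measurable.of_discrete.comp (measurable_pre n)

lemma Adapted.measurable_tau {β : Type*} [MeasurableSpace β] {Φ : ℕ → Path d → β} (h : Adapted Φ)
    (u : Fin d → ℤ) : Measurable fun f => Φ (tau u f) f :=
  measurable_apply_nat h.measurable (RWRE.measurable_tau u)

/-- the law of the walk conditioned to never go below its starting level. -/
def upLaw {d : ℕ} (P : Measure (Env d)) (Pq : Env d → Site d → Measure (Path d)) (u : Fin d → ℤ) :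
    Measure (Path d) := (annM P Pq 0 (stayUp u))⁻¹ • (annM P Pq 0).restrict (stayUp u)

lemma Setup.hasReg_ae (hd : 0 < d) (S : Setup P Pq) : ∀ᵐ f ∂(annM P Pq 0), HasReg S.u f := by
  obtain ⟨C, b, κ, hC, hb, hκ, hbound⟩ := S.exists_regIn_bound hd
  obtain ⟨K, hK, hKb⟩ := exists_exp_le_pow hb hκ 1
  rw [ae_iff]
  refine le_antisymm (ENNReal.le_of_forall_pos_le_add fun ε hε _ => ?_) zero_le
  obtain ⟨r, hr⟩ := exists_nat_gt (max 1 (C * K / ε))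
  have hr1 : (1 : ℝ) < r := (le_max_left _ _).trans_lt hr
  have hr2 : C * K / ε < r := (le_max_right _ _).trans_lt hr
  have hε' : (0 : ℝ) < ε := hε
  rw [zero_add]
  calc annM P Pq 0 {f | ¬ HasReg S.u f} ≤ annM P Pq 0 {f | ¬ RegIn S.u r f} :=
        measure_mono fun f hf h => hf (by obtain ⟨t, h1, h2, -⟩ := h; exact ⟨t, h1, h2⟩)
    _ ≤ ENNReal.ofReal (C * Real.exp (-(b * (r : ℝ) ^ κ))) := hbound r (by exact_mod_cast hr1.le)
    _ ≤ ENNReal.ofReal ε := by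
        refine ENNReal.ofReal_le_ofReal ?_
        have h1 := hKb r hr1.le
        have hr0 : (0 : ℝ) < r := by linarith
        rw [div_lt_iff₀ hε'] at hr2
        calc C * Real.exp (-(b * (r : ℝ) ^ κ)) ≤ C * (K / (r : ℝ) ^ 1) := by gcongr
          _ = C * K / r := by rw [pow_one]; ring
          _ ≤ ε := by rw [div_le_iff₀ hr0]; linarith
    _ = ε := ENNReal.ofReal_coe_nnreal

lemma map_recen_restrict (hPq : IsQuenchedFamily Pq) (h : IsIID P) (u : Fin d → ℤ) (x : Site d)
    {n : ℕ} {B : Set (Path d)} (hB : UpTo n B)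
    (hrec : ∀ f ∈ B, ∀ i < n, lev u (f i) < lev u (f n)) :
    ((annM P Pq x).restrict (B ∩ recen n ⁻¹' stayUp u)).map (recen n) =
      annM P Pq x B • (annM P Pq 0).restrict (stayUp u) := by
  ext A hA
  have hA' := hA.inter (measurableSet_stayUp u)
  rw [Measure.map_apply (measurable_recen n) hA,
    Measure.restrict_apply (measurable_recen n hA), Measure.smul_apply,
    Measure.restrict_apply hA, smul_eq_mul,
    ← annM_record_single hPq h u x hB hrec hA' (hPq.local_stay 0 hA' Set.inter_subset_right)]
  congr 1
  ext f
  simp only [Set.mem_inter_iff, Set.mem_preimage]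
  tauto

lemma lintegral_record (hPq : IsQuenchedFamily Pq) (h : IsIID P) (u : Fin d → ℤ) (x : Site d)
    {n : ℕ} {Φ : ℕ → Path d → ℝ≥0∞} (hΦ : Adapted Φ) {H : Path d → ℝ≥0∞} (hH : Measurable H) :
    ∫⁻ f in preReg u n ∩ recen n ⁻¹' stayUp u, Φ n f * H (recen n f) ∂(annM P Pq x) =
      (∫⁻ f in preReg u n, Φ n f ∂(annM P Pq x)) * ∫⁻ f in stayUp u, H f ∂(annM P Pq 0) := by
  have hmeas : MeasurableSet (preReg u n ∩ recen n ⁻¹' stayUp u) :=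
    (upTo_preReg u n).measurableSet.inter (measurable_recen n (measurableSet_stayUp u))
  have hsplit : ∀ (B : Set (Path d)) (g : Path d → ℝ≥0∞), MeasurableSet B →
      ∫⁻ f in B, g f ∂(annM P Pq x) =
      ∑' s : Fin (n + 1) → Site d, ∫⁻ f in cyl n (extend s) ∩ B, g f ∂(annM P Pq x) := by
    intro B g hB
    rw [← lintegral_iUnion]
    · congr 2
      rw [← Set.iUnion_inter]
      have : (⋃ s : Fin (n + 1) → Site d, cyl n (extend s)) = Set.univ := by
        refine Set.eq_univ_of_forall fun f => Set.mem_iUnion.2 ⟨pre n f, ?_⟩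
        rw [← preimage_pre]
        rfl
      rw [this, Set.univ_inter]
    · exact fun s => (measurableSet_cyl _ _).inter hB
    · intro s t hst
      refine Disjoint.mono Set.inter_subset_left Set.inter_subset_left ?_
      rw [← preimage_pre, ← preimage_pre]
      exact Disjoint.preimage _ (by simpa using hst)
  rw [hsplit _ _ hmeas, hsplit _ _ (upTo_preReg u n).measurableSet, ← ENNReal.tsum_mul_right]
  refine tsum_congr fun s => ?_
  have hB : UpTo n (cyl n (extend s) ∩ preReg u n) := (upTo_cyl _ _).inter (upTo_preReg u n)
  have hc : ∀ f ∈ cyl n (extend s), Φ n f = Φ n (extend s) := fun f hf => hΦ n _ _ hf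
  rw [← Set.inter_assoc]
  have e1 : ∫⁻ f in cyl n (extend s) ∩ preReg u n ∩ recen n ⁻¹' stayUp u,
      Φ n f * H (recen n f) ∂(annM P Pq x) =
      Φ n (extend s) * ∫⁻ f in cyl n (extend s) ∩ preReg u n ∩ recen n ⁻¹' stayUp u,
        H (recen n f) ∂(annM P Pq x) := by
    rw [← lintegral_const_mul _ (f := fun f => H (recen n f)) (hH.comp (measurable_recen n))]
    refine setLIntegral_congr_fun (hB.measurableSet.inter
      (measurable_recen n (measurableSet_stayUp u))) fun f hf => ?_
    simp only [hc f hf.1.1]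
  have e2 : ∫⁻ f in cyl n (extend s) ∩ preReg u n, Φ n f ∂(annM P Pq x) =
      Φ n (extend s) * annM P Pq x (cyl n (extend s) ∩ preReg u n) := by
    rw [← setLIntegral_const]
    exact setLIntegral_congr_fun hB.measurableSet fun f hf => hc f hf.1
  rw [e1, e2, ← lintegral_map hH (measurable_recen n),
    map_recen_restrict hPq h u x hB fun f hf i hi => hf.2.2.1 i hi, lintegral_smul_measure,
    smul_eq_mul, mul_assoc]

/-- the block structure at the first renewal time. -/
structure Renewal {d : ℕ} (P : Measure (Env d)) (Pq : Env d → Site d → Measure (Path d))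
    (u : Fin d → ℤ) (μ : Measure (Path d)) : Prop where
  prob : IsProbabilityMeasure μ
  hasReg : ∀ᵐ f ∂μ, HasReg u f
  nn : ∀ᵐ f ∂μ, NN f
  start : ∀ᵐ f ∂μ, f 0 = 0
  indep : ∀ (Φ : ℕ → Path d → ℝ≥0∞) (H : Path d → ℝ≥0∞), Adapted Φ → Measurable H →
    ∫⁻ f, Φ (tau u f) f * H (renew u f) ∂μ =
      (∫⁻ f, Φ (tau u f) f ∂μ) * ∫⁻ f, H f ∂(upLaw P Pq u)

lemma Setup.renewal_annM (hd : 0 < d) (S : Setup P Pq) : Renewal P Pq S.u (annM P Pq 0) := by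
  have := S.prob
  refine ⟨isProbabilityMeasure_annM S.hPq 0, S.hasReg_ae hd, ae_nn_annM S.hPq 0,
    ae_start_annM S.hPq 0, fun Φ H hΦ hH => ?_⟩
  set p := annM P Pq 0 (stayUp S.u) with hp
  have hprob := isProbabilityMeasure_annM (P := P) S.hPq (0 : Site d)
  have hp0 : p ≠ 0 := (S.stayUp_pos hd).ne'
  have hpt : p ≠ ⊤ := measure_ne_top _ _
  have hsplit : ∀ K : Path d → ℝ≥0∞, ∫⁻ f, K f ∂(annM P Pq 0) =
      ∑' n, ∫⁻ f in preReg S.u n ∩ recen n ⁻¹' stayUp S.u, K f ∂(annM P Pq 0) := by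
    intro K
    rw [← lintegral_iUnion]
    · rw [Measure.restrict_eq_self_of_ae_mem]
      filter_upwards [S.hasReg_ae hd] with f hf
      exact Set.mem_iUnion.2 ⟨tau S.u f, (mem_preReg_iff _ _ _).2 ⟨hf, rfl⟩⟩
    · exact fun n => (upTo_preReg S.u n).measurableSet.inter
        (measurable_recen n (measurableSet_stayUp S.u))
    · intro n m hnm
      rw [Function.onFun, Set.disjoint_left]
      intro f hf hf'
      rw [mem_preReg_iff] at hf hf'
      exact hnm (hf.2.symm.trans hf'.2)
  have hform : ∀ K : Path d → ℝ≥0∞, Measurable K →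
      ∫⁻ f, Φ (tau S.u f) f * K (renew S.u f) ∂(annM P Pq 0) =
        (∑' n, ∫⁻ f in preReg S.u n, Φ n f ∂(annM P Pq 0)) *
          ∫⁻ f in stayUp S.u, K f ∂(annM P Pq 0) := by
    intro K hK
    rw [hsplit, ← ENNReal.tsum_mul_right]
    refine tsum_congr fun n => ?_
    rw [← lintegral_record S.hPq S.iid S.u 0 hΦ hK]
    refine setLIntegral_congr_fun ((upTo_preReg S.u n).measurableSet.inter
      (measurable_recen n (measurableSet_stayUp S.u))) fun f hf => ?_
    rw [mem_preReg_iff] at hf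
    simp only [renew, hf.2]
  have h1 := hform (fun _ => 1) measurable_const
  simp only [mul_one, setLIntegral_one] at h1
  rw [hform H hH, h1, upLaw, lintegral_smul_measure, smul_eq_mul, ← hp, mul_assoc, ← mul_assoc p,
    ENNReal.mul_inv_cancel hp0 hpt, one_mul]

lemma Setup.lintegral_upLaw (S : Setup P Pq) (K : Path d → ℝ≥0∞) :
    ∫⁻ f, K f ∂(upLaw P Pq S.u) = (annM P Pq 0 (stayUp S.u))⁻¹ *
      ∫⁻ f, (stayUp S.u).indicator 1 f * K f ∂(annM P Pq 0) := by
  rw [upLaw, lintegral_smul_measure, smul_eq_mul, ← lintegral_indicator (measurableSet_stayUp S.u)]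
  congr 2
  funext f
  by_cases hf : f ∈ stayUp S.u <;> simp [hf]

lemma Setup.upLaw_ac (S : Setup P Pq) : upLaw P Pq S.u ≪ annM P Pq 0 :=
  Measure.AbsolutelyContinuous.smul_left Measure.absolutelyContinuous_restrict _

lemma Setup.renewal_upLaw (hd : 0 < d) (S : Setup P Pq) : Renewal P Pq S.u (upLaw P Pq S.u) := by
  have hR := S.renewal_annM hd
  have hprob := hR.prob
  set p := annM P Pq 0 (stayUp S.u) with hp
  have hp0 : p ≠ 0 := (S.stayUp_pos hd).ne'
  have hpt : p ≠ ⊤ := measure_ne_top _ _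
  refine ⟨⟨?_⟩, S.upLaw_ac.ae_le hR.hasReg, S.upLaw_ac.ae_le hR.nn, S.upLaw_ac.ae_le hR.start,
    fun Φ H hΦ hH => ?_⟩
  · rw [upLaw, Measure.smul_apply, Measure.restrict_apply_univ, smul_eq_mul,
      ENNReal.inv_mul_cancel hp0 hpt]
  set Φ' : ℕ → Path d → ℝ≥0∞ := fun n f =>
    ({f : Path d | ∀ i ≤ n, 0 ≤ lev S.u (f i)}).indicator 1 f * Φ n f with hΦ'
  have hΦ'a : Adapted Φ' := by
    intro n f g h
    simp only [hΦ']
    congr 1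
    · have : f ∈ {f : Path d | ∀ i ≤ n, 0 ≤ lev S.u (f i)} ↔
          g ∈ {f : Path d | ∀ i ≤ n, 0 ≤ lev S.u (f i)} :=
        forall₂_congr fun i hi => by rw [h i hi]
      by_cases hf : f ∈ {f : Path d | ∀ i ≤ n, 0 ≤ lev S.u (f i)}
      · rw [Set.indicator_of_mem hf, Set.indicator_of_mem (this.1 hf)]
        rfl
      · rw [Set.indicator_of_notMem hf, Set.indicator_of_notMem fun h => hf (this.2 h)]
    · exact hΦ n f g h
  have key : ∀ᵐ f ∂(annM P Pq 0),
      (stayUp S.u).indicator 1 f * Φ (tau S.u f) f = Φ' (tau S.u f) f := by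
    filter_upwards [hR.hasReg] with f hf
    simp only [hΦ']
    congr 1
    have : f ∈ stayUp S.u ↔ f ∈ {g : Path d | ∀ i ≤ tau S.u f, 0 ≤ lev S.u (g i)} := by
      constructor
      · intro h i _
        exact h i
      · intro h i
        rcases le_or_gt i (tau S.u f) with hi | hi
        · exact h i hi
        · exact (h _ le_rfl).trans (hf.isReg.2 i hi.le)
    by_cases hs : f ∈ stayUp S.u
    · rw [Set.indicator_of_mem hs, Set.indicator_of_mem (this.1 hs)]
    · rw [Set.indicator_of_notMem hs, Set.indicator_of_notMem fun h => hs (this.2 h)]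
  rw [S.lintegral_upLaw, S.lintegral_upLaw (fun f => Φ (tau S.u f) f), mul_assoc]
  congr 1
  rw [lintegral_congr_ae key, ← hR.indep Φ' H hΦ'a hH]
  refine lintegral_congr_ae ?_
  filter_upwards [key] with f hf
  rw [← mul_assoc, hf]

lemma Renewal.map_renew {u : Fin d → ℤ} {μ : Measure (Path d)} (h : Renewal P Pq u μ) :
    μ.map (renew u) = upLaw P Pq u := by
  have := h.prob
  ext A hA
  have h1 := h.indep (fun _ _ => 1) (A.indicator 1) (fun _ _ _ _ => rfl) (measurable_one.indicator hA)
  simp only [one_mul, lintegral_one, measure_univ, lintegral_indicator_one hA] at h1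
  rw [← h1, ← lintegral_map (measurable_one.indicator hA) (measurable_renew u),
    lintegral_indicator_one hA]

lemma Renewal.map_renew_iterate {u : Fin d → ℤ} (h : Renewal P Pq u (upLaw P Pq u)) (k : ℕ) :
    (upLaw P Pq u).map (renew u)^[k] = upLaw P Pq u := by
  induction k with
  | zero => simp
  | succ k ih =>
    rw [Function.iterate_succ', ← Measure.map_map (measurable_renew u)
      ((measurable_renew u).iterate k), ih, h.map_renew]

/-- functionals of successive blocks are independent and identically distributed. -/
lemma Renewal.lintegral_prod {u : Fin d → ℤ} (h : Renewal P Pq u (upLaw P Pq u))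
    {Φ : ℕ → Path d → ℝ≥0∞} (hΦ : Adapted Φ) (k : ℕ) :
    ∫⁻ f, ∏ i ∈ Finset.range k, Φ (tau u ((renew u)^[i] f)) ((renew u)^[i] f) ∂(upLaw P Pq u) =
      (∫⁻ f, Φ (tau u f) f ∂(upLaw P Pq u)) ^ k := by
  have := h.prob
  induction k with
  | zero => simp
  | succ k ih =>
    simp only [Finset.prod_range_succ', Function.iterate_succ_apply, Function.iterate_zero_apply]
    rw [pow_succ', ← ih, ← h.indep Φ _ hΦ]
    · exact lintegral_congr fun f => mul_comm _ _
    · exact Finset.measurable_prod _ fun i _ =>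
        (hΦ.measurable_tau u).comp ((measurable_renew u).iterate i)

end Blocks

section Concentration

lemma exp_le_quadratic {x : ℝ} (hx : |x| ≤ 2) : Real.exp x ≤ 1 + x + 2 * x ^ 2 := by
  obtain ⟨h1, h2⟩ := abs_le.1 hx
  have hy : |x / 2| ≤ 1 := by rw [abs_div, abs_two]; linarith
  have hb := Real.abs_exp_sub_one_sub_id_le hy
  have hb' := (abs_le.1 hb).2
  have hpos := Real.exp_pos (x / 2)
  have he : Real.exp x = Real.exp (x / 2) ^ 2 := by rw [← Real.exp_nat_mul]; congr 1; push_cast; ring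
  rw [he]
  have h3 : Real.exp (x / 2) ≤ 1 + x / 2 + (x / 2) ^ 2 := by linarith
  have h4 : Real.exp (x / 2) ^ 2 ≤ (1 + x / 2 + (x / 2) ^ 2) ^ 2 := by
    apply pow_le_pow_left₀ hpos.le h3
  nlinarith [sq_nonneg x, mul_nonneg (sq_nonneg x) (by linarith : (0:ℝ) ≤ 2 - x),
    mul_nonneg (sq_nonneg x) (by linarith : (0:ℝ) ≤ x + 2),
    mul_nonneg (mul_nonneg (sq_nonneg x) (by linarith : (0:ℝ) ≤ 2 - x)) (by linarith : (0:ℝ) ≤ x + 2)]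

/-- truncation at height `N`. -/
def trunc (N : ℝ) (x : ℝ) : ℝ := if |x| ≤ N then x else 0

lemma abs_trunc_le {N : ℝ} (hN : 0 ≤ N) (x : ℝ) : |trunc N x| ≤ N := by
  unfold trunc; split_ifs with h
  · exact h
  · simpa using hN

lemma abs_trunc_le_abs (N x : ℝ) : |trunc N x| ≤ |x| := by
  unfold trunc; split_ifs <;> simp

lemma measurable_trunc (N : ℝ) : Measurable (trunc N) :=
  Measurable.ite (measurableSet_le (measurable_id.abs) measurable_const) measurable_id measurable_const

variable {Ω : Type*} [MeasurableSpace Ω] {μ : Measure Ω} [IsProbabilityMeasure μ]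

lemma integral_exp_trunc_le {X : Ω → ℝ} (hX : Measurable X) (hX2 : Integrable (fun x => X x ^ 2) μ)
    {N : ℝ} (hN : 0 < N) {σ : ℝ} (hσ : |σ| = 1) :
    ∫⁻ x, ENNReal.ofReal (Real.exp (σ * (trunc N (X x) - ∫ y, trunc N (X y) ∂μ) / N)) ∂μ ≤
      ENNReal.ofReal (Real.exp (2 * (∫ x, X x ^ 2 ∂μ) / N ^ 2)) := by
  set Y : Ω → ℝ := fun x => trunc N (X x) with hY
  have hYm : Measurable Y := (measurable_trunc N).comp hX
  have hYb : ∀ x, |Y x| ≤ N := fun x => abs_trunc_le hN.le _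
  have hYi : Integrable Y μ := Integrable.of_bound hYm.aestronglyMeasurable N
    (Eventually.of_forall hYb)
  set m := ∫ y, Y y ∂μ with hm
  have hmb : |m| ≤ N := by
    have := norm_integral_le_of_norm_le_const (μ := μ) (f := Y) (Eventually.of_forall hYb)
    simpa using this
  set Z : Ω → ℝ := fun x => σ * (Y x - m) / N with hZ
  have hZm : Measurable Z := ((hYm.sub_const m).const_mul σ).div_const N
  have hZb : ∀ x, |Z x| ≤ 2 := fun x => by
    rw [hZ]
    simp only [abs_div, abs_mul, hσ, one_mul, abs_of_pos hN]
    rw [div_le_iff₀ hN]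
    have := abs_sub (Y x) m
    linarith [hYb x]
  have hY2i : Integrable (fun x => Y x ^ 2) μ := by
    refine hX2.mono' (hYm.pow_const 2).aestronglyMeasurable (Eventually.of_forall fun x => ?_)
    rw [Real.norm_eq_abs, abs_pow, ← sq_abs (X x)]
    exact pow_le_pow_left₀ (abs_nonneg _) (abs_trunc_le_abs _ _) 2
  have hexpi : Integrable (fun x => Real.exp (Z x)) μ :=
    Integrable.of_bound (Real.measurable_exp.comp hZm).aestronglyMeasurable (Real.exp 2)
      (Eventually.of_forall fun x => by
        rw [Real.norm_eq_abs, abs_of_pos (Real.exp_pos _)]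
        exact Real.exp_le_exp.2 (abs_le.1 (hZb x)).2)
  rw [← ofReal_integral_eq_lintegral_ofReal hexpi (Eventually.of_forall fun x => (Real.exp_pos _).le)]
  refine ENNReal.ofReal_le_ofReal ?_
  have hZi : Integrable Z μ := Integrable.of_bound hZm.aestronglyMeasurable 2
    (Eventually.of_forall hZb)
  have hZ2 : Integrable (fun x => Z x ^ 2) μ :=
    Integrable.of_bound (hZm.pow_const 2).aestronglyMeasurable 4
      (Eventually.of_forall fun x => by
        rw [Real.norm_eq_abs, abs_pow]
        nlinarith [hZb x, abs_nonneg (Z x)])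
  have hZ0 : ∫ x, Z x ∂μ = 0 := by
    simp only [hZ]
    rw [integral_div, integral_const_mul, integral_sub hYi (integrable_const _)]
    simp [hm]
  have hσ2 : σ ^ 2 = 1 := by rw [← sq_abs, hσ, one_pow]
  have hZ2e : ∫ x, Z x ^ 2 ∂μ ≤ (∫ x, X x ^ 2 ∂μ) / N ^ 2 := by
    have h1 : ∀ x, Z x ^ 2 = (Y x ^ 2 - (2 * m * Y x - m ^ 2)) / N ^ 2 := fun x => by
      simp only [hZ]; rw [div_pow, mul_pow, hσ2]; ring
    simp only [h1]
    have hli : Integrable (fun x => 2 * m * Y x - m ^ 2) μ :=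
      (hYi.const_mul _).sub (integrable_const _)
    rw [integral_div, integral_sub hY2i hli,
      integral_sub (hYi.const_mul _) (integrable_const _), integral_const_mul, ← hm]
    gcongr
    have h2 : ∫ x, Y x ^ 2 ∂μ ≤ ∫ x, X x ^ 2 ∂μ := by
      refine integral_mono hY2i hX2 fun x => ?_
      simp only
      rw [← sq_abs, ← sq_abs (X x)]
      exact pow_le_pow_left₀ (abs_nonneg _) (abs_trunc_le_abs _ _) 2
    simp
    nlinarith [sq_nonneg m]
  calc ∫ x, Real.exp (Z x) ∂μ ≤ ∫ x, (1 + Z x + 2 * Z x ^ 2) ∂μ :=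
        integral_mono hexpi (((integrable_const _).add hZi).add (hZ2.const_mul 2))
          fun x => exp_le_quadratic (hZb x)
    _ = 1 + 2 * ∫ x, Z x ^ 2 ∂μ := by
        have hli : Integrable (fun x => 1 + Z x) μ := (integrable_const _).add hZi
        rw [integral_add hli (hZ2.const_mul 2),
          integral_add (integrable_const _) hZi, integral_const_mul, hZ0]
        simp
    _ ≤ 1 + 2 * (∫ x, X x ^ 2 ∂μ) / N ^ 2 := by rw [mul_div_assoc]; gcongr
    _ ≤ _ := by rw [add_comm]; exact Real.add_one_le_exp _

lemma trunc_sum_tail {X : ℕ → Ω → ℝ} (hX : ∀ i, Measurable (X i))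
    (hprod : ∀ (φ : ℝ → ℝ≥0∞) (k : ℕ), Measurable φ →
      ∫⁻ x, ∏ i ∈ Finset.range k, φ (X i x) ∂μ = (∫⁻ x, φ (X 0 x) ∂μ) ^ k)
    (hX2 : Integrable (fun x => X 0 x ^ 2) μ)
    {N : ℝ} (hN : 0 < N) {σ : ℝ} (hσ : |σ| = 1) (k : ℕ) (D : ℝ) :
    μ {x | D ≤ σ * ∑ i ∈ Finset.range k, (trunc N (X i x) - ∫ y, trunc N (X 0 y) ∂μ)} ≤
      ENNReal.ofReal (Real.exp (2 * (∫ x, X 0 x ^ 2 ∂μ) * k / N ^ 2 - D / N)) := by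
  set m := ∫ y, trunc N (X 0 y) ∂μ with hm
  set φ : ℝ → ℝ≥0∞ := fun x => ENNReal.ofReal (Real.exp (σ * (trunc N x - m) / N)) with hφ
  have hφm : Measurable φ := by
    have := measurable_trunc N
    exact (Real.measurable_exp.comp (((this.sub_const m).const_mul σ).div_const N)).ennreal_ofReal
  have h1 := hprod φ k hφm
  have h2 := integral_exp_trunc_le (hX 0) hX2 hN hσ
  have h3 : ∀ x, ∏ i ∈ Finset.range k, φ (X i x) = ENNReal.ofReal (Real.exp
      (σ * (∑ i ∈ Finset.range k, (trunc N (X i x) - m)) / N)) := fun x => by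
    simp only [hφ]
    rw [← ENNReal.ofReal_prod_of_nonneg fun i _ => (Real.exp_pos _).le, ← Real.exp_sum,
      Finset.mul_sum, Finset.sum_div]
  have h4 : {x | D ≤ σ * ∑ i ∈ Finset.range k, (trunc N (X i x) - m)} ⊆
      {x | ENNReal.ofReal (Real.exp (D / N)) ≤ ∏ i ∈ Finset.range k, φ (X i x)} := by
    intro x hx
    simp only [Set.mem_ofPred_eq] at hx ⊢
    rw [h3]
    refine ENNReal.ofReal_le_ofReal (Real.exp_le_exp.2 ?_)
    gcongr
  have h5 := mul_meas_ge_le_lintegral (μ := μ) (f := fun x => ∏ i ∈ Finset.range k, φ (X i x))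
    (Finset.measurable_prod _ fun i _ => hφm.comp (hX i)) (ENNReal.ofReal (Real.exp (D / N)))
  rw [h1] at h5
  have h6 : ENNReal.ofReal (Real.exp (D / N)) ≠ 0 := by simp [Real.exp_pos]
  have h7 : (∫⁻ x, φ (X 0 x) ∂μ) ^ k ≤
      ENNReal.ofReal (Real.exp (2 * (∫ x, X 0 x ^ 2 ∂μ) * k / N ^ 2)) := by
    refine (pow_le_pow_left' h2 k).trans (le_of_eq ?_)
    rw [← ENNReal.ofReal_pow (Real.exp_pos _).le, ← Real.exp_nat_mul]
    congr 2
    ring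
  calc μ {x | D ≤ σ * ∑ i ∈ Finset.range k, (trunc N (X i x) - m)}
      ≤ μ {x | ENNReal.ofReal (Real.exp (D / N)) ≤ ∏ i ∈ Finset.range k, φ (X i x)} :=
        measure_mono h4
    _ ≤ ENNReal.ofReal (Real.exp (2 * (∫ x, X 0 x ^ 2 ∂μ) * k / N ^ 2)) /
        ENNReal.ofReal (Real.exp (D / N)) := by
        rw [ENNReal.le_div_iff_mul_le (Or.inl h6) (Or.inl ENNReal.ofReal_ne_top), mul_comm]
        exact h5.trans h7
    _ = _ := by
        rw [← ENNReal.ofReal_div_of_pos (Real.exp_pos _), Real.exp_sub]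

/-- concentration for sums of independent copies with a finite fourth moment. -/
lemma sum_concentration {X : ℕ → Ω → ℝ} (hX : ∀ i, Measurable (X i))
    (hid : ∀ i, μ.map (X i) = μ.map (X 0))
    (hprod : ∀ (φ : ℝ → ℝ≥0∞) (k : ℕ), Measurable φ →
      ∫⁻ x, ∏ i ∈ Finset.range k, φ (X i x) ∂μ = (∫⁻ x, φ (X 0 x) ∂μ) ^ k)
    (hX4 : Integrable (fun x => X 0 x ^ 4) μ) (K : ℕ) :
    ∃ C : ℝ, 0 < C ∧ ∀ (N k : ℕ) (D : ℝ), 1 ≤ N → k ≤ K * N ^ 2 →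
      μ {x | D + C < |∑ i ∈ Finset.range k, X i x - k * ∫ y, X 0 y ∂μ|} ≤
        ENNReal.ofReal (2 * Real.exp (C - D / N)) + (K * N ^ 2 : ℕ) * μ {x | (N : ℝ) < |X 0 x|} := by
  have hX2 : Integrable (fun x => X 0 x ^ 2) μ := by
    refine ((integrable_const (1 : ℝ)).add hX4).mono' ((hX 0).pow_const 2).aestronglyMeasurable
      (Eventually.of_forall fun x => ?_)
    rw [Real.norm_eq_abs, abs_of_nonneg (sq_nonneg _)]
    simp only [Pi.add_apply]
    nlinarith [sq_nonneg (X 0 x ^ 2 - 1)]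
  have hX1 : Integrable (X 0) μ := by
    refine ((integrable_const (1 : ℝ)).add hX2).mono' (hX 0).aestronglyMeasurable
      (Eventually.of_forall fun x => ?_)
    rw [Real.norm_eq_abs]
    simp only [Pi.add_apply]
    nlinarith [sq_abs (X 0 x), sq_nonneg (|X 0 x| - 1)]
  set s2 := ∫ x, X 0 x ^ 2 ∂μ with hs2
  set s4 := ∫ x, X 0 x ^ 4 ∂μ with hs4
  have hs2n : 0 ≤ s2 := integral_nonneg fun x => sq_nonneg _
  have hs4n : 0 ≤ s4 := integral_nonneg fun x => by positivity
  refine ⟨2 * s2 * K + K * s4 + 1, by positivity, fun N k D hN hk => ?_⟩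
  set C := 2 * s2 * K + K * s4 + 1 with hC
  have hN0 : (0 : ℝ) < N := by exact_mod_cast hN
  have hN1 : (1 : ℝ) ≤ N := by exact_mod_cast hN
  have hkr : (k : ℝ) ≤ K * (N : ℝ) ^ 2 := by exact_mod_cast hk
  set m := ∫ y, trunc N (X 0 y) ∂μ with hm
  have hti : Integrable (fun x => trunc N (X 0 x)) μ :=
    Integrable.of_bound ((measurable_trunc N).comp (hX 0)).aestronglyMeasurable N
      (Eventually.of_forall fun x => abs_trunc_le hN0.le _)
  have hmean : k * |m - ∫ y, X 0 y ∂μ| ≤ K * s4 := by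
    have h1 : |m - ∫ y, X 0 y ∂μ| ≤ s4 / N ^ 3 := by
      rw [hm, ← integral_sub hti hX1]
      refine (abs_integral_le_integral_abs).trans ?_
      rw [hs4, ← integral_div]
      refine integral_mono (hti.sub hX1).abs (hX4.div_const _) fun x => ?_
      simp only [trunc]
      split_ifs with h
      · simp; positivity
      · rw [zero_sub, abs_neg, le_div_iff₀ (by positivity)]
        push Not at h
        have h2 : X 0 x ^ 4 = |X 0 x| ^ 3 * |X 0 x| := by
          rw [← pow_succ, Even.pow_abs ⟨2, rfl⟩]
        rw [h2, mul_comm]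
        gcongr
    calc k * |m - ∫ y, X 0 y ∂μ| ≤ (K * (N : ℝ) ^ 2) * (s4 / N ^ 3) := by gcongr
      _ = K * s4 / N := by field_simp
      _ ≤ K * s4 := div_le_self (by positivity) hN1
  have hsub : {x | D + C < |∑ i ∈ Finset.range k, X i x - k * ∫ y, X 0 y ∂μ|} ⊆
      ({x | D ≤ 1 * ∑ i ∈ Finset.range k, (trunc N (X i x) - m)} ∪
        {x | D ≤ (-1) * ∑ i ∈ Finset.range k, (trunc N (X i x) - m)}) ∪
        ⋃ i ∈ Finset.range k, {x | (N : ℝ) < |X i x|} := by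
    intro x hx
    by_contra hcon
    simp only [Set.mem_union, Set.mem_ofPred_eq, Set.mem_iUnion, not_or, not_exists, not_le,
      not_lt] at hcon hx
    obtain ⟨⟨h1, h2⟩, h3⟩ := hcon
    have h4 : ∑ i ∈ Finset.range k, (trunc N (X i x) - m) =
        ∑ i ∈ Finset.range k, X i x - k * m := by
      rw [Finset.sum_sub_distrib]
      congr 1
      · refine Finset.sum_congr rfl fun i hi => ?_
        rw [trunc, if_pos (h3 i hi)]
      · simp
    rw [h4] at h1 h2
    have h5 : |(k : ℝ) * m - k * ∫ y, X 0 y ∂μ| ≤ K * s4 := by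
      rw [← mul_sub, abs_mul, Nat.abs_cast]
      exact hmean
    have h6 : |∑ i ∈ Finset.range k, X i x - k * m| ≤ D := by
      rw [abs_le]; constructor <;> linarith
    have h7 := abs_add_le (∑ i ∈ Finset.range k, X i x - k * m) (k * m - k * ∫ y, X 0 y ∂μ)
    rw [sub_add_sub_cancel] at h7
    have : 0 ≤ 2 * s2 * K := by positivity
    linarith
  have htail : ∀ σ : ℝ, |σ| = 1 →
      μ {x | D ≤ σ * ∑ i ∈ Finset.range k, (trunc N (X i x) - m)} ≤
        ENNReal.ofReal (Real.exp (C - D / N)) := fun σ hσ => by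
    refine (trunc_sum_tail hX hprod hX2 hN0 hσ k D).trans (ENNReal.ofReal_le_ofReal ?_)
    refine Real.exp_le_exp.2 ?_
    have : 2 * s2 * k / (N : ℝ) ^ 2 ≤ 2 * s2 * K := by
      rw [div_le_iff₀ (by positivity), mul_assoc (2 * s2)]
      gcongr
    have : 0 ≤ K * s4 := by positivity
    rw [← hs2]
    linarith
  refine (measure_mono hsub).trans ((measure_union_le _ _).trans (add_le_add ?_ ?_))
  · refine (measure_union_le _ _).trans ((add_le_add (htail 1 (by simp)) (htail (-1) (by simp))).trans ?_)
    rw [← ENNReal.ofReal_add (Real.exp_pos _).le (Real.exp_pos _).le, ← two_mul]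
  · refine (measure_biUnion_finset_le _ _).trans ?_
    have h1 : ∀ i, μ {x | (N : ℝ) < |X i x|} = μ {x | (N : ℝ) < |X 0 x|} := fun i => by
      have hs : MeasurableSet {y : ℝ | (N : ℝ) < |y|} :=
        measurableSet_lt measurable_const measurable_id.abs
      have h2 := congrArg (fun ν => ν {y : ℝ | (N : ℝ) < |y|}) (hid i)
      simp only [Measure.map_apply (hX i) hs, Measure.map_apply (hX 0) hs] at h2
      exact h2
    simp only [h1, Finset.sum_const, Finset.card_range, nsmul_eq_mul]
    gcongr

/-- polynomial tails of every order. -/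
def SupTail (μ : Measure Ω) (X : Ω → ℝ) : Prop :=
  ∀ k : ℕ, ∃ C : ℝ, 0 < C ∧ ∀ N : ℕ, 1 ≤ N → μ {x | (N : ℝ) < |X x|} ≤ ENNReal.ofReal (C / (N : ℝ) ^ k)

lemma SupTail.integrable_pow {X : Ω → ℝ} (hX : Measurable X) (h : SupTail μ X) (p : ℕ) :
    Integrable (fun x => |X x| ^ p) μ := by
  obtain ⟨C, hC, hb⟩ := h (p + 2)
  refine ⟨(hX.abs.pow_const p).aestronglyMeasurable, ?_⟩
  rw [hasFiniteIntegral_iff_ofReal (Eventually.of_forall fun x => by positivity)]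
  set g : ℕ → Ω → ℝ≥0∞ := fun N => {x | (N : ℝ) < |X x|}.indicator
    fun _ => ENNReal.ofReal (((N : ℝ) + 1) ^ p) with hg
  have hms : ∀ N : ℕ, MeasurableSet {x | (N : ℝ) < |X x|} := fun N =>
    measurableSet_lt measurable_const hX.abs
  have h1 : ∀ x, ENNReal.ofReal (|X x| ^ p) ≤ 1 + ∑' N, g N x := by
    intro x
    by_cases h0 : |X x| = 0
    · rw [h0]
      refine le_add_right (ENNReal.ofReal_le_one.2 (pow_le_one₀ le_rfl zero_le_one))
    · have hpos : 0 < |X x| := lt_of_le_of_ne (abs_nonneg _) (Ne.symm h0)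
      set M := ⌈|X x|⌉₊ - 1 with hM
      have hc : 0 < ⌈|X x|⌉₊ := Nat.ceil_pos.2 hpos
      have hM1 : (M : ℝ) < |X x| := by
        have := Nat.ceil_lt_add_one hpos.le
        have h2 : (M : ℝ) + 1 = ⌈|X x|⌉₊ := by
          rw [hM]; norm_cast; omega
        linarith
      have hM2 : |X x| ≤ M + 1 := by
        have := Nat.le_ceil |X x|
        have h2 : (M : ℝ) + 1 = ⌈|X x|⌉₊ := by
          rw [hM]; norm_cast; omega
        linarith
      refine le_add_left (le_trans ?_ (ENNReal.le_tsum M))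
      simp only [hg]
      rw [Set.indicator_of_mem (show x ∈ {x | (M : ℝ) < |X x|} from hM1)]
      exact ENNReal.ofReal_le_ofReal (pow_le_pow_left₀ hpos.le hM2 p)
  have h2 : ∫⁻ x, ENNReal.ofReal (|X x| ^ p) ∂μ ≤
      1 + ∑' N : ℕ, ENNReal.ofReal (((N : ℝ) + 1) ^ p) * μ {x | (N : ℝ) < |X x|} := by
    calc _ ≤ ∫⁻ x, (1 + ∑' N, g N x) ∂μ := lintegral_mono h1
      _ = _ := by
        rw [lintegral_add_left measurable_const, lintegral_tsum fun N =>
          (measurable_const.indicator (hms N)).aemeasurable]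
        simp [hms]
  refine h2.trans_lt ?_
  have h3 : Summable fun N : ℕ => (2 : ℝ) ^ p * C / ((N : ℝ) + 1) ^ 2 := by
    have := (summable_nat_add_iff 1).2 (Real.summable_one_div_nat_pow.2 (by norm_num : 1 < 2))
    have h4 := this.mul_left ((2 : ℝ) ^ p * C)
    refine h4.congr fun N => ?_
    push_cast
    ring
  rw [tsum_eq_zero_add' ENNReal.summable]
  have h5 : ∑' N : ℕ, ENNReal.ofReal ((((N + 1 : ℕ) : ℝ) + 1) ^ p) *
      μ {x | ((N + 1 : ℕ) : ℝ) < |X x|} ≤ ∑' N : ℕ, ENNReal.ofReal ((2 : ℝ) ^ p * C / ((N : ℝ) + 1) ^ 2) := by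
    refine ENNReal.tsum_le_tsum fun N => ?_
    refine (mul_le_mul' le_rfl (hb (N + 1) (by omega))).trans ?_
    rw [← ENNReal.ofReal_mul (by positivity)]
    refine ENNReal.ofReal_le_ofReal ?_
    push_cast
    set y : ℝ := (N : ℝ) + 1
    have hy : 1 ≤ y := by simp [y]
    calc (y + 1) ^ p * (C / y ^ (p + 2)) ≤ (2 * y) ^ p * (C / y ^ (p + 2)) := by
          gcongr; linarith
      _ = 2 ^ p * C / y ^ 2 := by
          rw [mul_pow, pow_add]; field_simp
  refine ENNReal.add_lt_top.2 ⟨ENNReal.one_lt_top, ENNReal.add_lt_top.2 ⟨?_, h5.trans_lt ?_⟩⟩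
  · exact ENNReal.mul_lt_top ENNReal.ofReal_lt_top (measure_lt_top _ _)
  · rw [← ENNReal.ofReal_tsum_of_nonneg (fun N => by positivity) h3]
    exact ENNReal.ofReal_lt_top

end Concentration

section BlockSums

variable {d : ℕ} {P : Measure (Env d)} {Pq : Env d → Site d → Measure (Path d)}

/-- the sum of an adapted functional over the first `k` blocks. -/
def blockSum {d : ℕ} (u : Fin d → ℤ) (g : ℕ → Path d → ℝ) (k : ℕ) (f : Path d) : ℝ :=
  ∑ i ∈ Finset.range k, g (tau u ((renew u)^[i] f)) ((renew u)^[i] f)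

/-- the mean of an adapted functional over a block. -/
def blockMean {d : ℕ} (P : Measure (Env d)) (Pq : Env d → Site d → Measure (Path d))
    (u : Fin d → ℤ) (g : ℕ → Path d → ℝ) : ℝ := ∫ f, g (tau u f) f ∂(upLaw P Pq u)

/-- the maximal absolute value of a functional up to time `n`. -/
def blockMax {d : ℕ} (g : ℕ → Path d → ℝ) (n : ℕ) (f : Path d) : ℝ :=
  (Finset.range (n + 1)).sup' Finset.nonempty_range_add_one fun t => |g t f|

lemma abs_le_blockMax (g : ℕ → Path d → ℝ) {n t : ℕ} (h : t ≤ n) (f : Path d) :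
    |g t f| ≤ blockMax g n f :=
  Finset.le_sup' (fun t => |g t f|) (Finset.mem_range.2 (Nat.lt_succ_of_le h))

lemma Adapted.blockMax {g : ℕ → Path d → ℝ} (hg : Adapted g) : Adapted (blockMax g) :=
  fun n f f' h => by
    refine Finset.sup'_congr _ rfl fun t ht => ?_
    rw [hg t f f' fun i hi => h i (hi.trans (Nat.lt_succ_iff.1 (Finset.mem_range.1 ht)))]

lemma SupTail.mono_abs {Ω : Type*} [MeasurableSpace Ω] {μ : Measure Ω} {X Y : Ω → ℝ}
    (h : SupTail μ Y) (hXY : ∀ x, |X x| ≤ |Y x|) : SupTail μ X := fun k => by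
  obtain ⟨C, hC, hb⟩ := h k
  exact ⟨C, hC, fun N hN => (measure_mono fun x hx => lt_of_lt_of_le hx (hXY x)).trans (hb N hN)⟩

/-- a set-valued sequence whose measure decays faster than every power. -/
def SupSmall {Ω : Type*} [MeasurableSpace Ω] (μ : Measure Ω) (B : ℕ → Set Ω) : Prop :=
  ∀ p : ℕ, ∃ C : ℝ, 0 < C ∧ ∀ N : ℕ, 1 ≤ N → μ (B N) ≤ ENNReal.ofReal (C / (N : ℝ) ^ p)

lemma SupSmall.mono_ae {Ω : Type*} [MeasurableSpace Ω] {μ : Measure Ω} {B B' : ℕ → Set Ω}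
    (h : SupSmall μ B) (hBB : ∀ᵐ x ∂μ, ∀ N, 1 ≤ N → x ∈ B' N → x ∈ B N) : SupSmall μ B' :=
  fun p => by
    obtain ⟨C, hC, hb⟩ := h p
    refine ⟨C, hC, fun N hN => le_trans (measure_mono_ae ?_) (hb N hN)⟩
    filter_upwards [hBB] with x hx using hx N hN

lemma SupSmall.union {Ω : Type*} [MeasurableSpace Ω] {μ : Measure Ω} {B B' : ℕ → Set Ω}
    (h : SupSmall μ B) (h' : SupSmall μ B') : SupSmall μ fun N => B N ∪ B' N := fun p => by
  obtain ⟨C, hC, hb⟩ := h p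
  obtain ⟨C', hC', hb'⟩ := h' p
  refine ⟨C + C', by positivity, fun N hN => (measure_union_le _ _).trans ?_⟩
  rw [add_div, ENNReal.ofReal_add (by positivity) (by positivity)]
  exact add_le_add (hb N hN) (hb' N hN)

lemma SupSmall.iUnion {Ω ι : Type*} [MeasurableSpace Ω] [Finite ι] {μ : Measure Ω}
    {B : ι → ℕ → Set Ω} (h : ∀ i, SupSmall μ (B i)) : SupSmall μ fun N => ⋃ i, B i N := fun p => by
  have := Fintype.ofFinite ι
  choose C hC hb using fun i => h i p
  refine ⟨∑ i, C i + 1, by have := Finset.sum_nonneg fun i (_ : i ∈ Finset.univ) => (hC i).le;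
                           linarith, fun N hN => (measure_iUnion_fintype_le _ _).trans ?_⟩
  calc ∑ i, μ (B i N) ≤ ∑ i, ENNReal.ofReal (C i / (N : ℝ) ^ p) :=
        Finset.sum_le_sum fun i _ => hb i N hN
    _ = ENNReal.ofReal ((∑ i, C i) / (N : ℝ) ^ p) := by
        rw [← ENNReal.ofReal_sum_of_nonneg fun i _ => by have := hC i; positivity, Finset.sum_div]
    _ ≤ _ := by gcongr; linarith

lemma exp_neg_log_sq_le (p : ℕ) {N : ℝ} (hN : 1 ≤ N) :
    Real.exp (-(Real.log N ^ 2)) ≤ Real.exp (p ^ 2) / N ^ p := by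
  have hN0 : 0 < N := by linarith
  rw [le_div_iff₀ (by positivity), ← Real.exp_log (x := N ^ p) (by positivity), ← Real.exp_add,
    Real.log_pow]
  refine Real.exp_le_exp.2 ?_
  nlinarith [sq_nonneg (Real.log N - p), sq_nonneg (Real.log N), sq_nonneg (p : ℝ)]

lemma Renewal.iterate_measure {u : Fin d → ℤ} (h : Renewal P Pq u (upLaw P Pq u)) (k : ℕ)
    {A : Set (Path d)} (hA : MeasurableSet A) :
    upLaw P Pq u ((renew u)^[k] ⁻¹' A) = upLaw P Pq u A := by
  rw [← Measure.map_apply ((measurable_renew u).iterate k) hA, h.map_renew_iterate]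

lemma Renewal.blockMax_small {u : Fin d → ℤ} (h : Renewal P Pq u (upLaw P Pq u))
    {g : ℕ → Path d → ℝ} (hg : Adapted g) (ht : SupTail (upLaw P Pq u) fun f => g (tau u f) f)
    (K : ℕ) : SupSmall (upLaw P Pq u) fun N =>
      {f | ∃ k ≤ K * N ^ 2, (N : ℝ) < |g (tau u ((renew u)^[k] f)) ((renew u)^[k] f)|} := by
  intro p
  obtain ⟨C, hC, hb⟩ := ht (p + 2)
  refine ⟨(K + 1) * C, by positivity, fun N hN => ?_⟩
  have hN0 : (1 : ℝ) ≤ N := by exact_mod_cast hN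
  have hm : MeasurableSet {f : Path d | (N : ℝ) < |g (tau u f) f|} :=
    measurableSet_lt measurable_const (hg.measurable_tau u).abs
  have hsub : {f : Path d | ∃ k ≤ K * N ^ 2, (N : ℝ) <
      |g (tau u ((renew u)^[k] f)) ((renew u)^[k] f)|} ⊆ ⋃ k ∈ Finset.range (K * N ^ 2 + 1),
        (renew u)^[k] ⁻¹' {f : Path d | (N : ℝ) < |g (tau u f) f|} := by
    rintro f ⟨k, hk, hf⟩
    simp only [Set.mem_iUnion, Finset.mem_range]
    exact ⟨k, Nat.lt_succ_of_le hk, hf⟩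
  refine (measure_mono hsub).trans ((measure_biUnion_finset_le _ _).trans ?_)
  simp only [h.iterate_measure _ hm, Finset.sum_const, Finset.card_range, nsmul_eq_mul]
  calc ((K * N ^ 2 + 1 : ℕ) : ℝ≥0∞) * upLaw P Pq u {f | (N : ℝ) < |g (tau u f) f|}
      ≤ ENNReal.ofReal ((K * N ^ 2 + 1 : ℕ) : ℝ) * ENNReal.ofReal (C / (N : ℝ) ^ (p + 2)) := by
        rw [ENNReal.ofReal_natCast]; gcongr; exact hb N hN
    _ = ENNReal.ofReal (((K * N ^ 2 + 1 : ℕ) : ℝ) * (C / (N : ℝ) ^ (p + 2))) :=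
        (ENNReal.ofReal_mul (by positivity)).symm
    _ ≤ _ := by
        refine ENNReal.ofReal_le_ofReal ?_
        rw [mul_div_assoc', div_le_div_iff₀ (by positivity) (by positivity)]
        push_cast
        have : (1 : ℝ) ≤ (N : ℝ) ^ 2 := one_le_pow₀ hN0
        have h3 : (K * (N : ℝ) ^ 2 + 1) ≤ (K + 1) * (N : ℝ) ^ 2 := by nlinarith
        calc (K * (N : ℝ) ^ 2 + 1) * C * (N : ℝ) ^ p ≤ ((K + 1) * (N : ℝ) ^ 2) * C * (N : ℝ) ^ p := by
              gcongr
          _ = _ := by ring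

lemma Renewal.blockSum_small {u : Fin d → ℤ} (h : Renewal P Pq u (upLaw P Pq u))
    {g : ℕ → Path d → ℝ} (hg : Adapted g) (ht : SupTail (upLaw P Pq u) fun f => g (tau u f) f)
    (K : ℕ) : ∃ C : ℝ, 0 < C ∧ SupSmall (upLaw P Pq u) fun N =>
      {f | ∃ k ≤ K * N ^ 2, N * Real.log N ^ 2 + C <
        |blockSum u g k f - k * blockMean P Pq u g|} := by
  have hprob := h.prob
  set X : ℕ → Path d → ℝ := fun i f => g (tau u ((renew u)^[i] f)) ((renew u)^[i] f) with hX
  have hX0 : X 0 = fun f => g (tau u f) f := rfl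
  have hm0 := hg.measurable_tau u
  have hXm : ∀ i, Measurable (X i) := fun i => hm0.comp ((measurable_renew u).iterate i)
  have hid : ∀ i, (upLaw P Pq u).map (X i) = (upLaw P Pq u).map (X 0) := fun i => by
    have : X i = (fun f => g (tau u f) f) ∘ (renew u)^[i] := rfl
    rw [this, ← Measure.map_map hm0 ((measurable_renew u).iterate i), h.map_renew_iterate, hX0]
  have hprod : ∀ (φ : ℝ → ℝ≥0∞) (k : ℕ), Measurable φ →
      ∫⁻ x, ∏ i ∈ Finset.range k, φ (X i x) ∂(upLaw P Pq u) =
        (∫⁻ x, φ (X 0 x) ∂(upLaw P Pq u)) ^ k := fun φ k _ =>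
    h.lintegral_prod (Φ := fun n f => φ (g n f)) (fun n f f' hff => congrArg φ (hg n f f' hff)) k
  have hX4 : Integrable (fun x => X 0 x ^ 4) (upLaw P Pq u) := by
    refine (ht.integrable_pow hm0 4).congr (Eventually.of_forall fun x => ?_)
    exact Even.pow_abs ⟨2, rfl⟩ _
  obtain ⟨C, hC, hconc⟩ := sum_concentration hXm hid hprod hX4 K
  refine ⟨C, hC, fun p => ?_⟩
  obtain ⟨C', hC', hb⟩ := ht (p + 4)
  refine ⟨(K + 1) * (2 * Real.exp (C + ((p + 2 : ℕ) : ℝ) ^ 2) + K * C'), by positivity,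
    fun N hN => ?_⟩
  have hN0 : (1 : ℝ) ≤ N := by exact_mod_cast hN
  have hNp : (0 : ℝ) < N := by linarith
  have hsub : {f : Path d | ∃ k ≤ K * N ^ 2, N * Real.log N ^ 2 + C <
        |blockSum u g k f - k * blockMean P Pq u g|} ⊆ ⋃ k ∈ Finset.range (K * N ^ 2 + 1),
        {f | N * Real.log N ^ 2 + C < |∑ i ∈ Finset.range k, X i f - k * ∫ y, X 0 y ∂(upLaw P Pq u)|} := by
    rintro f ⟨k, hk, hf⟩
    simp only [Set.mem_iUnion, Finset.mem_range]
    exact ⟨k, Nat.lt_succ_of_le hk, hf⟩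
  refine (measure_mono hsub).trans ((measure_biUnion_finset_le _ _).trans ?_)
  have hone : ∀ k ∈ Finset.range (K * N ^ 2 + 1), upLaw P Pq u
      {f | N * Real.log N ^ 2 + C < |∑ i ∈ Finset.range k, X i f - k * ∫ y, X 0 y ∂(upLaw P Pq u)|} ≤
      ENNReal.ofReal ((2 * Real.exp (C + ((p + 2 : ℕ) : ℝ) ^ 2) + K * C') / (N : ℝ) ^ (p + 2)) := by
    intro k hk
    refine (hconc N k _ hN (Nat.lt_succ_iff.1 (Finset.mem_range.1 hk))).trans ?_
    rw [add_div, ENNReal.ofReal_add (by positivity) (by positivity)]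
    refine add_le_add (ENNReal.ofReal_le_ofReal ?_) ?_
    · rw [mul_div_cancel_left₀ _ hNp.ne', sub_eq_add_neg, Real.exp_add, Real.exp_add, mul_div_assoc,
        mul_div_assoc]
      gcongr
      exact exp_neg_log_sq_le _ hN0
    · calc ((K * N ^ 2 : ℕ) : ℝ≥0∞) * upLaw P Pq u {x | (N : ℝ) < |X 0 x|}
          ≤ ENNReal.ofReal ((K * N ^ 2 : ℕ) : ℝ) * ENNReal.ofReal (C' / (N : ℝ) ^ (p + 4)) := by
            rw [ENNReal.ofReal_natCast]; gcongr; exact hb N hN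
        _ = ENNReal.ofReal (((K * N ^ 2 : ℕ) : ℝ) * (C' / (N : ℝ) ^ (p + 4))) :=
            (ENNReal.ofReal_mul (by positivity)).symm
        _ ≤ _ := by
            refine ENNReal.ofReal_le_ofReal (le_of_eq ?_)
            push_cast
            field_simp
            ring
  refine (Finset.sum_le_sum hone).trans ?_
  rw [Finset.sum_const, Finset.card_range, nsmul_eq_mul, ← ENNReal.ofReal_natCast,
    ← ENNReal.ofReal_mul (by positivity)]
  refine ENNReal.ofReal_le_ofReal ?_
  set E := 2 * Real.exp (C + ((p + 2 : ℕ) : ℝ) ^ 2) + K * C' with hE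
  have hE0 : 0 < E := by positivity
  rw [mul_div_assoc', div_le_div_iff₀ (by positivity) (by positivity)]
  push_cast
  have : (1 : ℝ) ≤ (N : ℝ) ^ 2 := one_le_pow₀ hN0
  have h3 : (K * (N : ℝ) ^ 2 + 1) ≤ (K + 1) * (N : ℝ) ^ 2 := by nlinarith
  calc (K * (N : ℝ) ^ 2 + 1) * E * (N : ℝ) ^ p ≤ ((K + 1) * (N : ℝ) ^ 2) * E * (N : ℝ) ^ p := by
        gcongr
    _ = _ := by ring

end BlockSums

section Track

variable {d : ℕ} {P : Measure (Env d)} {Pq : Env d → Site d → Measure (Path d)}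

/-- an adapted additive functional of the increments of the path. -/
structure Cocycle {d : ℕ} (A : ℕ → Path d → ℝ) : Prop where
  adapted : Adapted A
  add : ∀ s t f, A (s + t) f = A s f + A t (recen s f)

/-- the end of the `k`-th block. -/
def regT {d : ℕ} (u : Fin d → ℤ) (k : ℕ) (f : Path d) : ℕ :=
  ∑ i ∈ Finset.range k, tau u ((renew u)^[i] f)

lemma regT_succ (u : Fin d → ℤ) (k : ℕ) (f : Path d) :
    regT u (k + 1) f = regT u k f + tau u ((renew u)^[k] f) := Finset.sum_range_succ _ _

lemma iterate_renew {u : Fin d → ℤ} {f : Path d} (h0 : f 0 = 0) (k : ℕ) :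
    (renew u)^[k] f = recen (regT u k f) f := by
  induction k with
  | zero => funext i; simp [regT, h0]
  | succ k ih =>
    rw [Function.iterate_succ_apply', regT_succ]
    conv_lhs => rw [renew]
    conv_lhs => arg 2; rw [ih]
    rw [recen_recen]

lemma Cocycle.regT_eq {A : ℕ → Path d → ℝ} (hA : Cocycle A) {u : Fin d → ℤ} {f : Path d}
    (h0 : f 0 = 0) (k : ℕ) : A (regT u k f) f = blockSum u A k f := by
  induction k with
  | zero =>
    have := hA.add 0 0 f
    have h1 : recen 0 f = f := by funext i; simp [h0]
    rw [h1] at this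
    simp only [regT, blockSum, Finset.range_zero, Finset.sum_empty]
    simpa using this
  | succ k ih =>
    rw [regT_succ, hA.add, ih, ← iterate_renew h0, blockSum, blockSum, Finset.sum_range_succ]

/-- the functionals `A i` follow the line of slope `m` up to distance `D`, until a time at which
`n` blocks are completed. -/
def Track {d : ℕ} {ι : Type*} (u : Fin d → ℤ) (A : ι → ℕ → Path d → ℝ) (m : ι → ℝ) (D : ℝ) (n : ℕ)
    (f : Path d) : Prop :=
  ∃ T : ℕ, (∀ t ≤ T, ∃ k ≤ n, ∀ i, |A i t f - k * m i| ≤ D) ∧ (∀ i, |A i T f - n * m i| ≤ D) ∧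
    n ≤ lev u (f T)

lemma le_lev_regT {u : Fin d → ℤ} {f : Path d} (h0 : f 0 = 0)
    (hreg : ∀ k, HasReg u ((renew u)^[k] f)) (n : ℕ) : (n : ℤ) ≤ lev u (f (regT u n f)) := by
  induction n with
  | zero => simp [regT, h0]
  | succ n ih =>
    have h1 := (hreg n).isReg.1 0 (hreg n).tau_pos
    have h2 : (renew u)^[n] f = recen (regT u n f) f := iterate_renew h0 n
    rw [regT_succ]
    set t := tau u ((renew u)^[n] f) with ht
    rw [h2] at h1
    simp only [recen_apply, lev_sub, add_zero] at h1
    push_cast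
    linarith

lemma track_of_blocks {ι : Type*} {u : Fin d → ℤ} {A : ι → ℕ → Path d → ℝ}
    (hA : ∀ i, Cocycle (A i)) {m : ι → ℝ} {D B : ℝ} {n : ℕ} {f : Path d} (h0 : f 0 = 0)
    (hreg : ∀ k, HasReg u ((renew u)^[k] f)) (hB : 0 ≤ B)
    (hsum : ∀ i, ∀ k ≤ n, |blockSum u (A i) k f - k * m i| ≤ D)
    (hmax : ∀ i, ∀ k ≤ n,
      |blockMax (A i) (tau u ((renew u)^[k] f)) ((renew u)^[k] f)| ≤ B) :
    Track u A m (D + B) n f := by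
  refine ⟨regT u n f, fun t ht => ?_, fun i => ?_, le_lev_regT h0 hreg n⟩
  · set k := Nat.findGreatest (fun k => regT u k f ≤ t) n with hk
    have hkn : k ≤ n := Nat.findGreatest_le n
    have hkt : regT u k f ≤ t :=
      Nat.findGreatest_spec (P := fun k => regT u k f ≤ t) (Nat.zero_le n) (by simp [regT])
    have htk : t - regT u k f ≤ tau u ((renew u)^[k] f) := by
      rcases hkn.eq_or_lt with h | h
      · rw [← h] at ht; omega
      · have := Nat.findGreatest_is_greatest (P := fun k => regT u k f ≤ t) (k := k + 1)
          (Nat.lt_succ_self _) h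
        rw [regT_succ] at this
        omega
    refine ⟨k, hkn, fun i => ?_⟩
    obtain ⟨r, hr⟩ := Nat.exists_eq_add_of_le hkt
    rw [hr] at htk ⊢
    rw [(hA i).add, (hA i).regT_eq h0, ← iterate_renew h0]
    rw [add_tsub_cancel_left] at htk
    have h1 := abs_le_blockMax (A i) htk ((renew u)^[k] f)
    have h2 := (h1.trans (le_abs_self _)).trans (hmax i k hkn)
    have h3 := hsum i k hkn
    rw [abs_le] at *
    constructor <;> linarith
  · rw [(hA i).regT_eq h0]
    exact (hsum i n le_rfl).trans (by linarith)

lemma Renewal.iterate_hasReg {u : Fin d → ℤ} (h : Renewal P Pq u (upLaw P Pq u)) :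
    ∀ᵐ f ∂(upLaw P Pq u), ∀ k, HasReg u ((renew u)^[k] f) := by
  rw [ae_all_iff]
  intro k
  have h1 := h.hasReg
  rw [← h.map_renew_iterate k] at h1
  exact ae_of_ae_map ((measurable_renew u).iterate k).aemeasurable h1

lemma Renewal.exists_track {ι : Type*} [Finite ι] {u : Fin d → ℤ}
    (h : Renewal P Pq u (upLaw P Pq u)) {A : ι → ℕ → Path d → ℝ} (hA : ∀ i, Cocycle (A i))
    (ht : ∀ i, SupTail (upLaw P Pq u) fun f => blockMax (A i) (tau u f) f) (K : ℕ) :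
    ∃ C : ℝ, 0 < C ∧ SupSmall (upLaw P Pq u) fun N =>
      {f | ¬ Track u A (fun i => blockMean P Pq u (A i)) (N * Real.log N ^ 2 + C + N) (K * N ^ 2) f} := by
  have := Fintype.ofFinite ι
  have hts : ∀ i, SupTail (upLaw P Pq u) fun f => A i (tau u f) f := fun i =>
    (ht i).mono_abs fun f => (abs_le_blockMax (A i) le_rfl f).trans (le_abs_self _)
  choose C hC hb using fun i => h.blockSum_small (hA i).adapted (hts i) K
  refine ⟨∑ i, C i + 1, by have := Finset.sum_nonneg fun i (_ : i ∈ Finset.univ) => (hC i).le;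
                           linarith, ?_⟩
  refine ((SupSmall.iUnion hb).union (SupSmall.iUnion fun i =>
    h.blockMax_small (hA i).adapted.blockMax (ht i) K)).mono_ae ?_
  filter_upwards [h.start, h.iterate_hasReg] with f h0 hreg N hN hf
  by_contra hcon
  simp only [Set.mem_union, Set.mem_iUnion, Set.mem_ofPred_eq, not_or, not_exists, not_and,
    not_lt] at hcon
  refine hf (track_of_blocks hA h0 hreg (Nat.cast_nonneg N) (fun i k hk => (hcon.1 i k hk).trans ?_)
    fun i k hk => hcon.2 i k hk)
  have := Finset.single_le_sum (f := C) (fun i _ => (hC i).le) (Finset.mem_univ i)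
  linarith

/-- a coordinate of the path, as an additive functional. -/
def coordF {d : ℕ} (i : Fin d) (t : ℕ) (f : Path d) : ℝ := (f t i : ℝ) - f 0 i

lemma cocycle_coordF (i : Fin d) : Cocycle (coordF i) :=
  ⟨fun n f g h => by rw [coordF, coordF, h n le_rfl, h 0 (Nat.zero_le _)], fun s t f => by
    simp [coordF]⟩

lemma Setup.regIn_supTail (hd : 0 < d) (S : Setup P Pq) :
    SupSmall (annM P Pq 0) fun r => {f | ¬ RegIn S.u r f} := by
  obtain ⟨C, b, κ, hC, hb, hκ, hbound⟩ := S.exists_regIn_bound hd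
  intro p
  obtain ⟨K, hK, hKb⟩ := exists_exp_le_pow hb hκ p
  refine ⟨C * K, by positivity, fun N hN => (hbound N hN).trans (ENNReal.ofReal_le_ofReal ?_)⟩
  rw [mul_div_assoc]
  gcongr
  exact hKb N (by exact_mod_cast hN)

lemma Setup.upLaw_le (hd : 0 < d) (S : Setup P Pq) : ∃ C : ℝ, 0 < C ∧ ∀ B : Set (Path d),
    upLaw P Pq S.u B ≤ ENNReal.ofReal C * annM P Pq 0 B := by
  have hp := S.stayUp_pos hd
  have := S.prob
  have hprob := isProbabilityMeasure_annM (P := P) S.hPq (0 : Site d)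
  have hpt : annM P Pq 0 (stayUp S.u) ≠ ⊤ := measure_ne_top _ _
  refine ⟨(annM P Pq 0 (stayUp S.u))⁻¹.toReal, ENNReal.toReal_pos (ENNReal.inv_ne_zero.2 hpt)
    (ENNReal.inv_ne_top.2 hp.ne'), fun B => ?_⟩
  rw [ENNReal.ofReal_toReal (ENNReal.inv_ne_top.2 hp.ne'), upLaw, Measure.smul_apply, smul_eq_mul]
  gcongr
  exact Measure.restrict_le_self

lemma Setup.supSmall_upLaw (hd : 0 < d) (S : Setup P Pq) {B : ℕ → Set (Path d)}
    (h : SupSmall (annM P Pq 0) B) : SupSmall (upLaw P Pq S.u) B := fun p => by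
  obtain ⟨C, hC, hb⟩ := h p
  obtain ⟨C', hC', hb'⟩ := S.upLaw_le hd
  refine ⟨C' * C, by positivity, fun N hN => (hb' _).trans ?_⟩
  rw [mul_div_assoc, ENNReal.ofReal_mul hC'.le]
  gcongr
  exact hb N hN

lemma RegIn.blockMax_coordF_le {u : Fin d → ℤ} {r : ℕ} {f : Path d} (h : RegIn u r f)
    (h0 : f 0 = 0) (i : Fin d) : |blockMax (coordF i) (tau u f) f| ≤ r := by
  obtain ⟨t, h1, h2, h3⟩ := h
  rw [abs_of_nonneg ((abs_nonneg _).trans (abs_le_blockMax _ (Nat.zero_le _) f))]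
  refine Finset.sup'_le _ _ fun s hs => ?_
  have := h3 s ((Nat.lt_succ_iff.1 (Finset.mem_range.1 hs)).trans (tau_le h1 h2))
  rw [mem_box] at this
  simp only [coordF, h0, Pi.zero_apply, Int.cast_zero, sub_zero]
  exact_mod_cast this i

lemma Setup.coordF_supSmall (hd : 0 < d) (S : Setup P Pq) (i : Fin d) :
    SupSmall (annM P Pq 0) fun N => {f | (N : ℝ) < |blockMax (coordF i) (tau S.u f) f|} := by
  refine (S.regIn_supTail hd).mono_ae ?_
  filter_upwards [ae_start_annM S.hPq 0] with f h0 N _ hf hcon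
  exact absurd (hcon.blockMax_coordF_le h0 i) (not_le.2 hf)

lemma Setup.coordF_supTail (hd : 0 < d) (S : Setup P Pq) (i : Fin d) :
    SupTail (upLaw P Pq S.u) fun f => blockMax (coordF i) (tau S.u f) f :=
  S.supSmall_upLaw hd (S.coordF_supSmall hd i)

end Track

section Layers

variable {d : ℕ} {P : Measure (Env d)} {Pq : Env d → Site d → Measure (Path d)}

/-- inside `V`, the path descends to level `r` while staying below level `ℓ`. -/
def descend (u : Fin d → ℤ) (V : Finset (Site d)) (ℓ r : ℤ) : Set (Path d) :=
  {f | ∃ t, (∀ i ≤ t, f i ∈ V ∧ lev u (f i) ≤ ℓ) ∧ lev u (f t) ≤ r}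

/-- the layer of thickness `width u` below level `b`. -/
def layer (u : Fin d → ℤ) (b : ℤ) : Set (Site d) := {z | b - width u < lev u z ∧ lev u z ≤ b}

/-- the slab around the layer below level `b`, with half width `s`. -/
def slab (u : Fin d → ℤ) (b : ℤ) (s : ℕ) : Set (Site d) :=
  {z | b - s < lev u z ∧ lev u z ≤ b + s - width u}

/-- the path leaves the slab at time `n`, within `V` and into the layer below level `b'`. -/
def slabExit (u : Fin d → ℤ) (V : Finset (Site d)) (b : ℤ) (s : ℕ) (b' : ℤ) (n : ℕ) :
    Set (Path d) :=
  {f | (∀ i < n, f i ∈ V ∧ f i ∈ slab u b s) ∧ f n ∈ V ∧ f n ∉ slab u b s ∧ f n ∈ layer u b'}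

lemma upTo_slabExit (u : Fin d → ℤ) (V : Finset (Site d)) (b : ℤ) (s : ℕ) (b' : ℤ) (n : ℕ) :
    UpTo n (slabExit u V b s b' n) := by
  intro f g h hf
  refine ⟨fun i hi => ?_, ?_⟩
  · rw [← h i hi.le]; exact hf.1 i hi
  · rw [← h n le_rfl]; exact hf.2

lemma disjoint_slabExit (u : Fin d → ℤ) (V : Finset (Site d)) (b : ℤ) (s : ℕ) (b' : ℤ) :
    Pairwise (Function.onFun Disjoint (slabExit u V b s b')) := by
  intro n m hnm
  rw [Function.onFun, Set.disjoint_left]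
  rintro f hf hf'
  rcases lt_or_gt_of_ne hnm with h | h
  · exact hf.2.2.1 (hf'.1 n h).2
  · exact hf'.2.2.1 (hf.1 m h).2

lemma measurableSet_iUnion_slabExit (u : Fin d → ℤ) (V : Finset (Site d)) (b : ℤ) (s : ℕ)
    (b' : ℤ) : MeasurableSet (⋃ n, slabExit u V b s b' n) :=
  MeasurableSet.iUnion fun n => (upTo_slabExit u V b s b' n).measurableSet

lemma measurableSet_descend (u : Fin d → ℤ) (V : Finset (Site d)) (ℓ r : ℤ) :
    MeasurableSet (descend u V ℓ r) := by
  have : descend u V ℓ r =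
      ⋃ t, {f | (∀ i ≤ t, f i ∈ V ∧ lev u (f i) ≤ ℓ) ∧ lev u (f t) ≤ r} := by
    ext f; simp [descend]
  rw [this]
  refine MeasurableSet.iUnion fun n => UpTo.measurableSet (n := n) fun f g h hf => ?_
  simp only [Set.mem_ofPred_eq] at *
  rw [← h n le_rfl]
  exact ⟨fun m hm => by rw [← h m hm]; exact hf.1 m hm, hf.2⟩

lemma descend_subset {u : Fin d → ℤ} {V : Finset (Site d)} {ℓ r b : ℤ} {s : ℕ} {f : Path d}
    (hf : NN f) (hws : width u ≤ s) (h0 : f 0 ∈ layer u b) (hr : r ≤ b - s)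
    (hd : f ∈ descend u V ℓ r) :
    f ∈ (⋃ n, slabExit u V b s (b - s) n ∩ after n ⁻¹' descend u V ℓ r) ∪
      ⋃ n, slabExit u V b s (b + s) n ∩ after n ⁻¹' descend u V ℓ r := by
  classical
  obtain ⟨t, hV, ht⟩ := hd
  have hex : ∃ n, f n ∉ slab u b s := ⟨t, fun h => by have := h.1; omega⟩
  set n := Nat.find hex with hn
  have hn1 : f n ∉ slab u b s := Nat.find_spec hex
  have hn2 : ∀ i < n, f i ∈ slab u b s := fun i hi => not_not.1 (Nat.find_min hex hi)
  have hnt : n ≤ t := Nat.find_min' hex fun h => by have := h.1; omega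
  have hws' : (width u : ℤ) ≤ s := by exact_mod_cast hws
  have hn0 : n ≠ 0 := by
    intro h
    rw [h] at hn1
    exact hn1 ⟨by have := h0.1; omega, by have := h0.2; omega⟩
  have hprev := hn2 (n - 1) (by omega)
  have hstep := hf.lev_succ u (n - 1)
  rw [show n - 1 + 1 = n by omega, abs_le] at hstep
  have hafter : after n f ∈ descend u V ℓ r := by
    refine ⟨t - n, fun i hi => hV (n + i) (by omega), ?_⟩
    simp only [after_apply]
    rwa [show n + (t - n) = t by omega]
  have hin : ∀ i < n, f i ∈ V ∧ f i ∈ slab u b s := fun i hi => ⟨(hV i (by omega)).1, hn2 i hi⟩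
  obtain ⟨hp1, hp2⟩ := hprev
  by_cases hdown : lev u (f n) ≤ b - s
  · exact Or.inl (Set.mem_iUnion.2 ⟨n, ⟨hin, (hV n hnt).1, hn1, by omega, hdown⟩, hafter⟩)
  · refine Or.inr (Set.mem_iUnion.2 ⟨n, ⟨hin, (hV n hnt).1, hn1, ?_, by omega⟩, hafter⟩)
    by_contra hcon
    exact hn1 ⟨by omega, by omega⟩

lemma IsQuenchedFamily.descend_le (hPq : IsQuenchedFamily Pq) (ω : Env d) {u : Fin d → ℤ}
    {V : Finset (Site d)} {ℓ r b : ℤ} {s : ℕ} (hws : width u ≤ s) (hr : r ≤ b - s)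
    {z : Site d} (hz : z ∈ layer u b) {G₁ G₂ : ℝ≥0∞}
    (h₁ : ∀ x ∈ V, x ∈ layer u (b - s) → Pq ω x (descend u V ℓ r) ≤ G₁)
    (h₂ : ∀ x ∈ V, x ∈ layer u (b + s) → Pq ω x (descend u V ℓ r) ≤ G₂) :
    Pq ω z (descend u V ℓ r) ≤ G₁ * Pq ω z (⋃ n, slabExit u V b s (b - s) n) +
      G₂ * Pq ω z (⋃ n, slabExit u V b s (b + s) n) := by
  have hm := measurableSet_descend u V ℓ r
  calc _ ≤ Pq ω z ((⋃ n, slabExit u V b s (b - s) n ∩ after n ⁻¹' descend u V ℓ r) ∪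
      ⋃ n, slabExit u V b s (b + s) n ∩ after n ⁻¹' descend u V ℓ r) := by
        refine measure_mono_ae ?_
        filter_upwards [hPq.ae_nn ω z, hPq.start ω z] with f hf h0 hfd
        exact descend_subset hf hws (by rw [h0]; exact hz) hr hfd
    _ ≤ _ := measure_union_le _ _
    _ ≤ _ := add_le_add
        (hPq.strong_markov_le ω z (upTo_slabExit u V b s _) (disjoint_slabExit u V b s _) hm
          fun n f hf => h₁ _ hf.2.1 hf.2.2.2)
        (hPq.strong_markov_le ω z (upTo_slabExit u V b s _) (disjoint_slabExit u V b s _) hm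
          fun n f hf => h₂ _ hf.2.1 hf.2.2.2)

lemma IsQuenchedFamily.slabExit_add_le (hPq : IsQuenchedFamily Pq) (ω : Env d) (u : Fin d → ℤ)
    (V : Finset (Site d)) (b : ℤ) {s : ℕ} (hws : width u < s) (z : Site d) :
    Pq ω z (⋃ n, slabExit u V b s (b - s) n) + Pq ω z (⋃ n, slabExit u V b s (b + s) n) ≤ 1 := by
  have := hPq.prob ω z
  rw [← measure_union _ (measurableSet_iUnion_slabExit _ _ _ _ _)]
  · exact prob_le_one
  · rw [Set.disjoint_left]
    rintro f hf hf'
    obtain ⟨n, hn⟩ := Set.mem_iUnion.1 hf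
    obtain ⟨m, hm⟩ := Set.mem_iUnion.1 hf'
    rcases lt_trichotomy n m with h | h | h
    · exact hn.2.2.1 (hm.1 n h).2
    · subst h
      have h1 := hn.2.2.2.2
      have h2 := hm.2.2.2.1
      omega
    · exact hm.2.2.1 (hn.1 m h).2

lemma Setup.slabExit_le (S : Setup P Pq) {st : StepIdx d} (hst : 1 ≤ lev S.u (stepVec st))
    {ω : Env d} (hω : Ell S.η ω) (V : Finset (Site d)) (b : ℤ) {s : ℕ} (hws : width S.u < s)
    {z : Site d} (hz : z ∈ layer S.u b) :
    (Pq ω z).real (⋃ n, slabExit S.u V b s (b - s) n) ≤ 1 - S.η ^ s := by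
  have := S.hPq.prob ω z
  have h1 := S.hPq.straight_ge hω z st s
  have hsub : (⋃ n, slabExit S.u V b s (b - s) n) ⊆ (cyl s (straight z st))ᶜ := by
    intro f hf hc
    obtain ⟨n, hn⟩ := Set.mem_iUnion.1 hf
    have hlev : ∀ i ≤ s, lev S.u (f i) = lev S.u z + i * lev S.u (stepVec st) := by
      intro i hi
      rw [hc i hi, straight, lev_add, lev_nsmul]
    obtain ⟨hz1, hz2⟩ := hz
    rcases le_or_gt n s with h | h
    · have h2 := hn.2.2.2.2
      rw [hlev n h] at h2
      have : (0 : ℤ) ≤ n * lev S.u (stepVec st) := by positivity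
      omega
    · have h2 := (hn.1 s h).2.2
      rw [hlev s le_rfl] at h2
      have : (s : ℤ) * 1 ≤ s * lev S.u (stepVec st) := by gcongr
      omega
  have h2 : (Pq ω z).real (⋃ n, slabExit S.u V b s (b - s) n) ≤
      (Pq ω z).real (cyl s (straight z st))ᶜ := measureReal_mono hsub
  rw [probReal_compl_eq_one_sub (measurableSet_cyl _ _)] at h2
  have h3 : S.η ^ s ≤ (Pq ω z).real (cyl s (straight z st)) := by
    rw [← ENNReal.ofReal_pow S.η_pos.le] at h1
    exact (ENNReal.ofReal_le_iff_le_toReal (measure_ne_top _ _)).1 h1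
  linarith

end Layers

lemma exists_finset_sup {α : Type*} (F : Set α) (hF : F.Finite) (h : α → ℝ) :
    ∃ g : ℝ, 0 ≤ g ∧ (∀ z ∈ F, h z ≤ g) ∧ ∀ X, 0 ≤ X → (∀ z ∈ F, h z ≤ X) → g ≤ X := by
  rcases F.eq_empty_or_nonempty with rfl | hne
  · exact ⟨0, le_rfl, by simp, fun X hX _ => hX⟩
  · obtain ⟨z, hz, hmax⟩ := hF.exists_maximalFor h F hne
    have hmax' : ∀ x ∈ F, h x ≤ h z := fun x hx => by
      rcases le_total (h x) (h z) with h1 | h1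
      · exact h1
      · exact hmax hx h1
    refine ⟨max (h z) 0, le_max_right _ _, fun x hx => (hmax' x hx).trans (le_max_left _ _), ?_⟩
    exact fun X hX hb => max_le (hb z hz) hX

lemma increment_le_prod (g ρ : ℕ → ℝ) (m : ℕ) (hρ : ∀ k, 0 ≤ ρ k) (h0 : g 0 = 0)
    (hg : ∀ k, 0 ≤ g k) (h1 : ∀ k, g k ≤ 1)
    (hstep : ∀ k < m, g (k + 1) ≤ g k ∨
      g (k + 1) - g k ≤ ρ k * (g (k + 2) - g (k + 1))) :
    g 1 ≤ ∏ k ∈ Finset.range m, ρ k := by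
  have key : ∀ j ≤ m, g 1 ≤ (∏ k ∈ Finset.range j, ρ k) * max (g (j + 1) - g j) 0 := by
    intro j
    induction j with
    | zero => intro _; simp [h0]
    | succ j ih =>
      intro hj
      refine (ih (by omega)).trans ?_
      rw [Finset.prod_range_succ, mul_assoc]
      refine mul_le_mul_of_nonneg_left ?_ (Finset.prod_nonneg fun k _ => hρ k)
      have hnn : 0 ≤ ρ j * max (g (j + 1 + 1) - g (j + 1)) 0 :=
        mul_nonneg (hρ j) (le_max_right _ _)
      rcases hstep j (by omega) with h | h
      · rw [max_eq_right (by linarith)]; exact hnn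
      · refine max_le (h.trans ?_) hnn
        exact mul_le_mul_of_nonneg_left (le_max_left _ _) (hρ j)
  refine (key m le_rfl).trans (mul_le_of_le_one_right (Finset.prod_nonneg fun k _ => hρ k) ?_)
  exact max_le (by linarith [h1 (m + 1), hg m]) zero_le_one

section Bad

variable {d : ℕ} {P : Measure (Env d)} {Pq : Env d → Site d → Measure (Path d)}

/-- the environments in which some site of the layer has a sizeable chance to exit the slab
downwards. -/
def badEnv (Pq : Env d → Site d → Measure (Path d)) (u : Fin d → ℤ) (V : Finset (Site d))
    (b : ℤ) (s : ℕ) : Set (Env d) :=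
  ⋃ z ∈ V, {ω | z ∈ layer u b ∧ 3⁻¹ < Pq ω z (⋃ n, slabExit u V b s (b - s) n)}

lemma measurableSet_badEnv (hPq : IsQuenchedFamily Pq) (u : Fin d → ℤ) (V : Finset (Site d))
    (b : ℤ) (s : ℕ) : MeasurableSet (badEnv Pq u V b s) := by
  refine Finset.measurableSet_biUnion _ fun z _ => ?_
  by_cases h : z ∈ layer u b
  · simp only [h, true_and]
    exact measurableSet_lt measurable_const (hPq.2 z _ (measurableSet_iUnion_slabExit _ _ _ _ _))
  · simp [h]

lemma IsQuenchedFamily.local_badEnv (hPq : IsQuenchedFamily Pq) (u : Fin d → ℤ)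
    (V : Finset (Site d)) (b : ℤ) (s : ℕ) : LocalOn (slab u b s) fun ω => ω ∈ badEnv Pq u V b s := by
  intro ω ω' h
  simp only [badEnv, Set.mem_iUnion, Set.mem_ofPred_eq, eq_iff_iff]
  refine exists_congr fun z => exists_congr fun _ => and_congr_right fun _ => ?_
  have := hPq.local_iUnion z (upTo_slabExit u V b s (b - s)) (S := slab u b s)
    (fun n f hf i hi => (hf.1 i hi).2) ω ω' h
  simp only at this
  rw [this]

lemma Setup.badEnv_le (hd : 0 < d) (S : Setup P Pq) (V : Finset (Site d)) (b : ℤ) {s : ℕ}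
    (hws : width S.u < s) :
    P (badEnv Pq S.u V b s) ≤ ENNReal.ofReal
      (3 * S.C * (V.card : ℝ) ^ 2 * Real.exp (-(S.a * ((s : ℝ) - width S.u) ^ S.γ))) := by
  have hL : (0 : ℝ) < (s : ℝ) - width S.u := by
    have : (width S.u : ℝ) < s := by exact_mod_cast hws
    linarith
  calc P (badEnv Pq S.u V b s)
      ≤ ∑ z ∈ V, P {ω | z ∈ layer S.u b ∧ 3⁻¹ < Pq ω z (⋃ n, slabExit S.u V b s (b - s) n)} :=
        measure_biUnion_finset_le _ _
    _ ≤ ∑ z ∈ V, 3 * ENNReal.ofReal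
        (S.C * V.card * Real.exp (-(S.a * ((s : ℝ) - width S.u) ^ S.γ))) := by
        refine Finset.sum_le_sum fun z _ => ?_
        by_cases h : z ∈ layer S.u b
        · simp only [h, true_and]
          have hmeas := S.hPq.2 z _ (measurableSet_iUnion_slabExit S.u V b s (b - s))
          have hmk := meas_ge_le_lintegral_div (μ := P) hmeas.aemeasurable
            (ε := 3⁻¹) (by simp) (by simp)
          rw [← annM_apply S.hPq z (measurableSet_iUnion_slabExit _ _ _ _ _)] at hmk
          refine (measure_mono (t := {ω | 3⁻¹ ≤ Pq ω z (⋃ n, slabExit S.u V b s (b - s) n)})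
            fun ω hω => by simp only [Set.mem_ofPred_eq] at *; exact hω.le).trans (hmk.trans ?_)
          rw [ENNReal.div_eq_inv_mul, inv_inv]
          gcongr
          refine le_trans (measure_mono_ae ?_) (S.cone V z _ hL)
          filter_upwards [ae_start_annM S.hPq z] with f h0 hf
          obtain ⟨n, hn⟩ := Set.mem_iUnion.1 hf
          refine ⟨n, fun m hm => ?_, 0, Nat.zero_le _, ⟨0, hd⟩, ?_⟩
          · rcases hm.lt_or_eq with h1 | rfl
            · exact (hn.1 m h1).1
            · exact hn.2.1
          · have h1 := hn.2.2.2.2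
            have h2 := h.1
            rw [h0]
            have h3 : (lev S.u (f n) : ℝ) - lev S.u z < -((s : ℝ) - width S.u) := by
              have : lev S.u (f n) - lev S.u z < -((s : ℤ) - width S.u) := by omega
              exact_mod_cast this
            have h4 : 0 ≤ S.c * |(f n ⟨0, hd⟩ : ℝ) - z ⟨0, hd⟩| :=
              mul_nonneg S.c_pos.le (abs_nonneg _)
            linarith
        · simp [h]
    _ = _ := by
        rw [Finset.sum_const, nsmul_eq_mul]
        rw [show (3 : ℝ≥0∞) = ENNReal.ofReal 3 by simp, ← ENNReal.ofReal_natCast,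
          ← ENNReal.ofReal_mul (by norm_num), ← ENNReal.ofReal_mul (by positivity)]
        congr 1
        ring

open Classical in
/-- the number of indices in `I` whose event occurs. -/
def countIn {Ω : Type*} (I : Finset ℕ) (B : ℕ → Set Ω) (ω : Ω) : ℕ := (I.filter fun k => ω ∈ B k).card

lemma IsIID.count_le (h : IsIID P) (I : Finset ℕ) {Sl : ℕ → Set (Site d)} {B : ℕ → Set (Env d)}
    (hS : ∀ i ∈ I, ∀ j ∈ I, i ≠ j → Disjoint (Sl i) (Sl j))
    (hB : ∀ k, MeasurableSet (B k)) (hloc : ∀ k, LocalOn (Sl k) fun ω => ω ∈ B k)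
    {π : ℝ} (hπ : 0 ≤ π) (hp : ∀ k, P (B k) ≤ ENNReal.ofReal π) (z : ℕ) :
    P {ω | z ≤ countIn I B ω} ≤ ENNReal.ofReal (Real.exp (2 * π * I.card - z)) := by
  classical
  have := h.isProbabilityMeasure
  set g : ℕ → Env d → ℝ≥0∞ := fun k ω =>
    1 + (B k).indicator (fun _ => ENNReal.ofReal (Real.exp 1 - 1)) ω with hg
  have hgm : ∀ k, Measurable (g k) := fun k =>
    Measurable.const_add (measurable_const.indicator (hB k)) 1
  have hgl : ∀ k ∈ I, LocalOn (Sl k) (g k) := by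
    intro k _ ω ω' hω
    have := hloc k ω ω' hω
    simp only [eq_iff_iff] at this
    simp only [hg, Set.indicator_apply, this]
  have he : (1 : ℝ) ≤ Real.exp 1 := by simp
  have hprod : ∀ ω, ∏ k ∈ I, g k ω = ENNReal.ofReal (Real.exp 1) ^ countIn I B ω := by
    intro ω
    have h1 : ∀ k, g k ω = if ω ∈ B k then ENNReal.ofReal (Real.exp 1) else 1 := by
      intro k
      simp only [hg, Set.indicator_apply]
      split_ifs
      · rw [← ENNReal.ofReal_one, ← ENNReal.ofReal_add zero_le_one (by linarith)]
        congr 1; ring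
      · simp
    simp only [h1]
    rw [Finset.prod_ite]
    simp [countIn]
  have hInt := h.lintegral_prod I hS hgm hgl
  simp only [hprod] at hInt
  have hone : ∀ k, ∫⁻ ω, g k ω ∂P ≤ ENNReal.ofReal (Real.exp (2 * π)) := by
    intro k
    simp only [hg]
    rw [lintegral_add_left measurable_const, lintegral_indicator (hB k)]
    simp only [lintegral_const, measure_univ, mul_one, MeasurableSet.univ, Measure.restrict_apply,
      Set.univ_inter]
    calc _ ≤ 1 + ENNReal.ofReal (Real.exp 1 - 1) * ENNReal.ofReal π := by gcongr; exact hp k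
      _ = ENNReal.ofReal (1 + (Real.exp 1 - 1) * π) := by
        rw [← ENNReal.ofReal_mul (by linarith), ← ENNReal.ofReal_one,
          ← ENNReal.ofReal_add zero_le_one (mul_nonneg (by linarith) hπ)]
      _ ≤ _ := by
        apply ENNReal.ofReal_le_ofReal
        have h1 := Real.add_one_le_exp (2 * π)
        have h2 := Real.exp_one_lt_three
        nlinarith
  have hmk := mul_meas_ge_le_lintegral₀ (μ := P)
    (f := fun ω => ENNReal.ofReal (Real.exp 1) ^ countIn I B ω)
    (by simp only [← hprod]; exact (Finset.measurable_prod _ fun k _ => hgm k).aemeasurable)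
    (ENNReal.ofReal (Real.exp 1) ^ z)
  have hsub : {ω | z ≤ countIn I B ω} ⊆
      {ω | ENNReal.ofReal (Real.exp 1) ^ z ≤ ENNReal.ofReal (Real.exp 1) ^ countIn I B ω} := by
    intro ω hω
    exact pow_le_pow_right₀ (a := ENNReal.ofReal (Real.exp 1)) (by simp) hω
  have hfin : ENNReal.ofReal (Real.exp 1) ^ z * P {ω | z ≤ countIn I B ω} ≤
      ENNReal.ofReal (Real.exp (2 * π)) ^ I.card := by
    refine (mul_le_mul_right (measure_mono hsub) _).trans (hmk.trans ?_)
    rw [hInt]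
    exact Finset.prod_le_pow_card _ _ _ fun k _ => hone k
  rw [← ENNReal.ofReal_pow (Real.exp_pos _).le, ← ENNReal.ofReal_pow (Real.exp_pos _).le,
    ← Real.exp_nat_mul, ← Real.exp_nat_mul] at hfin
  have hz : ENNReal.ofReal (Real.exp (z * 1)) ≠ 0 := by simp [Real.exp_pos]
  calc _ = (ENNReal.ofReal (Real.exp (z * 1)))⁻¹ *
        (ENNReal.ofReal (Real.exp (z * 1)) * P {ω | z ≤ countIn I B ω}) := by
        rw [← mul_assoc, ENNReal.inv_mul_cancel hz ENNReal.ofReal_ne_top, one_mul]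
    _ ≤ (ENNReal.ofReal (Real.exp (z * 1)))⁻¹ * ENNReal.ofReal (Real.exp (I.card * (2 * π))) := by
        gcongr
    _ = _ := by
        rw [← ENNReal.ofReal_inv_of_pos (Real.exp_pos _), ← Real.exp_neg,
          ← ENNReal.ofReal_mul (Real.exp_pos _).le, ← Real.exp_add]
        congr 2; ring

end Bad

section Descend

variable {d : ℕ} {P : Measure (Env d)} {Pq : Env d → Site d → Measure (Path d)}

open Classical in
lemma Setup.descend_le_prod (S : Setup P Pq) {st : StepIdx d} (hst : 1 ≤ lev S.u (stepVec st))
    {ω : Env d} (hω : Ell S.η ω) (V : Finset (Site d)) {s : ℕ} (hws : width S.u < s) (m : ℕ)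
    {y : Site d} (hy : y ∈ V) :
    (Pq ω y).real (descend S.u V (lev S.u y) (lev S.u y - m * s)) ≤
      ∏ k ∈ Finset.range m, if ω ∈ badEnv Pq S.u V (lev S.u y - k * s) s then
        (S.η ^ s)⁻¹ else 1 / 2 := by
  set ℓ := lev S.u y with hℓ
  set A := descend S.u V ℓ (ℓ - m * s) with hA
  have hw1 : 1 ≤ width S.u := by
    have := (abs_le.1 (abs_lev_stepVec_le S.u st)).2
    omega
  have hηs : 0 < S.η ^ s := pow_pos S.η_pos s
  have hex := fun k : ℕ => exists_finset_sup {x | x ∈ V ∧ x ∈ layer S.u (ℓ + s - k * s)}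
    (V.finite_toSet.subset fun x hx => hx.1) fun x => (Pq ω x).real A
  choose g hg0 hgle hgmin using hex
  have hP := fun x => S.hPq.prob ω x
  have hH1 : ∀ x, (Pq ω x).real A ≤ 1 := fun x => measureReal_le_one
  have hgk : ∀ k : ℕ, ∀ x ∈ V, x ∈ layer S.u (ℓ + s - k * s) → Pq ω x A ≤ ENNReal.ofReal (g k) := by
    intro k x hx hxl
    rw [← ofReal_measureReal (measure_ne_top _ _)]
    exact ENNReal.ofReal_le_ofReal (hgle k x ⟨hx, hxl⟩)
  have hstart : (Pq ω y).real A ≤ g 1 := by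
    refine hgle 1 y ⟨hy, ?_⟩
    constructor <;> simp only [← hℓ] <;> push_cast <;> omega
  refine hstart.trans (increment_le_prod g _ m (fun k => ?_) ?_ hg0
    (fun k => hgmin k 1 zero_le_one fun x _ => hH1 x) fun k hk => ?_)
  · split_ifs
    · positivity
    · norm_num
  · refine le_antisymm (hgmin 0 0 le_rfl fun x hx => le_of_eq ?_) (hg0 0)
    rw [measureReal_eq_zero_iff]
    refine measure_mono_null ?_ (show Pq ω x {f | ¬ f 0 = x} = 0 from S.hPq.start ω x)
    rintro f ⟨t, hf, -⟩ h0
    have h1 := (hf 0 (Nat.zero_le _)).2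
    have h2 := hx.2.1
    rw [h0] at h1
    push_cast at h2
    omega
  · set b : ℤ := ℓ - k * s with hb
    have hr : ℓ - m * s ≤ b - s := by
      have : ((k : ℤ) + 1) * s ≤ m * s := by gcongr; exact_mod_cast hk
      rw [hb]; linarith
    have hH : ∀ z ∈ V, z ∈ layer S.u b → (Pq ω z).real A ≤
        g (k + 2) * (Pq ω z).real (⋃ n, slabExit S.u V b s (b - s) n) +
        g k * (1 - (Pq ω z).real (⋃ n, slabExit S.u V b s (b - s) n)) := by
      intro z hz hzl
      have h1 := S.hPq.descend_le ω hws.le hr hzl (V := V) (ℓ := ℓ)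
        (G₁ := ENNReal.ofReal (g (k + 2))) (G₂ := ENNReal.ofReal (g k))
        (fun x hx hxl => hgk (k + 2) x hx (by
          rw [show ℓ + s - ((k + 2 : ℕ) : ℤ) * s = b - s by rw [hb]; push_cast; ring]; exact hxl))
        (fun x hx hxl => hgk k x hx (by
          rw [show ℓ + s - (k : ℤ) * s = b + s by rw [hb]; ring]; exact hxl))
      have h2 := S.hPq.slabExit_add_le ω S.u V b hws z
      rw [← ofReal_measureReal (μ := Pq ω z) (s := ⋃ n, slabExit S.u V b s (b - s) n)
          (measure_ne_top _ _),
        ← ofReal_measureReal (μ := Pq ω z) (s := ⋃ n, slabExit S.u V b s (b + s) n)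
          (measure_ne_top _ _)] at h1 h2
      rw [← ENNReal.ofReal_add measureReal_nonneg measureReal_nonneg,
        ← ENNReal.ofReal_one, ENNReal.ofReal_le_ofReal_iff zero_le_one] at h2
      rw [← ENNReal.ofReal_mul (hg0 _), ← ENNReal.ofReal_mul (hg0 _),
        ← ENNReal.ofReal_add (mul_nonneg (hg0 _) measureReal_nonneg)
          (mul_nonneg (hg0 _) measureReal_nonneg),
        ← ofReal_measureReal (μ := Pq ω z) (measure_ne_top _ _),
        ENNReal.ofReal_le_ofReal_iff (add_nonneg (mul_nonneg (hg0 _) measureReal_nonneg)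
          (mul_nonneg (hg0 _) measureReal_nonneg))] at h1
      refine h1.trans ?_
      gcongr
      · exact hg0 k
      · linarith
    have hlayer : ∀ z, z ∈ layer S.u (ℓ + s - ((k + 1 : ℕ) : ℤ) * s) ↔ z ∈ layer S.u b := by
      intro z
      rw [show ℓ + s - ((k + 1 : ℕ) : ℤ) * s = b by rw [hb]; push_cast; ring]
    by_cases hle : g (k + 2) ≤ g k
    · left
      refine hgmin _ _ (hg0 _) fun z hz => ?_
      have hq0 : 0 ≤ (Pq ω z).real (⋃ n, slabExit S.u V b s (b - s) n) := measureReal_nonneg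
      have := hH z hz.1 ((hlayer z).1 hz.2)
      nlinarith
    push Not at hle
    have hQ : ∀ Q : ℝ, 0 ≤ Q → Q ≤ 1 → (∀ z ∈ V, z ∈ layer S.u b →
        (Pq ω z).real (⋃ n, slabExit S.u V b s (b - s) n) ≤ Q) →
        (1 - Q) * (g (k + 1) - g k) ≤ Q * (g (k + 2) - g (k + 1)) := by
      intro Q hQ0 hQ1 hz
      have : g (k + 1) ≤ g k + Q * (g (k + 2) - g k) := by
        refine hgmin _ _ (add_nonneg (hg0 _) (mul_nonneg hQ0 (by linarith))) fun z hz' => ?_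
        have h1 := hH z hz'.1 ((hlayer z).1 hz'.2)
        have h2 := hz z hz'.1 ((hlayer z).1 hz'.2)
        nlinarith
      linarith
    by_cases hx : g (k + 1) ≤ g k
    · exact Or.inl hx
    push Not at hx
    right
    split_ifs with hbad
    · have hη1 : S.η ^ s ≤ 1 := by
        have := S.slabExit_le hst hω V b hws (z := y)
        by_contra hcon
        push Not at hcon
        have h1 := S.hPq.straight_ge hω y st s
        rw [← ENNReal.ofReal_pow S.η_pos.le] at h1
        have h2 := h1.trans prob_le_one
        rw [ENNReal.ofReal_le_one] at h2
        linarith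
      have h1 := hQ (1 - S.η ^ s) (by linarith) (by linarith)
        fun z _ hzl => S.slabExit_le hst hω V b hws hzl
      rw [← div_eq_inv_mul, le_div_iff₀ hηs]
      have : 0 < g (k + 2) - g (k + 1) := by
        by_contra hcon
        push Not at hcon
        have : 0 < S.η ^ s * (g (k + 1) - g k) := mul_pos hηs (by linarith)
        have : (1 - S.η ^ s) * (g (k + 2) - g (k + 1)) ≤ 0 :=
          mul_nonpos_of_nonneg_of_nonpos (by linarith) hcon
        linarith
      nlinarith
    · have h1 := hQ (1 / 3) (by norm_num) (by norm_num) fun z hz hzl => ?_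
      · linarith
      · by_contra hcon
        push Not at hcon
        apply hbad
        simp only [badEnv, Set.mem_iUnion, Set.mem_ofPred_eq]
        refine ⟨z, hz, hzl, ?_⟩
        rw [← ofReal_measureReal (μ := Pq ω z) (measure_ne_top _ _),
          show (3 : ℝ≥0∞)⁻¹ = ENNReal.ofReal (1 / 3) by
            rw [one_div, ENNReal.ofReal_inv_of_pos (by norm_num)]; simp]
        exact (ENNReal.ofReal_lt_ofReal_iff (by linarith)).2 hcon

lemma disjoint_slab (u : Fin d → ℤ) (ℓ : ℤ) (s : ℕ) (i j : ℕ) (hij : i + 2 ≤ j) :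
    Disjoint (slab u (ℓ - i * s) s) (slab u (ℓ - j * s) s) := by
  rw [Set.disjoint_left]
  rintro z ⟨h1, -⟩ ⟨-, h2⟩
  have h3 : ((i : ℤ) + 2) * s ≤ j * s := by gcongr; exact_mod_cast hij
  have h4 : (0 : ℤ) ≤ width u := by positivity
  linarith

lemma Setup.annM_descend_le (hd : 0 < d) (S : Setup P Pq) (V : Finset (Site d)) {s : ℕ}
    (hws : width S.u < s) (m z : ℕ) {y : Site d} (hy : y ∈ V) {π : ℝ} (hπ : π =
      3 * S.C * (V.card : ℝ) ^ 2 * Real.exp (-(S.a * ((s : ℝ) - width S.u) ^ S.γ))) :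
    annM P Pq y (descend S.u V (lev S.u y) (lev S.u y - m * s)) ≤ ENNReal.ofReal
      ((1 / 2) ^ m * (2 * (S.η ^ s)⁻¹) ^ (2 * z) + 2 * Real.exp (2 * π * m - z)) := by
  classical
  have := S.prob
  obtain ⟨st, hst⟩ := S.exists_upStep hd
  have hηs : 0 < S.η ^ s := pow_pos S.η_pos s
  have hπ0 : 0 ≤ π := by rw [hπ]; have := S.C_pos; positivity
  set B : ℕ → Set (Env d) := fun k => badEnv Pq S.u V (lev S.u y - k * s) s with hB
  set I : ℕ → Finset ℕ := fun p => (Finset.range m).filter fun k => k % 2 = p with hI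
  have hIcard : ∀ p, (I p).card ≤ m := fun p => (Finset.card_filter_le _ _).trans (by simp)
  have hcount : ∀ p, P {ω | z ≤ countIn (I p) B ω} ≤ ENNReal.ofReal (Real.exp (2 * π * m - z)) := by
    intro p
    refine (S.iid.count_le (I p) (Sl := fun k => slab S.u (lev S.u y - k * s) s) ?_
      (fun k => measurableSet_badEnv S.hPq _ _ _ _) (fun k => S.hPq.local_badEnv _ _ _ _) hπ0
      (fun k => by rw [hπ]; exact S.badEnv_le hd V _ hws) z).trans ?_
    · intro i hi j hj hij
      simp only [hI, Finset.mem_filter] at hi hj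
      rcases lt_or_gt_of_ne hij with h | h
      · exact disjoint_slab _ _ _ _ _ (by omega)
      · exact (disjoint_slab _ _ _ _ _ (by omega)).symm
    · gcongr
      exact_mod_cast hIcard p
  set E : Set (Env d) := {ω | z ≤ countIn (I 0) B ω} ∪ {ω | z ≤ countIn (I 1) B ω} with hE
  have hPE : P E ≤ ENNReal.ofReal (2 * Real.exp (2 * π * m - z)) := by
    refine (measure_union_le _ _).trans ((add_le_add (hcount 0) (hcount 1)).trans (le_of_eq ?_))
    rw [← ENNReal.ofReal_add (Real.exp_pos _).le (Real.exp_pos _).le]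
    congr 1; ring
  have hq : ∀ ω, Ell S.η ω → Pq ω y (descend S.u V (lev S.u y) (lev S.u y - m * s)) ≤
      ENNReal.ofReal ((1 / 2) ^ m * (2 * (S.η ^ s)⁻¹) ^ (2 * z)) + (toMeasurable P E).indicator 1 ω := by
    intro ω hω
    have := S.hPq.prob ω y
    by_cases hωE : ω ∈ toMeasurable P E
    · rw [Set.indicator_of_mem hωE]
      exact prob_le_one.trans le_add_self
    · have hωE' : ω ∉ E := fun h => hωE (subset_toMeasurable P E h)
      rw [Set.indicator_of_notMem hωE, add_zero, ← ofReal_measureReal (measure_ne_top _ _)]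
      apply ENNReal.ofReal_le_ofReal
      refine (S.descend_le_prod hst hω V hws m hy).trans ?_
      simp only [hE, Set.mem_union, Set.mem_ofPred_eq, not_or, not_le] at hωE'
      have hη1 : S.η ^ s ≤ 1 := by
        have h1 := S.hPq.straight_ge hω y st s
        rw [← ENNReal.ofReal_pow S.η_pos.le] at h1
        have h2 := h1.trans prob_le_one
        rwa [ENNReal.ofReal_le_one] at h2
      have h2 : 1 ≤ 2 * (S.η ^ s)⁻¹ := by
        have := (one_le_inv₀ hηs).2 hη1
        linarith
      have hcnt : countIn (Finset.range m) B ω ≤ 2 * z := by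
        have : (Finset.range m).filter (fun k => ω ∈ B k) ⊆
            (I 0).filter (fun k => ω ∈ B k) ∪ (I 1).filter (fun k => ω ∈ B k) := by
          intro k hk
          simp only [hI, Finset.mem_union, Finset.mem_filter] at *
          have : k % 2 = 0 ∨ k % 2 = 1 := by omega
          tauto
        have h3 := (Finset.card_le_card this).trans (Finset.card_union_le _ _)
        simp only [countIn] at hωE' ⊢
        omega
      calc _ = ∏ k ∈ Finset.range m, (1 / 2) * (if ω ∈ B k then 2 * (S.η ^ s)⁻¹ else 1) := by
            refine Finset.prod_congr rfl fun k _ => ?_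
            simp only [hB]
            split_ifs <;> ring
        _ = (1 / 2) ^ m * (2 * (S.η ^ s)⁻¹) ^ countIn (Finset.range m) B ω := by
            rw [Finset.prod_mul_distrib, Finset.prod_ite]
            simp [countIn]
        _ ≤ _ := by gcongr
  rw [annM_apply S.hPq y (measurableSet_descend _ _ _ _)]
  calc _ ≤ ∫⁻ ω, (ENNReal.ofReal ((1 / 2) ^ m * (2 * (S.η ^ s)⁻¹) ^ (2 * z)) +
        (toMeasurable P E).indicator 1 ω) ∂P := by
        refine lintegral_mono_ae ?_
        filter_upwards [S.ell] with ω hω using hq ω hω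
    _ = ENNReal.ofReal ((1 / 2) ^ m * (2 * (S.η ^ s)⁻¹) ^ (2 * z)) + P E := by
        rw [lintegral_add_left measurable_const,
          lintegral_indicator_one (measurableSet_toMeasurable _ _), measure_toMeasurable]
        simp
    _ ≤ _ := by
        rw [ENNReal.ofReal_add (by positivity) (by positivity)]
        gcongr

/-- inside `V`, the level of the path falls by at least `R`. -/
def levDrop (u : Fin d → ℤ) (V : Finset (Site d)) (R : ℤ) : Set (Path d) :=
  {f | ∃ t, (∀ i ≤ t, f i ∈ V) ∧ ∃ j ≤ t, lev u (f t) ≤ lev u (f j) - R}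

lemma measurableSet_levDrop (u : Fin d → ℤ) (V : Finset (Site d)) (R : ℤ) :
    MeasurableSet (levDrop u V R) := by
  have : levDrop u V R =
      ⋃ t, {f | (∀ i ≤ t, f i ∈ V) ∧ ∃ j ≤ t, lev u (f t) ≤ lev u (f j) - R} := by
    ext f; simp [levDrop]
  rw [this]
  refine MeasurableSet.iUnion fun n => UpTo.measurableSet (n := n) fun f g h hf => ?_
  obtain ⟨h1, j, hj, h2⟩ := hf
  refine ⟨fun i hi => by rw [← h i hi]; exact h1 i hi, j, hj, ?_⟩
  rw [← h n le_rfl, ← h j hj]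
  exact h2

lemma levDrop_subset (u : Fin d → ℤ) (V : Finset (Site d)) (R : ℤ) :
    levDrop u V R ⊆ ⋃ y ∈ V, ⋃ n, firstHit {y} n ∩
      after n ⁻¹' descend u V (lev u y) (lev u y - R) := by
  rintro f ⟨n, hV, j, hj, hdrop⟩
  obtain ⟨t, ht, hmax, hfirst⟩ := exists_first_argmax (fun x => (lev u x : ℝ)) f n
  simp only [Int.cast_le] at hmax
  simp only [Set.mem_iUnion]
  refine ⟨f t, hV t ht, t, ⟨rfl, fun m hm => hfirst m hm⟩, n - t,
    fun i hi => ⟨hV _ (by omega), hmax _ (by omega)⟩, ?_⟩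
  simp only [after_apply]
  rw [show t + (n - t) = n by omega]
  linarith [hmax j hj]

lemma annM_levDrop_le (hPq : IsQuenchedFamily Pq) (x : Site d) (u : Fin d → ℤ)
    (V : Finset (Site d)) (R : ℤ) (b : ℝ≥0∞)
    (hb : ∀ y ∈ V, annM P Pq y (descend u V (lev u y) (lev u y - R)) ≤ b) :
    annM P Pq x (levDrop u V R) ≤ V.card * b := by
  calc _ ≤ _ := measure_mono (levDrop_subset u V R)
    _ ≤ ∑ y ∈ V, annM P Pq x (⋃ n, firstHit {y} n ∩
          after n ⁻¹' descend u V (lev u y) (lev u y - R)) := measure_biUnion_finset_le _ _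
    _ ≤ ∑ y ∈ V, b := Finset.sum_le_sum fun y hy =>
        (annM_firstHit_le hPq x y (measurableSet_descend _ _ _ _)).trans (hb y hy)
    _ = _ := by simp

lemma card_box_le (d A q : ℕ) (hq : 1 ≤ q) :
    ((box d (q ^ A)).card : ℝ) ≤ 3 ^ d * (q : ℝ) ^ (A * d) := by
  rw [card_box, pow_mul, ← mul_pow]
  push_cast
  have : (1 : ℝ) ≤ (q : ℝ) ^ A := one_le_pow₀ (by exact_mod_cast hq)
  gcongr
  linarith

lemma Setup.exists_levDrop_bound (hd : 0 < d) (S : Setup P Pq) (A : ℕ) :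
    ∃ q₀ : ℕ, ∀ q ≥ q₀, ∀ x, annM P Pq x (levDrop S.u (box d (q ^ A)) ((q : ℤ) ^ 24)) ≤
      ENNReal.ofReal (Real.exp (-(q : ℝ) ^ 21)) := by
  set p := 2 * (A * d) + 24 with hp
  obtain ⟨K, hK, hKb⟩ := exists_exp_le_pow S.a_pos S.γ_pos p
  set lam := |Real.log S.η| with hlam
  have hlam0 : 0 ≤ lam := abs_nonneg _
  have hC := S.C_pos
  set M₁ : ℝ := 2 * (3 * S.C * (3 ^ d) ^ 2 * (K * 2 ^ p)) with hM₁
  have hpoly : ∀ᶠ q : ℕ in atTop, (3 : ℝ) ^ d * (q : ℝ) ^ (A * d) ≤ Real.exp q := by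
    have h1 := ((Real.isLittleO_pow_exp_atTop (n := A * d)).const_mul_left ((3 : ℝ) ^ d)).comp_tendsto
      tendsto_natCast_atTop_atTop
    filter_upwards [h1.bound zero_lt_one] with q hq
    simp only [Function.comp_apply, Real.norm_eq_abs, one_mul, Real.abs_exp] at hq
    exact (le_abs_self _).trans hq
  have hlarge : ∀ r : ℝ, ∀ᶠ q : ℕ in atTop, r ≤ q := fun r =>
    tendsto_natCast_atTop_atTop.eventually_ge_atTop r
  have hev := hpoly.and ((hlarge (2 * width S.u + 4)).and ((hlarge M₁).and
    (hlarge (8 * (1 + lam) + 4))))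
  obtain ⟨q₀, hq₀⟩ := eventually_atTop.1 hev
  refine ⟨q₀, fun q hq x => ?_⟩
  obtain ⟨h1, h2, h3, h4⟩ := hq₀ q hq
  have hw0 : (0 : ℝ) ≤ width S.u := by positivity
  have hq4 : (4 : ℝ) ≤ q := by linarith
  have hq1 : 1 ≤ q := by
    have : (1 : ℝ) ≤ q := by linarith
    exact_mod_cast this
  have hws : width S.u < q := by
    have : (width S.u : ℝ) < q := by linarith
    exact_mod_cast this
  set V := box d (q ^ A) with hV
  have hcard : (V.card : ℝ) ≤ 3 ^ d * (q : ℝ) ^ (A * d) := card_box_le d A q hq1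
  set π := 3 * S.C * (V.card : ℝ) ^ 2 * Real.exp (-(S.a * ((q : ℝ) - width S.u) ^ S.γ)) with hπ
  have hπle : 2 * π * (q : ℝ) ^ 23 ≤ 1 := by
    have e1 : Real.exp (-(S.a * ((q : ℝ) - width S.u) ^ S.γ)) ≤ K * 2 ^ p / (q : ℝ) ^ p := by
      refine (hKb _ (by linarith)).trans ?_
      have : ((q : ℝ) / 2) ^ p ≤ ((q : ℝ) - width S.u) ^ p := by
        gcongr; linarith
      calc K / ((q : ℝ) - width S.u) ^ p ≤ K / ((q : ℝ) / 2) ^ p := by gcongr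
        _ = _ := by rw [div_pow]; field_simp
    have e2 : π ≤ 3 * S.C * (3 ^ d * (q : ℝ) ^ (A * d)) ^ 2 * (K * 2 ^ p / (q : ℝ) ^ p) := by
      rw [hπ]; gcongr
    calc 2 * π * (q : ℝ) ^ 23 ≤
        2 * (3 * S.C * (3 ^ d * (q : ℝ) ^ (A * d)) ^ 2 * (K * 2 ^ p / (q : ℝ) ^ p)) * (q : ℝ) ^ 23 := by
          gcongr
      _ = M₁ / q := by
          have : (q : ℝ) ^ p = ((q : ℝ) ^ (A * d)) ^ 2 * (q : ℝ) ^ 23 * q := by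
            rw [hp]; ring
          rw [this, hM₁]
          have : (q : ℝ) ≠ 0 := by positivity
          field_simp
      _ ≤ 1 := by rw [div_le_one (by positivity)]; exact h3
  have hdesc : ∀ y ∈ V, annM P Pq y (descend S.u V (lev S.u y) (lev S.u y - (q : ℤ) ^ 24)) ≤
      ENNReal.ofReal ((1 / 2) ^ (q ^ 23) * (2 * (S.η ^ q)⁻¹) ^ (2 * (2 * q ^ 21)) +
        2 * Real.exp (2 * π * (q ^ 23 : ℕ) - (2 * q ^ 21 : ℕ))) := by
    intro y hy
    have := S.annM_descend_le hd V hws (q ^ 23) (2 * q ^ 21) hy hπ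
    rwa [show ((q ^ 23 : ℕ) : ℤ) * q = (q : ℤ) ^ 24 by push_cast; ring] at this
  refine (annM_levDrop_le S.hPq x S.u V _ _ hdesc).trans ?_
  rw [← ENNReal.ofReal_natCast, ← ENNReal.ofReal_mul (by positivity)]
  apply ENNReal.ofReal_le_ofReal
  have b1 : (1 / 2 : ℝ) ^ (q ^ 23) ≤ Real.exp (-((q : ℝ) ^ 23 / 2)) := by
    have : (1 / 2 : ℝ) ≤ Real.exp (-(1 / 2)) := by
      have := Real.add_one_le_exp (-(1 / 2) : ℝ)
      linarith
    calc (1 / 2 : ℝ) ^ (q ^ 23) ≤ Real.exp (-(1 / 2)) ^ (q ^ 23) := by gcongr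
      _ = _ := by rw [← Real.exp_nat_mul]; congr 1; push_cast; ring
  have b2 : (2 * (S.η ^ q)⁻¹) ^ (2 * (2 * q ^ 21)) ≤ Real.exp (4 * q ^ 21 * (1 + q * lam)) := by
    have e1 : (2 : ℝ) ≤ Real.exp 1 := by
      have := Real.add_one_le_exp (1 : ℝ)
      linarith
    have e2 : (S.η ^ q)⁻¹ ≤ Real.exp (q * lam) := by
      rw [← Real.exp_log S.η_pos, ← Real.exp_nat_mul, ← Real.exp_neg]
      apply Real.exp_le_exp.2
      have := neg_abs_le (Real.log S.η)
      have hq0 : (0 : ℝ) ≤ q := by positivity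
      nlinarith
    have hηi : 0 ≤ (S.η ^ q)⁻¹ := by have := S.η_pos; positivity
    calc (2 * (S.η ^ q)⁻¹) ^ (2 * (2 * q ^ 21)) ≤ (Real.exp 1 * Real.exp (q * lam)) ^ (2 * (2 * q ^ 21)) := by
          gcongr
      _ = _ := by rw [← Real.exp_add, ← Real.exp_nat_mul]; congr 1; push_cast; ring
  have b3 : (1 / 2 : ℝ) ^ (q ^ 23) * (2 * (S.η ^ q)⁻¹) ^ (2 * (2 * q ^ 21)) ≤
      Real.exp (-(2 * (q : ℝ) ^ 21)) := by
    have hηi : 0 ≤ (S.η ^ q)⁻¹ := by have := S.η_pos; positivity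
    calc _ ≤ Real.exp (-((q : ℝ) ^ 23 / 2)) * Real.exp (4 * q ^ 21 * (1 + q * lam)) := by gcongr
      _ ≤ _ := by
        rw [← Real.exp_add]
        apply Real.exp_le_exp.2
        have hq1' : (1 : ℝ) ≤ q := by linarith
        have : (0 : ℝ) ≤ (q : ℝ) ^ 21 * ((q : ℝ) ^ 2 / 2 - 4 * (1 + q * lam) - 2) := by
          apply mul_nonneg (by positivity)
          nlinarith
        linarith [this]
  have b4 : 2 * Real.exp (2 * π * (q ^ 23 : ℕ) - (2 * q ^ 21 : ℕ)) ≤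
      2 * (Real.exp 1 * Real.exp (-(2 * (q : ℝ) ^ 21))) := by
    rw [← Real.exp_add]
    gcongr
    push_cast
    linarith
  have e3 := Real.exp_one_lt_three
  have hpow : (q : ℝ) + 2 ≤ (q : ℝ) ^ 21 := by
    calc (q : ℝ) + 2 ≤ (q : ℝ) ^ 2 := by nlinarith
      _ ≤ (q : ℝ) ^ 21 := pow_le_pow_right₀ (by linarith) (by norm_num)
  have e7 : (7 : ℝ) ≤ Real.exp 2 := by
    have h := Real.exp_one_gt_d9
    have : Real.exp 2 = Real.exp 1 * Real.exp 1 := by rw [← Real.exp_add]; norm_num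
    rw [this]
    nlinarith
  have hpos : 0 < Real.exp (-(2 * (q : ℝ) ^ 21)) := Real.exp_pos _
  calc _ ≤ Real.exp q * (Real.exp 2 * Real.exp (-(2 * (q : ℝ) ^ 21))) := by
        have hηi := S.η_pos
        gcongr
        · exact hcard.trans h1
        · nlinarith
    _ ≤ _ := by
        rw [← Real.exp_add, ← Real.exp_add]
        apply Real.exp_le_exp.2
        linarith

end Descend

section Occupation

variable {d : ℕ} {P : Measure (Env d)} {Pq : Env d → Site d → Measure (Path d)}

/-- the path leaves `V` without returning to `x` after time `0`. -/
def escape (V : Finset (Site d)) (x : Site d) : Set (Path d) :=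
  {f | ∃ t, f t ∉ V ∧ ∀ i, 0 < i → i ≤ t → f i ≠ x}

/-- the path stays in `V` up to time `M`. -/
def stayTill (V : Finset (Site d)) (M : ℕ) : Set (Path d) := {f | ∀ i ≤ M, f i ∈ V}

lemma measurableSet_escape (V : Finset (Site d)) (x : Site d) : MeasurableSet (escape V x) := by
  have : escape V x = ⋃ t, {f | f t ∉ V ∧ ∀ i, 0 < i → i ≤ t → f i ≠ x} := by
    ext f; simp [escape]
  rw [this]
  refine MeasurableSet.iUnion fun n => UpTo.measurableSet (n := n) fun f g h hf => ?_
  simp only [Set.mem_ofPred_eq] at *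
  rw [← h n le_rfl]
  exact ⟨hf.1, fun i hi hin => by rw [← h i hin]; exact hf.2 i hi hin⟩

lemma upTo_stayTill (V : Finset (Site d)) (M : ℕ) : UpTo M (stayTill V M) := by
  intro f g h hf i hi
  rw [← h i hi]
  exact hf i hi

lemma stayTill_anti (V : Finset (Site d)) {M M' : ℕ} (h : M ≤ M') :
    stayTill V M' ⊆ stayTill V M := fun _ hf i hi => hf i (hi.trans h)

lemma IsQuenchedFamily.occupation_le (hPq : IsQuenchedFamily Pq) {ω : Env d}
    {V : Finset (Site d)} {e : ℝ≥0∞} (he : ∀ x ∈ V, e ≤ Pq ω x (escape V x)) (y : Site d)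
    (M : ℕ) : ((M + 1 : ℕ) : ℝ≥0∞) * (e * Pq ω y (stayTill V M)) ≤ V.card := by
  have := hPq.prob ω y
  set B : ℕ → Site d → Set (Path d) := fun t x => {f | f ∈ stayTill V t ∧ f t = x} with hB
  have hup : ∀ t x, UpTo t (B t x) := by
    intro t x f g h hf
    refine ⟨upTo_stayTill V t f g h hf.1, ?_⟩
    rw [← h t le_rfl]
    exact hf.2
  have hmark : ∀ t, ∀ x ∈ V, e * Pq ω y (B t x) ≤
      Pq ω y (B t x ∩ after t ⁻¹' escape V x) := by
    intro t x hx
    refine hPq.le_markov ω y (hup t x) (measurableSet_escape V x) fun f hf => ?_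
    rw [hf.2]
    exact he x hx
  have hdisj : ∀ x, Pairwise (Function.onFun Disjoint
      fun t => B t x ∩ after t ⁻¹' escape V x) := by
    intro x
    have key : ∀ t t', t < t' → ∀ f, f ∈ B t x → after t f ∈ escape V x → f ∉ B t' x := by
      rintro t t' htt f hf ⟨s, hs, hs'⟩ hf'
      have hlt : t' < t + s := by
        by_contra hcon
        exact hs (hf'.1 _ (by omega))
      refine hs' (t' - t) (by omega) (by omega) ?_
      simp only [after_apply]
      rw [show t + (t' - t) = t' by omega]
      exact hf'.2
    intro t t' htt
    rw [Function.onFun, Set.disjoint_left]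
    rintro f ⟨h1, h2⟩ ⟨h3, h4⟩
    rcases lt_or_gt_of_ne htt with h | h
    · exact key t t' h f h1 h2 h3
    · exact key t' t h f h3 h4 h1
  have hone : ∀ x ∈ V, ∑ t ∈ Finset.range (M + 1), e * Pq ω y (B t x) ≤ 1 := by
    intro x hx
    calc _ ≤ ∑ t ∈ Finset.range (M + 1), Pq ω y (B t x ∩ after t ⁻¹' escape V x) :=
          Finset.sum_le_sum fun t _ => hmark t x hx
      _ = Pq ω y (⋃ t ∈ Finset.range (M + 1), B t x ∩ after t ⁻¹' escape V x) := by
          rw [measure_biUnion_finset]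
          · exact fun i _ j _ hij => hdisj x hij
          · exact fun t _ => (hup t x).measurableSet.inter
              (measurable_after t (measurableSet_escape V x))
      _ ≤ 1 := prob_le_one
  have hcov : ∀ t ∈ Finset.range (M + 1), e * Pq ω y (stayTill V M) ≤
      ∑ x ∈ V, e * Pq ω y (B t x) := by
    intro t ht
    rw [← Finset.mul_sum]
    gcongr
    refine (measure_mono (fun f hf => ?_)).trans (measure_biUnion_finset_le V fun x => B t x)
    have htM : t ≤ M := by simpa [Nat.lt_succ_iff] using ht
    simp only [Set.mem_iUnion]
    exact ⟨f t, hf t htM, stayTill_anti V htM hf, rfl⟩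
  calc ((M + 1 : ℕ) : ℝ≥0∞) * (e * Pq ω y (stayTill V M)) =
        ∑ t ∈ Finset.range (M + 1), e * Pq ω y (stayTill V M) := by simp
    _ ≤ ∑ t ∈ Finset.range (M + 1), ∑ x ∈ V, e * Pq ω y (B t x) := Finset.sum_le_sum hcov
    _ = ∑ x ∈ V, ∑ t ∈ Finset.range (M + 1), e * Pq ω y (B t x) := Finset.sum_comm
    _ ≤ ∑ x ∈ V, 1 := Finset.sum_le_sum hone
    _ = V.card := by simp

lemma IsQuenchedFamily.stayTill_pow_le (hPq : IsQuenchedFamily Pq) {ω : Env d}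
    {V : Finset (Site d)} {M : ℕ} {δ : ℝ≥0∞} (h : ∀ y, Pq ω y (stayTill V M) ≤ δ) (y : Site d)
    (j : ℕ) : Pq ω y (stayTill V (j * M)) ≤ δ ^ j := by
  induction j with
  | zero => have := hPq.prob ω y; simpa using prob_le_one
  | succ j ih =>
    have hsub : stayTill V ((j + 1) * M) ⊆
        stayTill V (j * M) ∩ after (j * M) ⁻¹' stayTill V M := by
      intro f hf
      refine ⟨stayTill_anti V (by nlinarith) hf, fun i hi => ?_⟩
      simp only [after_apply]
      exact hf _ (by nlinarith)
    calc _ ≤ _ := measure_mono hsub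
      _ ≤ δ * Pq ω y (stayTill V (j * M)) := hPq.markov_le ω y (upTo_stayTill V _)
          (upTo_stayTill V M).measurableSet fun f _ => h (f (j * M))
      _ ≤ δ * δ ^ j := by gcongr
      _ = _ := by rw [pow_succ, mul_comm]

end Occupation

section Avoid

variable {d : ℕ} {P : Measure (Env d)} {Pq : Env d → Site d → Measure (Path d)}

/-- the path leaves `V` without visiting `x`. -/
def avoid (V : Finset (Site d)) (x : Site d) : Set (Path d) :=
  {f | ∃ t, f t ∉ V ∧ ∀ i ≤ t, f i ≠ x}

lemma measurableSet_avoid (V : Finset (Site d)) (x : Site d) : MeasurableSet (avoid V x) := by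
  have : avoid V x = ⋃ t, {f | f t ∉ V ∧ ∀ i ≤ t, f i ≠ x} := by
    ext f; simp [avoid]
  rw [this]
  refine MeasurableSet.iUnion fun n => UpTo.measurableSet (n := n) fun f g h hf => ?_
  simp only [Set.mem_ofPred_eq] at *
  rw [← h n le_rfl]
  exact ⟨hf.1, fun i hin => by rw [← h i hin]; exact hf.2 i hin⟩

/-- one step, made with probability at least `η`, followed by an event. -/
lemma IsQuenchedFamily.step_ge (hPq : IsQuenchedFamily Pq) {η : ℝ} {ω : Env d} (hω : Ell η ω)
    (z : Site d) (s : StepIdx d) {A : Set (Path d)} (hA : MeasurableSet A) :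
    ENNReal.ofReal η * Pq ω (z + stepVec s) A ≤
      Pq ω z {f | f 0 = z ∧ f 1 = z + stepVec s ∧ after 1 f ∈ A} := by
  set γ : ℕ → Site d := fun i => if i = 0 then z else z + stepVec s with hγ
  have hc : ENNReal.ofReal η ^ 1 ≤ Pq ω z (cyl 1 γ) := by
    refine hPq.cyl_ge hω z 1 γ (by simp [hγ]) ?_
    intro i hi
    have : i = 0 := by omega
    subst this
    exact ⟨s, by simp [hγ]⟩
  rw [pow_one] at hc
  calc _ ≤ Pq ω (z + stepVec s) A * Pq ω z (cyl 1 γ) := by rw [mul_comm]; gcongr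
    _ ≤ Pq ω z (cyl 1 γ ∩ after 1 ⁻¹' A) := by
        refine hPq.le_markov ω z (upTo_cyl 1 γ) hA fun f hf => ?_
        rw [hf 1 le_rfl]
        simp [hγ]
    _ ≤ _ := by
        refine measure_mono fun f hf => ⟨?_, ?_, hf.2⟩
        · simpa [hγ] using hf.1 0 (by omega)
        · simpa [hγ] using hf.1 1 le_rfl

lemma IsQuenchedFamily.avoid_step (hPq : IsQuenchedFamily Pq) {η : ℝ} {ω : Env d} (hω : Ell η ω)
    (V : Finset (Site d)) (x z : Site d) (hz : z ≠ x) (s : StepIdx d) :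
    ENNReal.ofReal η * Pq ω (z + stepVec s) (avoid V x) ≤ Pq ω z (avoid V x) := by
  refine (hPq.step_ge hω z s (measurableSet_avoid V x)).trans (measure_mono ?_)
  rintro f ⟨h0, h1, t, ht, hi⟩
  refine ⟨1 + t, ht, fun i hit => ?_⟩
  rcases Nat.eq_zero_or_pos i with rfl | hpos
  · rwa [h0]
  · have := hi (i - 1) (by omega)
    simp only [after_apply] at this
    rwa [show 1 + (i - 1) = i by omega] at this

lemma IsQuenchedFamily.escape_step (hPq : IsQuenchedFamily Pq) {η : ℝ} {ω : Env d} (hω : Ell η ω)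
    (V : Finset (Site d)) (x : Site d) (s : StepIdx d) :
    ENNReal.ofReal η * Pq ω (x + stepVec s) (avoid V x) ≤ Pq ω x (escape V x) := by
  refine (hPq.step_ge hω x s (measurableSet_avoid V x)).trans (measure_mono ?_)
  rintro f ⟨h0, h1, t, ht, hi⟩
  refine ⟨1 + t, ht, fun i hpos hit => ?_⟩
  have := hi (i - 1) (by omega)
  simp only [after_apply] at this
  rwa [show 1 + (i - 1) = i by omega] at this

/-- a walk starting above the level of `x` can be steered upwards while avoiding `x`. -/
lemma IsQuenchedFamily.avoid_steer (hPq : IsQuenchedFamily Pq) {η : ℝ} {ω : Env d}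
    (hω : Ell η ω) (V : Finset (Site d)) (x : Site d) (u : Fin d → ℤ) (n : ℕ) :
    ∀ z v : Site d, lev u x < lev u z → (∀ i, 0 ≤ u i * v i) → ∑ i, (v i).natAbs = n →
      ENNReal.ofReal η ^ n * Pq ω (z + v) (avoid V x) ≤ Pq ω z (avoid V x) := by
  induction n with
  | zero =>
    intro z v _ _ hn
    have : v = 0 := by
      ext i
      simpa using (Finset.sum_eq_zero_iff.1 hn) i (Finset.mem_univ i)
    simp [this]
  | succ n ih =>
    intro z v hz huv hn
    obtain ⟨i, hi⟩ : ∃ i, v i ≠ 0 := by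
      by_contra hcon
      push Not at hcon
      simp [hcon] at hn
    obtain ⟨s, hs1, hs⟩ : ∃ s : StepIdx d, s.1 = i ∧ stepVec s i = (v i).sign := by
      rcases lt_or_gt_of_ne hi with h | h
      · exact ⟨(i, false), rfl, by simp [stepVec, Int.sign_eq_neg_one_of_neg h]⟩
      · exact ⟨(i, true), rfl, by simp [stepVec, Int.sign_eq_one_of_pos h]⟩
    have hoff : ∀ j, j ≠ i → stepVec s j = 0 := by
      intro j hj
      simp [stepVec, hs1, hj]
    have hzx : z ≠ x := by
      rintro rfl
      exact lt_irrefl _ hz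
    have hsgn : 0 ≤ u i * (v i).sign := by
      have := huv i
      rcases lt_or_gt_of_ne hi with h | h
      · rw [Int.sign_eq_neg_one_of_neg h]; nlinarith
      · rw [Int.sign_eq_one_of_pos h]; nlinarith
    have hlev : lev u (stepVec s) = u i * (v i).sign := by
      rw [lev, Finset.sum_eq_single i, hs]
      · intro j _ hj; rw [hoff j hj, mul_zero]
      · simp
    have hrec := ih (z + stepVec s) (v - stepVec s) (by rw [lev_add, hlev]; linarith) (by
        intro j
        by_cases hj : j = i
        · subst hj
          simp only [Pi.sub_apply, hs]
          have := huv j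
          rcases lt_or_gt_of_ne hi with h | h
          · rw [Int.sign_eq_neg_one_of_neg h]
            have : u j ≤ 0 := by nlinarith
            nlinarith
          · rw [Int.sign_eq_one_of_pos h]
            have : 0 ≤ u j := by nlinarith
            nlinarith
        · simpa [hoff j hj] using huv j) (by
        rw [← Finset.add_sum_erase _ _ (Finset.mem_univ i)] at hn ⊢
        have h1 : ∑ j ∈ Finset.univ.erase i, ((v - stepVec s) j).natAbs =
            ∑ j ∈ Finset.univ.erase i, (v j).natAbs := by
          refine Finset.sum_congr rfl fun j hj => ?_
          simp [hoff j (Finset.ne_of_mem_erase hj)]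
        have h2 : ((v - stepVec s) i).natAbs + 1 = (v i).natAbs := by
          simp only [Pi.sub_apply, hs]
          rcases lt_or_gt_of_ne hi with h | h
          · rw [Int.sign_eq_neg_one_of_neg h]; omega
          · rw [Int.sign_eq_one_of_pos h]; omega
        omega)
    rw [show z + stepVec s + (v - stepVec s) = z + v by abel] at hrec
    calc _ = ENNReal.ofReal η * (ENNReal.ofReal η ^ n * Pq ω (z + v) (avoid V x)) := by
          rw [pow_succ]; ring
      _ ≤ ENNReal.ofReal η * Pq ω (z + stepVec s) (avoid V x) := by gcongr
      _ ≤ _ := hPq.avoid_step hω V x z hzx s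

/-- a walk far above `x` leaves `V` without visiting `x`, unless its level drops a lot. -/
lemma IsQuenchedFamily.avoid_ge_half (hd : 0 < d) (hPq : IsQuenchedFamily Pq) {η : ℝ}
    (hη : 0 < η) {ω : Env d} (hω : Ell η ω) (r : ℕ) (u : Fin d → ℤ) (R : ℤ) (x v : Site d)
    (hx : x ∈ box d r) (hR : 0 ≤ R) (hxv : lev u x + R < lev u v)
    (hdrop : v ∈ box d r → Pq ω v (levDrop u (box d r) R) ≤ 1 / 2) :
    1 / 2 ≤ Pq ω v (avoid (box d r) x) := by
  have := hPq.prob ω v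
  by_cases hv : v ∈ box d r
  swap
  · have h1 : Pq ω v (avoid (box d r) x)ᶜ = 0 := by
      refine measure_mono_null (t := {f | ¬ f 0 = v}) ?_ (hPq.start ω v)
      intro f hf h0
      refine hf ⟨0, by rwa [h0], fun i hi => ?_⟩
      rw [Nat.le_zero.1 hi, h0]
      rintro rfl
      linarith
    rw [(prob_compl_eq_zero_iff (measurableSet_avoid _ _)).1 h1]
    norm_num
  · have hcompl : Pq ω v (avoid (box d r) x)ᶜ ≤ 1 / 2 := by
      refine le_trans (measure_mono_ae ?_) (hdrop hv)
      have hstay : ∀ᵐ f ∂(Pq ω v), f ∉ stay (box d r : Set (Site d)) := by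
        rw [ae_iff]
        simpa using hPq.stay_box_eq_zero hd hη hω r v
      filter_upwards [hPq.start ω v, hstay] with f h0 hs hf
      have hex : ∃ t, f t ∉ box d r := by
        by_contra hcon
        push Not at hcon
        exact hs fun n => hcon n
      classical
      have ht := Nat.find_spec hex
      have htm : ∀ i < Nat.find hex, f i ∈ box d r := fun i hi => not_not.1 (Nat.find_min hex hi)
      have hvis : ∃ i ≤ Nat.find hex, f i = x := by
        by_contra hcon
        push Not at hcon
        exact hf ⟨_, ht, hcon⟩
      obtain ⟨i, hi, hix⟩ := hvis
      by_cases hie : i = Nat.find hex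
      · rw [← hie, hix] at ht
        exact absurd hx ht
      · refine ⟨i, fun j hj => htm j (by omega), 0, Nat.zero_le _, ?_⟩
        rw [hix, h0]
        linarith
    have hadd := prob_add_prob_compl (μ := Pq ω v) (measurableSet_avoid (box d r) x)
    by_contra hcon
    push Not at hcon
    have hlt : Pq ω v (avoid (box d r) x) + Pq ω v (avoid (box d r) x)ᶜ < 1 / 2 + 1 / 2 :=
      ENNReal.add_lt_add_of_lt_of_le (measure_ne_top _ _) hcon hcompl
    rw [hadd, ENNReal.add_halves] at hlt
    exact lt_irrefl _ hlt

end Avoid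

section Climb

variable {d : ℕ} {P : Measure (Env d)} {Pq : Env d → Site d → Measure (Path d)}

/-- the path rises above level `L` for the first time at time `n`, staying in `S`. -/
def climbAt (u : Fin d → ℤ) (S : Set (Site d)) (L : ℤ) (n : ℕ) : Set (Path d) :=
  {f | L < lev u (f n) ∧ (∀ i < n, lev u (f i) ≤ L) ∧ ∀ i ≤ n, f i ∈ S}

/-- the path rises above level `L` while staying in `S`. -/
def climb (u : Fin d → ℤ) (S : Set (Site d)) (L : ℤ) : Set (Path d) := ⋃ n, climbAt u S L n

lemma upTo_climbAt (u : Fin d → ℤ) (S : Set (Site d)) (L : ℤ) (n : ℕ) :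
    UpTo n (climbAt u S L n) := by
  rintro f g h ⟨h1, h2, h3⟩
  refine ⟨by rwa [← h n le_rfl], fun i hi => ?_, fun i hi => ?_⟩
  · rw [← h i hi.le]; exact h2 i hi
  · rw [← h i hi]; exact h3 i hi

lemma measurableSet_climb (u : Fin d → ℤ) (S : Set (Site d)) (L : ℤ) :
    MeasurableSet (climb u S L) :=
  MeasurableSet.iUnion fun n => (upTo_climbAt u S L n).measurableSet

lemma disjoint_climbAt (u : Fin d → ℤ) (S : Set (Site d)) (L : ℤ) :
    Pairwise (Function.onFun Disjoint (climbAt u S L)) := by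
  intro n m hnm
  rw [Function.onFun, Set.disjoint_left]
  intro f hf hf'
  rcases lt_or_gt_of_ne hnm with h | h
  · exact absurd hf.1 (not_lt.2 (hf'.2.1 n h))
  · exact absurd hf'.1 (not_lt.2 (hf.2.1 m h))

lemma mem_climb {u : Fin d → ℤ} {S : Set (Site d)} {L : ℤ} {f : Path d} {t : ℕ}
    (hL : L < lev u (f t)) (hS : ∀ i ≤ t, f i ∈ S) : f ∈ climb u S L := by
  classical
  have hex : ∃ t, L < lev u (f t) := ⟨t, hL⟩
  refine Set.mem_iUnion.2 ⟨Nat.find hex, Nat.find_spec hex, fun i hi =>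
    not_lt.1 (Nat.find_min hex hi), fun i hi => hS i (hi.trans (Nat.find_min' hex hL))⟩

lemma IsQuenchedFamily.local_climb (hPq : IsQuenchedFamily Pq) (x : Site d) (u : Fin d → ℤ)
    (S : Set (Site d)) (L : ℤ) : LocalOn S fun ω => Pq ω x (climb u S L) :=
  hPq.local_iUnion x (upTo_climbAt u S L) fun _ _ hf i hi => hf.2.2 i hi.le

lemma annM_climb (hPq : IsQuenchedFamily Pq) (h : IsIID P) (y : Site d) (u : Fin d → ℤ)
    (T : Set (Site d)) (L : ℤ) :
    annM P Pq y (climb u {w | w - y ∈ T} L) = annM P Pq 0 (climb u T (L - lev u y)) := by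
  rw [annM_eq hPq h y (measurableSet_climb _ _ _)]
  congr 1
  ext f
  simp only [climb, climbAt, Set.mem_preimage, Set.mem_iUnion, Set.mem_ofPred_eq, translate,
    lev_add, add_sub_cancel_left]
  refine exists_congr fun n => ?_
  refine and_congr (by constructor <;> intro h <;> linarith)
    (and_congr (forall_congr' fun i => forall_congr' fun _ => ?_) Iff.rfl)
  constructor <;> intro h <;> linarith

lemma IsQuenchedFamily.avoid_of_climb (hPq : IsQuenchedFamily Pq) {ω : Env d}
    (V : Finset (Site d)) (u : Fin d → ℤ) (S : Set (Site d)) (L : ℤ) (x y : Site d) (hx : x ∉ S)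
    (h : ∀ v, L < lev u v → 1 / 2 ≤ Pq ω v (avoid V x)) :
    1 / 2 * Pq ω y (climb u S L) ≤ Pq ω y (avoid V x) := by
  refine (hPq.le_strong_markov ω y (upTo_climbAt u S L) (disjoint_climbAt u S L)
    (measurableSet_avoid V x) fun n f hf => h _ hf.1).trans (measure_mono ?_)
  intro f hf
  obtain ⟨n, hn, t, ht, hti⟩ := Set.mem_iUnion.1 hf
  refine ⟨n + t, ht, fun i hi => ?_⟩
  by_cases hin : i ≤ n
  · intro hix
    exact hx (hix ▸ hn.2.2 i hin)
  · have := hti (i - n) (by omega)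
    simp only [after_apply] at this
    rwa [show n + (i - n) = i by omega] at this

/-- independent attempts all fail with probability exponentially small in their number. -/
lemma IsIID.all_fail_le (h : IsIID P) {ι : Type*} (s : Finset ι) {S : ι → Set (Site d)}
    (hS : ∀ i ∈ s, ∀ j ∈ s, i ≠ j → Disjoint (S i) (S j))
    {g : ι → Env d → ℝ≥0∞} (hg : ∀ i, Measurable (g i)) (hgS : ∀ i ∈ s, LocalOn (S i) (g i))
    (hg1 : ∀ i ω, g i ω ≤ 1) {β : ℝ} (hβ : 0 < β)
    (hmean : ∀ i ∈ s, ENNReal.ofReal (2 * β) ≤ ∫⁻ ω, g i ω ∂P) :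
    P {ω | ∀ i ∈ s, g i ω < ENNReal.ofReal β} ≤ ENNReal.ofReal (Real.exp (-(β * s.card))) := by
  classical
  have := h.isProbabilityMeasure
  set F : ι → Set (Env d) := fun i => {ω | g i ω < ENNReal.ofReal β} with hF
  have hFm : ∀ i, MeasurableSet (F i) := fun i => measurableSet_lt (hg i) measurable_const
  have hloc : ∀ i ∈ s, LocalOn (S i) (fun ω => (F i).indicator (fun _ => (1 : ℝ≥0∞)) ω) := by
    intro i hi ω ω' hω
    have := hgS i hi ω ω' hω
    simp only [Set.indicator_apply, hF, Set.mem_ofPred_eq, this]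
  have hfail : ∀ i ∈ s, P (F i) ≤ ENNReal.ofReal (Real.exp (-β)) := by
    intro i hi
    have h1 : ∫⁻ ω, g i ω ∂P ≤ ENNReal.ofReal β + P (F i)ᶜ := by
      calc ∫⁻ ω, g i ω ∂P ≤ ∫⁻ ω, (ENNReal.ofReal β + (F i)ᶜ.indicator (fun _ => 1) ω) ∂P := by
            refine lintegral_mono fun ω => ?_
            by_cases hω : ω ∈ F i
            · exact (le_of_lt hω).trans le_self_add
            · rw [Set.indicator_of_mem (show ω ∈ (F i)ᶜ from hω)]
              exact (hg1 i ω).trans le_add_self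
        _ = _ := by
            rw [lintegral_add_left measurable_const, lintegral_indicator_const (hFm i).compl]
            simp
    have h2 : ENNReal.ofReal β ≤ P (F i)ᶜ := by
      have h3 := (hmean i hi).trans h1
      rw [two_mul, ENNReal.ofReal_add hβ.le hβ.le] at h3
      exact (ENNReal.add_le_add_iff_left ENNReal.ofReal_ne_top).1 h3
    rw [prob_compl_eq_one_sub (hFm i)] at h2
    have h4 : P (F i) ≤ 1 - ENNReal.ofReal β := by
      have hle : P (F i) ≤ 1 := prob_le_one
      have hb : ENNReal.ofReal β ≤ 1 := h2.trans tsub_le_self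
      exact ENNReal.le_sub_of_add_le_left ENNReal.ofReal_ne_top (by
        calc ENNReal.ofReal β + P (F i) ≤ (1 - P (F i)) + P (F i) := by gcongr
          _ = 1 := tsub_add_cancel_of_le hle)
    refine h4.trans ?_
    rw [← ENNReal.ofReal_one, ← ENNReal.ofReal_sub _ hβ.le]
    apply ENNReal.ofReal_le_ofReal
    linarith [Real.add_one_le_exp (-β)]
  calc P {ω | ∀ i ∈ s, g i ω < ENNReal.ofReal β} =
        ∫⁻ ω, ∏ i ∈ s, (F i).indicator (fun _ => (1 : ℝ≥0∞)) ω ∂P := by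
        have hset : {ω | ∀ i ∈ s, g i ω < ENNReal.ofReal β} = ⋂ i ∈ s, F i := by
          ext ω; simp [hF]
        rw [hset, ← lintegral_indicator_one (Finset.measurableSet_biInter s fun i _ => hFm i)]
        refine lintegral_congr fun ω => ?_
        by_cases hω : ω ∈ ⋂ i ∈ s, F i
        · rw [Set.indicator_of_mem hω, Finset.prod_eq_one]
          · rfl
          · intro i hi
            rw [Set.indicator_of_mem]
            simp only [Set.mem_iInter] at hω
            exact hω i hi
        · rw [Set.indicator_of_notMem hω]
          simp only [Set.mem_iInter, not_forall] at hω
          obtain ⟨i, hi, hiω⟩ := hω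
          exact (Finset.prod_eq_zero hi (Set.indicator_of_notMem hiω _)).symm
    _ = ∏ i ∈ s, ∫⁻ ω, (F i).indicator (fun _ => (1 : ℝ≥0∞)) ω ∂P :=
        h.lintegral_prod s hS (fun i => measurable_const.indicator (hFm i)) hloc
    _ ≤ ∏ i ∈ s, ENNReal.ofReal (Real.exp (-β)) := by
        refine Finset.prod_le_prod' fun i hi => ?_
        have := lintegral_indicator_one (μ := P) (hFm i)
        exact this.le.trans (hfail i hi)
    _ = _ := by
        rw [Finset.prod_const, ← ENNReal.ofReal_pow (Real.exp_pos _).le, ← Real.exp_nat_mul]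
        congr 2; ring

end Climb

section Columns

variable {d : ℕ}

/-- the sign of an integer, with value `1` at `0`. -/
def sg (a : ℤ) : ℤ := if 0 ≤ a then 1 else -1

lemma mul_sg (a : ℤ) : a * sg a = |a| := by
  unfold sg
  split_ifs with h
  · rw [abs_of_nonneg h, mul_one]
  · rw [abs_of_neg (not_le.1 h)]; ring

lemma abs_sg (a : ℤ) : |sg a| = 1 := by
  unfold sg
  split_ifs <;> simp

/-- the tube of radius `W` around the half line of multiples of `m`. -/
def tube (m : Fin d → ℝ) (W : ℝ) : Set (Site d) := {w | ∃ k : ℕ, ∀ j, |(w j : ℝ) - k * m j| ≤ W}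

/-- the displacement from a site to the start of the column with label `b`. -/
def column (u : Fin d → ℤ) (j₀ : Fin d) (h σ : ℕ) (b : Fin d → ℕ) : Site d :=
  fun i => sg (u i) * (if i = j₀ then (h : ℤ) else σ * b i)

/-- the labels of the columns. -/
def labels (j₀ : Fin d) (Q : ℕ) : Finset (Fin d → ℕ) :=
  Fintype.piFinset fun i => if i = j₀ then {0} else Finset.range Q

lemma card_labels (j₀ : Fin d) (Q : ℕ) : (labels j₀ Q).card = Q ^ (d - 1) := by
  rw [labels, Fintype.card_piFinset, ← Finset.mul_prod_erase _ _ (Finset.mem_univ j₀)]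
  rw [Finset.prod_congr rfl (g := fun _ => Q)]
  · simp
  · intro i hi
    simp [Finset.ne_of_mem_erase hi]

lemma lev_tube_ge {u : Fin d → ℤ} {m : Fin d → ℝ} (hm : 0 ≤ ∑ i, (u i : ℝ) * m i) {W : ℕ}
    {w : Site d} (hw : w ∈ tube m W) : -((width u * W : ℕ) : ℤ) ≤ lev u w := by
  obtain ⟨k, hk⟩ := hw
  have h1 : (lev u w : ℝ) = ∑ i, (u i : ℝ) * ((w i : ℝ) - k * m i) + k * ∑ i, (u i : ℝ) * m i := by
    rw [lev, Finset.mul_sum, ← Finset.sum_add_distrib]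
    push_cast
    exact Finset.sum_congr rfl fun i _ => by ring
  have h2 : |∑ i, (u i : ℝ) * ((w i : ℝ) - k * m i)| ≤ width u * W := by
    refine (Finset.abs_sum_le_sum_abs _ _).trans ?_
    rw [width]
    push_cast
    rw [Finset.sum_mul]
    refine Finset.sum_le_sum fun i _ => ?_
    rw [abs_mul, Nat.cast_natAbs, Int.cast_abs]
    exact mul_le_mul_of_nonneg_left (hk i) (abs_nonneg _)
  have h3 : (0 : ℝ) ≤ k * ∑ i, (u i : ℝ) * m i := mul_nonneg (Nat.cast_nonneg k) hm
  have h4 : (-((width u * W : ℕ) : ℤ) : ℝ) ≤ (lev u w : ℝ) := by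
    push_cast
    linarith [(abs_le.1 h2).1]
  exact_mod_cast h4

lemma mul_column_nonneg (u : Fin d → ℤ) (j₀ : Fin d) (h σ : ℕ) (b : Fin d → ℕ) (i : Fin d) :
    0 ≤ u i * column u j₀ h σ b i := by
  rw [column, ← mul_assoc, mul_sg]
  positivity

lemma le_lev_column {u : Fin d → ℤ} {j₀ : Fin d} (hu : u j₀ ≠ 0) (h σ : ℕ) (b : Fin d → ℕ) :
    (h : ℤ) ≤ lev u (column u j₀ h σ b) := by
  rw [lev]
  refine le_trans ?_ (Finset.single_le_sum (fun i _ => mul_column_nonneg u j₀ h σ b i)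
    (Finset.mem_univ j₀))
  rw [column, ← mul_assoc, mul_sg, if_pos rfl]
  have : 1 ≤ |u j₀| := Int.one_le_abs hu
  nlinarith

lemma sum_natAbs_column_le (u : Fin d → ℤ) {j₀ : Fin d} (h σ Q : ℕ) {b : Fin d → ℕ}
    (hb : b ∈ labels j₀ Q) :
    ∑ i, (column u j₀ h σ b i).natAbs ≤ h + d * (σ * Q) := by
  rw [← Finset.add_sum_erase _ _ (Finset.mem_univ j₀)]
  have h1 : ∀ a : ℤ, (sg a).natAbs = 1 := fun a => by
    unfold sg
    split_ifs <;> simp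
  refine add_le_add ?_ ?_
  · simp [column, Int.natAbs_mul, h1]
  · calc _ ≤ ∑ i ∈ Finset.univ.erase j₀, σ * Q := by
          refine Finset.sum_le_sum fun i hi => ?_
          have hij := Finset.ne_of_mem_erase hi
          have hbi := Fintype.mem_piFinset.1 hb i
          rw [if_neg hij, Finset.mem_range] at hbi
          simp only [column, Int.natAbs_mul, h1, if_neg hij, Int.natAbs_natCast, one_mul]
          gcongr
      _ ≤ _ := by
          rw [Finset.sum_const, smul_eq_mul]
          gcongr
          refine (Finset.card_le_univ _).trans ?_
          simp

lemma disjoint_columns {u : Fin d → ℤ} {m : Fin d → ℝ} {j₀ : Fin d} (hm : m j₀ ≠ 0) {W σ : ℕ}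
    (hW : 0 < W) {Cm : ℕ} (hCm : 2 * (1 + ∑ i, |m i| / |m j₀|) < Cm) (hσ : σ = Cm * W) (x : Site d)
    (h Q : ℕ) {b b' : Fin d → ℕ} (hb : b ∈ labels j₀ Q) (hb' : b' ∈ labels j₀ Q) (hne : b ≠ b') :
    Disjoint {w | w - (x + column u j₀ h σ b) ∈ tube m W}
      {w | w - (x + column u j₀ h σ b') ∈ tube m W} := by
  rw [Set.disjoint_left]
  rintro w ⟨k, hk⟩ ⟨k', hk'⟩
  have hmpos : 0 < |m j₀| := abs_pos.2 hm
  obtain ⟨i, hi⟩ := Function.ne_iff.1 hne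
  have hij : i ≠ j₀ := by
    rintro rfl
    have h1 := Fintype.mem_piFinset.1 hb i
    have h2 := Fintype.mem_piFinset.1 hb' i
    simp only [if_pos, Finset.mem_singleton] at h1 h2
    exact hi (h1.trans h2.symm)
  have e1 : |((k : ℝ) - k') * m j₀| ≤ 2 * W := by
    have a1 := hk j₀
    have a2 := hk' j₀
    simp only [Pi.sub_apply, Pi.add_apply, column, if_pos] at a1 a2
    rw [abs_le] at *
    constructor <;> linarith [a1.1, a1.2, a2.1, a2.2]
  have e2 : |(k : ℝ) - k'| ≤ 2 * W / |m j₀| := by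
    rw [le_div_iff₀ hmpos, ← abs_mul]
    exact e1
  have e3 : (σ : ℝ) ≤ |(column u j₀ h σ b i : ℝ) - column u j₀ h σ b' i| := by
    simp only [column, if_neg hij]
    have : (1 : ℤ) ≤ |(b i : ℤ) - b' i| := by
      apply Int.one_le_abs
      intro hcon
      apply hi
      omega
    have h2 : (σ : ℤ) ≤ |sg (u i) * (σ * b i) - sg (u i) * (σ * b' i)| := by
      rw [← mul_sub, ← mul_sub, abs_mul, abs_mul, abs_sg, one_mul, Nat.abs_cast]
      nlinarith
    exact_mod_cast h2
  have e4 : |(column u j₀ h σ b i : ℝ) - column u j₀ h σ b' i| ≤ |(k : ℝ) - k'| * |m i| + 2 * W := by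
    rw [← abs_mul]
    have a1 := hk i
    have a2 := hk' i
    simp only [Pi.sub_apply, Pi.add_apply, Int.cast_sub, Int.cast_add] at a1 a2
    have a3 := neg_abs_le (((k : ℝ) - k') * m i)
    have a4 := le_abs_self (((k : ℝ) - k') * m i)
    rw [abs_le] at *
    constructor <;> linarith [a1.1, a1.2, a2.1, a2.2]
  have e5 : |m i| / |m j₀| ≤ ∑ i, |m i| / |m j₀| :=
    Finset.single_le_sum (f := fun i => |m i| / |m j₀|) (fun i _ => by positivity)
      (Finset.mem_univ i)
  have hWpos : (0 : ℝ) < W := by exact_mod_cast hW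
  have e6 : |(k : ℝ) - k'| * |m i| ≤ 2 * W * (|m i| / |m j₀|) := by
    calc _ ≤ 2 * W / |m j₀| * |m i| := by gcongr
      _ = _ := by ring
  have e7 : (σ : ℝ) = Cm * W := by rw [hσ]; push_cast; rfl
  nlinarith

end Columns

section Drift

variable {d : ℕ} {P : Measure (Env d)} {Pq : Env d → Site d → Measure (Path d)}

lemma integrable_of_supTail_blockMax {μ : Measure (Path d)} [IsProbabilityMeasure μ]
    {u : Fin d → ℤ} {A : ℕ → Path d → ℝ} (hA : Adapted A)
    (h : SupTail μ fun f => blockMax A (tau u f) f) : Integrable (fun f => A (tau u f) f) μ := by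
  have hts : SupTail μ fun f => A (tau u f) f :=
    h.mono_abs fun f => (abs_le_blockMax A le_rfl f).trans (le_abs_self _)
  have hm := hA.measurable_tau u
  have := hts.integrable_pow hm 1
  simp only [pow_one] at this
  exact (integrable_norm_iff hm.aestronglyMeasurable).1 this

lemma Setup.one_le_mean_lev (hd : 0 < d) (S : Setup P Pq) :
    1 ≤ ∑ i, (S.u i : ℝ) * blockMean P Pq S.u (coordF i) := by
  have h := S.renewal_upLaw hd
  have := h.prob
  have hInt : ∀ i, Integrable (fun f => coordF i (tau S.u f) f) (upLaw P Pq S.u) := fun i =>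
    integrable_of_supTail_blockMax (cocycle_coordF i).adapted (S.coordF_supTail hd i)
  calc (1 : ℝ) = ∫ _, (1 : ℝ) ∂(upLaw P Pq S.u) := by simp
    _ ≤ ∫ f, ∑ i, (S.u i : ℝ) * coordF i (tau S.u f) f ∂(upLaw P Pq S.u) := by
        refine integral_mono_ae (integrable_const 1)
          (integrable_finsetSum _ fun i _ => (hInt i).const_mul _) ?_
        filter_upwards [h.hasReg, h.start] with f hf h0
        have h1 := hf.isReg.1 0 hf.tau_pos
        rw [h0, lev_zero] at h1
        have h2 : ((lev S.u (f (tau S.u f)) : ℤ) : ℝ) =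
            ∑ i, (S.u i : ℝ) * coordF i (tau S.u f) f := by
          simp [lev, coordF, h0]
        rw [← h2]
        exact_mod_cast h1
    _ = _ := by
        rw [integral_finsetSum _ fun i _ => (hInt i).const_mul _]
        simp only [integral_const_mul, blockMean]

lemma eventually_log_sq_le (c C : ℝ) : ∀ᶠ q : ℕ in atTop, c * Real.log q ^ 2 + C ≤ q := by
  have h1 := ((Real.isLittleO_pow_log_id_atTop (n := 2)).const_mul_left c).comp_tendsto
    tendsto_natCast_atTop_atTop
  have h2 : ∀ᶠ q : ℕ in atTop, 2 * C ≤ q := tendsto_natCast_atTop_atTop.eventually_ge_atTop _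
  filter_upwards [h1.bound (show (0 : ℝ) < 1 / 2 by norm_num), h2] with q hq hq2
  simp only [Function.comp_apply, Real.norm_eq_abs, id, Nat.abs_cast] at hq
  linarith [(le_abs_self _).trans hq]

lemma Setup.exists_climb_bound (hd : 0 < d) (S : Setup P Pq) :
    ∃ β : ℝ, 0 < β ∧ ∃ q₀ : ℕ, ∀ q ≥ q₀, ∀ L : ℤ, L < (q : ℤ) ^ 24 →
      ENNReal.ofReal (2 * β) ≤ annM P Pq 0
        (climb S.u (tube (fun i => blockMean P Pq S.u (coordF i)) ((q ^ 13 : ℕ) : ℝ)) L) := by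
  have h := S.renewal_upLaw hd
  have := h.prob
  obtain ⟨C, hC, hsmall⟩ := h.exists_track (fun i => cocycle_coordF i) (S.coordF_supTail hd) 1
  obtain ⟨C₁, hC₁, hb⟩ := hsmall 1
  obtain ⟨C₂, hC₂, hup⟩ := S.upLaw_le hd
  refine ⟨1 / (4 * C₂), by positivity, ?_⟩
  have hlarge : ∀ r : ℝ, ∀ᶠ q : ℕ in atTop, r ≤ q := fun r =>
    tendsto_natCast_atTop_atTop.eventually_ge_atTop r
  obtain ⟨q₀, hq₀⟩ := eventually_atTop.1 ((eventually_log_sq_le 144 (C + 1)).and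
    ((hlarge 1).and (hlarge (2 * C₁))))
  refine ⟨q₀, fun q hq L hL => ?_⟩
  obtain ⟨h1, h2, h3⟩ := hq₀ q hq
  have hq1 : 1 ≤ q := by exact_mod_cast h2
  set m : Fin d → ℝ := fun i => blockMean P Pq S.u (coordF i) with hm
  have hD : ((q ^ 12 : ℕ) : ℝ) * Real.log ((q ^ 12 : ℕ) : ℝ) ^ 2 + C + ((q ^ 12 : ℕ) : ℝ) ≤
      ((q ^ 13 : ℕ) : ℝ) := by
    push_cast
    rw [Real.log_pow]
    push_cast
    have hp : (1 : ℝ) ≤ (q : ℝ) ^ 12 := one_le_pow₀ h2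
    calc _ ≤ (q : ℝ) ^ 12 * (144 * Real.log q ^ 2 + (C + 1)) := by nlinarith
      _ ≤ (q : ℝ) ^ 12 * q := by gcongr
      _ = _ := by ring
  have hbad : upLaw P Pq S.u (climb S.u (tube m ((q ^ 13 : ℕ) : ℝ)) L)ᶜ ≤ 1 / 2 := by
    have hb' := hb (q ^ 12) (Nat.one_le_pow _ _ hq1)
    refine le_trans (measure_mono_ae ?_) (hb'.trans ?_)
    · filter_upwards [h.start] with f h0 hf hcon
      obtain ⟨T, hT1, -, hT3⟩ := hcon
      refine hf (mem_climb (t := T) ?_ fun i hi => ?_)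
      · refine lt_of_lt_of_le hL (le_trans (le_of_eq ?_) hT3)
        push_cast
        ring
      · obtain ⟨k, -, hk⟩ := hT1 i hi
        refine ⟨k, fun j => le_trans ?_ hD⟩
        have := hk j
        simpa only [coordF, h0, Pi.zero_apply, Int.cast_zero, sub_zero] using this
    · rw [show (1 / 2 : ℝ≥0∞) = ENNReal.ofReal (1 / 2) by
        rw [ENNReal.ofReal_div_of_pos (by norm_num)]; simp]
      apply ENNReal.ofReal_le_ofReal
      rw [pow_one, div_le_div_iff₀ (by positivity) (by norm_num)]
      have : (q : ℝ) ≤ ((q ^ 12 : ℕ) : ℝ) := by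
        push_cast
        exact le_self_pow₀ h2 (by norm_num)
      linarith
  have hgood : 1 / 2 ≤ upLaw P Pq S.u (climb S.u (tube m ((q ^ 13 : ℕ) : ℝ)) L) := by
    have hadd := prob_add_prob_compl (μ := upLaw P Pq S.u)
      (measurableSet_climb S.u (tube m ((q ^ 13 : ℕ) : ℝ)) L)
    by_contra hcon
    push Not at hcon
    have hlt := ENNReal.add_lt_add_of_lt_of_le (measure_ne_top _ _) hcon hbad
    rw [hadd, ENNReal.add_halves] at hlt
    exact lt_irrefl _ hlt
  have hfin := hgood.trans (hup _)
  have hC₂' : ENNReal.ofReal C₂ ≠ 0 := by simpa using hC₂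
  calc ENNReal.ofReal (2 * (1 / (4 * C₂))) = (ENNReal.ofReal C₂)⁻¹ * (1 / 2) := by
        rw [← ENNReal.ofReal_inv_of_pos hC₂, show (1 / 2 : ℝ≥0∞) = ENNReal.ofReal (1 / 2) by
          rw [ENNReal.ofReal_div_of_pos (by norm_num)]; simp, ← ENNReal.ofReal_mul (by positivity)]
        congr 1
        field_simp
        norm_num
    _ ≤ (ENNReal.ofReal C₂)⁻¹ * (ENNReal.ofReal C₂ * annM P Pq 0 (climb S.u (tube m ((q ^ 13 : ℕ) : ℝ)) L)) := by
        gcongr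
    _ = _ := by rw [← mul_assoc, ENNReal.inv_mul_cancel hC₂' ENNReal.ofReal_ne_top, one_mul]

end Drift

section EscapeBound

variable {d : ℕ} {P : Measure (Env d)} {Pq : Env d → Site d → Measure (Path d)}

/-- quenched lower bound for the escape probability, given a successful column. -/
lemma IsQuenchedFamily.escape_ge_of_column (hd : 0 < d) (hPq : IsQuenchedFamily Pq) {η : ℝ}
    (hη : 0 < η) {ω : Env d} (hω : Ell η ω) (r : ℕ) (u : Fin d → ℤ) (m : Fin d → ℝ)
    (hm : 0 ≤ ∑ i, (u i : ℝ) * m i) {R : ℤ} (hR : 0 ≤ R)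
    (hdrop : ∀ v ∈ box d r, Pq ω v (levDrop u (box d r) R) ≤ 1 / 2)
    {x : Site d} (hx : x ∈ box d r) {j₀ : Fin d} (hu : u j₀ ≠ 0) {W h σ Q : ℕ}
    (hW : width u * W < h) {b : Fin d → ℕ} (hb : b ∈ labels j₀ Q) {β : ℝ≥0∞}
    (hβ : β ≤ Pq ω (x + column u j₀ h σ b)
      (climb u {w | w - (x + column u j₀ h σ b) ∈ tube m W} (lev u x + R))) :
    ∃ n ≤ h + d * (σ * Q), ENNReal.ofReal η ^ n * (1 / 2 * β) ≤ Pq ω x (escape (box d r) x) := by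
  set y := x + column u j₀ h σ b with hy
  have havoid : 1 / 2 * β ≤ Pq ω y (avoid (box d r) x) := by
    refine le_trans (by gcongr) (hPq.avoid_of_climb (box d r) u
      {w | w - y ∈ tube m W} (lev u x + R) x y ?_ fun v hv =>
        hPq.avoid_ge_half hd hη hω r u R x v hx hR hv fun hvb => hdrop v hvb)
    intro hcon
    have h1 := lev_tube_ge hm hcon
    have h2 := le_lev_column hu h σ b
    rw [hy, lev_sub, lev_add] at h1
    have : ((width u * W : ℕ) : ℤ) < h := by exact_mod_cast hW
    linarith
  have hh : 0 < h := lt_of_le_of_lt (Nat.zero_le _) hW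
  obtain ⟨s, hs1, hs⟩ : ∃ s : StepIdx d, s.1 = j₀ ∧ stepVec s j₀ = sg (u j₀) := by
    unfold sg
    split_ifs
    · exact ⟨(j₀, true), rfl, by simp [stepVec]⟩
    · exact ⟨(j₀, false), rfl, by simp [stepVec]⟩
  have hstep : ∀ i, stepVec s i = if i = j₀ then sg (u j₀) else 0 := by
    intro i
    split_ifs with hi
    · rw [hi, hs]
    · simp [stepVec, hs1, hi]
  have hcol : column u j₀ h σ b = stepVec s + column u j₀ (h - 1) σ b := by
    ext i
    rw [Pi.add_apply, hstep, column, column]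
    split_ifs with hi
    · rw [hi]; push_cast [Nat.cast_sub hh]; ring
    · ring
  have hlev : lev u x < lev u (x + stepVec s) := by
    have h3 : lev u (stepVec s) = |u j₀| := by
      rw [lev, Finset.sum_eq_single j₀, hs, mul_sg]
      · intro j _ hj; rw [hstep, if_neg hj, mul_zero]
      · simp
    have : 1 ≤ |u j₀| := Int.one_le_abs hu
    rw [lev_add, h3]
    linarith
  set n := ∑ i, (column u j₀ (h - 1) σ b i).natAbs with hn
  have hsteer := hPq.avoid_steer hω (box d r) x u n (x + stepVec s) (column u j₀ (h - 1) σ b) hlev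
    (mul_column_nonneg u j₀ (h - 1) σ b) rfl
  rw [add_assoc, ← hcol, ← hy] at hsteer
  refine ⟨n + 1, ?_, ?_⟩
  · have := sum_natAbs_column_le u (h - 1) σ Q hb
    omega
  · calc _ ≤ ENNReal.ofReal η ^ (n + 1) * Pq ω y (avoid (box d r) x) := by gcongr
      _ = ENNReal.ofReal η * (ENNReal.ofReal η ^ n * Pq ω y (avoid (box d r) x)) := by
          rw [pow_succ]; ring
      _ ≤ ENNReal.ofReal η * Pq ω (x + stepVec s) (avoid (box d r) x) := by gcongr
      _ ≤ _ := hPq.escape_step hω (box d r) x s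

lemma exp_neg_le_pow {η : ℝ} (hη : 0 < η) (n : ℕ) : Real.exp (-(|Real.log η| * n)) ≤ η ^ n := by
  rw [← Real.exp_log (pow_pos hη n), Real.log_pow]
  apply Real.exp_le_exp.2
  have := neg_abs_le (Real.log η)
  have hn : (0 : ℝ) ≤ n := by positivity
  nlinarith

lemma eventually_card_box_le (d A : ℕ) :
    ∀ᶠ q : ℕ in atTop, ((box d (q ^ A)).card : ℝ) ≤ Real.exp q := by
  have h1 := ((Real.isLittleO_pow_exp_atTop (n := A * d)).const_mul_left ((3 : ℝ) ^ d)).comp_tendsto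
    tendsto_natCast_atTop_atTop
  filter_upwards [h1.bound zero_lt_one, eventually_ge_atTop 1] with q hq hq1
  simp only [Function.comp_apply, Real.norm_eq_abs, one_mul, Real.abs_exp] at hq
  exact (card_box_le d A q hq1).trans ((le_abs_self _).trans hq)

lemma Setup.exists_escape_bound (hd : 4 ≤ d) (S : Setup P Pq) (A : ℕ) :
    ∃ K c : ℝ, 0 < K ∧ 0 < c ∧ ∃ q₀ : ℕ, ∀ q ≥ q₀,
      P {ω | ¬ ∀ x ∈ box d (q ^ A), ENNReal.ofReal (Real.exp (-(K * (q : ℝ) ^ 20))) ≤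
        Pq ω x (escape (box d (q ^ A)) x)} ≤ ENNReal.ofReal (Real.exp (-(c * (q : ℝ) ^ 21))) := by
  have hd0 : 0 < d := by omega
  have hP := S.prob
  obtain ⟨β, hβ, q₁, hclimb⟩ := S.exists_climb_bound hd0
  obtain ⟨q₂, hdropb⟩ := S.exists_levDrop_bound hd0 A
  set m : Fin d → ℝ := fun i => blockMean P Pq S.u (coordF i) with hm
  have hlevm : 1 ≤ ∑ i, (S.u i : ℝ) * m i := S.one_le_mean_lev hd0
  obtain ⟨j₀, hj₀⟩ : ∃ j, 0 < (S.u j : ℝ) * m j := by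
    by_contra hcon
    push Not at hcon
    linarith [Finset.sum_nonpos fun i (_ : i ∈ Finset.univ) => hcon i]
  have hu0 : S.u j₀ ≠ 0 := by
    intro h0
    simp [h0] at hj₀
  have hm0 : m j₀ ≠ 0 := by
    intro h0
    simp [h0] at hj₀
  obtain ⟨Cm, hCm⟩ := exists_nat_gt (2 * (1 + ∑ i, |m i| / |m j₀|))
  set w := width S.u with hw
  set lam := |Real.log S.η| with hlam
  have hlam0 : 0 ≤ lam := abs_nonneg _
  set G : ℝ := ((w + 1 + d * Cm : ℕ) : ℝ) with hG
  set K : ℝ := lam * G + 1 with hK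
  set c₀ : ℝ := min 1 β with hc₀
  have hc₀pos : 0 < c₀ := lt_min one_pos hβ
  have hKpos : 0 < K := by
    have : 0 ≤ lam * G := mul_nonneg hlam0 (by rw [hG]; positivity)
    linarith
  have hlarge : ∀ r : ℝ, ∀ᶠ q : ℕ in atTop, r ≤ q := fun r =>
    tendsto_natCast_atTop_atTop.eventually_ge_atTop r
  obtain ⟨q₃, hq₃⟩ := eventually_atTop.1 ((eventually_card_box_le d A).and ((hlarge 1).and
    ((hlarge (-Real.log (β / 2))).and (hlarge (6 / c₀)))))
  refine ⟨K, c₀ / 2, hKpos, by positivity, max q₁ (max q₂ q₃), fun q hq => ?_⟩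
  have hqq₁ : q₁ ≤ q := (le_max_left _ _).trans hq
  have hqq₂ : q₂ ≤ q := (le_max_left _ _).trans ((le_max_right _ _).trans hq)
  obtain ⟨hcard, hq1, hqβ, hqc⟩ := hq₃ q ((le_max_right _ _).trans ((le_max_right _ _).trans hq))
  have hq1' : 1 ≤ q := by exact_mod_cast hq1
  set V := box d (q ^ A) with hV
  set W := q ^ 13 with hW
  set h := (w + 1) * W with hh
  set σ := Cm * W with hσ
  have hWpos : 0 < W := by positivity
  set R : ℤ := (q : ℤ) ^ 24 with hR
  set Y : Site d → (Fin d → ℕ) → Site d := fun x b => x + column S.u j₀ h σ b with hY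
  set g : Site d → (Fin d → ℕ) → Env d → ℝ≥0∞ := fun x b ω =>
    Pq ω (Y x b) (climb S.u {z | z - Y x b ∈ tube m W} (lev S.u x + R)) with hg
  set Bdrop : Site d → Set (Env d) := fun v => {ω | 1 / 2 ≤ Pq ω v (levDrop S.u V R)} with hBdrop
  set Bcol : Site d → Set (Env d) := fun x =>
    {ω | ∀ b ∈ labels j₀ (q ^ 7), g x b ω < ENNReal.ofReal β} with hBcol
  have hdropP : ∀ v, P (Bdrop v) ≤ ENNReal.ofReal (2 * Real.exp (-(q : ℝ) ^ 21)) := by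
    intro v
    have h1 := mul_meas_ge_le_lintegral₀ (μ := P)
      (S.hPq.2 v _ (measurableSet_levDrop S.u V R)).aemeasurable (1 / 2)
    rw [← annM_apply S.hPq v (measurableSet_levDrop S.u V R)] at h1
    have h2 := h1.trans (hdropb q hqq₂ v)
    calc P (Bdrop v) = 2 * (1 / 2 * P (Bdrop v)) := by
          rw [← mul_assoc, one_div, ENNReal.mul_inv_cancel (by norm_num) (by norm_num), one_mul]
      _ ≤ 2 * ENNReal.ofReal (Real.exp (-(q : ℝ) ^ 21)) := by gcongr
      _ = _ := by rw [ENNReal.ofReal_mul (by norm_num)]; simp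
  have hcolP : ∀ x, P (Bcol x) ≤ ENNReal.ofReal (Real.exp (-(β * (q : ℝ) ^ 21))) := by
    intro x
    refine (S.iid.all_fail_le (labels j₀ (q ^ 7)) (S := fun b => {z | z - Y x b ∈ tube m W})
      (fun b hb b' hb' hne => disjoint_columns hm0 hWpos hCm hσ x h (q ^ 7) hb hb' hne)
      (fun b => S.hPq.2 _ _ (measurableSet_climb _ _ _))
      (fun b _ => S.hPq.local_climb _ _ _ _)
      (fun b ω => by have := S.hPq.prob ω (Y x b); exact prob_le_one) hβ ?_).trans ?_
    · intro b _
      rw [← annM_apply S.hPq _ (measurableSet_climb _ _ _), annM_climb S.hPq S.iid]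
      refine hclimb q hqq₁ _ ?_
      have h2 := le_lev_column hu0 h σ b
      have h3 : (0 : ℤ) < h := by
        have : 0 < h := by positivity
        exact_mod_cast this
      simp only [hY, lev_add]
      rw [hR]
      linarith
    · apply ENNReal.ofReal_le_ofReal
      apply Real.exp_le_exp.2
      rw [card_labels]
      have : q ^ 21 ≤ (q ^ 7) ^ (d - 1) := by
        rw [← pow_mul]
        exact Nat.pow_le_pow_right hq1' (by omega)
      have h4 : (q : ℝ) ^ 21 ≤ (((q ^ 7) ^ (d - 1) : ℕ) : ℝ) := by exact_mod_cast this
      nlinarith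
  have hsub : ∀ᵐ ω ∂P, ω ∈ {ω | ¬ ∀ x ∈ V, ENNReal.ofReal (Real.exp (-(K * (q : ℝ) ^ 20))) ≤
      Pq ω x (escape V x)} → ω ∈ ⋃ x ∈ V, (Bdrop x ∪ Bcol x) := by
    filter_upwards [S.ell] with ω hω hbad
    by_contra hcon
    simp only [Set.mem_iUnion, Set.mem_union, not_exists, not_or] at hcon
    refine hbad fun x hx => ?_
    have hnc := (hcon x hx).2
    simp only [hBcol, Set.mem_ofPred_eq, not_forall, not_lt] at hnc
    obtain ⟨b, hb, hβb⟩ := hnc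
    obtain ⟨n, hn, hn'⟩ := S.hPq.escape_ge_of_column hd0 S.η_pos hω (q ^ A) S.u m
      (by linarith) (R := R) (by positivity)
      (fun v hv => (not_le.1 (hcon v hv).1).le) hx hu0 (W := W) (h := h) (σ := σ) (Q := q ^ 7)
      (by rw [hh]; nlinarith) hb hβb
    refine le_trans ?_ hn'
    rw [← ENNReal.ofReal_pow S.η_pos.le, show (1 / 2 : ℝ≥0∞) = ENNReal.ofReal (1 / 2) by
      rw [ENNReal.ofReal_div_of_pos (by norm_num)]; simp, ← ENNReal.ofReal_mul (by norm_num),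
      ← ENNReal.ofReal_mul (pow_nonneg S.η_pos.le n)]
    apply ENNReal.ofReal_le_ofReal
    have e1 : Real.exp (-(q : ℝ)) ≤ 1 / 2 * β := by
      calc Real.exp (-(q : ℝ)) ≤ Real.exp (Real.log (β / 2)) := Real.exp_le_exp.2 (by linarith)
        _ = _ := by rw [Real.exp_log (by positivity)]; ring
    have e2 : (n : ℝ) ≤ G * (q : ℝ) ^ 20 := by
      have h5 : n ≤ (w + 1 + d * Cm) * q ^ 20 := by
        refine hn.trans ?_
        rw [hh, hσ, hW]
        have h6 : q ^ 13 ≤ q ^ 20 := Nat.pow_le_pow_right hq1' (by norm_num)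
        have h7 : q ^ 13 * q ^ 7 = q ^ 20 := by rw [← pow_add]
        calc (w + 1) * q ^ 13 + d * (Cm * q ^ 13 * q ^ 7) =
              (w + 1) * q ^ 13 + d * Cm * (q ^ 13 * q ^ 7) := by ring
          _ ≤ (w + 1) * q ^ 20 + d * Cm * q ^ 20 := by rw [h7]; gcongr
          _ = _ := by ring
      rw [hG]
      exact_mod_cast h5
    have e3 : (q : ℝ) ≤ (q : ℝ) ^ 20 := le_self_pow₀ hq1 (by norm_num)
    calc Real.exp (-(K * (q : ℝ) ^ 20)) ≤ Real.exp (-(lam * n)) * Real.exp (-(q : ℝ)) := by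
          rw [← Real.exp_add]
          apply Real.exp_le_exp.2
          rw [hK]
          nlinarith
      _ ≤ S.η ^ n * (1 / 2 * β) := by
          exact mul_le_mul (exp_neg_le_pow S.η_pos n) e1 (Real.exp_pos _).le
            (pow_nonneg S.η_pos.le n)
  calc _ ≤ P (⋃ x ∈ V, (Bdrop x ∪ Bcol x)) := measure_mono_ae hsub
    _ ≤ ∑ x ∈ V, P (Bdrop x ∪ Bcol x) := measure_biUnion_finset_le _ _
    _ ≤ ∑ x ∈ V, ENNReal.ofReal (3 * Real.exp (-(c₀ * (q : ℝ) ^ 21))) := by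
        refine Finset.sum_le_sum fun x _ => (measure_union_le _ _).trans
          ((add_le_add (hdropP x) (hcolP x)).trans ?_)
        rw [← ENNReal.ofReal_add (by positivity) (by positivity)]
        apply ENNReal.ofReal_le_ofReal
        have hq21 : (0 : ℝ) ≤ (q : ℝ) ^ 21 := by positivity
        have a1 : Real.exp (-(q : ℝ) ^ 21) ≤ Real.exp (-(c₀ * (q : ℝ) ^ 21)) :=
          Real.exp_le_exp.2 (by nlinarith [min_le_left 1 β])
        have a2 : Real.exp (-(β * (q : ℝ) ^ 21)) ≤ Real.exp (-(c₀ * (q : ℝ) ^ 21)) :=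
          Real.exp_le_exp.2 (by nlinarith [min_le_right 1 β])
        linarith
    _ ≤ _ := by
        rw [Finset.sum_const, nsmul_eq_mul, ← ENNReal.ofReal_natCast,
          ← ENNReal.ofReal_mul (by positivity)]
        apply ENNReal.ofReal_le_ofReal
        have e3 : (3 : ℝ) ≤ Real.exp 2 := by linarith [Real.add_one_le_exp (2 : ℝ)]
        calc (V.card : ℝ) * (3 * Real.exp (-(c₀ * (q : ℝ) ^ 21))) ≤
              Real.exp q * (Real.exp 2 * Real.exp (-(c₀ * (q : ℝ) ^ 21))) := by gcongr
          _ ≤ _ := by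
              rw [← Real.exp_add, ← Real.exp_add]
              apply Real.exp_le_exp.2
              have b1 : 6 ≤ c₀ * q := by
                rw [div_le_iff₀ hc₀pos] at hqc
                linarith
              have b2 : (q : ℝ) ≤ (q : ℝ) ^ 20 := le_self_pow₀ hq1 (by norm_num)
              have b3 : (c₀ * q) * (q : ℝ) ^ 20 = c₀ * (q : ℝ) ^ 21 := by ring
              nlinarith

end EscapeBound

section TimeTail

variable {d : ℕ} {P : Measure (Env d)} {Pq : Env d → Site d → Measure (Path d)}

lemma RegIn.tau_spec {u : Fin d → ℤ} {r : ℕ} {f : Path d} (h : RegIn u r f) :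
    f ∈ stayTill (box d r) (tau u f) := by
  obtain ⟨t, h1, h2, h3⟩ := h
  exact fun i hi => h3 i (hi.trans (tau_le h1 h2))

lemma IsQuenchedFamily.stayTill_le_exp (hPq : IsQuenchedFamily Pq) {ω : Env d}
    {V : Finset (Site d)} {κ : ℝ} {M : ℕ} (hM : Real.exp (2 * κ) ≤ M)
    (he : ∀ x ∈ V, ENNReal.ofReal (Real.exp (-κ)) ≤ Pq ω x (escape V x)) {a : ℝ}
    (hV : (V.card : ℝ) ≤ Real.exp a) (y : Site d) :
    Pq ω y (stayTill V M) ≤ ENNReal.ofReal (Real.exp (a - κ)) := by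
  have := hPq.prob ω y
  have h1 := hPq.occupation_le he y M
  have hpt : Pq ω y (stayTill V M) ≠ ⊤ := measure_ne_top _ _
  set p := Pq ω y (stayTill V M) with hp
  rw [← ENNReal.ofReal_toReal hpt, ← ENNReal.ofReal_mul (Real.exp_pos _).le,
    ← ENNReal.ofReal_natCast, ← ENNReal.ofReal_natCast, ← ENNReal.ofReal_mul (Nat.cast_nonneg _),
    ENNReal.ofReal_le_ofReal_iff (Nat.cast_nonneg _)] at h1
  rw [← ENNReal.ofReal_toReal hpt]
  apply ENNReal.ofReal_le_ofReal
  have hp0 : 0 ≤ p.toReal := ENNReal.toReal_nonneg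
  have h2 : Real.exp κ * p.toReal ≤ Real.exp a := by
    calc Real.exp κ * p.toReal = Real.exp (2 * κ) * (Real.exp (-κ) * p.toReal) := by
          rw [← mul_assoc, ← Real.exp_add]; congr 2; ring
      _ ≤ ((M + 1 : ℕ) : ℝ) * (Real.exp (-κ) * p.toReal) := by
          gcongr
          push_cast
          linarith
      _ ≤ _ := h1.trans hV
  rw [Real.exp_sub, le_div_iff₀ (Real.exp_pos _)]
  linarith

lemma Setup.exists_tau_bound (hd : 4 ≤ d) (S : Setup P Pq) :
    ∃ K c C : ℝ, 0 < K ∧ 0 < c ∧ 0 < C ∧ ∃ q₀ : ℕ, ∀ q ≥ q₀,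
      annM P Pq 0 {f | Real.exp (K * (q : ℝ) ^ 20) < tau S.u f} ≤
        ENNReal.ofReal (C * Real.exp (-(c * (q : ℝ) ^ 21))) := by
  have hd0 : 0 < d := by omega
  have hP := S.prob
  obtain ⟨C, b, κ, hC, hb, hκ, hreg⟩ := S.exists_regIn_bound hd0
  obtain ⟨A, hA⟩ := exists_nat_gt (22 / κ)
  obtain ⟨K₁, c, hK₁, hc, q₁, hesc⟩ := S.exists_escape_bound hd A
  have hlarge : ∀ r : ℝ, ∀ᶠ q : ℕ in atTop, r ≤ q := fun r =>
    tendsto_natCast_atTop_atTop.eventually_ge_atTop r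
  set K := K₁ + 2 with hK
  obtain ⟨q₂, hq₂⟩ := eventually_atTop.1 ((eventually_card_box_le d A).and ((hlarge 1).and
    (hlarge (1 / b))))
  refine ⟨3 * K, min c 1, C + 2, by positivity, by positivity, by positivity, max q₁ q₂,
    fun q hq => ?_⟩
  obtain ⟨hcard, hq1, hqb⟩ := hq₂ q ((le_max_right _ _).trans hq)
  have hq1' : 1 ≤ q := by exact_mod_cast hq1
  have hqq : (q : ℝ) ≤ (q : ℝ) ^ 20 := le_self_pow₀ hq1 (by norm_num)
  have hesc' := hesc q ((le_max_left _ _).trans hq)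
  set V := box d (q ^ A) with hV
  set M := ⌈Real.exp (2 * (K * (q : ℝ) ^ 20))⌉₊ with hM
  set E : Set (Env d) := {ω | ¬ ∀ x ∈ V, ENNReal.ofReal (Real.exp (-(K₁ * (q : ℝ) ^ 20))) ≤
    Pq ω x (escape V x)} with hE
  have hstay : annM P Pq 0 (stayTill V (q * M)) ≤
      P E + ENNReal.ofReal (Real.exp (-(q : ℝ) ^ 21)) := by
    rw [annM_apply S.hPq 0 (upTo_stayTill V _).measurableSet]
    have hEm : MeasurableSet E := by
      have : E = ⋃ x ∈ V, {ω | ENNReal.ofReal (Real.exp (-(K₁ * (q : ℝ) ^ 20))) ≤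
          Pq ω x (escape V x)}ᶜ := by
        ext ω
        simp only [hE, Set.mem_ofPred_eq, not_forall, Set.mem_iUnion, Set.mem_compl_iff]
      rw [this]
      exact Finset.measurableSet_biUnion V fun x _ =>
        (measurableSet_le measurable_const (S.hPq.2 x _ (measurableSet_escape V x))).compl
    calc ∫⁻ ω, Pq ω 0 (stayTill V (q * M)) ∂P ≤
          ∫⁻ ω, (E.indicator (fun _ => 1) ω + ENNReal.ofReal (Real.exp (-(q : ℝ) ^ 21))) ∂P := by
          refine lintegral_mono fun ω => ?_
          by_cases hω : ω ∈ E
          · have := S.hPq.prob ω 0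
            rw [Set.indicator_of_mem hω]
            exact prob_le_one.trans le_self_add
          · simp only [hE, Set.mem_ofPred_eq, not_not] at hω
            refine le_trans ?_ le_add_self
            have h1 : ∀ y, Pq ω y (stayTill V M) ≤ ENNReal.ofReal (Real.exp (-(q : ℝ) ^ 20)) := by
              intro y
              refine (S.hPq.stayTill_le_exp (κ := K * (q : ℝ) ^ 20) (Nat.le_ceil _) (fun x hx => ?_)
                hcard y).trans (ENNReal.ofReal_le_ofReal (Real.exp_le_exp.2 ?_))
              · refine le_trans (ENNReal.ofReal_le_ofReal (Real.exp_le_exp.2 ?_)) (hω x hx)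
                rw [hK]; nlinarith
              · rw [hK]; nlinarith
            refine (S.hPq.stayTill_pow_le h1 0 q).trans ?_
            rw [← ENNReal.ofReal_pow (Real.exp_pos _).le, ← Real.exp_nat_mul]
            apply le_of_eq
            congr 2
            ring
      _ = _ := by
          rw [lintegral_add_right _ measurable_const, lintegral_indicator_const hEm]
          simp
  have hMle : ((q * M : ℕ) : ℝ) ≤ Real.exp (3 * K * (q : ℝ) ^ 20) := by
    have h1 : (M : ℝ) ≤ 2 * Real.exp (2 * (K * (q : ℝ) ^ 20)) := by
      have h2 : (M : ℝ) < Real.exp (2 * (K * (q : ℝ) ^ 20)) + 1 :=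
        Nat.ceil_lt_add_one (Real.exp_pos _).le
      have h3 : (1 : ℝ) ≤ Real.exp (2 * (K * (q : ℝ) ^ 20)) := Real.one_le_exp (by positivity)
      linarith
    have h4 : 2 * (q : ℝ) ≤ Real.exp (2 * q) := by linarith [Real.add_one_le_exp (2 * (q : ℝ))]
    push_cast
    calc (q : ℝ) * M ≤ q * (2 * Real.exp (2 * (K * (q : ℝ) ^ 20))) := by gcongr
      _ = 2 * q * Real.exp (2 * (K * (q : ℝ) ^ 20)) := by ring
      _ ≤ Real.exp (2 * q) * Real.exp (2 * (K * (q : ℝ) ^ 20)) := by gcongr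
      _ ≤ _ := by
          rw [← Real.exp_add]
          apply Real.exp_le_exp.2
          have : 2 * (q : ℝ) ≤ K * (q : ℝ) ^ 20 := by rw [hK]; nlinarith
          linarith
  have hsub : {f : Path d | Real.exp (3 * K * (q : ℝ) ^ 20) < tau S.u f} ⊆
      {f | ¬ RegIn S.u (q ^ A) f} ∪ stayTill V (q * M) := by
    intro f hf
    by_cases hreg : RegIn S.u (q ^ A) f
    · right
      refine stayTill_anti V ?_ hreg.tau_spec
      have : ((q * M : ℕ) : ℝ) < tau S.u f := lt_of_le_of_lt hMle hf
      exact_mod_cast this.le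
    · exact Or.inl hreg
  have hregq : annM P Pq 0 {f | ¬ RegIn S.u (q ^ A) f} ≤
      ENNReal.ofReal (C * Real.exp (-(q : ℝ) ^ 21)) := by
    refine (hreg (q ^ A) (Nat.one_le_pow _ _ hq1')).trans (ENNReal.ofReal_le_ofReal ?_)
    gcongr
    push_cast
    rw [← Real.rpow_natCast (q : ℝ) A, ← Real.rpow_mul (by positivity)]
    have h1 : (q : ℝ) ^ 22 ≤ (q : ℝ) ^ ((A : ℝ) * κ) := by
      rw [← Real.rpow_natCast]
      apply Real.rpow_le_rpow_of_exponent_le hq1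
      rw [div_lt_iff₀ hκ] at hA
      push_cast
      linarith
    have h2 : 1 ≤ b * q := by
      rw [div_le_iff₀ hb] at hqb
      linarith
    calc (q : ℝ) ^ 21 ≤ (b * q) * (q : ℝ) ^ 21 := le_mul_of_one_le_left (by positivity) h2
      _ = b * (q : ℝ) ^ 22 := by ring
      _ ≤ _ := by gcongr
  refine (measure_mono hsub).trans ((measure_union_le _ _).trans
    ((add_le_add hregq (hstay.trans (add_le_add hesc' le_rfl))).trans ?_))
  rw [← ENNReal.ofReal_add (by positivity) (by positivity),
    ← ENNReal.ofReal_add (by positivity) (by positivity)]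
  apply ENNReal.ofReal_le_ofReal
  have hq21 : (0 : ℝ) ≤ (q : ℝ) ^ 21 := by positivity
  have a1 : Real.exp (-(q : ℝ) ^ 21) ≤ Real.exp (-(min c 1 * (q : ℝ) ^ 21)) :=
    Real.exp_le_exp.2 (by nlinarith [min_le_right c 1])
  have a2 : Real.exp (-(c * (q : ℝ) ^ 21)) ≤ Real.exp (-(min c 1 * (q : ℝ) ^ 21)) :=
    Real.exp_le_exp.2 (by nlinarith [min_le_left c 1])
  nlinarith

lemma Setup.tau_supSmall (hd : 4 ≤ d) (S : Setup P Pq) :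
    SupSmall (annM P Pq 0) fun N => {f | N < tau S.u f} := by
  have hP := S.prob
  have hprob := isProbabilityMeasure_annM (P := P) S.hPq (0 : Site d)
  obtain ⟨K, c, C, hK, hc, hC, q₀, hb⟩ := S.exists_tau_bound hd
  intro p
  obtain ⟨q₁, hq₁⟩ := exists_nat_gt (K * p * 2 ^ 20 / c)
  set q₂ := max q₀ (max q₁ 1) with hq₂
  refine ⟨C + Real.exp (K * (q₂ : ℝ) ^ 20) ^ p, by positivity, fun N hN => ?_⟩
  have hNpos : (0 : ℝ) < N := by exact_mod_cast hN
  by_cases hNq : (N : ℝ) < Real.exp (K * (q₂ : ℝ) ^ 20)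
  · refine prob_le_one.trans ?_
    rw [← ENNReal.ofReal_one]
    apply ENNReal.ofReal_le_ofReal
    rw [one_le_div (by positivity)]
    have : (N : ℝ) ^ p ≤ Real.exp (K * (q₂ : ℝ) ^ 20) ^ p := by gcongr
    linarith
  · push Not at hNq
    classical
    have hmono : ∀ a b : ℕ, a ≤ b → Real.exp (K * (a : ℝ) ^ 20) ≤ Real.exp (K * (b : ℝ) ^ 20) := by
      intro a b hab
      gcongr
    have hex : ∃ q : ℕ, (N : ℝ) < Real.exp (K * ((q + 1 : ℕ) : ℝ) ^ 20) := by
      obtain ⟨q, hq⟩ := exists_nat_gt ((N : ℝ) / K)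
      refine ⟨q, ?_⟩
      rw [div_lt_iff₀ hK] at hq
      have h1 : (q : ℝ) ≤ ((q + 1 : ℕ) : ℝ) ^ 20 := by
        have : (1 : ℝ) ≤ ((q + 1 : ℕ) : ℝ) := by push_cast; linarith [Nat.cast_nonneg (α := ℝ) q]
        refine le_trans ?_ (le_self_pow₀ this (by norm_num))
        push_cast; linarith
      have h2 := Real.add_one_le_exp (K * ((q + 1 : ℕ) : ℝ) ^ 20)
      nlinarith
    set q := Nat.find hex with hq
    have hqs : (N : ℝ) < Real.exp (K * ((q + 1 : ℕ) : ℝ) ^ 20) := Nat.find_spec hex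
    have hqq₂ : q₂ ≤ q := by
      by_contra hcon
      push Not at hcon
      exact absurd (hqs.trans_le (hmono (q + 1) q₂ hcon)) (not_lt.2 hNq)
    have hq1 : 1 ≤ q := ((le_max_right _ _).trans (le_max_right _ _)).trans hqq₂
    have hle : Real.exp (K * (q : ℝ) ^ 20) ≤ N := by
      have := Nat.find_min hex (show q - 1 < Nat.find hex by omega)
      rw [show q - 1 + 1 = q by omega] at this
      exact not_lt.1 this
    have hsub : {f : Path d | N < tau S.u f} ⊆ {f | Real.exp (K * (q : ℝ) ^ 20) < tau S.u f} := by
      intro f hf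
      simp only [Set.mem_ofPred_eq] at *
      exact lt_of_le_of_lt hle (by exact_mod_cast hf)
    refine (measure_mono hsub).trans ((hb q ((le_max_left _ _).trans hqq₂)).trans
      (ENNReal.ofReal_le_ofReal ?_))
    rw [le_div_iff₀ (by positivity)]
    have hNp : (N : ℝ) ^ p ≤ Real.exp (c * (q : ℝ) ^ 21) := by
      calc (N : ℝ) ^ p ≤ Real.exp (K * ((q + 1 : ℕ) : ℝ) ^ 20) ^ p := by gcongr
        _ = Real.exp (K * p * ((q + 1 : ℕ) : ℝ) ^ 20) := by
            rw [← Real.exp_nat_mul]; congr 1; ring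
        _ ≤ _ := by
            apply Real.exp_le_exp.2
            have h1 : ((q + 1 : ℕ) : ℝ) ≤ 2 * q := by
              have : (1 : ℝ) ≤ q := by exact_mod_cast hq1
              push_cast; linarith
            have h2 : K * p * 2 ^ 20 ≤ c * q := by
              rw [div_lt_iff₀ hc] at hq₁
              have : (q₁ : ℝ) ≤ q := by
                exact_mod_cast ((le_max_left _ _).trans (le_max_right _ _)).trans hqq₂
              nlinarith
            calc K * p * ((q + 1 : ℕ) : ℝ) ^ 20 ≤ K * p * (2 * q) ^ 20 := by gcongr
              _ = K * p * 2 ^ 20 * (q : ℝ) ^ 20 := by ring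
              _ ≤ c * q * (q : ℝ) ^ 20 := by gcongr
              _ = _ := by ring
    calc C * Real.exp (-(c * (q : ℝ) ^ 21)) * (N : ℝ) ^ p ≤
          C * Real.exp (-(c * (q : ℝ) ^ 21)) * Real.exp (c * (q : ℝ) ^ 21) := by gcongr
      _ = C := by rw [mul_assoc, ← Real.exp_add]; simp
      _ ≤ _ := by linarith [pow_pos (Real.exp_pos (K * (q₂ : ℝ) ^ 20)) p]

/-- elapsed time, as a functional of the path. -/
def timeF (t : ℕ) (_ : Path d) : ℝ := t

lemma cocycle_timeF : Cocycle (timeF (d := d)) :=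
  ⟨fun n f g _ => rfl, fun s t f => by simp [timeF]⟩

lemma blockMax_timeF (n : ℕ) (f : Path d) : blockMax timeF n f = n := by
  refine le_antisymm (Finset.sup'_le _ _ fun t ht => ?_) ?_
  · simp only [timeF, Nat.abs_cast]
    exact_mod_cast Nat.lt_succ_iff.1 (Finset.mem_range.1 ht)
  · have := abs_le_blockMax (timeF (d := d)) (le_refl n) f
    simpa [timeF] using this

lemma Setup.timeF_supSmall (hd : 4 ≤ d) (S : Setup P Pq) :
    SupSmall (annM P Pq 0) fun N => {f | (N : ℝ) < |blockMax timeF (tau S.u f) f|} := by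
  refine (S.tau_supSmall hd).mono_ae (Eventually.of_forall fun f N _ hf => ?_)
  simp only [Set.mem_ofPred_eq, blockMax_timeF, Nat.abs_cast] at *
  exact_mod_cast hf

lemma Setup.timeF_supTail (hd : 4 ≤ d) (S : Setup P Pq) :
    SupTail (upLaw P Pq S.u) fun f => blockMax timeF (tau S.u f) f :=
  S.supSmall_upLaw (by omega) (S.timeF_supSmall hd)

end TimeTail

section Follows

variable {d : ℕ} {P : Measure (Env d)} {Pq : Env d → Site d → Measure (Path d)}

/-- up to some time `T`, the path and the clock follow a linear profile for `n` units, up to an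
error `D`. -/
def Follows {d : ℕ} (m : Fin d → ℝ) (s D : ℝ) (n : ℕ) (f : Path d) : Prop :=
  ∃ T : ℕ, (∀ t ≤ T, ∃ k ≤ n, (∀ i, |(f t i : ℝ) - k * m i| ≤ D) ∧ |(t : ℝ) - k * s| ≤ D) ∧
    ∀ i, |(f T i : ℝ) - n * m i| ≤ D

/-- the mean displacement over a block. -/
def meanStep {d : ℕ} (P : Measure (Env d)) (Pq : Env d → Site d → Measure (Path d))
    (u : Fin d → ℤ) : Fin d → ℝ := fun i => blockMean P Pq u (coordF i)

/-- the mean duration of a block. -/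
def meanTime {d : ℕ} (P : Measure (Env d)) (Pq : Env d → Site d → Measure (Path d))
    (u : Fin d → ℤ) : ℝ := blockMean P Pq u timeF

lemma meanTime_nonneg (u : Fin d → ℤ) : 0 ≤ meanTime P Pq u :=
  integral_nonneg fun _ => Nat.cast_nonneg _

lemma follows_of_track {u : Fin d → ℤ} {m : Fin d → ℝ} {s D : ℝ} {n N : ℕ} {f : Path d}
    (h0 : f 0 = 0) (hD : 0 ≤ D)
    (ht : Track u (fun o : Option (Fin d) => o.elim timeF coordF) (fun o => o.elim s m) D n
      (renew u f))
    (hc : ∀ i, |blockMax (coordF i) (tau u f) f| ≤ N) (hτ : tau u f ≤ N) :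
    Follows m s (D + N) n f := by
  obtain ⟨T, h1, h2, -⟩ := ht
  have hcoord : ∀ i, ∀ t ≤ tau u f, |(f t i : ℝ)| ≤ N := fun i t ht => by
    have h3 := (abs_le_blockMax (coordF i) ht f).trans ((le_abs_self _).trans (hc i))
    simpa [coordF, h0] using h3
  have hN : (tau u f : ℝ) ≤ N := by exact_mod_cast hτ
  have hsplit : ∀ (v : ℕ) (i : Fin d), (f (tau u f + v) i : ℝ) =
      f (tau u f) i + coordF i v (renew u f) := fun v i => by
    simp [coordF, renew]
  refine ⟨tau u f + T, fun t ht => ?_, fun i => ?_⟩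
  · rcases le_total t (tau u f) with hle | hle
    · have htN : (t : ℝ) ≤ N := (Nat.cast_le.2 hle).trans hN
      refine ⟨0, Nat.zero_le _, fun i => ?_, ?_⟩
      · have := hcoord i t hle
        simp only [Nat.cast_zero, zero_mul, sub_zero]
        linarith
      · simp only [Nat.cast_zero, zero_mul, sub_zero, Nat.abs_cast]
        linarith
    · obtain ⟨v, rfl⟩ := Nat.exists_eq_add_of_le hle
      obtain ⟨k, hk, hb⟩ := h1 v (by omega)
      refine ⟨k, hk, fun i => ?_, ?_⟩
      · have h3 := hb (some i)
        have h4 := hcoord i _ le_rfl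
        simp only [Option.elim] at h3
        rw [hsplit]
        rw [abs_le] at *
        constructor <;> linarith
      · have h3 := hb none
        simp only [Option.elim, timeF] at h3
        push_cast
        rw [abs_le] at *
        have : (0 : ℝ) ≤ tau u f := Nat.cast_nonneg _
        constructor <;> linarith
  · have h3 := h2 (some i)
    have h4 := hcoord i _ le_rfl
    simp only [Option.elim] at h3
    rw [hsplit]
    rw [abs_le] at *
    constructor <;> linarith

lemma Setup.exists_follows (hd : 4 ≤ d) (S : Setup P Pq) (K : ℕ) : ∃ C : ℝ, 0 < C ∧
    SupSmall (annM P Pq 0) fun N => {f | ¬ Follows (meanStep P Pq S.u) (meanTime P Pq S.u)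
      (N * Real.log N ^ 2 + C + 2 * N) (K * N ^ 2) f} := by
  have hd0 : 0 < d := by omega
  obtain ⟨C, hC, hb⟩ := (S.renewal_upLaw hd0).exists_track
    (A := fun o : Option (Fin d) => o.elim timeF coordF)
    (by rintro (_ | i); exacts [cocycle_timeF, cocycle_coordF i])
    (by rintro (_ | i); exacts [S.timeF_supTail hd, S.coordF_supTail hd0 i]) K
  have hR := S.renewal_annM hd0
  refine ⟨C, hC, ?_⟩
  have hb' : SupSmall (annM P Pq 0) fun N => renew S.u ⁻¹' {f | ¬ Track S.u
      (fun o : Option (Fin d) => o.elim timeF coordF)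
      (fun o => blockMean P Pq S.u (o.elim timeF coordF))
      (N * Real.log N ^ 2 + C + N) (K * N ^ 2) f} := fun p => by
    obtain ⟨C', hC', h⟩ := hb p
    refine ⟨C', hC', fun N hN => le_trans ?_ (h N hN)⟩
    rw [← hR.map_renew]
    exact Measure.le_map_apply (measurable_renew _).aemeasurable _
  refine ((hb'.union (SupSmall.iUnion fun i => S.coordF_supSmall hd0 i)).union
    (S.tau_supSmall hd)).mono_ae ?_
  filter_upwards [hR.start] with f h0 N hN hf
  by_contra hcon
  simp only [Set.mem_union, Set.mem_preimage, Set.mem_ofPred_eq, Set.mem_iUnion, not_or,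
    not_exists, not_lt, not_not] at hcon hf
  obtain ⟨⟨h1, h2⟩, h3⟩ := hcon
  apply hf
  have h4 := follows_of_track (D := N * Real.log N ^ 2 + C + N) (m := meanStep P Pq S.u) (s := meanTime P Pq S.u)
    h0 (by positivity) (by
      convert h1 using 1
      funext o
      cases o <;> rfl) h2 h3
  convert h4 using 1
  ring

end Follows

section Direction

variable {d : ℕ} {P : Measure (Env d)} {Pq : Env d → Site d → Measure (Path d)}

lemma eventually_error_le (C : ℝ) {ε : ℝ} (hε : 0 < ε) :
    ∀ᶠ N : ℕ in atTop, N * Real.log N ^ 2 + C + 2 * N ≤ ε * (N : ℝ) ^ 2 := by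
  filter_upwards [eventually_log_sq_le (1 / ε) ((|C| + 2) / ε), eventually_ge_atTop 1] with N h hN
  have hN1 : (1 : ℝ) ≤ N := by exact_mod_cast hN
  have h1 : Real.log N ^ 2 + (|C| + 2) ≤ ε * N := by
    have := mul_le_mul_of_nonneg_left h hε.le
    field_simp at this
    linarith
  have h2 : |C| ≤ |C| * N := le_mul_of_one_le_right (abs_nonneg _) hN1
  calc N * Real.log N ^ 2 + C + 2 * N ≤ N * (Real.log N ^ 2 + (|C| + 2)) := by
        linarith [le_abs_self C]
    _ ≤ N * (ε * N) := by gcongr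
    _ = _ := by ring

lemma SupSmall.ae_eventually {Ω : Type*} [MeasurableSpace Ω] {μ : Measure Ω} {B : ℕ → Set Ω}
    (h : SupSmall μ B) : ∀ᵐ x ∂μ, ∀ᶠ N in atTop, x ∉ B N := by
  obtain ⟨C, hC, hb⟩ := h 2
  have hs : ∑' N : ℕ, μ (B (N + 1)) ≠ ⊤ := by
    have h0 : Summable fun N : ℕ => C / (N : ℝ) ^ 2 := by
      simpa [div_eq_mul_inv] using (Real.summable_one_div_nat_pow.2 one_lt_two).mul_left C
    have hsum : Summable fun N : ℕ => C / ((N + 1 : ℕ) : ℝ) ^ 2 :=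
      (summable_nat_add_iff (f := fun N : ℕ => C / (N : ℝ) ^ 2) 1).2 h0
    refine ne_top_of_le_ne_top ?_ (ENNReal.tsum_le_tsum fun N => hb (N + 1) (by omega))
    rw [← ENNReal.ofReal_tsum_of_nonneg (fun N => by positivity) hsum]
    exact ENNReal.ofReal_ne_top
  filter_upwards [ae_eventually_notMem hs] with x hx
  exact (eventually_atTop.1 hx).elim fun a ha => eventually_atTop.2 ⟨a + 1, fun N hN => by
    have := ha (N - 1) (by omega)
    rwa [show N - 1 + 1 = N by omega] at this⟩

lemma continuous_norm2R : Continuous (norm2R : (Fin d → ℝ) → ℝ) := by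
  unfold norm2R
  fun_prop

lemma norm2R_div (v : Fin d → ℝ) {c : ℝ} (hc : 0 < c) :
    norm2R (fun i => v i / c) = norm2R v / c := by
  unfold norm2R
  simp_rw [div_pow, ← Finset.sum_div]
  rw [Real.sqrt_div' _ (sq_nonneg c), Real.sqrt_sq hc.le]

lemma DirSpeed.ae (hPq : IsQuenchedFamily Pq) {ϑ : Fin d → ℝ} (h : DirSpeed P Pq ϑ) :
    ∀ᵐ f ∂(annM P Pq 0), Tendsto (fun n => fun i => toR (f n) i / norm2R (toR (f n)))
      atTop (nhds ϑ) := by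
  have hm : MeasurableSet {f : Path d |
      Tendsto (fun n => fun i => toR (f n) i / norm2R (toR (f n))) atTop (nhds ϑ)} :=
    measurableSet_tendsto _ fun n => (Measurable.of_discrete
      (f := fun x : Site d => fun i => toR x i / norm2R (toR x))).comp (measurable_pi_apply n)
  rw [ae_iff]
  exact (ann_eq_annM hPq 0 hm.compl).symm.trans h

lemma norm2R_pos_of_ne {v : Fin d → ℝ} {j : Fin d} (h : v j ≠ 0) : 0 < norm2R v :=
  Real.sqrt_pos.2 (lt_of_lt_of_le (by positivity)
    (Finset.single_le_sum (f := fun i => v i ^ 2) (fun i _ => sq_nonneg _) (Finset.mem_univ j)))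

lemma Setup.meanStep_eq (hd : 4 ≤ d) (S : Setup P Pq) {ϑ : Fin d → ℝ} (h : DirSpeed P Pq ϑ) :
    0 < norm2R (meanStep P Pq S.u) ∧
      ∀ i, meanStep P Pq S.u i = norm2R (meanStep P Pq S.u) * ϑ i := by
  have hd0 : 0 < d := by omega
  have hlev := S.one_le_mean_lev hd0
  obtain ⟨C, hC, hb⟩ := S.exists_follows hd 1
  have hR := S.renewal_annM hd0
  have hprob := hR.prob
  set m := meanStep P Pq S.u with hm
  obtain ⟨j, hj⟩ : ∃ j, m j ≠ 0 := by
    by_contra hcon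
    push Not at hcon
    have : ∑ i, (S.u i : ℝ) * blockMean P Pq S.u (coordF i) = 0 :=
      Finset.sum_eq_zero fun i _ => by
        rw [show blockMean P Pq S.u (coordF i) = m i from rfl, hcon i, mul_zero]
    linarith
  have hpos : 0 < norm2R m := norm2R_pos_of_ne hj
  refine ⟨hpos, ?_⟩
  obtain ⟨f, hf1, hf2, hf3, hf4⟩ := (((h.ae S.hPq).and (hb.ae_eventually.and
    (hR.nn.and hR.start)))).exists
  simp only [Set.mem_ofPred_eq, not_not] at hf2
  have hex : ∀ N : ℕ, ∃ T : ℕ, Follows m (meanTime P Pq S.u)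
      (N * Real.log N ^ 2 + C + 2 * N) (1 * N ^ 2) f → ∀ i, |(f T i : ℝ) - (1 * N ^ 2 : ℕ) * m i| ≤
        N * Real.log N ^ 2 + C + 2 * N := fun N => by
    by_cases hN : Follows m (meanTime P Pq S.u) (N * Real.log N ^ 2 + C + 2 * N) (1 * N ^ 2) f
    · exact hN.imp fun T hT _ => hT.2
    · exact ⟨0, fun h => absurd h hN⟩
  choose T hT using hex
  have hlim : ∀ i, Tendsto (fun N : ℕ => toR (f (T N)) i / (N : ℝ) ^ 2) atTop (nhds (m i)) := by
    intro i
    rw [Metric.tendsto_atTop']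
    intro ε hε
    obtain ⟨N₀, hN₀⟩ := eventually_atTop.1
      ((hf2.and (eventually_error_le C (half_pos hε))).and (eventually_ge_atTop 1))
    refine ⟨N₀, fun N hN => ?_⟩
    obtain ⟨⟨h1, h2⟩, h3⟩ := hN₀ N hN.le
    have hN1 : (0 : ℝ) < (N : ℝ) ^ 2 := by positivity
    have h4 := (hT N h1 i).trans h2
    push_cast at h4
    rw [one_mul] at h4
    have : toR (f (T N)) i / (N : ℝ) ^ 2 - m i = ((f (T N) i : ℝ) - (N : ℝ) ^ 2 * m i) / (N : ℝ) ^ 2 := by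
      rw [toR]; field_simp
    rw [Real.dist_eq, this, abs_div, abs_of_pos hN1, div_lt_iff₀ hN1]
    nlinarith
  have hTtop : Tendsto T atTop atTop := by
    rw [← tendsto_natCast_atTop_iff (R := ℝ)]
    have h1 : Tendsto (fun N : ℕ => |toR (f (T N)) j / (N : ℝ) ^ 2| * (N : ℝ) ^ 2) atTop atTop :=
      (hlim j).abs.pos_mul_atTop (abs_pos.2 hj)
        ((tendsto_pow_atTop two_ne_zero).comp tendsto_natCast_atTop_atTop)
    refine tendsto_atTop_mono' _ ?_ h1
    filter_upwards [eventually_ge_atTop 1] with N hN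
    have hN1 : (0 : ℝ) < (N : ℝ) ^ 2 := by positivity
    rw [abs_div, abs_of_pos hN1, div_mul_cancel₀ _ hN1.ne', toR]
    have := hf3.coord_le 0 (T N) j
    simp only [zero_add, hf4, Pi.zero_apply, sub_zero] at this
    exact_mod_cast this
  have hnorm : Tendsto (fun N : ℕ => norm2R (toR (f (T N))) / (N : ℝ) ^ 2) atTop (nhds (norm2R m)) := by
    have h1 := (continuous_norm2R.tendsto m).comp (tendsto_pi_nhds.2 hlim)
    refine h1.congr' ?_
    filter_upwards [eventually_ge_atTop 1] with N hN
    exact norm2R_div _ (by positivity)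
  intro i
  have h1 := (hlim i).div hnorm hpos.ne'
  have h2 := (tendsto_pi_nhds.1 hf1 i).comp hTtop
  have h3 : m i / norm2R m = ϑ i := by
    refine tendsto_nhds_unique (h1.congr' ?_) h2
    filter_upwards [eventually_ge_atTop 1] with N hN
    have hN1 : (N : ℝ) ^ 2 ≠ 0 := by positivity
    simp only [Pi.div_apply, Function.comp_apply]
    rw [div_div_div_cancel_right₀ hN1]
  rw [← h3]
  field_simp

end Direction

section Exit

variable {d : ℕ}

lemma firstCoord_eq (hd : 0 < d) (x : Site d) : firstCoord x = x ⟨0, hd⟩ := by simp [firstCoord, hd]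

lemma firstCoordR_eq (hd : 0 < d) (v : Fin d → ℝ) : firstCoordR v = v ⟨0, hd⟩ := by
  simp [firstCoordR, hd]

lemma norm1_stepVec (s : StepIdx d) : norm1 (stepVec s) = 1 := by
  have h : ∀ j, |stepVec s j| = if j = s.1 then 1 else 0 := fun j => by
    unfold stepVec
    split_ifs <;> simp
  simp [norm1, h]

lemma NN.translate {f : Path d} (hf : NN f) (z : Site d) : NN (translate z f) := fun n => by
  obtain ⟨s, hs⟩ := hf n
  exact ⟨s, by simp [RWRE.translate, hs, add_assoc]⟩

lemma mem_paraBdry_of_step {ϑ : Fin d → ℝ} {z : Site d} {N : ℕ} {f : Path d} (hf : NN f) {t : ℕ}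
    (h1 : f t ∈ para ϑ z N) (h2 : f (t + 1) ∉ para ϑ z N) : f (t + 1) ∈ paraBdry ϑ z N := by
  obtain ⟨s, hs⟩ := hf t
  exact ⟨h2, f t, h1, by rw [hs, add_sub_cancel_left, norm1_stepVec]⟩

lemma hitTime_paraBdry_le {ϑ : Fin d → ℝ} {z : Site d} {N : ℕ} {f : Path d} (hf : NN f)
    (h0 : f 0 ∈ para ϑ z N) {T : ℕ} (hT : f T ∉ para ϑ z N) : hitTime (paraBdry ϑ z N) f ≤ T := by
  classical
  have hex : ∃ t, f t ∉ para ϑ z N := ⟨T, hT⟩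
  have hne : Nat.find hex ≠ 0 := fun h => (h ▸ Nat.find_spec hex) h0
  obtain ⟨t, ht⟩ := Nat.exists_eq_succ_of_ne_zero hne
  have h1 : f t ∈ para ϑ z N := not_not.1 (Nat.find_min hex (by omega))
  have h2 := Nat.find_spec hex
  rw [ht] at h2
  refine (Nat.sInf_le (mem_paraBdry_of_step hf h1 h2)).trans ?_
  rw [← Nat.succ_eq_add_one, ← ht]
  exact Nat.find_min' hex hT

lemma paraMid_subset_para (ϑ : Fin d → ℝ) (z : Site d) (N : ℕ) : paraMid ϑ z N ⊆ para ϑ z N := by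
  rintro x ⟨h1, h2⟩
  exact ⟨by linarith [abs_nonneg (firstCoord (x - z))], fun i => by
    linarith [h2 i, abs_nonneg (((x - z) i : ℝ) - (firstCoord (x - z) : ℝ) / firstCoordR ϑ * ϑ i)]⟩

lemma hitTime_eq {A : Set (Site d)} {f : Path d} {t : ℕ} (h1 : f t ∈ A) (h2 : ∀ r < t, f r ∉ A) :
    hitTime A f = t := by
  refine le_antisymm (Nat.sInf_le h1) (le_csInf ⟨t, h1⟩ fun r hr => ?_)
  by_contra hcon
  exact h2 r (not_le.1 hcon) hr

lemma Follows.exists_exit {ϑ m : Fin d → ℝ} {a s D : ℝ} {N n : ℕ} {z : Site d} {f : Path d}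
    (hF : Follows m s D n f) (hd : 0 < d) (ha : 0 < a) (hm : ∀ i, m i = a * ϑ i)
    (hϑ : 0 < firstCoordR ϑ) (hz : z ∈ paraMid ϑ 0 N) (hf : NN f) (h0 : f 0 = 0)
    (hn : 2 * (N : ℝ) ^ 2 ≤ n * firstCoordR m) (hD : 2 * D ≤ (N : ℝ) ^ 2)
    (hD' : ∀ i, 2 * ((1 + |ϑ i / firstCoordR ϑ|) * D) ≤ N * Rk 5 N) :
    ∃ t, translate z f t ∈ paraBdryPlus ϑ 0 N ∧ (∀ r < t, translate z f r ∈ para ϑ 0 N) ∧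
      |(t : ℝ) - s * ((N : ℝ) ^ 2 - firstCoord z) / firstCoordR m| ≤
        D * (1 + |s| / firstCoordR m) := by
  classical
  obtain ⟨T, h1, h2⟩ := hF
  obtain ⟨hz1, hz2⟩ := hz
  simp only [sub_zero] at hz1 hz2
  rw [firstCoord_eq hd] at *
  simp only [firstCoordR_eq hd] at *
  set o : Fin d := ⟨0, hd⟩ with ho
  have hmo : 0 < m o := by rw [hm]; positivity
  have hD0 : 0 ≤ D := (abs_nonneg _).trans (h2 o)
  have hN : (0 : ℝ) < (N : ℝ) ^ 2 := by
    have h3 : (0 : ℤ) < (N : ℤ) ^ 2 := lt_of_le_of_lt (by positivity) hz1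
    exact_mod_cast h3
  have hzR : 3 * |(z o : ℝ)| < (N : ℝ) ^ 2 := by exact_mod_cast hz1
  have hzo := abs_lt.1 (show |(z o : ℝ)| < (N : ℝ) ^ 2 / 3 by linarith)
  have hex : ∃ t, (N : ℤ) ^ 2 ≤ z o + f t o := ⟨T, by
    have h3 := (abs_le.1 (h2 o)).1
    have : (N : ℝ) ^ 2 ≤ z o + f T o := by linarith
    exact_mod_cast this⟩
  set t := Nat.find hex with ht
  have htT : t ≤ T := Nat.find_min' hex (by
    have h3 := (abs_le.1 (h2 o)).1
    have : (N : ℝ) ^ 2 ≤ z o + f T o := by linarith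
    exact_mod_cast this)
  have hspec : (N : ℤ) ^ 2 ≤ z o + f t o := Nat.find_spec hex
  have hmin : ∀ r < t, z o + f r o < (N : ℤ) ^ 2 := fun r hr => not_le.1 (Nat.find_min hex hr)
  have hpara : ∀ r < t, translate z f r ∈ para ϑ 0 N := by
    intro r hr
    obtain ⟨k, hk, hb, -⟩ := h1 r (hr.le.trans htT)
    have h3 := hmin r hr
    refine ⟨?_, fun i => ?_⟩
    · simp only [translate, sub_zero]
      rw [firstCoord_eq hd, abs_lt]
      refine ⟨?_, h3⟩
      have h4 := (abs_le.1 (hb o)).1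
      have h5 : (0 : ℝ) ≤ k * m o := by positivity
      have : -(N : ℝ) ^ 2 < z o + f r o := by linarith
      exact_mod_cast this
    · simp only [translate, sub_zero, firstCoord_eq hd, firstCoordR_eq hd, Pi.add_apply]
      rw [← ho]
      have h4 : ((z i + f r i : ℤ) : ℝ) - ((z o + f r o : ℤ) : ℝ) / ϑ o * ϑ i =
          ((z i : ℝ) - (z o : ℝ) / ϑ o * ϑ i) + ((f r i : ℝ) - k * m i) -
            ϑ i / ϑ o * ((f r o : ℝ) - k * m o) := by
        rw [hm i, hm o]
        push_cast
        field_simp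
        ring
      rw [h4]
      have h5 : |ϑ i / ϑ o * ((f r o : ℝ) - k * m o)| ≤ |ϑ i / ϑ o| * D := by
        rw [abs_mul]
        exact mul_le_mul_of_nonneg_left (hb o) (abs_nonneg _)
      have h6 := hz2 i
      have h7 := hb i
      have h8 := hD' i
      have h9 := abs_sub (((z i : ℝ) - (z o : ℝ) / ϑ o * ϑ i) + ((f r i : ℝ) - k * m i))
        (ϑ i / ϑ o * ((f r o : ℝ) - k * m o))
      have h10 := abs_add_le ((z i : ℝ) - (z o : ℝ) / ϑ o * ϑ i) ((f r i : ℝ) - k * m i)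
      have h11 := abs_nonneg ((z i : ℝ) - (z o : ℝ) / ϑ o * ϑ i)
      linarith
  have ht0 : t ≠ 0 := fun h => by
    rw [h, h0] at hspec
    simp only [Pi.zero_apply, add_zero] at hspec
    have : (N : ℝ) ^ 2 ≤ z o := by exact_mod_cast hspec
    linarith
  obtain ⟨r, hr⟩ := Nat.exists_eq_succ_of_ne_zero ht0
  have heq : z o + f t o = (N : ℤ) ^ 2 := by
    have h3 := hmin r (by omega)
    have h4 := hf.coord_le r 1 o
    rw [← Nat.succ_eq_add_one, ← hr] at h4
    have := (abs_le.1 h4).2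
    push_cast at this
    omega
  have hnot : translate z f t ∉ para ϑ 0 N := fun h => by
    have h3 := h.1
    simp only [translate, sub_zero] at h3
    rw [firstCoord_eq hd, Pi.add_apply, ← ho, heq, abs_of_nonneg (by positivity)] at h3
    exact lt_irrefl _ h3
  refine ⟨t, ⟨?_, ?_⟩, hpara, ?_⟩
  · have h3 := mem_paraBdry_of_step (t := r) (hf.translate z) (hpara r (by omega)) (by
      rw [← Nat.succ_eq_add_one, ← hr]; exact hnot)
    rwa [← Nat.succ_eq_add_one, ← hr] at h3
  · simp only [translate, sub_zero]
    rw [firstCoord_eq hd]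
    exact heq
  · obtain ⟨k, -, hb, hk⟩ := h1 t htT
    have h3 : (f t o : ℝ) = (N : ℝ) ^ 2 - z o := by
      have : (z o : ℝ) + f t o = (N : ℝ) ^ 2 := by exact_mod_cast heq
      linarith
    have h4 := hb o
    rw [h3] at h4
    have h5 : (t : ℝ) - s * ((N : ℝ) ^ 2 - z o) / m o =
        (t - k * s) - s / m o * ((N : ℝ) ^ 2 - z o - k * m o) := by
      field_simp
      ring
    rw [h5]
    calc _ ≤ |(t : ℝ) - k * s| + |s / m o * ((N : ℝ) ^ 2 - z o - k * m o)| := abs_sub _ _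
      _ ≤ D + |s| / m o * D := by
          rw [abs_mul, abs_div, abs_of_pos hmo]
          gcongr
      _ = _ := by ring

/-- a crude bound on the exit time. -/
lemma Follows.hitTime_le {ϑ m : Fin d → ℝ} {s D : ℝ} {N M n : ℕ} {z : Site d} {f : Path d}
    (hF : Follows m s D n f) (hd : 0 < d) (hz : z ∈ paraMid ϑ 0 N) (hf : NN f) (h0 : f 0 = 0)
    (hs : 0 ≤ s) (hn : 2 * (M : ℝ) ^ 2 ≤ n * firstCoordR m) (hD : 2 * D ≤ (M : ℝ) ^ 2)
    (hM : N ≤ M) :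
    (hitTime (paraBdry ϑ 0 N) (translate z f) : ℝ) ≤ n * s + D := by
  obtain ⟨T, h1, h2⟩ := hF
  have h3 : translate z f T ∉ para ϑ 0 N := fun h => by
    have h4 := (abs_lt.1 h.1).2
    have h5 := hz.1
    simp only [translate, sub_zero] at h4 h5
    rw [firstCoord_eq hd] at h4 h5
    rw [firstCoordR_eq hd] at hn
    have h6 := (abs_le.1 (h2 ⟨0, hd⟩)).1
    have h7 : (N : ℝ) ^ 2 ≤ (M : ℝ) ^ 2 := by gcongr
    have h8 : (z ⟨0, hd⟩ + f T ⟨0, hd⟩ : ℝ) < (N : ℝ) ^ 2 := by exact_mod_cast h4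
    have h9 : 3 * |(z ⟨0, hd⟩ : ℝ)| < (N : ℝ) ^ 2 := by exact_mod_cast h5
    have h10 := neg_abs_le (z ⟨0, hd⟩ : ℝ)
    have h11 : (0 : ℝ) < (N : ℝ) ^ 2 := lt_of_le_of_lt (by positivity) h9
    linarith
  have h4 := hitTime_paraBdry_le (hf.translate z)
    (by simpa [translate, h0] using paraMid_subset_para _ _ _ hz) h3
  obtain ⟨k, hk, -, hb⟩ := h1 T le_rfl
  have h5 := (abs_le.1 hb).2
  have h6 : (k : ℝ) * s ≤ n * s := by gcongr
  have h7 : (hitTime (paraBdry ϑ 0 N) (translate z f) : ℝ) ≤ T := by exact_mod_cast h4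
  linarith

end Exit

section Expectation

variable {d : ℕ} {P : Measure (Env d)} {Pq : Env d → Site d → Measure (Path d)}

lemma measurable_hitTime (A : Set (Site d)) : Measurable (hitTime A : Path d → ℕ) := by
  refine measurable_of_Iic fun n => ?_
  have h : (hitTime A : Path d → ℕ) ⁻¹' Set.Iic n =
      (⋃ m ∈ Finset.range (n + 1), {f : Path d | f m ∈ A}) ∪ ⋂ m, {f : Path d | f m ∈ A}ᶜ := by
    ext f
    simp only [Set.mem_preimage, Set.mem_Iic, Set.mem_union, Set.mem_iUnion, Finset.mem_range,
      Set.mem_iInter, Set.mem_compl_iff, Set.mem_ofPred_eq, exists_prop]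
    constructor
    · intro h
      by_cases hex : ∃ m, f m ∈ A
      · exact Or.inl ⟨hitTime A f, by omega, Nat.sInf_mem (s := {n | f n ∈ A}) hex⟩
      · exact Or.inr (not_exists.1 hex)
    · rintro (⟨m, hm, h⟩ | h)
      · exact (Nat.sInf_le h).trans (by omega)
      · have : {n | f n ∈ A} = ∅ := Set.eq_empty_of_forall_notMem h
        simp [hitTime, this]
  rw [h]
  exact (Finset.measurableSet_biUnion _ fun m _ => measurableSet_eval m A).union
    (MeasurableSet.iInter fun m => (measurableSet_eval m A).compl)

lemma annE_eq_toReal (hPq : IsQuenchedFamily Pq) (z : Site d) {h : Path d → ℕ}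
    (hh : Measurable h) (hfin : ∫⁻ f, (h f : ℝ≥0∞) ∂(annM P Pq z) ≠ ⊤) :
    annE P Pq z (fun f => (h f : ℝ)) = (∫⁻ f, (h f : ℝ≥0∞) ∂(annM P Pq z)).toReal := by
  have hm : Measurable fun f => (h f : ℝ≥0∞) := Measurable.of_discrete.comp hh
  have hmR : Measurable fun f => (h f : ℝ) := Measurable.of_discrete.comp hh
  have hmω : Measurable fun ω => ∫⁻ f, (h f : ℝ≥0∞) ∂(Pq ω z) :=
    (Measure.measurable_lintegral hm).comp (hPq.measurable z)
  rw [annM, Measure.lintegral_bind (hPq.measurable z).aemeasurable hm.aemeasurable] at hfin ⊢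
  rw [annE, ← integral_toReal hmω.aemeasurable (ae_lt_top hmω hfin)]
  congr 1
  funext ω
  rw [integral_eq_lintegral_of_nonneg_ae (Eventually.of_forall fun f => Nat.cast_nonneg _)
    hmR.aestronglyMeasurable]
  simp

lemma lintegral_annM (hPq : IsQuenchedFamily Pq) (h : IsIID P) (z : Site d) {F : Path d → ℝ≥0∞}
    (hF : Measurable F) :
    ∫⁻ f, F f ∂(annM P Pq z) = ∫⁻ f, F (translate z f) ∂(annM P Pq 0) := by
  conv_lhs => rw [← add_zero z, annM_add hPq h, lintegral_map hF (measurable_translate z)]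

lemma abs_lintegral_sub_le {Ω : Type*} [MeasurableSpace Ω] {μ : Measure Ω} [IsProbabilityMeasure μ]
    {B : ℕ → Set Ω} (hB : ∀ N, MeasurableSet (B N)) {N : ℕ} {h : Ω → ℕ} (hh : Measurable h)
    {b δ c W : ℝ} (hb : 0 ≤ b) (hδ : 0 ≤ δ) (hW : 0 ≤ W)
    (hgood : ∀ᵐ x ∂μ, x ∉ B N → |(h x : ℝ) - b| ≤ δ)
    (htail : ∀ᵐ x ∂μ, ∀ M ≥ N, x ∉ B M → (h x : ℝ) ≤ c * (M : ℝ) ^ 2)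
    (hev : ∀ᵐ x ∂μ, ∃ j, x ∉ B (N + j))
    (hsum : ∑' j : ℕ, ENNReal.ofReal (c * ((N + j + 1 : ℕ) : ℝ) ^ 2) * μ (B (N + j)) ≤
      ENNReal.ofReal W)
    (hbad : ENNReal.ofReal b * μ (B N) ≤ ENNReal.ofReal W) :
    ∫⁻ x, (h x : ℝ≥0∞) ∂μ ≠ ⊤ ∧ |(∫⁻ x, (h x : ℝ≥0∞) ∂μ).toReal - b| ≤ δ + W := by
  classical
  have hm : Measurable fun x => (h x : ℝ≥0∞) := Measurable.of_discrete.comp hh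
  set F : ℕ → Ω → ℝ≥0∞ := fun j => (B (N + j)).indicator fun _ =>
    ENNReal.ofReal (c * ((N + j + 1 : ℕ) : ℝ) ^ 2) with hF
  have hFm : ∀ j, Measurable (F j) := fun j => measurable_const.indicator (hB _)
  have hup : ∫⁻ x, (h x : ℝ≥0∞) ∂μ ≤ ENNReal.ofReal (b + δ + W) := by
    calc ∫⁻ x, (h x : ℝ≥0∞) ∂μ ≤ ∫⁻ x, (ENNReal.ofReal (b + δ) + ∑' j, F j x) ∂μ := by
          refine lintegral_mono_ae ?_
          filter_upwards [hgood, htail, hev] with x h1 h2 h3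
          rw [← ENNReal.ofReal_natCast]
          rcases Nat.eq_zero_or_pos (Nat.find h3) with h4 | h4
          · have h5 := Nat.find_spec h3
            rw [h4, add_zero] at h5
            exact le_add_right (ENNReal.ofReal_le_ofReal (by linarith [(abs_le.1 (h1 h5)).2]))
          · obtain ⟨j, hj⟩ := Nat.exists_eq_succ_of_ne_zero h4.ne'
            have h5 : x ∈ B (N + j) := not_not.1 (Nat.find_min h3 (by omega))
            have h6 := h2 (N + Nat.find h3) (by omega) (Nat.find_spec h3)
            rw [hj, show N + (j + 1) = N + j + 1 by omega] at h6
            refine le_add_left (le_trans ?_ (ENNReal.le_tsum j))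
            simp only [hF, Set.indicator_of_mem h5]
            exact ENNReal.ofReal_le_ofReal h6
      _ = ENNReal.ofReal (b + δ) + ∑' j : ℕ,
            ENNReal.ofReal (c * ((N + j + 1 : ℕ) : ℝ) ^ 2) * μ (B (N + j)) := by
          rw [lintegral_add_left measurable_const, lintegral_const, measure_univ, mul_one,
            lintegral_tsum fun j => (hFm j).aemeasurable]
          congr 2
          funext j
          exact lintegral_indicator_const (hB _) _
      _ ≤ ENNReal.ofReal (b + δ) + ENNReal.ofReal W := by gcongr
      _ = _ := (ENNReal.ofReal_add (by positivity) hW).symm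
  have hfin : ∫⁻ x, (h x : ℝ≥0∞) ∂μ ≠ ⊤ := ne_top_of_le_ne_top ENNReal.ofReal_ne_top hup
  refine ⟨hfin, ?_⟩
  have hlow : ENNReal.ofReal (b - δ) ≤ ∫⁻ x, (h x : ℝ≥0∞) ∂μ + ENNReal.ofReal W := by
    calc ENNReal.ofReal (b - δ) = ∫⁻ _, ENNReal.ofReal (b - δ) ∂μ := by simp
      _ ≤ ∫⁻ x, ((h x : ℝ≥0∞) + (B N).indicator (fun _ => ENNReal.ofReal b) x) ∂μ := by
          refine lintegral_mono_ae ?_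
          filter_upwards [hgood] with x h1
          by_cases hx : x ∈ B N
          · rw [Set.indicator_of_mem hx]
            exact le_add_left (ENNReal.ofReal_le_ofReal (by linarith))
          · rw [Set.indicator_of_notMem hx, add_zero, ← ENNReal.ofReal_natCast]
            exact ENNReal.ofReal_le_ofReal (by linarith [(abs_le.1 (h1 hx)).1])
      _ = ∫⁻ x, (h x : ℝ≥0∞) ∂μ + ENNReal.ofReal b * μ (B N) := by
          rw [lintegral_add_left hm, lintegral_indicator_const (hB N)]
      _ ≤ _ := by gcongr
  have h1 : (∫⁻ x, (h x : ℝ≥0∞) ∂μ).toReal ≤ b + δ + W :=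
    ENNReal.toReal_le_of_le_ofReal (by positivity) hup
  have h2 : b - δ ≤ (∫⁻ x, (h x : ℝ≥0∞) ∂μ).toReal + W := by
    rw [← ENNReal.ofReal_toReal hfin, ← ENNReal.ofReal_add ENNReal.toReal_nonneg hW,
      ENNReal.ofReal_le_ofReal_iff (by positivity)] at hlow
    exact hlow
  rw [abs_le]
  constructor <;> linarith

lemma SupSmall.exists_tsum_le {Ω : Type*} [MeasurableSpace Ω] {μ : Measure Ω} {B : ℕ → Set Ω}
    (h : SupSmall μ B) {c : ℝ} (hc : 0 ≤ c) : ∃ W : ℝ, 0 ≤ W ∧ ∀ N, 1 ≤ N →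
      ∑' j : ℕ, ENNReal.ofReal (c * ((N + j + 1 : ℕ) : ℝ) ^ 2) * μ (B (N + j)) ≤ ENNReal.ofReal W ∧
      ENNReal.ofReal (c * (N : ℝ) ^ 2) * μ (B N) ≤ ENNReal.ofReal W := by
  obtain ⟨C, hC, hb⟩ := h 4
  set a : ℕ → ℝ := fun M => 4 * c * C * (1 / (M : ℝ) ^ 2) with ha
  have hsum : Summable a := (Real.summable_one_div_nat_pow.2 one_lt_two).mul_left _
  have ha0 : ∀ M, 0 ≤ a M := fun M => by positivity
  have hterm : ∀ M, 1 ≤ M → ENNReal.ofReal (c * ((M + 1 : ℕ) : ℝ) ^ 2) * μ (B M) ≤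
      ENNReal.ofReal (a M) := by
    intro M hM
    have hM1 : (1 : ℝ) ≤ M := by exact_mod_cast hM
    calc _ ≤ ENNReal.ofReal (c * ((M + 1 : ℕ) : ℝ) ^ 2) * ENNReal.ofReal (C / (M : ℝ) ^ 4) := by
          gcongr
          exact hb M hM
      _ = ENNReal.ofReal (c * ((M + 1 : ℕ) : ℝ) ^ 2 * (C / (M : ℝ) ^ 4)) :=
          (ENNReal.ofReal_mul (by positivity)).symm
      _ ≤ ENNReal.ofReal (c * (2 * M) ^ 2 * (C / (M : ℝ) ^ 4)) := by
          gcongr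
          push_cast
          linarith
      _ = _ := by
          congr 1
          rw [ha]
          field_simp
          ring
  refine ⟨∑' M, a M, tsum_nonneg ha0, fun N hN => ?_⟩
  rw [ENNReal.ofReal_tsum_of_nonneg ha0 hsum]
  refine ⟨(ENNReal.tsum_le_tsum fun j => hterm (N + j) (by omega)).trans
    (ENNReal.tsum_comp_le_tsum_of_injective (add_right_injective N) fun M => ENNReal.ofReal (a M)),
    le_trans ?_ ((hterm N hN).trans (ENNReal.le_tsum N))⟩
  gcongr
  omega

lemma eventually_log_sq_le_Rk (A : ℝ) {k : ℕ} (hk : 2 ≤ k) :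
    ∀ᶠ N : ℕ in atTop, A * (Real.log N ^ 2 + 1) ≤ Rk k N := by
  have hlog : Tendsto (fun N : ℕ => Real.log N) atTop atTop :=
    Real.tendsto_log_atTop.comp tendsto_natCast_atTop_atTop
  have hloglog : Tendsto (fun N : ℕ => Real.log (Real.log N)) atTop atTop :=
    Real.tendsto_log_atTop.comp hlog
  filter_upwards [hlog.eventually_ge_atTop (2 * |A| + 2), hloglog.eventually_ge_atTop 2] with N h1 h2
  set L := Real.log N with hL
  set y := Real.log L with hy
  have hL0 : 0 < L := by linarith [abs_nonneg A]
  have h3 : 3 * y ≤ y ^ (k + 1) := by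
    calc 3 * y ≤ y ^ 2 * y := by gcongr; nlinarith
      _ = y ^ 3 := by ring
      _ ≤ _ := pow_le_pow_right₀ (by linarith) (by omega)
  have h4 : L ^ 3 ≤ Real.exp (y ^ (k + 1)) := by
    refine le_trans (le_of_eq ?_) (Real.exp_le_exp.2 h3)
    rw [show 3 * y = ((3 : ℕ) : ℝ) * y by norm_num, Real.exp_nat_mul, hy, Real.exp_log hL0]
  have h5 : Real.exp (y ^ (k + 1)) < Rk k N + 1 := Nat.lt_floor_add_one _
  have h6 : A ≤ |A| := le_abs_self A
  have h7 : 0 ≤ |A| := abs_nonneg A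
  have h8 : |A| * (L ^ 2 + 1) + 1 ≤ L ^ 3 := by
    have : (2 * |A| + 2) * L ^ 2 ≤ L * L ^ 2 := by gcongr
    have hL2 : 1 ≤ L ^ 2 := by nlinarith
    nlinarith
  have h9 : A * (L ^ 2 + 1) ≤ |A| * (L ^ 2 + 1) := by gcongr
  linarith

lemma SupSmall.superpoly {Ω : Type*} [MeasurableSpace Ω] {μ : Measure Ω} {B : ℕ → Set Ω}
    (h : SupSmall μ B) (N₀ : ℕ) : Superpoly fun N => if N < N₀ then 1 else (μ (B N)).toReal := by
  intro k
  obtain ⟨C, hC, hb⟩ := h (k + 1)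
  refine squeeze_zero' (g := fun N : ℕ => C / N) (Eventually.of_forall fun N => ?_) ?_
    (tendsto_const_div_atTop_nhds_zero_nat C)
  · dsimp only
    split_ifs <;> positivity
  · filter_upwards [eventually_ge_atTop N₀, eventually_ge_atTop 1] with N h1 h2
    have hN : (0 : ℝ) < N := by exact_mod_cast h2
    rw [if_neg (not_lt.2 h1)]
    have h3 := ENNReal.toReal_le_of_le_ofReal (by positivity) (hb N h2)
    calc (N : ℝ) ^ k * (μ (B N)).toReal ≤ (N : ℝ) ^ k * (C / (N : ℝ) ^ (k + 1)) := by gcongr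
      _ = C / N := by rw [pow_succ]; field_simp

end Expectation

section Conclusion

variable {d : ℕ} {P : Measure (Env d)} {Pq : Env d → Site d → Measure (Path d)}

lemma translate_neg_mem_ae (hPq : IsQuenchedFamily Pq) (z : Site d) :
    ∀ᵐ f ∂(annM P Pq z), NN (translate (-z) f) ∧ translate (-z) f 0 = 0 ∧
      translate z (translate (-z) f) = f := by
  filter_upwards [ae_nn_annM hPq z, ae_start_annM hPq z] with f h1 h2
  refine ⟨h1.translate _, by simp [translate, h2], ?_⟩
  funext n
  simp [translate]

lemma ann_le_of_forall (hPq : IsQuenchedFamily Pq) (h : IsIID P) (z : Site d)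
    {A B : Set (Path d)} (hB : MeasurableSet B)
    (hAB : ∀ f, NN f → f 0 = 0 → translate z f ∈ A → f ∈ B) :
    ann P Pq z A ≤ annM P Pq 0 B := by
  have hm : MeasurableSet (translate (-z) ⁻¹' B) := measurable_translate _ hB
  have h1 : translate z ⁻¹' (translate (-z) ⁻¹' B) = B := by
    rw [← Set.preimage_comp]
    convert Set.preimage_id
    funext f n
    simp [translate]
  rw [← h1, ← annM_eq hPq h z hm]
  refine (ann_le_annM hPq z A).trans (measure_mono_ae ?_)
  filter_upwards [translate_neg_mem_ae hPq z] with f hf hfA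
  exact hAB _ hf.1 hf.2.1 (by rw [hf.2.2]; exact hfA)

end Conclusion

/-- The walk exits `𝒫(0,N)` through the right boundary except on an
event of superpolynomially small annealed probability, and the exit time is
concentrated within `N R₂(N)` of its annealed expectation. -/
theorem statement9 (d : ℕ) (hd : 4 ≤ d)
    (P : Measure (Env d)) [IsProbabilityMeasure P]
    (Pq : Env d → Site d → Measure (Path d)) (hPq : IsQuenchedFamily Pq)
    (hUE : UniformlyElliptic P) (hIID : IsIID P) (hCond : CondP P Pq)
    (ϑ : Fin d → ℝ) (hϑu : norm2R ϑ = 1) (hϑ : DirSpeed P Pq ϑ)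
    (hϑ1 : 0 < firstCoordR ϑ) :
    ∃ g : ℕ → ℝ, Superpoly g ∧
      ∀ N : ℕ, ∀ z ∈ paraMid ϑ 0 N,
        (ann P Pq z {f : Path d | ¬ ∃ n, f n ∈ paraBdry ϑ 0 N ∧
            (∀ m < n, f m ∉ paraBdry ϑ 0 N) ∧ f n ∈ paraBdryPlus ϑ 0 N}).toReal ≤ g N ∧
        (ann P Pq z {f : Path d |
            (N : ℝ) * (Rk 2 N : ℝ) <
              |(hitTime (paraBdry ϑ 0 N) f : ℝ) -
                annE P Pq z fun p => (hitTime (paraBdry ϑ 0 N) p : ℝ)|}).toReal ≤ g N := by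
  have hd0 : 0 < d := by omega
  obtain ⟨S⟩ := exists_setup hPq hUE hIID hCond
  obtain ⟨ha, hm⟩ := S.meanStep_eq hd hϑ
  set m := meanStep P Pq S.u with hmdef
  set s := meanTime P Pq S.u with hs
  have hs0 : 0 ≤ s := meanTime_nonneg _
  have hm1 : 0 < firstCoordR m := by
    rw [firstCoordR_eq hd0] at hϑ1 ⊢
    rw [hm]
    positivity
  obtain ⟨K, hK⟩ := exists_nat_ge (2 / firstCoordR m)
  have hKm : 2 ≤ K * firstCoordR m := (div_le_iff₀ hm1).1 hK
  obtain ⟨C, hC, hsmall⟩ := S.exists_follows hd K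
  set D : ℕ → ℝ := fun N => N * Real.log N ^ 2 + C + 2 * N with hD
  have hprob := isProbabilityMeasure_annM (P := P) hPq (0 : Site d)
  set μ := annM P Pq (0 : Site d) with hμ
  set B : ℕ → Set (Path d) := fun N => toMeasurable μ {f | ¬ Follows m s (D N) (K * N ^ 2) f}
    with hBdef
  have hBm : ∀ N, MeasurableSet (B N) := fun N => measurableSet_toMeasurable _ _
  have hBs : SupSmall μ B := fun p => by
    obtain ⟨C', hC', h⟩ := hsmall p
    exact ⟨C', hC', fun N hN => (measure_toMeasurable _).trans_le (h N hN)⟩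
  have hBF : ∀ N f, f ∉ B N → Follows m s (D N) (K * N ^ 2) f := fun N f hf => by
    by_contra hcon
    exact hf (subset_toMeasurable _ _ hcon)
  have hnK : ∀ N : ℕ, 2 * (N : ℝ) ^ 2 ≤ ((K * N ^ 2 : ℕ) : ℝ) * firstCoordR m := fun N => by
    push_cast
    nlinarith [sq_nonneg (N : ℝ)]
  set q := 1 + |s| / firstCoordR m with hq
  have hq1 : 1 ≤ q := by rw [hq]; linarith [div_nonneg (abs_nonneg s) hm1.le]
  set c := K * s + 1 + 2 * s / firstCoordR m with hc
  have hc0 : 0 ≤ c := by positivity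
  obtain ⟨W, hW, hWb⟩ := hBs.exists_tsum_le hc0
  have hDle : ∀ N : ℕ, 1 ≤ N → D N ≤ (C + 2) * (N * (Real.log N ^ 2 + 1)) := fun N hN => by
    have hN1 : (1 : ℝ) ≤ N := by exact_mod_cast hN
    have h1 : C ≤ C * N := le_mul_of_one_le_right hC.le hN1
    have h2 : 0 ≤ N * Real.log N ^ 2 := by positivity
    simp only [hD]
    nlinarith
  have hev : ∀ᶠ N : ℕ in atTop, 1 ≤ N ∧ 2 * D N ≤ (N : ℝ) ^ 2 ∧
      (∀ i, 2 * ((1 + |ϑ i / firstCoordR ϑ|) * D N) ≤ N * Rk 5 N) ∧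
      2 * (D N * q) + W ≤ N * Rk 2 N := by
    have h5 : ∀ᶠ N : ℕ in atTop, ∀ i,
        2 * (1 + |ϑ i / firstCoordR ϑ|) * (C + 2) * (Real.log N ^ 2 + 1) ≤ Rk 5 N :=
      eventually_all.2 fun i => eventually_log_sq_le_Rk _ (by norm_num)
    filter_upwards [eventually_ge_atTop 1, eventually_error_le C (show (0 : ℝ) < 1 / 2 by norm_num),
      h5, eventually_log_sq_le_Rk (2 * q * (C + 2) + W) le_rfl] with N hN h1 h2 h3
    have hN1 : (1 : ℝ) ≤ N := by exact_mod_cast hN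
    have hDN := hDle N hN
    refine ⟨hN, by simp only [hD]; linarith, fun i => ?_, ?_⟩
    · calc 2 * ((1 + |ϑ i / firstCoordR ϑ|) * D N)
          ≤ 2 * ((1 + |ϑ i / firstCoordR ϑ|) * ((C + 2) * (N * (Real.log N ^ 2 + 1)))) := by gcongr
        _ = N * (2 * (1 + |ϑ i / firstCoordR ϑ|) * (C + 2) * (Real.log N ^ 2 + 1)) := by ring
        _ ≤ _ := by gcongr; exact h2 i
    · calc 2 * (D N * q) + W
          ≤ 2 * ((C + 2) * (N * (Real.log N ^ 2 + 1)) * q) + W * (N * (Real.log N ^ 2 + 1)) := by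
            have h4 : 1 ≤ N * (Real.log N ^ 2 + 1) := by nlinarith [sq_nonneg (Real.log N)]
            have h6 : W ≤ W * (N * (Real.log N ^ 2 + 1)) := le_mul_of_one_le_right hW h4
            gcongr
        _ = N * ((2 * q * (C + 2) + W) * (Real.log N ^ 2 + 1)) := by ring
        _ ≤ _ := by gcongr
  obtain ⟨N₀, hN₀⟩ := eventually_atTop.1 hev
  refine ⟨_, hBs.superpoly N₀, fun N z hz => ?_⟩
  by_cases hN : N < N₀
  · have hle : ∀ A : Set (Path d), (ann P Pq z A).toReal ≤ 1 := fun A => by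
      have := isProbabilityMeasure_annM (P := P) hPq z
      refine ENNReal.toReal_le_of_le_ofReal zero_le_one ((ann_le_annM hPq z A).trans ?_)
      rw [ENNReal.ofReal_one]
      exact prob_le_one
    simp only [if_pos hN]
    exact ⟨hle _, hle _⟩
  rw [if_neg hN]
  push Not at hN
  obtain ⟨hN1, hN2, hN3, hN4⟩ := hN₀ N hN
  set b := s * ((N : ℝ) ^ 2 - firstCoord z) / firstCoordR m with hb
  set h := fun f : Path d => hitTime (paraBdry ϑ 0 N) (translate z f) with hh
  have hexit : ∀ f, NN f → f 0 = 0 → f ∉ B N →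
      ∃ t, translate z f t ∈ paraBdryPlus ϑ 0 N ∧ (∀ r < t, translate z f r ∉ paraBdry ϑ 0 N) ∧
        |(t : ℝ) - b| ≤ D N * q := fun f hf hf0 hfB => by
    obtain ⟨t, h1, h2, h3⟩ := (hBF N f hfB).exists_exit hd0 ha hm hϑ1 hz hf hf0 (hnK N) hN2 hN3
    exact ⟨t, h1, fun r hr hcon => hcon.1 (h2 r hr), h3⟩
  have hgood : ∀ f, NN f → f 0 = 0 → f ∉ B N → |(h f : ℝ) - b| ≤ D N * q :=
    fun f hf hf0 hfB => by
    obtain ⟨t, h1, h2, h3⟩ := hexit f hf hf0 hfB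
    simp only [hh]
    rwa [hitTime_eq h1.1 h2]
  have hz1 : |(firstCoord z : ℝ)| < (N : ℝ) ^ 2 := by
    have h1 := (paraMid_subset_para _ _ _ hz).1
    rw [sub_zero] at h1
    exact_mod_cast h1
  have hb0 : 0 ≤ b := div_nonneg (mul_nonneg hs0 (by linarith [le_abs_self (firstCoord z : ℝ)])) hm1.le
  have hbc : b ≤ c * (N : ℝ) ^ 2 := by
    have h1 : b ≤ s * (2 * (N : ℝ) ^ 2) / firstCoordR m := by
      rw [hb]
      gcongr
      linarith [neg_abs_le (firstCoord z : ℝ)]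
    have h2 : (0 : ℝ) ≤ (K * s + 1) * (N : ℝ) ^ 2 := by positivity
    calc b ≤ s * (2 * (N : ℝ) ^ 2) / firstCoordR m + (K * s + 1) * (N : ℝ) ^ 2 := by linarith
      _ = _ := by rw [hc]; ring
  have hDnn : 0 ≤ D N := by positivity
  obtain ⟨hfin, hE⟩ := abs_lintegral_sub_le (μ := μ) (h := h) (N := N) (b := b) (δ := D N * q)
    (c := c) (W := W) hBm ((measurable_hitTime _).comp (measurable_translate z)) hb0
    (by positivity) hW
    (by filter_upwards [ae_nn_annM hPq 0, ae_start_annM hPq 0] with f hf hf0 using hgood f hf hf0)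
    (by
      filter_upwards [ae_nn_annM hPq 0, ae_start_annM hPq 0] with f hf hf0 M hM hfB
      have hDM := (hN₀ M (hN.trans hM)).2.1
      have h1 := (hBF M f hfB).hitTime_le hd0 hz hf hf0 hs0 (hnK M) hDM hM
      have h2 : 0 ≤ 2 * s / firstCoordR m * (M : ℝ) ^ 2 := by positivity
      push_cast at h1
      rw [hc]
      nlinarith [sq_nonneg (M : ℝ)])
    (by
      filter_upwards [hBs.ae_eventually] with f hf
      obtain ⟨M, hM⟩ := eventually_atTop.1 hf
      exact ⟨M, hM _ (by omega)⟩)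
    (hWb N hN1).1
    (le_trans (by gcongr) (hWb N hN1).2)
  have hEeq : annE P Pq z (fun p => (hitTime (paraBdry ϑ 0 N) p : ℝ)) =
      (∫⁻ f, (h f : ℝ≥0∞) ∂μ).toReal := by
    have h1 := lintegral_annM (P := P) hPq hIID z
      (F := fun f => (hitTime (paraBdry ϑ 0 N) f : ℝ≥0∞))
      (Measurable.of_discrete.comp (measurable_hitTime _))
    rw [annE_eq_toReal hPq z (measurable_hitTime _) (by rw [h1]; exact hfin), h1]
  rw [hEeq]
  constructor
  · refine ENNReal.toReal_mono (measure_ne_top _ _)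
      (ann_le_of_forall hPq hIID z (hBm N) fun f hf hf0 hfA => ?_)
    by_contra hcon
    obtain ⟨t, h1, h2, -⟩ := hexit f hf hf0 hcon
    exact hfA ⟨t, h1.1, h2, h1⟩
  · refine ENNReal.toReal_mono (measure_ne_top _ _)
      (ann_le_of_forall hPq hIID z (hBm N) fun f hf hf0 hfA => ?_)
    by_contra hcon
    have h1 := hgood f hf hf0 hcon
    rw [Set.mem_ofPred_eq] at hfA
    have h2 := abs_sub_le (h f : ℝ) b (∫⁻ f, (h f : ℝ≥0∞) ∂μ).toReal
    rw [abs_sub_comm b] at h2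
    have h3 : |(h f : ℝ) - (∫⁻ f, (h f : ℝ≥0∞) ∂μ).toReal| ≤ N * Rk 2 N := by linarith
    exact absurd hfA (not_lt.2 h3)

end RWRE
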